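/- There exist universal constants κ > 0 and C > 0 such that for every real Z ≥ 1 and every α > 0 with Zα² ≤ κ, the grand-canonical ground state energies satisfy E^{nf}_Z ≥ E^{cl}_{Z,α} ≥ E^{nf}_Z − C·Z^{7/3 − 1/63}. -/

import Mathlib

open MeasureTheory

noncomputable section

/-- Euclidean norm on ℝ³ (encoded as `Fin 3 → ℝ`). -/
def enorm3 (x : Fin 3 → ℝ) : ℝ := Real.sqrt (∑ k, x k ^ 2)

/-- The Pauli matrices σ₁, σ₂, σ₃. -/
def pauli : Fin 3 → Matrix (Fin 2) (Fin 2) ℂ :=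
  ![!![0, 1; 1, 0], !![0, -Complex.I; Complex.I, 0], !![1, 0; 0, -1]]

/-- The partial derivative ∂ᵢ Aⱼ of a vector field on ℝ³. -/
def pdVec (A : (Fin 3 → ℝ) → Fin 3 → ℝ) (i j : Fin 3) (x : Fin 3 → ℝ) : ℝ :=
  fderiv ℝ A x (Pi.single i 1) j

/-- The curl ∇×A of a vector field on ℝ³. -/
def curl3 (A : (Fin 3 → ℝ) → Fin 3 → ℝ) (x : Fin 3 → ℝ) : Fin 3 → ℝ :=
  ![pdVec A 1 2 x - pdVec A 2 1 x, pdVec A 2 0 x - pdVec A 0 2 x,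
    pdVec A 0 1 x - pdVec A 1 0 x]

/-- |∇×A|²(x). -/
def curlSq (A : (Fin 3 → ℝ) → Fin 3 → ℝ) (x : Fin 3 → ℝ) : ℝ :=
  ∑ k, (curl3 A x k) ^ 2

/-- |∇⊗A|²(x) = Σᵢⱼ |∂ᵢAⱼ|². -/
def gradSq (A : (Fin 3 → ℝ) → Fin 3 → ℝ) (x : Fin 3 → ℝ) : ℝ :=
  ∑ i, ∑ j, (pdVec A i j x) ^ 2

/-- A divergence-free smooth compactly supported vector potential. -/
def IsVecPot (A : (Fin 3 → ℝ) → Fin 3 → ℝ) : Prop :=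
  ContDiff ℝ (⊤ : ℕ∞) A ∧ HasCompactSupport A ∧ ∀ x, ∑ k, pdVec A k k x = 0

/-- The unit basis vector of the configuration space (ℝ³)^N in direction
(particle j, coordinate k). -/
def eVec (N : ℕ) (j : Fin N) (k : Fin 3) : Fin N → Fin 3 → ℝ :=
  Pi.single j (Pi.single k 1)

/-- A normalized `N`-electron wave function: smooth, compactly supported,
antisymmetric under simultaneous permutation of position-spin pairs, L²-normalized. -/
structure IsWaveFun (N : ℕ) (Ψ : (Fin N → Fin 3 → ℝ) → (Fin N → Fin 2) → ℂ) : Prop where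
  smooth : ∀ s, ContDiff ℝ (⊤ : ℕ∞) fun x => Ψ x s
  compactSupport : ∀ s, HasCompactSupport fun x => Ψ x s
  antisymm : ∀ (π : Equiv.Perm (Fin N)) (x : Fin N → Fin 3 → ℝ) (s : Fin N → Fin 2),
    Ψ (fun i => x (π i)) (fun i => s (π i)) = ((Equiv.Perm.sign π : ℤ) : ℂ) * Ψ x s
  normalized : ∑ s : Fin N → Fin 2, ∫ x : Fin N → Fin 3 → ℝ, ‖Ψ x s‖ ^ 2 = 1

/-- The expectation ∫ W |Ψ|² of a multiplication operator, including spin summation. -/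
def potInt (N : ℕ) (W : (Fin N → Fin 3 → ℝ) → ℝ)
    (Ψ : (Fin N → Fin 3 → ℝ) → (Fin N → Fin 2) → ℂ) : ℝ :=
  ∑ s : Fin N → Fin 2, ∫ x : Fin N → Fin 3 → ℝ, W x * ‖Ψ x s‖ ^ 2

/-- The Pauli kinetic form t_A^{(j)}[Ψ] = ‖σ^{(j)}·(−i∇_{x_j} + A(x_j))Ψ‖². -/
def pauliKin (N : ℕ) (A : (Fin 3 → ℝ) → Fin 3 → ℝ) (j : Fin N)
    (Ψ : (Fin N → Fin 3 → ℝ) → (Fin N → Fin 2) → ℂ) : ℝ :=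
  ∑ s : Fin N → Fin 2, ∫ x : Fin N → Fin 3 → ℝ,
    ‖∑ k : Fin 3, ∑ t : Fin 2, pauli k (s j) t *
      (-Complex.I * fderiv ℝ (fun y => Ψ y (Function.update s j t)) x (eVec N j k)
        + (A (x j) k : ℂ) * Ψ x (Function.update s j t))‖ ^ 2

/-- The classical-field (Pauli) energy functional 𝓔^{cl}_{N,Z,α}[Ψ,A]. -/
def clPauliEnergy (N : ℕ) (Z α : ℝ) (A : (Fin 3 → ℝ) → Fin 3 → ℝ)
    (Ψ : (Fin N → Fin 3 → ℝ) → (Fin N → Fin 2) → ℂ) : ℝ :=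
  (∑ j : Fin N, (pauliKin N A j Ψ - Z * potInt N (fun x => (enorm3 (x j))⁻¹) Ψ))
    + (∑ i : Fin N, ∑ j : Fin N,
        if i < j then potInt N (fun x => (enorm3 (x i - x j))⁻¹) Ψ else 0)
    + (8 * Real.pi * α ^ 2)⁻¹ * ∫ x : Fin 3 → ℝ, curlSq A x

/-- All values of the classical-field energy functional. -/
def clSet (Z α : ℝ) : Set ℝ :=
  {E | ∃ N : ℕ, 1 ≤ N ∧ ∃ A, IsVecPot A ∧
    ∃ Ψ, IsWaveFun N Ψ ∧ E = clPauliEnergy N Z α A Ψ}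

/-- All values of the energy functional with no magnetic field (A ≡ 0). -/
def nfSet (Z α : ℝ) : Set ℝ :=
  {E | ∃ N : ℕ, 1 ≤ N ∧ ∃ Ψ, IsWaveFun N Ψ ∧ E = clPauliEnergy N Z α (fun _ => 0) Ψ}

section

open Set Filter Topology
open scoped ENNReal NNReal

/-- Configuration space of a single particle. -/
abbrev E3 := Fin 3 → ℝ

/-- Squared length of the gradient, as an extended nonnegative number. -/
def gradE {F : Type*} [NormedAddCommGroup F] [NormedSpace ℝ F] (u : E3 → F) (x : E3) : ℝ≥0∞ :=
  ∑ k, ‖fderiv ℝ u x (Pi.single k 1)‖ₑ ^ 2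

theorem ENNReal.add_sq_le_two (a b : ℝ≥0∞) : (a + b) ^ 2 ≤ 2 * (a ^ 2 + b ^ 2) := by
  rcases eq_or_ne a ⊤ with rfl | ha
  · simp
  rcases eq_or_ne b ⊤ with rfl | hb
  · simp
  lift a to ℝ≥0 using ha
  lift b to ℝ≥0 using hb
  exact_mod_cast (add_sq_le : (a + b) ^ 2 ≤ 2 * (a ^ 2 + b ^ 2))

theorem ENNReal.sum_sq_le {ι : Type*} (s : Finset ι) (f : ι → ℝ≥0∞) :
    (∑ i ∈ s, f i) ^ 2 ≤ s.card * ∑ i ∈ s, f i ^ 2 := by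
  by_cases h : ∀ i ∈ s, f i ≠ ⊤
  · have : ∀ i ∈ s, f i = ((f i).toNNReal : ℝ≥0∞) := fun i hi => (ENNReal.coe_toNNReal (h i hi)).symm
    have h2 : ∑ i ∈ s, f i ^ 2 = ∑ i ∈ s, ((f i).toNNReal : ℝ≥0∞) ^ 2 :=
      Finset.sum_congr rfl fun i hi => by rw [← this i hi]
    rw [Finset.sum_congr rfl this, h2]
    exact_mod_cast sq_sum_le_card_mul_sum_sq (s := s) (f := fun i => (f i).toNNReal)
  · push Not at h
    obtain ⟨i, hi, hfi⟩ := h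
    have h1 : ∑ i ∈ s, f i ^ 2 = ⊤ := ENNReal.sum_eq_top.2 ⟨i, hi, by simp [hfi]⟩
    have h2 : s.card ≠ 0 := Finset.card_ne_zero_of_mem hi
    rw [h1, ENNReal.mul_top (by exact_mod_cast h2)]
    exact le_top

theorem lintegral_mul_sq_le {α : Type*} [MeasurableSpace α] (μ : Measure α) {f g : α → ℝ≥0∞}
    (hf : AEMeasurable f μ) (hg : AEMeasurable g μ) :
    (∫⁻ a, f a * g a ∂μ) ^ 2 ≤ (∫⁻ a, f a ^ 2 ∂μ) * ∫⁻ a, g a ^ 2 ∂μ := by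
  have h := ENNReal.lintegral_mul_le_Lp_mul_Lq μ (p := 2) (q := 2)
    Real.HolderConjugate.two_two hf hg
  calc (∫⁻ a, f a * g a ∂μ) ^ 2 ≤ ((∫⁻ a, f a ^ (2:ℝ) ∂μ) ^ (1 / 2 : ℝ)
        * (∫⁻ a, g a ^ (2:ℝ) ∂μ) ^ (1 / 2 : ℝ)) ^ 2 := by gcongr; exact h
    _ = _ := by
      rw [mul_pow, ← ENNReal.rpow_natCast, ← ENNReal.rpow_natCast, ← ENNReal.rpow_mul,
        ← ENNReal.rpow_mul]
      norm_num

theorem lintegral_sq_le {α : Type*} [MeasurableSpace α] (μ : Measure α) {f : α → ℝ≥0∞}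
    (hf : AEMeasurable f μ) :
    (∫⁻ a, f a ∂μ) ^ 2 ≤ μ univ * ∫⁻ a, f a ^ 2 ∂μ := by
  have := lintegral_mul_sq_le μ (f := fun _ => 1) aemeasurable_const hf
  simpa using this

section
variable {F : Type*} [NormedAddCommGroup F] [NormedSpace ℝ F]

theorem enorm_fderiv_apply_sq_le (u : E3 → F) (x v : E3) :
    ‖fderiv ℝ u x v‖ₑ ^ 2 ≤ 3 * ‖v‖ₑ ^ 2 * gradE u x := by
  have h1 : fderiv ℝ u x v = ∑ k, v k • fderiv ℝ u x (Pi.single k 1) := by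
    conv_lhs => rw [← Finset.univ_sum_single v]
    rw [map_sum]
    refine Finset.sum_congr rfl fun k _ => ?_
    rw [← map_smul]
    congr 1
    ext j
    simp [Pi.single_apply]
  have h2 : ‖fderiv ℝ u x v‖ₑ ≤ ∑ k, ‖v‖ₑ * ‖fderiv ℝ u x (Pi.single k 1)‖ₑ := by
    rw [h1]
    refine (enorm_sum_le _ _).trans (Finset.sum_le_sum fun k _ => ?_)
    rw [enorm_smul]
    gcongr
    exact enorm_le_iff_norm_le.2 (norm_le_pi_norm v k)
  calc ‖fderiv ℝ u x v‖ₑ ^ 2 ≤ (∑ k, ‖v‖ₑ * ‖fderiv ℝ u x (Pi.single k 1)‖ₑ) ^ 2 := by gcongr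
    _ ≤ _ := ENNReal.sum_sq_le _ _
    _ = _ := by simp [gradE, mul_pow, Finset.mul_sum, mul_assoc]

theorem enorm_fderiv_sq_le (u : E3 → F) (x : E3) :
    ‖fderiv ℝ u x‖ₑ ^ 2 ≤ 3 * gradE u x := by
  rcases eq_or_ne (gradE u x) ⊤ with h | h
  · simp [h]
  have h0 : ‖fderiv ℝ u x‖ ≤ √(3 * (gradE u x).toReal) := by
    refine ContinuousLinearMap.opNorm_le_bound _ (Real.sqrt_nonneg _) fun v => ?_
    have h1 := enorm_fderiv_apply_sq_le u x v
    have h2 : ‖fderiv ℝ u x v‖ ^ 2 ≤ 3 * ‖v‖ ^ 2 * (gradE u x).toReal := by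
      have := ENNReal.toReal_mono (by finiteness) h1
      simpa using this
    rw [← Real.sqrt_sq (norm_nonneg v), ← Real.sqrt_mul (by positivity)]
    apply Real.le_sqrt_of_sq_le
    linarith
  have h1 : ‖fderiv ℝ u x‖ ^ 2 ≤ 3 * (gradE u x).toReal := by
    rw [← Real.sq_sqrt (show 0 ≤ 3 * (gradE u x).toReal by positivity)]
    gcongr
  rw [← ENNReal.toReal_le_toReal (by finiteness) (by finiteness)]
  simpa using h1

theorem measurable_gradE {u : E3 → F} (hu : ContDiff ℝ 1 u) : Measurable (gradE u) := by
  unfold gradE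
  refine Finset.measurable_sum _ fun k _ => ?_
  have : Continuous fun x => fderiv ℝ u x (Pi.single k 1) :=
    (hu.continuous_fderiv (by norm_num)).clm_apply continuous_const
  exact this.enorm.measurable.pow_const 2

theorem lintegral_comp_affine (g : E3 → ℝ≥0∞) (hg : Measurable g) {t : ℝ} (ht : 0 < t) (a : E3) :
    ∫⁻ x, g (t • x + a) = ENNReal.ofReal (t⁻¹ ^ 3) * ∫⁻ x, g x := by
  have h1 : ∫⁻ x, g (t • x + a) = ∫⁻ y, g (y + a) ∂(Measure.map (t • ·) volume) := by
    rw [lintegral_map (by fun_prop) (by fun_prop)]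
  rw [h1, Measure.map_addHaar_smul volume ht.ne', lintegral_smul_measure,
    lintegral_add_right_eq_self]
  simp [abs_of_pos ht]

theorem segment_sq_le [CompleteSpace F] {u : E3 → F} (hu : ContDiff ℝ 1 u) (x y : E3) :
    ‖u x - u y‖ₑ ^ 2 ≤ 3 * ‖x - y‖ₑ ^ 2 *
      ∫⁻ t in Ioc (0:ℝ) 1, gradE u (t • x + (1 - t) • y) := by
  have hder : ∀ t : ℝ, HasDerivAt (fun t : ℝ => u (t • x + (1 - t) • y))
      (fderiv ℝ u (t • x + (1 - t) • y) (x - y)) t := by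
    intro t
    have h1 := (hu.differentiable (by norm_num) (t • x + (1 - t) • y)).hasFDerivAt
    have h2 : HasDerivAt (fun t : ℝ => t • x + (1 - t) • y) (x - y) t := by
      have := ((hasDerivAt_id t).smul_const x).add
        (((hasDerivAt_id t).const_sub 1).smul_const y)
      have e : (1:ℝ) • x + (-1:ℝ) • y = x - y := by module
      rw [e] at this
      exact this
    exact h1.comp_hasDerivAt t h2
  have hc : Continuous fun t : ℝ => fderiv ℝ u (t • x + (1 - t) • y) (x - y) := by
    have := hu.continuous_fderiv (by norm_num)
    fun_prop
  have h := intervalIntegral.integral_eq_sub_of_hasDerivAt (a := 0) (b := 1) (fun t _ => hder t)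
    (hc.intervalIntegrable _ _)
  simp only [one_smul, sub_self, zero_smul, add_zero, sub_zero, zero_add] at h
  rw [← h, intervalIntegral.integral_of_le zero_le_one]
  have hm : Measurable fun t : ℝ => gradE u (t • x + (1 - t) • y) :=
    (measurable_gradE hu).comp (by fun_prop)
  calc _ ≤ (∫⁻ t in Ioc (0:ℝ) 1, ‖fderiv ℝ u (t • x + (1 - t) • y) (x - y)‖ₑ) ^ 2 := by
        gcongr; exact enorm_integral_le_lintegral_enorm _
    _ ≤ volume.restrict (Ioc (0:ℝ) 1) univ * _ :=
        lintegral_sq_le _ hc.enorm.measurable.aemeasurable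
    _ ≤ ∫⁻ t in Ioc (0:ℝ) 1, 3 * ‖x - y‖ₑ ^ 2 * gradE u (t • x + (1 - t) • y) := by
        simp only [Measure.restrict_apply_univ, Real.volume_Ioc, sub_zero, ENNReal.ofReal_one,
          one_mul]
        exact lintegral_mono fun t => enorm_fderiv_apply_sq_le _ _ _
    _ = _ := lintegral_const_mul _ hm

theorem convex_comb_lintegral_le (g : E3 → ℝ≥0∞) (hg : Measurable g) {B : Set E3}
    (hB : MeasurableSet B) (hc : Convex ℝ B) {t : ℝ} (ht : 0 < t) (ht1 : t ≤ 1) :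
    ∫⁻ y in B, ∫⁻ x in B, g (t • x + (1 - t) • y) ≤
      ENNReal.ofReal (t⁻¹ ^ 3) * (volume B * ∫⁻ x in B, g x) := by
  have hi : Measurable (B.indicator g) := hg.indicator hB
  calc _ ≤ ∫⁻ y in B, ENNReal.ofReal (t⁻¹ ^ 3) * ∫⁻ x in B, g x := by
        refine setLIntegral_mono' hB fun y hy => ?_
        rw [← lintegral_indicator hB (f := g), ← lintegral_comp_affine _ hi ht ((1 - t) • y),
          ← lintegral_indicator hB]
        refine lintegral_mono fun x => ?_
        by_cases hx : x ∈ B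
        · have : t • x + (1 - t) • y ∈ B := hc hx hy ht.le (by linarith) (by ring)
          simp [hx, this]
        · simp [hx]
    _ = _ := by simp; ring

/-- A double-integral form of the Poincaré inequality on cubes. -/
theorem poincare_double [CompleteSpace F] {u : E3 → F} (hu : ContDiff ℝ 1 u) (z : E3) (h : ℝ) :
    ∫⁻ y in Metric.closedBall z h, ∫⁻ x in Metric.closedBall z h, ‖u x - u y‖ₑ ^ 2 ≤
      ENNReal.ofReal (96 * h ^ 2) * volume (Metric.closedBall z h) *
        ∫⁻ x in Metric.closedBall z h, gradE u x := by
  set B := Metric.closedBall z h with hBdef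
  have hB : MeasurableSet B := Metric.isClosed_closedBall.measurableSet
  have hcv : Convex ℝ B := convex_closedBall z h
  have hg := measurable_gradE hu
  set μ := volume.restrict B
  have hm3 : Measurable fun p : (E3 × E3) × ℝ => gradE u (p.2 • p.1.2 + (1 - p.2) • p.1.1) :=
    hg.comp (by fun_prop)
  have hm2 : Measurable fun p : E3 × ℝ => ∫⁻ x, gradE u (p.2 • x + (1 - p.2) • p.1) ∂μ := by
    apply Measurable.lintegral_prod_right' (f := fun q : (E3 × ℝ) × E3 =>
      gradE u (q.1.2 • q.2 + (1 - q.1.2) • q.1.1))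
    exact hg.comp (by fun_prop)
  calc _ ≤ ∫⁻ y, ∫⁻ x, ENNReal.ofReal (12 * h ^ 2) *
          (∫⁻ t in Ioc (0:ℝ) 1, gradE u (t • x + (1 - t) • y)) ∂μ ∂μ := by
        refine setLIntegral_mono' hB fun y hy => setLIntegral_mono' hB fun x hx => ?_
        refine (segment_sq_le hu x y).trans ?_
        gcongr
        have h1 : ‖x - y‖ ≤ 2 * h := by
          rw [← dist_eq_norm]
          calc dist x y ≤ dist x z + dist y z := dist_triangle_right _ _ _
            _ ≤ 2 * h := by
              have := Metric.mem_closedBall.1 hx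
              have := Metric.mem_closedBall.1 hy
              linarith
        rw [← ofReal_norm, ← ENNReal.ofReal_pow (norm_nonneg _)]
        rw [show (3 : ℝ≥0∞) = ENNReal.ofReal 3 by simp, ← ENNReal.ofReal_mul (by norm_num)]
        apply ENNReal.ofReal_le_ofReal
        nlinarith [norm_nonneg (x - y)]
    _ = ENNReal.ofReal (12 * h ^ 2) * ∫⁻ t in Ioc (0:ℝ) 1, ∫⁻ y, ∫⁻ x,
          gradE u (t • x + (1 - t) • y) ∂μ ∂μ := by
        have e1 : ∀ y : E3, ∫⁻ x, ENNReal.ofReal (12 * h ^ 2) *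
          (∫⁻ t in Ioc (0:ℝ) 1, gradE u (t • x + (1 - t) • y)) ∂μ =
          ENNReal.ofReal (12 * h ^ 2) * ∫⁻ t in Ioc (0:ℝ) 1, ∫⁻ x,
            gradE u (t • x + (1 - t) • y) ∂μ := by
          intro y
          rw [lintegral_const_mul' _ _ ENNReal.ofReal_ne_top, lintegral_lintegral_swap]
          exact (hg.comp (by fun_prop : Measurable fun p : E3 × ℝ =>
            p.2 • p.1 + (1 - p.2) • y)).aemeasurable
        simp_rw [e1]
        rw [lintegral_const_mul' _ _ ENNReal.ofReal_ne_top, lintegral_lintegral_swap]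
        exact hm2.aemeasurable
    _ ≤ ENNReal.ofReal (12 * h ^ 2) * ∫⁻ t in Ioc (0:ℝ) 1, 8 *
          (volume B * ∫⁻ x in B, gradE u x) := by
        gcongr 1
        refine setLIntegral_mono' measurableSet_Ioc fun t ht => ?_
        have key : ∀ s : ℝ, 1 / 2 ≤ s → ENNReal.ofReal (s⁻¹ ^ 3) ≤ 8 := by
          intro s hs
          rw [show (8 : ℝ≥0∞) = ENNReal.ofReal 8 by simp]
          apply ENNReal.ofReal_le_ofReal
          have : s⁻¹ ≤ 2 := by
            rw [inv_le_comm₀ (by linarith) (by norm_num)]; linarith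
          calc s⁻¹ ^ 3 ≤ 2 ^ 3 := by
                have : 0 ≤ s⁻¹ := by positivity
                gcongr
            _ = 8 := by norm_num
        rcases le_total (1 / 2) t with h1 | h1
        · refine (convex_comb_lintegral_le _ hg hB hcv ht.1 ht.2).trans ?_
          gcongr
          exact key t h1
        · rw [lintegral_lintegral_swap]
          · have := convex_comb_lintegral_le (t := 1 - t) _ hg hB hcv (by linarith)
              (by linarith [ht.1])
            simp only [sub_sub_cancel] at this
            simp_rw [add_comm (t • _)]
            refine this.trans ?_
            gcongr
            exact key _ (by linarith)
          · exact (hg.comp (by fun_prop : Measurable fun p : E3 × E3 =>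
              t • p.2 + (1 - t) • p.1)).aemeasurable
    _ = _ := by
        simp only [lintegral_const, Measure.restrict_apply_univ, Real.volume_Ioc, sub_zero,
          ENNReal.ofReal_one, mul_one]
        rw [show (96 : ℝ) * h ^ 2 = 12 * h ^ 2 * 8 by ring,
          ENNReal.ofReal_mul (p := 12 * h ^ 2) (by positivity)]
        simp only [ENNReal.ofReal_ofNat]
        ring

/-- The Poincaré inequality on cubes. -/
theorem poincare [CompleteSpace F] {u : E3 → F} (hu : ContDiff ℝ 1 u) (z : E3) {h : ℝ}
    (hh : 0 < h) :
    ∫⁻ x in Metric.closedBall z h, ‖u x - ⨍ y in Metric.closedBall z h, u y‖ₑ ^ 2 ≤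
      ENNReal.ofReal (96 * h ^ 2) * ∫⁻ x in Metric.closedBall z h, gradE u x := by
  set B := Metric.closedBall z h with hBdef
  have hB : MeasurableSet B := Metric.isClosed_closedBall.measurableSet
  have hBv : volume B = ENNReal.ofReal ((2 * h) ^ 3) := by
    rw [hBdef, Real.volume_pi_closedBall _ hh.le]; rfl
  have hB0 : volume B ≠ 0 := by rw [hBv]; simp; positivity
  have hBt : volume B ≠ ⊤ := by rw [hBv]; simp
  have hInt : IntegrableOn u B volume :=
    (hu.continuous.continuousOn).integrableOn_compact (isCompact_closedBall z h)
  have hprob : IsFiniteMeasure (volume.restrict B) := ⟨by simpa using hBt.lt_top⟩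
  have hpt : ∀ x, ‖u x - ⨍ y in B, u y‖ₑ ^ 2 ≤ (volume B)⁻¹ * ∫⁻ y in B, ‖u x - u y‖ₑ ^ 2 := by
    intro x
    have e : u x - ⨍ y in B, u y = (volume.real B)⁻¹ • ∫ y in B, (u x - u y) := by
      rw [integral_sub (integrable_const _) hInt, smul_sub, setAverage_eq]
      simp only [integral_const, measureReal_restrict_apply_univ]
      rw [smul_smul, inv_mul_cancel₀, one_smul]
      rw [Measure.real, ENNReal.toReal_ne_zero]
      exact ⟨hB0, hBt⟩
    rw [e, enorm_smul]
    have hr : ‖(volume.real B)⁻¹‖ₑ = (volume B)⁻¹ := by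
      rw [enorm_inv (by rw [Measure.real, ENNReal.toReal_ne_zero]; exact ⟨hB0, hBt⟩)]
      rw [Real.enorm_of_nonneg (by positivity), Measure.real, ENNReal.ofReal_toReal hBt]
    rw [hr, mul_pow]
    calc _ ≤ (volume B)⁻¹ ^ 2 * (volume B * ∫⁻ y in B, ‖u x - u y‖ₑ ^ 2) := by
          gcongr
          refine le_trans (pow_le_pow_left' (enorm_integral_le_lintegral_enorm _) 2) ?_
          refine (lintegral_sq_le _ ?_).trans_eq (by simp)
          exact (continuous_const.sub hu.continuous).enorm.measurable.aemeasurable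
      _ = _ := by
          rw [sq, mul_assoc, ← mul_assoc _ (volume B), ENNReal.inv_mul_cancel hB0 hBt, one_mul]
  calc _ ≤ ∫⁻ x in B, (volume B)⁻¹ * ∫⁻ y in B, ‖u x - u y‖ₑ ^ 2 := lintegral_mono hpt
    _ = (volume B)⁻¹ * ∫⁻ x in B, ∫⁻ y in B, ‖u x - u y‖ₑ ^ 2 := by
        rw [lintegral_const_mul' _ _ (ENNReal.inv_ne_top.2 hB0)]
    _ = (volume B)⁻¹ * ∫⁻ x in B, ∫⁻ y in B, ‖u y - u x‖ₑ ^ 2 := by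
        simp_rw [enorm_sub_rev]
    _ ≤ (volume B)⁻¹ * (ENNReal.ofReal (96 * h ^ 2) * volume B * ∫⁻ x in B, gradE u x) := by
        gcongr; exact poincare_double hu z h
    _ = _ := by
        rw [mul_comm (ENNReal.ofReal _), mul_assoc, ← mul_assoc,
          ENNReal.inv_mul_cancel hB0 hBt, one_mul]

/-- The Sobolev inequality `Ḣ¹ ⊂ L⁶` in dimension three. -/
theorem sobolev_six (F : Type*) [NormedAddCommGroup F] [NormedSpace ℝ F] [FiniteDimensional ℝ F] :
    ∃ C : ℝ≥0, ∀ u : E3 → F, ContDiff ℝ 1 u → HasCompactSupport u →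
      (∫⁻ x, ‖u x‖ₑ ^ 6) ^ (1 / 3 : ℝ) ≤ C * ∫⁻ x, gradE u x := by
  refine ⟨SNormLESNormFDerivOfEqConst F (volume : Measure E3) 2 ^ 2 * 3, fun u hu hc => ?_⟩
  have h := eLpNorm_le_eLpNorm_fderiv_of_eq (volume : Measure E3) hu hc (p := 2) (p' := 6)
    (by norm_num) (by simp) (by simp; norm_num)
  rw [eLpNorm_eq_lintegral_rpow_enorm_toReal (by norm_num) (by norm_num),
    eLpNorm_eq_lintegral_rpow_enorm_toReal (by norm_num) (by norm_num)] at h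
  have h2 := pow_le_pow_left' h 2
  have e : ∀ (a : ℝ≥0∞) (r : ℝ), (a ^ r) ^ 2 = a ^ (r * 2) := fun a r => by
    rw [← ENNReal.rpow_natCast, ← ENNReal.rpow_mul]; norm_num
  rw [mul_pow, e, e] at h2
  norm_num at h2
  calc _ ≤ _ := h2
    _ ≤ (SNormLESNormFDerivOfEqConst F (volume : Measure E3) 2 : ℝ≥0∞) ^ 2 *
        ∫⁻ x, 3 * gradE u x := by
      gcongr with x
      exact enorm_fderiv_sq_le u x
    _ = _ := by
      rw [lintegral_const_mul _ (measurable_gradE hu)]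
      push_cast
      ring
end

/-- The partial derivative of a function on `E3`. -/
abbrev pdv {F : Type*} [NormedAddCommGroup F] [NormedSpace ℝ F] (k : Fin 3) (u : E3 → F) (x : E3) :
    F := fderiv ℝ u x (Pi.single k 1)

theorem continuous_pdv {F : Type*} [NormedAddCommGroup F] [NormedSpace ℝ F] {u : E3 → F}
    (hu : ContDiff ℝ 1 u) (k : Fin 3) : Continuous (pdv k u) :=
  (hu.continuous_fderiv (by norm_num)).clm_apply continuous_const

section
variable {𝕜 : Type*} [RCLike 𝕜]

theorem integral_pdv_mul_pdv_comm {u w : E3 → 𝕜} (hu : ContDiff ℝ 2 u) (hw : ContDiff ℝ 2 w)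
    (hc : HasCompactSupport u) (j k : Fin 3) :
    ∫ x, pdv j u x * pdv k w x = ∫ x, pdv k u x * pdv j w x := by
  have hw1 : ContDiff ℝ 1 (fderiv ℝ w) := hw.fderiv_right (by norm_num)
  have hd : ∀ k, ContDiff ℝ 1 (pdv k w) := fun k => hw1.clm_apply contDiff_const
  have hu1 : ContDiff ℝ 1 u := hu.of_le (by norm_num)
  have key : ∀ j k, ∫ x, pdv j u x * pdv k w x = - ∫ x, u x * pdv j (pdv k w) x := by
    intro j k
    rw [integral_mul_fderiv_eq_neg_fderiv_mul_of_integrable (f := u) (g := pdv k w), neg_neg]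
    · exact ((continuous_pdv hu1 j).mul (hd k).continuous).integrable_of_hasCompactSupport
        ((hc.fderiv_apply ℝ _).mul_right)
    · exact (hu.continuous.mul (continuous_pdv (hd k) j)).integrable_of_hasCompactSupport
        hc.mul_right
    · exact (hu.continuous.mul (hd k).continuous).integrable_of_hasCompactSupport hc.mul_right
    · exact fun x _ => hu.differentiable (by norm_num) x
    · exact fun x _ => (hd k).differentiable (by norm_num) x
  rw [key, key]
  congr 2
  ext x
  congr 1
  have h2 : ∀ j k, pdv j (pdv k w) x = fderiv ℝ (fderiv ℝ w) x (Pi.single j 1) (Pi.single k 1) := by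
    intro j k
    simp only [pdv]
    rw [fderiv_clm_apply (hw1.differentiable (by norm_num) x) (differentiableAt_const _)]
    simp
  rw [h2, h2]
  exact (hw.contDiffAt.isSymmSndFDerivAt (by simp)) _ _

end

theorem pdv_conj {u : E3 → ℂ} (k : Fin 3) (x : E3) :
    pdv k (fun y => (starRingEnd ℂ) (u y)) x = (starRingEnd ℂ) (pdv k u x) := by
  have := Complex.conjCLE.comp_fderiv (f := u) (x := x)
  have h2 : fderiv ℝ (Complex.conjCLE ∘ u) x (Pi.single k 1) = Complex.conjCLE (pdv k u x) := by
    rw [this]; rfl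
  exact h2

theorem integral_pdv_mul_conj_pdv {u v : E3 → ℂ} (hu : ContDiff ℝ 2 u) (hv : ContDiff ℝ 2 v)
    (hc : HasCompactSupport u) (j k : Fin 3) :
    Integrable (fun x => pdv j u x * (starRingEnd ℂ) (pdv k v x)
      - pdv k u x * (starRingEnd ℂ) (pdv j v x)) ∧
    ∫ x, (pdv j u x * (starRingEnd ℂ) (pdv k v x)
      - pdv k u x * (starRingEnd ℂ) (pdv j v x)) = 0 := by
  have hi : ∀ j k, Integrable (fun x => pdv j u x * (starRingEnd ℂ) (pdv k v x)) := by
    intro j k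
    have h1 := continuous_pdv (hu.of_le (by norm_num)) j
    have h2 := continuous_pdv (hv.of_le (by norm_num)) k
    exact (h1.mul (Complex.continuous_conj.comp h2)).integrable_of_hasCompactSupport
        ((hc.fderiv_apply ℝ _).mul_right)
  refine ⟨(hi j k).sub (hi k j), ?_⟩
  rw [integral_sub (hi j k) (hi k j), sub_eq_zero]
  have hw : ContDiff ℝ 2 (fun y => (starRingEnd ℂ) (v y)) := Complex.conjCLE.contDiff.comp hv
  have := integral_pdv_mul_pdv_comm hu hw hc j k
  simpa only [pdv_conj] using this

/-- Integrable functions with vanishing integral. -/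
def IntZero (f : E3 → ℝ) : Prop := Integrable f ∧ ∫ x, f x = 0

theorem IntZero.add {f g : E3 → ℝ} (hf : IntZero f) (hg : IntZero g) :
    IntZero fun x => f x + g x :=
  ⟨hf.1.add hg.1, by rw [integral_add hf.1 hg.1, hf.2, hg.2, add_zero]⟩

theorem IntZero.const_mul {f : E3 → ℝ} (hf : IntZero f) (c : ℝ) : IntZero fun x => c * f x :=
  ⟨hf.1.const_mul c, by rw [integral_const_mul, hf.2, mul_zero]⟩

theorem IntZero.integral_eq {f P Q : E3 → ℝ} (hf : IntZero f) (hQ : Integrable Q)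
    (h : ∀ x, P x = Q x + f x) : Integrable P ∧ ∫ x, P x = ∫ x, Q x := by
  obtain rfl : P = fun x => Q x + f x := funext h
  exact ⟨hQ.add hf.1, by rw [integral_add hQ hf.1, hf.2, add_zero]⟩

theorem integrable_norm_sq {α F : Type*} [MeasureSpace α] [TopologicalSpace α]
    [OpensMeasurableSpace α] [IsFiniteMeasureOnCompacts (volume : Measure α)]
    [NormedAddCommGroup F] {f : α → F} (hf : Continuous f)
    (hc : HasCompactSupport f) : Integrable fun x => ‖f x‖ ^ 2 :=
  have h : Continuous fun x => ‖f x‖ ^ 2 := by fun_prop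
  h.integrable_of_hasCompactSupport (hc.mono fun x hx h0 => hx (by simp [h0]))

/-- The squared length of a spinor value. -/
def sq2 (v : Fin 2 → ℂ) : ℝ≥0∞ := ∑ s, ‖v s‖ₑ ^ 2

/-- The squared gradient of a spinor. -/
def gradS (u : E3 → Fin 2 → ℂ) (x : E3) : ℝ≥0∞ := ∑ s, gradE (fun y => u y s) x

/-- The Dirac operator `σ · (-i∇ + A)`. -/
def dirac (A : E3 → Fin 3 → ℝ) (u : E3 → Fin 2 → ℂ) (x : E3) (s : Fin 2) : ℂ :=
  ∑ k, ∑ t, pauli k s t * (-Complex.I * pdv k (fun y => u y t) x + (A x k : ℂ) * u x t)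

theorem enorm_sq_eq_ofReal {F : Type*} [NormedAddCommGroup F] (z : F) :
    ‖z‖ₑ ^ 2 = ENNReal.ofReal (‖z‖ ^ 2) := by
  rw [← ofReal_norm, ENNReal.ofReal_pow (norm_nonneg _)]

theorem dirac_zero_sq (u : E3 → Fin 2 → ℂ) (x : E3) :
    ∑ s, ‖dirac (fun _ => 0) u x s‖ ^ 2 = (∑ s, ∑ k, ‖pdv k (fun y => u y s) x‖ ^ 2) +
      (2 * (pdv 0 (fun y => u y 1) x * (starRingEnd ℂ) (pdv 2 (fun y => u y 0) x)
        - pdv 2 (fun y => u y 1) x * (starRingEnd ℂ) (pdv 0 (fun y => u y 0) x)).re +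
      (2 * (pdv 1 (fun y => u y 1) x * (starRingEnd ℂ) (pdv 2 (fun y => u y 0) x)
        - pdv 2 (fun y => u y 1) x * (starRingEnd ℂ) (pdv 1 (fun y => u y 0) x)).im +
      ((-1) * (pdv 0 (fun y => u y 1) x * (starRingEnd ℂ) (pdv 1 (fun y => u y 1) x)
        - pdv 1 (fun y => u y 1) x * (starRingEnd ℂ) (pdv 0 (fun y => u y 1) x)).im +
      (pdv 0 (fun y => u y 0) x * (starRingEnd ℂ) (pdv 1 (fun y => u y 0) x)
        - pdv 1 (fun y => u y 0) x * (starRingEnd ℂ) (pdv 0 (fun y => u y 0) x)).im))) := by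
  simp only [dirac, pauli, Fin.sum_univ_two, Fin.sum_univ_three, Complex.sq_norm,
    Complex.normSq_apply]
  generalize pdv 0 (fun y => u y 0) x = a0
  generalize pdv 1 (fun y => u y 0) x = a1
  generalize pdv 2 (fun y => u y 0) x = a2
  generalize pdv 0 (fun y => u y 1) x = b0
  generalize pdv 1 (fun y => u y 1) x = b1
  generalize pdv 2 (fun y => u y 1) x = b2
  simp
  ring

theorem lintegral_dirac_zero {u : E3 → Fin 2 → ℂ} (hu : ∀ s, ContDiff ℝ 2 fun x => u x s)
    (hc : ∀ s, HasCompactSupport fun x => u x s) :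
    ∫⁻ x, sq2 (dirac (fun _ => 0) u x) = ∫⁻ x, gradS u x := by
  have hQ : Integrable fun x => ∑ s, ∑ k, ‖pdv k (fun y => u y s) x‖ ^ 2 := by
    refine integrable_finsetSum _ fun s _ => integrable_finsetSum _ fun k _ => ?_
    exact integrable_norm_sq (continuous_pdv ((hu s).of_le (by norm_num)) k)
      ((hc s).fderiv_apply ℝ (Pi.single k 1))
  have hre : ∀ s t j k, IntZero fun x =>
      (pdv j (fun y => u y s) x * (starRingEnd ℂ) (pdv k (fun y => u y t) x)
        - pdv k (fun y => u y s) x * (starRingEnd ℂ) (pdv j (fun y => u y t) x)).re := by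
    intro s t j k
    obtain ⟨h1, h2⟩ := integral_pdv_mul_conj_pdv (hu s) (hu t) (hc s) j k
    exact ⟨h1.re, by simpa [h2] using integral_re (𝕜 := ℂ) h1⟩
  have him : ∀ s t j k, IntZero fun x =>
      (pdv j (fun y => u y s) x * (starRingEnd ℂ) (pdv k (fun y => u y t) x)
        - pdv k (fun y => u y s) x * (starRingEnd ℂ) (pdv j (fun y => u y t) x)).im := by
    intro s t j k
    obtain ⟨h1, h2⟩ := integral_pdv_mul_conj_pdv (hu s) (hu t) (hc s) j k
    exact ⟨h1.im, by simpa [h2] using integral_im (𝕜 := ℂ) h1⟩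
  obtain ⟨hP, hI⟩ := (((hre 1 0 0 2).const_mul 2).add (((him 1 0 1 2).const_mul 2).add
    (((him 1 1 0 1).const_mul (-1)).add (him 0 0 0 1)))).integral_eq hQ (dirac_zero_sq u)
  have e1 : ∀ x, sq2 (dirac (fun _ => 0) u x) =
      ENNReal.ofReal (∑ s, ‖dirac (fun _ => 0) u x s‖ ^ 2) := fun x => by
    rw [ENNReal.ofReal_sum_of_nonneg fun _ _ => by positivity]
    simp only [sq2, enorm_sq_eq_ofReal]
  have e2 : ∀ x, gradS u x = ENNReal.ofReal (∑ s, ∑ k, ‖pdv k (fun y => u y s) x‖ ^ 2) := fun x => by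
    rw [ENNReal.ofReal_sum_of_nonneg fun _ _ => by positivity]
    refine Finset.sum_congr rfl fun s _ => ?_
    rw [ENNReal.ofReal_sum_of_nonneg fun _ _ => by positivity]
    simp only [gradE, enorm_sq_eq_ofReal]
  simp_rw [e1, e2]
  rw [← ofReal_integral_eq_lintegral_ofReal hP (ae_of_all _ fun _ => by positivity),
    ← ofReal_integral_eq_lintegral_ofReal hQ (ae_of_all _ fun _ => by positivity), hI]

theorem pdVec_eq_pdv {A : E3 → Fin 3 → ℝ} (hA : Differentiable ℝ A) (i j : Fin 3) (x : E3) :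
    pdVec A i j x = pdv i (fun y => A y j) x := by
  unfold pdVec pdv
  rw [fderiv_apply (hA x)]
  rfl

theorem integral_curlSq {A : E3 → Fin 3 → ℝ} (hA : IsVecPot A) :
    ∫ x, curlSq A x = ∫ x, gradSq A x := by
  obtain ⟨hs, hc, hdiv⟩ := hA
  have hd : Differentiable ℝ A := hs.differentiable (by simp)
  have hj : ∀ j, ContDiff ℝ 2 fun y => A y j := fun j =>
    mod_cast contDiff_infty.1 (contDiff_pi.1 hs j) 2
  have hcj : ∀ j, HasCompactSupport fun y => A y j := fun j =>
    hc.comp_left (g := fun v : Fin 3 → ℝ => v j) rfl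
  have hInt : ∀ i j k l, Integrable fun x => pdVec A i j x * pdVec A k l x := by
    intro i j k l
    simp_rw [pdVec_eq_pdv hd]
    exact ((continuous_pdv ((hj j).of_le (by norm_num)) i).mul
      (continuous_pdv ((hj l).of_le (by norm_num)) k)).integrable_of_hasCompactSupport
      (((hcj j).fderiv_apply ℝ _).mul_right)
  have hcomm : ∀ i j, ∫ x, (pdVec A i i x * pdVec A j j x - pdVec A j i x * pdVec A i j x) = 0 := by
    intro i j
    rw [integral_sub (hInt _ _ _ _) (hInt _ _ _ _), sub_eq_zero]
    simp_rw [pdVec_eq_pdv hd]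
    exact integral_pdv_mul_pdv_comm (hj i) (hj j) (hcj i) i j
  have hpt : ∀ x, curlSq A x = gradSq A x +
      (2 * (pdVec A 0 0 x * pdVec A 1 1 x - pdVec A 1 0 x * pdVec A 0 1 x) +
      (2 * (pdVec A 0 0 x * pdVec A 2 2 x - pdVec A 2 0 x * pdVec A 0 2 x) +
      2 * (pdVec A 1 1 x * pdVec A 2 2 x - pdVec A 2 1 x * pdVec A 1 2 x))) := by
    intro x
    have := hdiv x
    simp only [Fin.sum_univ_three] at this
    have h2 : pdVec A 2 2 x = - pdVec A 0 0 x - pdVec A 1 1 x := by linarith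
    simp [curlSq, curl3, gradSq, Fin.sum_univ_three, h2]
    ring
  have hz : ∀ i j, IntZero fun x =>
      2 * (pdVec A i i x * pdVec A j j x - pdVec A j i x * pdVec A i j x) := fun i j =>
    IntZero.const_mul ⟨(hInt _ _ _ _).sub (hInt _ _ _ _), hcomm i j⟩ 2
  have hgi : Integrable fun x => gradSq A x := by
    refine integrable_finsetSum _ fun s _ => integrable_finsetSum _ fun k _ => ?_
    simp_rw [sq]
    exact hInt _ _ _ _
  exact (((hz 0 1).add ((hz 0 2).add (hz 1 2))).integral_eq hgi hpt).2

theorem lintegral_gradE_ne_top {F : Type*} [NormedAddCommGroup F] [NormedSpace ℝ F] {u : E3 → F}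
    (hu : ContDiff ℝ 1 u) (hc : HasCompactSupport u) : ∫⁻ x, gradE u x ≠ ⊤ := by
  unfold gradE
  rw [lintegral_finsetSum]
  · refine (ENNReal.sum_lt_top.2 fun k _ => ?_).ne
    have h := integrable_norm_sq (continuous_pdv hu k) (hc.fderiv_apply ℝ (Pi.single k 1))
    simp_rw [enorm_sq_eq_ofReal]
    exact h.lintegral_lt_top
  · exact fun k _ => (continuous_pdv hu k).enorm.measurable.pow_const 2

/-- Scaled smooth cutoff functions. -/
theorem exists_cutoff : ∃ C : ℝ, 0 < C ∧ ∀ (z : E3) (h : ℝ), 0 < h → ∃ φ : E3 → ℝ,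
    ContDiff ℝ (⊤ : ℕ∞) φ ∧ (∀ x, 0 ≤ φ x) ∧ (∀ x, φ x ≤ 1) ∧
    (∀ x ∈ Metric.closedBall z h, φ x = 1) ∧ (∀ x, x ∉ Metric.closedBall z (2 * h) → φ x = 0) ∧
    ∀ x, gradE φ x ≤ ENNReal.ofReal (C / h ^ 2) := by
  let b : ContDiffBump (0 : E3) := ⟨1, 2, one_pos, one_lt_two⟩
  have hb1 : ContDiff ℝ 1 (b : E3 → ℝ) := b.contDiff
  obtain ⟨D, hD⟩ := (hb1.continuous_fderiv (by norm_num)).bounded_above_of_compact_support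
    (b.hasCompactSupport.fderiv ℝ)
  have hD0 : 0 ≤ D := (norm_nonneg _).trans (hD 0)
  refine ⟨3 * D ^ 2 + 1, by positivity, fun z h hh => ⟨fun x => b (h⁻¹ • (x - z)), ?_, ?_, ?_,
    ?_, ?_, ?_⟩⟩
  · exact b.contDiff.comp ((contDiff_id.sub contDiff_const).const_smul _)
  · exact fun x => b.nonneg
  · exact fun x => b.le_one
  · intro x hx
    apply b.one_of_mem_closedBall
    rw [mem_closedBall_zero_iff, norm_smul, norm_inv, Real.norm_of_nonneg hh.le,
      inv_mul_le_iff₀ hh, mul_one, ← dist_eq_norm]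
    exact hx
  · intro x hx
    apply b.zero_of_le_dist
    rw [dist_zero_right, norm_smul, norm_inv, Real.norm_of_nonneg hh.le,
      le_inv_mul_iff₀ hh, ← dist_eq_norm, mul_comm]
    simpa using (not_le.1 hx).le
  · intro x
    have hk : ∀ k, ‖pdv k (fun x => b (h⁻¹ • (x - z))) x‖ₑ ^ 2 ≤ ENNReal.ofReal (D ^ 2 / h ^ 2) := by
      intro k
      rw [enorm_sq_eq_ofReal]
      apply ENNReal.ofReal_le_ofReal
      have hder : HasFDerivAt (fun x : E3 => b (h⁻¹ • (x - z)))
          ((fderiv ℝ b (h⁻¹ • (x - z))).comp (h⁻¹ • ContinuousLinearMap.id ℝ E3)) x := by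
        refine (hb1.differentiable (by norm_num) _).hasFDerivAt.comp x ?_
        exact HasFDerivAt.const_smul ((hasFDerivAt_id x).sub_const z) (h⁻¹ : ℝ)
      have e : pdv k (fun x => b (h⁻¹ • (x - z))) x =
          h⁻¹ * fderiv ℝ b (h⁻¹ • (x - z)) (Pi.single k 1) := by
        rw [pdv, hder.fderiv]
        simp
      rw [e, norm_mul, norm_inv, Real.norm_of_nonneg hh.le]
      have h1 : ‖fderiv ℝ b (h⁻¹ • (x - z)) (Pi.single k 1)‖ ≤ D := by
        refine (ContinuousLinearMap.le_opNorm _ _).trans ?_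
        have : ‖(Pi.single k 1 : E3)‖ = 1 := by rw [Pi.norm_single]; simp
        rw [this, mul_one]
        exact hD _
      rw [mul_pow, div_eq_inv_mul, inv_pow]
      gcongr
    calc gradE _ x ≤ ∑ k : Fin 3, ENNReal.ofReal (D ^ 2 / h ^ 2) := Finset.sum_le_sum fun k _ => hk k
      _ = ENNReal.ofReal (3 * D ^ 2 / h ^ 2) := by
        rw [← ENNReal.ofReal_sum_of_nonneg fun _ _ => by positivity]
        congr 1
        simp
        ring
      _ ≤ _ := by
        apply ENNReal.ofReal_le_ofReal
        gcongr
        linarith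

theorem gradE_smul_le {F : Type*} [NormedAddCommGroup F] [NormedSpace ℝ F] {φ : E3 → ℝ} {u : E3 → F}
    (hφ : Differentiable ℝ φ) (hu : Differentiable ℝ u) (x : E3) :
    gradE (fun y => φ y • u y) x ≤ 2 * (‖φ x‖ₑ ^ 2 * gradE u x + ‖u x‖ₑ ^ 2 * gradE φ x) := by
  unfold gradE
  rw [Finset.mul_sum, Finset.mul_sum, ← Finset.sum_add_distrib, Finset.mul_sum]
  refine Finset.sum_le_sum fun k _ => ?_
  have e : fderiv ℝ (fun y => φ y • u y) x (Pi.single k 1) =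
      φ x • fderiv ℝ u x (Pi.single k 1) + fderiv ℝ φ x (Pi.single k 1) • u x := by
    rw [fderiv_fun_smul (hφ x) (hu x)]; simp
  rw [e]
  calc _ ≤ (‖φ x‖ₑ * ‖fderiv ℝ u x (Pi.single k 1)‖ₑ +
        ‖u x‖ₑ * ‖fderiv ℝ φ x (Pi.single k 1)‖ₑ) ^ 2 := by
        gcongr
        refine (enorm_add_le _ _).trans_eq ?_
        rw [enorm_smul, enorm_smul, mul_comm ‖u x‖ₑ]
    _ ≤ _ := ENNReal.add_sq_le_two _ _
    _ = _ := by simp only [mul_pow]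

theorem lintegral_sq_mul_sq_le {f g : E3 → ℝ≥0∞} (hf : Measurable f) (hg : Measurable g) {B : Set E3}
    (hB : MeasurableSet B) (hgB : ∀ x, x ∉ B → g x = 0) :
    ∫⁻ x, f x ^ 2 * g x ^ 2 ≤
      (∫⁻ x in B, f x ^ 6) ^ (1 / 3 : ℝ) * (volume B ^ (1 / 3 : ℝ) *
        (∫⁻ x, g x ^ 6) ^ (1 / 3 : ℝ)) := by
  have e0 : ∫⁻ x, f x ^ 2 * g x ^ 2 = ∫⁻ x in B, f x ^ 2 * g x ^ 2 := by
    rw [← lintegral_indicator hB]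
    refine lintegral_congr fun x => ?_
    by_cases hx : x ∈ B
    · simp [hx]
    · simp [hx, hgB x hx]
  have h1 := ENNReal.lintegral_mul_le_Lp_mul_Lq (volume.restrict B) (p := 3) (q := 3 / 2)
    (by constructor <;> norm_num) (hf.pow_const 2).aemeasurable (hg.pow_const 2).aemeasurable
  have e1 : ∀ a : ℝ≥0∞, (a ^ 2) ^ (3 : ℝ) = a ^ 6 := fun a => by
    rw [← ENNReal.rpow_natCast, ← ENNReal.rpow_mul, ← ENNReal.rpow_natCast]; norm_num
  have e2 : ∀ a : ℝ≥0∞, (a ^ 2) ^ (3 / 2 : ℝ) = a ^ 3 := fun a => by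
    rw [← ENNReal.rpow_natCast, ← ENNReal.rpow_mul, ← ENNReal.rpow_natCast]; norm_num
  have e3 : ∀ a : ℝ≥0∞, (a ^ 3) ^ 2 = a ^ 6 := fun a => by rw [← pow_mul]
  simp only [Pi.mul_apply, e1, e2] at h1
  rw [e0]
  refine h1.trans ?_
  gcongr
  have h2 := lintegral_sq_le (volume.restrict B) (hg.pow_const 3).aemeasurable
  simp only [Measure.restrict_apply_univ, e3] at h2
  calc (∫⁻ x in B, g x ^ 3) ^ (1 / (3 / 2) : ℝ)
      = ((∫⁻ x in B, g x ^ 3) ^ 2) ^ (1 / 3 : ℝ) := by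
        rw [← ENNReal.rpow_natCast, ← ENNReal.rpow_mul]; norm_num
    _ ≤ (volume B * ∫⁻ x in B, g x ^ 6) ^ (1 / 3 : ℝ) := by gcongr
    _ ≤ _ := by
        rw [ENNReal.mul_rpow_of_nonneg _ _ (by norm_num)]
        gcongr
        exact Measure.restrict_le_self

theorem volume_closedBall_rpow (z : E3) {h : ℝ} (hh : 0 ≤ h) :
    volume (Metric.closedBall z h) ^ (1 / 3 : ℝ) = ENNReal.ofReal (2 * h) := by
  rw [Real.volume_pi_closedBall _ hh, Fintype.card_fin, ENNReal.ofReal_pow (by positivity),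
    ← ENNReal.rpow_natCast, ← ENNReal.rpow_mul]
  norm_num

/-- Multiplication by an oscillation of a potential is controlled by local field energy. -/
theorem oscillation_bound : ∃ C : ℝ, 0 < C ∧ ∀ (w : E3 → ℝ), ContDiff ℝ 1 w → ∀ (z : E3) (h : ℝ),
    0 < h → ∀ Φ : E3 → ℂ, ContDiff ℝ 1 Φ → (∀ x, x ∉ Metric.closedBall z (2 * h) → Φ x = 0) →
    ∫⁻ x, ‖w x - ⨍ y in Metric.closedBall z (4 * h), w y‖ₑ ^ 2 * ‖Φ x‖ₑ ^ 2 ≤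
      ENNReal.ofReal (C * h) * (∫⁻ x in Metric.closedBall z (4 * h), gradE w x) *
        ∫⁻ x, gradE Φ x := by
  obtain ⟨C1, h1⟩ := sobolev_six ℝ
  obtain ⟨C2, h2⟩ := sobolev_six ℂ
  obtain ⟨C3, hC3, h3⟩ := exists_cutoff
  refine ⟨C1 * (2 * (1 + 96 * 4 * C3)) * 4 * C2 + 1, by positivity,
    fun w hw z h hh Φ hΦ hsupp => ?_⟩
  set c := ⨍ y in Metric.closedBall z (4 * h), w y
  set B := Metric.closedBall z (4 * h)
  have hB : MeasurableSet B := Metric.isClosed_closedBall.measurableSet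
  obtain ⟨φ, hφ, hφ0, hφ1, hφone, hφsupp, hφg⟩ := h3 z (2 * h) (by positivity)
  rw [show 2 * (2 * h) = 4 * h by ring] at hφsupp
  set v : E3 → ℝ := fun y => φ y • (w y - c)
  have hφ' : ContDiff ℝ 1 φ := hφ.of_le (by exact_mod_cast le_top)
  have hwc : ContDiff ℝ 1 fun y => w y - c := hw.sub contDiff_const
  have hv : ContDiff ℝ 1 v := hφ'.smul hwc
  have hvc : HasCompactSupport v := HasCompactSupport.of_support_subset_isCompact
    (isCompact_closedBall z (4 * h)) fun x hx => by
      by_contra hxB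
      exact hx (by simp [v, hφsupp x hxB])
  have hge : ∀ x, gradE (fun y => w y - c) x = gradE w x := fun x => by
    simp [gradE, fderiv_sub_const]
  have hgz : ∀ x, x ∉ B → gradE v x = 0 := by
    intro x hx
    have : v =ᶠ[𝓝 x] fun _ => 0 := by
      filter_upwards [Metric.isClosed_closedBall.isOpen_compl.mem_nhds hx] with y hy
      simp [v, hφsupp y hy]
    simp [gradE, this.fderiv_eq]
  have hgv : ∫⁻ x, gradE v x ≤ ENNReal.ofReal (2 * (1 + 96 * 4 * C3)) * ∫⁻ x in B, gradE w x := by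
    calc ∫⁻ x, gradE v x = ∫⁻ x in B, gradE v x := by
          rw [← lintegral_indicator hB]
          refine lintegral_congr fun x => ?_
          by_cases hx : x ∈ B
          · simp [hx]
          · simp [hx, hgz x hx]
      _ ≤ ∫⁻ x in B, 2 * (gradE w x + ENNReal.ofReal (C3 / (2 * h) ^ 2) * ‖w x - c‖ₑ ^ 2) := by
          refine lintegral_mono fun x => ?_
          refine (gradE_smul_le (hφ'.differentiable (by norm_num))
            (hwc.differentiable (by norm_num)) x).trans ?_
          rw [hge]
          gcongr 2 * (?_ + ?_)
          · refine mul_le_of_le_one_left' ?_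
            rw [enorm_sq_eq_ofReal]
            have : ‖φ x‖ ≤ 1 := by
              rw [Real.norm_of_nonneg (hφ0 x)]; exact hφ1 x
            exact ENNReal.ofReal_le_one.2 (pow_le_one₀ (norm_nonneg _) this)
          · rw [mul_comm]
            gcongr
            exact hφg x
      _ = 2 * ((∫⁻ x in B, gradE w x) + ENNReal.ofReal (C3 / (2 * h) ^ 2) *
            ∫⁻ x in B, ‖w x - c‖ₑ ^ 2) := by
          rw [lintegral_const_mul' _ _ (by simp), lintegral_add_left (measurable_gradE hw),
            lintegral_const_mul' _ _ (by simp)]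
      _ ≤ 2 * ((∫⁻ x in B, gradE w x) + ENNReal.ofReal (C3 / (2 * h) ^ 2) *
            (ENNReal.ofReal (96 * (4 * h) ^ 2) * ∫⁻ x in B, gradE w x)) := by
          gcongr
          exact poincare hw z (by positivity)
      _ = _ := by
          rw [← mul_assoc, ← ENNReal.ofReal_mul (div_nonneg hC3.le (sq_nonneg _)),
            show C3 / (2 * h) ^ 2 * (96 * (4 * h) ^ 2) = 96 * 4 * C3 by field_simp; ring,
            ENNReal.ofReal_mul zero_le_two, ENNReal.ofReal_add zero_le_one (by positivity),
            ENNReal.ofReal_one, ENNReal.ofReal_ofNat]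
          ring
  have hm1 : Measurable fun x => ‖w x - c‖ₑ := (hwc.continuous).enorm.measurable
  have hm2 : Measurable fun x => ‖Φ x‖ₑ := hΦ.continuous.enorm.measurable
  have hΦc : HasCompactSupport Φ := HasCompactSupport.of_support_subset_isCompact
    (isCompact_closedBall z (2 * h)) fun x hx => by
      by_contra hxB
      exact hx (hsupp x hxB)
  have hol := lintegral_sq_mul_sq_le hm1 hm2 (B := Metric.closedBall z (2 * h))
    Metric.isClosed_closedBall.measurableSet (fun x hx => by simp [hsupp x hx])
  rw [volume_closedBall_rpow z (by positivity)] at hol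
  have hA : (∫⁻ x in Metric.closedBall z (2 * h), ‖w x - c‖ₑ ^ 6) ^ (1 / 3 : ℝ) ≤
      C1 * ∫⁻ x, gradE v x := by
    refine le_trans (ENNReal.rpow_le_rpow ?_ (by norm_num)) (h1 v hv hvc)
    rw [← lintegral_indicator Metric.isClosed_closedBall.measurableSet]
    refine lintegral_mono fun x => ?_
    by_cases hx : x ∈ Metric.closedBall z (2 * h)
    · simp [hx, v, hφone x hx]
    · simp [hx]
  calc _ ≤ _ := hol
    _ ≤ (C1 * (ENNReal.ofReal (2 * (1 + 96 * 4 * C3)) * ∫⁻ x in B, gradE w x)) *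
        (ENNReal.ofReal (2 * (2 * h)) * (C2 * ∫⁻ x, gradE Φ x)) := by
      gcongr
      · exact hA.trans (by gcongr)
      · exact h2 Φ hΦ hΦc
    _ = ENNReal.ofReal (C1 * (2 * (1 + 96 * 4 * C3)) * 4 * C2 * h) *
        (∫⁻ x in B, gradE w x) * ∫⁻ x, gradE Φ x := by
      have e : ENNReal.ofReal (C1 * (2 * (1 + 96 * 4 * C3)) * 4 * C2 * h) =
          C1 * (ENNReal.ofReal (2 * (1 + 96 * 4 * C3)) * (ENNReal.ofReal (2 * (2 * h)) * C2)) := by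
        rw [← ENNReal.ofReal_coe_nnreal (p := C1), ← ENNReal.ofReal_coe_nnreal (p := C2),
          ← ENNReal.ofReal_mul (by positivity), ← ENNReal.ofReal_mul (by positivity),
          ← ENNReal.ofReal_mul (by positivity)]
        congr 1
        ring
      rw [e]
      ring
    _ ≤ _ := by
      gcongr
      linarith

/-- The total gradient energy density of a vector field. -/
def fieldE (A : E3 → Fin 3 → ℝ) (x : E3) : ℝ≥0∞ := ∑ j, gradE (fun y => A y j) x

/-- The plane wave `exp(i c·x)`. -/
def phase (c : E3) (x : E3) : ℂ := Complex.exp (Complex.I * ((∑ k, c k * x k : ℝ) : ℂ))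

theorem norm_phase (c x : E3) : ‖phase c x‖ = 1 := by
  rw [phase, mul_comm, Complex.norm_exp_ofReal_mul_I]

theorem enorm_phase (c x : E3) : ‖phase c x‖ₑ = 1 := by
  rw [← ofReal_norm, norm_phase, ENNReal.ofReal_one]

theorem contDiff_phase (c : E3) {n : WithTop ℕ∞} : ContDiff ℝ n (phase c) := by
  unfold phase
  refine Complex.contDiff_exp.comp ?_
  refine contDiff_const.mul ?_
  have h : ContDiff ℝ n fun x : E3 => ∑ k, c k * x k :=
    ContDiff.sum fun k _ => contDiff_const.mul (contDiff_apply ℝ ℝ k)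
  exact Complex.ofRealCLM.contDiff.comp h

theorem pdv_phase (c x : E3) (k : Fin 3) : pdv k (phase c) x = Complex.I * c k * phase c x := by
  have h1 : HasFDerivAt (fun x : E3 => (∑ j, c j * x j : ℝ))
      (∑ j, c j • ContinuousLinearMap.proj (R := ℝ) (φ := fun _ : Fin 3 => ℝ) j) x := by
    refine HasFDerivAt.fun_sum fun j _ => ?_
    exact (hasFDerivAt_apply j x).const_mul (c j)
  have h2 := ((Complex.ofRealCLM.hasFDerivAt.comp x h1).const_mul Complex.I).cexp
  have h3 : pdv k (phase c) x = _ := congrArg (fun L => L (Pi.single k 1)) h2.fderiv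
  rw [h3]
  simp [phase, Pi.single_apply]
  ring

theorem dirac_phase (A : E3 → Fin 3 → ℝ) (c : E3) {u : E3 → Fin 2 → ℂ}
    (hu : ∀ s, Differentiable ℝ fun x => u x s) (x : E3) (s : Fin 2) :
    dirac (fun _ => 0) (fun y t => phase c y * u y t) x s =
      phase c x * (dirac A u x s - ∑ k, ∑ t, pauli k s t * (((A x k - c k : ℝ) : ℂ) * u x t)) := by
  have hp : Differentiable ℝ (phase c) := (contDiff_phase c (n := 1)).differentiable (by norm_num)
  have h : ∀ k t, pdv k (fun y => phase c y * u y t) x =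
      phase c x * (Complex.I * c k * u x t + pdv k (fun y => u y t) x) := by
    intro k t
    have := pdv_phase c x k
    unfold pdv at this ⊢
    rw [fderiv_fun_mul (hp x) (hu t x)]
    simp only [add_apply, smul_apply, smul_eq_mul, this]
    ring
  unfold dirac
  rw [← Finset.sum_sub_distrib, Finset.mul_sum]
  refine Finset.sum_congr rfl fun k _ => ?_
  rw [← Finset.sum_sub_distrib, Finset.mul_sum]
  refine Finset.sum_congr rfl fun t _ => ?_
  rw [h]
  push_cast
  simp only [Pi.zero_apply, Complex.ofReal_zero]
  linear_combination (-(phase c x * c k * u x t * pauli k s t)) * Complex.I_sq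

theorem young_enorm (a b : ℂ) {θ : ℝ} (hθ : 0 < θ) :
    ‖a - b‖ₑ ^ 2 ≤ ENNReal.ofReal (1 + θ) * ‖a‖ₑ ^ 2 + ENNReal.ofReal (1 + 1 / θ) * ‖b‖ₑ ^ 2 := by
  rw [enorm_sq_eq_ofReal, enorm_sq_eq_ofReal, enorm_sq_eq_ofReal, ← ENNReal.ofReal_mul (by positivity),
    ← ENNReal.ofReal_mul (by positivity), ← ENNReal.ofReal_add (by positivity) (by positivity)]
  apply ENNReal.ofReal_le_ofReal
  have h1 : ‖a - b‖ ^ 2 ≤ (‖a‖ + ‖b‖) ^ 2 := by gcongr; exact norm_sub_le _ _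
  have h2 : 0 ≤ (θ * ‖a‖ - ‖b‖) ^ 2 / θ := by positivity
  have h3 : (θ * ‖a‖ - ‖b‖) ^ 2 / θ = θ * ‖a‖ ^ 2 - 2 * ‖a‖ * ‖b‖ + 1 / θ * ‖b‖ ^ 2 := by
    field_simp; ring
  nlinarith

theorem norm_pauli_le (k : Fin 3) (s t : Fin 2) : ‖pauli k s t‖ ≤ 1 := by
  fin_cases k <;> fin_cases s <;> fin_cases t <;> simp [pauli]

theorem sq2_pauli_le (b : Fin 3 → ℝ) (v : Fin 2 → ℂ) :
    sq2 (fun s => ∑ k, ∑ t, pauli k s t * (((b k : ℝ) : ℂ) * v t)) ≤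
      12 * ∑ k, ∑ t, ‖b k‖ₑ ^ 2 * ‖v t‖ₑ ^ 2 := by
  have h : ∀ s, ‖∑ k, ∑ t, pauli k s t * (((b k : ℝ) : ℂ) * v t)‖ₑ ^ 2 ≤
      6 * ∑ k, ∑ t, ‖b k‖ₑ ^ 2 * ‖v t‖ₑ ^ 2 := by
    intro s
    calc _ ≤ (∑ k, ∑ t, ‖b k‖ₑ * ‖v t‖ₑ) ^ 2 := by
          gcongr
          refine (enorm_sum_le _ _).trans (Finset.sum_le_sum fun k _ => ?_)
          refine (enorm_sum_le _ _).trans (Finset.sum_le_sum fun t _ => ?_)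
          rw [enorm_mul, enorm_mul]
          have h1 : ‖pauli k s t‖ₑ ≤ 1 := by
            rw [← ofReal_norm]; exact ENNReal.ofReal_le_one.2 (norm_pauli_le k s t)
          have h2 : ‖((b k : ℝ) : ℂ)‖ₑ = ‖b k‖ₑ := by
            rw [← ofReal_norm, Complex.norm_real, ofReal_norm]
          rw [h2]
          exact mul_le_of_le_one_left' h1
      _ ≤ 3 * ∑ k, (∑ t, ‖b k‖ₑ * ‖v t‖ₑ) ^ 2 := by
          simpa using ENNReal.sum_sq_le Finset.univ fun k => ∑ t, ‖b k‖ₑ * ‖v t‖ₑ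
      _ ≤ 3 * ∑ k, 2 * ∑ t, (‖b k‖ₑ * ‖v t‖ₑ) ^ 2 := by
          gcongr with k
          simpa using ENNReal.sum_sq_le Finset.univ fun t => ‖b k‖ₑ * ‖v t‖ₑ
      _ = _ := by
          rw [← Finset.mul_sum, ← mul_assoc]
          norm_num [mul_pow]
  unfold sq2
  calc _ ≤ ∑ s : Fin 2, 6 * ∑ k, ∑ t, ‖b k‖ₑ ^ 2 * ‖v t‖ₑ ^ 2 := Finset.sum_le_sum fun s _ => h s
    _ = _ := by
      rw [Finset.sum_const, Finset.card_univ, Fintype.card_fin, nsmul_eq_mul, ← mul_assoc]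
      norm_num

theorem hasCompactSupport_of_closedBall {F : Type*} [Zero F] {u : E3 → F} {z : E3} {r : ℝ}
    (h : ∀ x, x ∉ Metric.closedBall z r → u x = 0) : HasCompactSupport u :=
  HasCompactSupport.of_support_subset_isCompact (isCompact_closedBall z r) fun x hx => by
    by_contra hxB
    exact hx (h x hxB)

theorem continuous_dirac {A : E3 → Fin 3 → ℝ} (hA : Continuous A) {u : E3 → Fin 2 → ℂ}
    (hu : ∀ s, ContDiff ℝ 1 fun x => u x s) (s : Fin 2) : Continuous fun x => dirac A u x s := by
  unfold dirac
  refine continuous_finsetSum _ fun k _ => continuous_finsetSum _ fun t _ => ?_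
  refine continuous_const.mul ((continuous_const.mul (continuous_pdv (hu t) k)).add ?_)
  exact (Complex.continuous_ofReal.comp ((continuous_apply k).comp hA)).mul (hu t).continuous

/-- Local gauge fixing: where the field energy is small the Pauli form controls the full gradient
up to a plane-wave factor. -/
theorem local_gauge : ∃ C : ℝ, 0 < C ∧ ∀ (A : E3 → Fin 3 → ℝ), ContDiff ℝ 1 A → ∀ (z : E3) (h θ : ℝ),
    0 < h → 0 < θ → θ ≤ 1 / 4 →
    ENNReal.ofReal h * (∫⁻ x in Metric.closedBall z (4 * h), fieldE A x) ≤ ENNReal.ofReal (θ ^ 2 / C) →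
    ∃ c : E3, ∀ u : E3 → Fin 2 → ℂ, (∀ s, ContDiff ℝ 2 fun x => u x s) →
      (∀ x, x ∉ Metric.closedBall z (2 * h) → u x = 0) →
      ∫⁻ x, gradS (fun y t => phase c y * u y t) x ≤
        ENNReal.ofReal (1 + 4 * θ) * ∫⁻ x, sq2 (dirac A u x) := by
  obtain ⟨C, hC, H⟩ := oscillation_bound
  refine ⟨12 * C, by positivity, fun A hA z h θ hh hθ hθ1 hF => ?_⟩
  refine ⟨fun k => ⨍ y in Metric.closedBall z (4 * h), A y k, fun u hu hsupp => ?_⟩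
  set c : E3 := fun k => ⨍ y in Metric.closedBall z (4 * h), A y k
  have hAk : ∀ k, ContDiff ℝ 1 fun x => A x k := fun k => contDiff_pi.1 hA k
  set Φ : E3 → Fin 2 → ℂ := fun y t => phase c y * u y t
  have hΦ : ∀ t, ContDiff ℝ 2 fun x => Φ x t := fun t => (contDiff_phase c).mul (hu t)
  have hΦ1 : ∀ t, ContDiff ℝ 1 fun x => Φ x t := fun t => (hΦ t).of_le (by norm_num)
  have hΦ0 : ∀ t, ∀ x, x ∉ Metric.closedBall z (2 * h) → Φ x t = 0 := fun t x hx => by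
    simp [Φ, hsupp x hx]
  have hΦc : ∀ t, HasCompactSupport fun x => Φ x t := fun t =>
    hasCompactSupport_of_closedBall (hΦ0 t)
  set X := ∫⁻ x, gradS Φ x
  set Y := ∫⁻ x, sq2 (dirac A u x)
  have hX : X = ∑ t, ∫⁻ x, gradE (fun y => Φ y t) x := by
    simp only [X, gradS]
    rw [lintegral_finsetSum _ fun t _ => measurable_gradE (hΦ1 t)]
  have hXfin : X ≠ ⊤ := by
    rw [hX]
    exact (ENNReal.sum_lt_top.2 fun t _ => (lintegral_gradE_ne_top (hΦ1 t) (hΦc t)).lt_top).ne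
  have hW : ∫⁻ x, ∑ k, ∑ t, ‖A x k - c k‖ₑ ^ 2 * ‖u x t‖ₑ ^ 2 ≤
      ENNReal.ofReal C * (ENNReal.ofReal h * ∫⁻ x in Metric.closedBall z (4 * h), fieldE A x) * X := by
    have hm : ∀ k t, Measurable fun x => ‖A x k - c k‖ₑ ^ 2 * ‖u x t‖ₑ ^ 2 := fun k t =>
      ((((hAk k).continuous.sub continuous_const).enorm.measurable).pow_const 2).mul
        ((hu t).continuous.enorm.measurable.pow_const 2)
    rw [lintegral_finsetSum _ fun k _ => Finset.measurable_sum _ fun t _ => hm k t]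
    calc _ = ∑ k, ∑ t, ∫⁻ x, ‖A x k - c k‖ₑ ^ 2 * ‖Φ x t‖ₑ ^ 2 := by
          refine Finset.sum_congr rfl fun k _ => ?_
          rw [lintegral_finsetSum _ fun t _ => hm k t]
          simp only [Φ, enorm_mul, enorm_phase, one_mul]
      _ ≤ ∑ k, ∑ t, ENNReal.ofReal (C * h) *
            (∫⁻ x in Metric.closedBall z (4 * h), gradE (fun y => A y k) x) *
              ∫⁻ x, gradE (fun y => Φ y t) x :=
          Finset.sum_le_sum fun k _ => Finset.sum_le_sum fun t _ =>
            H _ (hAk k) z h hh _ (hΦ1 t) (hΦ0 t)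
      _ = _ := by
          simp only [fieldE]
          rw [lintegral_finsetSum _ fun k _ => measurable_gradE (hAk k), hX,
            ENNReal.ofReal_mul hC.le]
          simp only [Finset.mul_sum, Finset.sum_mul]
          rw [Finset.sum_comm]
          refine Finset.sum_congr rfl fun k _ => Finset.sum_congr rfl fun t _ => ?_
          ring
  have hpt : ∀ x, sq2 (dirac (fun _ => 0) Φ x) ≤ ENNReal.ofReal (1 + θ) * sq2 (dirac A u x) +
      ENNReal.ofReal (1 + 1 / θ) * (12 * ∑ k, ∑ t, ‖A x k - c k‖ₑ ^ 2 * ‖u x t‖ₑ ^ 2) := by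
    intro x
    refine le_trans ?_ (add_le_add_right (mul_le_mul_right
      (sq2_pauli_le (fun k => A x k - c k) (u x)) _) _)
    unfold sq2
    rw [Finset.mul_sum, Finset.mul_sum, ← Finset.sum_add_distrib]
    refine Finset.sum_le_sum fun s _ => ?_
    rw [dirac_phase A c (fun t => (hu t).differentiable (by norm_num)) x s, enorm_mul, enorm_phase,
      one_mul]
    exact young_enorm _ _ hθ
  have hmain : X ≤ ENNReal.ofReal (1 + θ) * Y + ENNReal.ofReal (θ + θ ^ 2) * X := by
    calc X = ∫⁻ x, sq2 (dirac (fun _ => 0) Φ x) := (lintegral_dirac_zero hΦ hΦc).symm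
      _ ≤ ∫⁻ x, (ENNReal.ofReal (1 + θ) * sq2 (dirac A u x) +
          ENNReal.ofReal (1 + 1 / θ) * (12 * ∑ k, ∑ t, ‖A x k - c k‖ₑ ^ 2 * ‖u x t‖ₑ ^ 2)) :=
        lintegral_mono hpt
      _ = ENNReal.ofReal (1 + θ) * Y + ENNReal.ofReal (1 + 1 / θ) * (12 *
          ∫⁻ x, ∑ k, ∑ t, ‖A x k - c k‖ₑ ^ 2 * ‖u x t‖ₑ ^ 2) := by
        rw [lintegral_add_left, lintegral_const_mul' _ _ (by simp), lintegral_const_mul' _ _ (by simp),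
          lintegral_const_mul' _ _ (by simp)]
        refine Measurable.const_mul ?_ _
        unfold sq2
        exact Finset.measurable_sum _ fun s _ => (continuous_dirac hA.continuous
          (fun t => (hu t).of_le (by norm_num)) s).enorm.measurable.pow_const 2
      _ ≤ ENNReal.ofReal (1 + θ) * Y + ENNReal.ofReal (1 + 1 / θ) * (12 *
          (ENNReal.ofReal C * ENNReal.ofReal (θ ^ 2 / (12 * C)) * X)) := by
        gcongr
        exact hW.trans (by gcongr)
      _ = _ := by
        congr 1
        rw [← ENNReal.ofReal_mul hC.le, ← mul_assoc, ← mul_assoc,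
          show (12 : ℝ≥0∞) = ENNReal.ofReal 12 by simp, ← ENNReal.ofReal_mul (by positivity),
          ← ENNReal.ofReal_mul (by positivity)]
        congr 2
        field_simp
        ring
  by_cases hY : Y = ⊤
  · rw [hY, ENNReal.mul_top]
    · exact le_top
    · simp only [ne_eq, ENNReal.ofReal_eq_zero, not_le]; positivity
  have hr := ENNReal.toReal_mono (by finiteness) hmain
  rw [ENNReal.toReal_add (by finiteness) (by finiteness), ENNReal.toReal_mul, ENNReal.toReal_mul,
    ENNReal.toReal_ofReal (by positivity), ENNReal.toReal_ofReal (by positivity)] at hr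
  rw [← ENNReal.ofReal_toReal hXfin, ← ENNReal.ofReal_toReal hY,
    ← ENNReal.ofReal_mul (by positivity)]
  apply ENNReal.ofReal_le_ofReal
  have hX0 : 0 ≤ X.toReal := ENNReal.toReal_nonneg
  have hY0 : 0 ≤ Y.toReal := ENNReal.toReal_nonneg
  have h1 : (1 - θ - θ ^ 2) * X.toReal ≤ (1 + θ) * Y.toReal := by nlinarith
  have h2 : 1 + θ ≤ (1 + 4 * θ) * (1 - θ - θ ^ 2) := by nlinarith
  have h3 : 0 < 1 - θ - θ ^ 2 := by nlinarith
  have h4 : (1 - θ - θ ^ 2) * X.toReal ≤ (1 - θ - θ ^ 2) * ((1 + 4 * θ) * Y.toReal) := by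
    nlinarith
  exact le_of_mul_le_mul_left h4 h3

/-- Integrability of inverse powers of the norm near the origin, with scaling. -/
theorem lintegral_norm_rpow {p : ℝ} (hp : p < 3) : ∃ C : ℝ, 0 < C ∧ ∀ a : ℝ, 0 < a →
    ∫⁻ x in Metric.closedBall (0 : E3) a, ENNReal.ofReal (‖x‖ ^ (-p)) ≤
      ENNReal.ofReal (C * a ^ (3 - p)) := by
  have hInt : IntegrableOn (fun x : E3 => ‖x‖ ^ (-p)) (Metric.ball 0 2) := by
    rw [integrableOn_fun_norm_addHaar (volume : Measure E3) (f := fun y => y ^ (-p))]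
    have h1 : IntegrableOn (fun y : ℝ => y ^ (2 - p)) (Ioo 0 2) := by
      have := intervalIntegral.intervalIntegrable_rpow' (a := 0) (b := 2) (r := 2 - p) (by linarith)
      rw [intervalIntegrable_iff_integrableOn_Ioo_of_le (by norm_num)] at this
      exact this
    refine h1.congr_fun (fun y hy => ?_) measurableSet_Ioo
    simp only [Module.finrank_fintype_fun_eq_card, Fintype.card_fin, smul_eq_mul]
    rw [sub_eq_add_neg, Real.rpow_add hy.1]
    norm_num
  set J := ∫⁻ x in Metric.closedBall (0 : E3) 1, ENNReal.ofReal (‖x‖ ^ (-p)) with hJ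
  have hJfin : J ≠ ⊤ := by
    have h2 := hInt.mono_set (Metric.closedBall_subset_ball (show (1 : ℝ) < 2 by norm_num))
    have h3 := h2.2.ne
    refine ne_top_of_le_ne_top h3 (lintegral_mono fun x => ?_)
    rw [Real.enorm_eq_ofReal (by positivity)]
  refine ⟨J.toReal + 1, by positivity, fun a ha => ?_⟩
  set g : E3 → ℝ≥0∞ := (Metric.closedBall (0 : E3) a).indicator fun x => ENNReal.ofReal (‖x‖ ^ (-p))
  have hg : Measurable g := by
    refine Measurable.indicator ?_ Metric.isClosed_closedBall.measurableSet
    fun_prop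
  have h4 := lintegral_comp_affine g hg ha 0
  have h5 : ∫⁻ x, g (a • x + 0) = ENNReal.ofReal (a ^ (-p)) * J := by
    rw [hJ, ← lintegral_indicator Metric.isClosed_closedBall.measurableSet, ← lintegral_const_mul]
    · refine lintegral_congr fun x => ?_
      have hiff : a • x ∈ Metric.closedBall (0 : E3) a ↔ x ∈ Metric.closedBall (0 : E3) 1 := by
        rw [mem_closedBall_zero_iff, mem_closedBall_zero_iff, norm_smul, Real.norm_of_nonneg ha.le]
        exact mul_le_iff_le_one_right ha
      by_cases hx : x ∈ Metric.closedBall (0 : E3) 1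
      · simp only [g, add_zero, indicator_of_mem hx, indicator_of_mem (hiff.2 hx)]
        rw [norm_smul, Real.norm_of_nonneg ha.le, Real.mul_rpow ha.le (norm_nonneg _),
          ENNReal.ofReal_mul (by positivity)]
      · simp only [g, add_zero, indicator_of_notMem hx, indicator_of_notMem (mt hiff.1 hx), mul_zero]
    · exact Measurable.indicator (by fun_prop) Metric.isClosed_closedBall.measurableSet
  rw [h5] at h4
  have h6 : ∫⁻ x in Metric.closedBall (0 : E3) a, ENNReal.ofReal (‖x‖ ^ (-p)) = ∫⁻ x, g x :=
    (lintegral_indicator Metric.isClosed_closedBall.measurableSet _).symm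
  have h7 : ∫⁻ x, g x = ENNReal.ofReal (a ^ 3) * (ENNReal.ofReal (a⁻¹ ^ 3) * ∫⁻ x, g x) := by
    rw [← mul_assoc, ← ENNReal.ofReal_mul (by positivity), ← mul_pow, mul_inv_cancel₀ ha.ne']
    simp
  rw [h6, h7, ← h4, ← ENNReal.ofReal_toReal hJfin, ← ENNReal.ofReal_mul (by positivity),
    ← ENNReal.ofReal_mul (by positivity)]
  apply ENNReal.ofReal_le_ofReal
  rw [sub_eq_add_neg, Real.rpow_add ha]
  norm_num
  have : 0 < a ^ 3 * a ^ (-p) := by positivity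
  nlinarith

/-- Coulomb singularity on a small ball is controlled by the gradient. -/
theorem coulomb_ball : ∃ C : ℝ, 0 < C ∧ ∀ u : E3 → ℂ, ContDiff ℝ 1 u → HasCompactSupport u →
    ∀ a : ℝ, 0 < a → ∫⁻ x in Metric.closedBall 0 a, ‖u x‖ₑ ^ 2 * ENNReal.ofReal ‖x‖⁻¹ ≤
      ENNReal.ofReal (C * a) * ∫⁻ x, gradE u x := by
  obtain ⟨C1, h1⟩ := sobolev_six ℂ
  obtain ⟨C2, hC2, h2⟩ := lintegral_norm_rpow (p := 3 / 2) (by norm_num)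
  refine ⟨C1 * C2 ^ (2 / 3 : ℝ) + 1, by positivity, fun u hu hc a ha => ?_⟩
  have e1 : ∀ b : ℝ≥0∞, (b ^ 2) ^ (3 : ℝ) = b ^ 6 := fun b => by
    rw [← ENNReal.rpow_natCast, ← ENNReal.rpow_mul, ← ENNReal.rpow_natCast]; norm_num
  have e2 : ∀ x : E3, ENNReal.ofReal ‖x‖⁻¹ ^ (3 / 2 : ℝ) = ENNReal.ofReal (‖x‖ ^ (-(3 / 2) : ℝ)) := by
    intro x
    rw [ENNReal.ofReal_rpow_of_nonneg (by positivity) (by norm_num), Real.rpow_neg (norm_nonneg _),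
      Real.inv_rpow (norm_nonneg _)]
  have hol := ENNReal.lintegral_mul_le_Lp_mul_Lq (volume.restrict (Metric.closedBall (0 : E3) a))
    (p := 3) (q := 3 / 2) (by constructor <;> norm_num) (f := fun x => ‖u x‖ₑ ^ 2)
    (g := fun x => ENNReal.ofReal ‖x‖⁻¹) (hu.continuous.enorm.measurable.pow_const 2).aemeasurable
    (by fun_prop)
  simp only [Pi.mul_apply, e1, e2] at hol
  calc _ ≤ _ := hol
    _ ≤ (C1 * ∫⁻ x, gradE u x) * ENNReal.ofReal (C2 * a ^ (3 - 3 / 2 : ℝ)) ^ (1 / (3 / 2) : ℝ) := by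
        refine mul_le_mul' (le_trans (ENNReal.rpow_le_rpow (setLIntegral_le_lintegral _ _)
          (by norm_num)) (h1 u hu hc)) (ENNReal.rpow_le_rpow (h2 a ha) (by norm_num))
    _ = ENNReal.ofReal (C1 * C2 ^ (2 / 3 : ℝ) * a) * ∫⁻ x, gradE u x := by
        rw [ENNReal.ofReal_rpow_of_nonneg (by positivity) (by norm_num),
          Real.mul_rpow hC2.le (by positivity), ← Real.rpow_mul ha.le]
        norm_num
        rw [mul_assoc (C1 : ℝ), ENNReal.ofReal_mul (q := C2 ^ (2 / 3 : ℝ) * a) (by positivity),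
          ENNReal.ofReal_coe_nnreal]
        ring
    _ ≤ _ := by
        gcongr
        linarith

section

/-- A measurable family of spinor fields whose one-particle density matrix is at most one. -/
structure BFam {Ω : Type} [MeasurableSpace Ω] (μ : Measure Ω) (ψ : Ω → E3 → Fin 2 → ℂ) : Prop where
  smooth : ∀ ω s, ContDiff ℝ 2 fun x => ψ ω x s
  meas : ∀ s, Measurable fun p : Ω × E3 => ψ p.1 p.2 s
  meas_pdv : ∀ k s, Measurable fun p : Ω × E3 => pdv k (fun y => ψ p.1 y s) p.2
  bessel : ∀ v : E3 → Fin 2 → ℂ, (∀ s, Measurable fun x => v x s) → (∃ C, ∀ x s, ‖v x s‖ ≤ C) →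
    (∃ R, ∀ x, x ∉ Metric.closedBall 0 R → v x = 0) →
    ∫⁻ ω, ‖∫ x, ∑ s, (starRingEnd ℂ) (v x s) * ψ ω x s‖ₑ ^ 2 ∂μ ≤ ∫⁻ x, sq2 (v x)

variable {Ω : Type} [MeasurableSpace Ω]

/-- One-particle density of a family. -/
def dens (μ : Measure Ω) (ψ : Ω → E3 → Fin 2 → ℂ) (x : E3) : ℝ≥0∞ := ∫⁻ ω, sq2 (ψ ω x) ∂μ

/-- Pauli kinetic energy density of a family. -/
def kinD (μ : Measure Ω) (A : E3 → Fin 3 → ℝ) (ψ : Ω → E3 → Fin 2 → ℂ) (x : E3) : ℝ≥0∞ :=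
  ∫⁻ ω, sq2 (dirac A (ψ ω) x) ∂μ

/-- Gradient energy density of a family. -/
def gradD (μ : Measure Ω) (ψ : Ω → E3 → Fin 2 → ℂ) (x : E3) : ℝ≥0∞ := ∫⁻ ω, gradS (ψ ω) x ∂μ

theorem enorm_le_one_of_norm {z : ℂ} (h : ‖z‖ ≤ 1) : ‖z‖ₑ ≤ 1 := by
  rw [← ofReal_norm]; exact ENNReal.ofReal_le_one.2 h

theorem pdv_mul {a u : E3 → ℂ} {x : E3} (ha : DifferentiableAt ℝ a x) (hu : DifferentiableAt ℝ u x)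
    (k : Fin 3) : pdv k (fun y => a y * u y) x = a x * pdv k u x + pdv k a x * u x := by
  unfold pdv
  rw [fderiv_fun_mul ha hu]
  simp [mul_comm]

theorem sq2_mul (a : ℂ) (v : Fin 2 → ℂ) : sq2 (fun s => a * v s) = ‖a‖ₑ ^ 2 * sq2 v := by
  simp only [sq2, enorm_mul, mul_pow, Finset.mul_sum]

namespace BFam

variable {μ : Measure Ω} {ψ : Ω → E3 → Fin 2 → ℂ}

theorem measurable_sq2 (h : BFam μ ψ) : Measurable fun p : Ω × E3 => sq2 (ψ p.1 p.2) :=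
  Finset.measurable_sum _ fun s _ => (h.meas s).enorm.pow_const 2

theorem measurable_gradS (h : BFam μ ψ) : Measurable fun p : Ω × E3 => gradS (ψ p.1) p.2 :=
  Finset.measurable_sum _ fun s _ => Finset.measurable_sum _ fun k _ =>
    (h.meas_pdv k s).enorm.pow_const 2

theorem measurable_dirac (h : BFam μ ψ) {A : E3 → Fin 3 → ℝ} (hA : Continuous A) :
    Measurable fun p : Ω × E3 => sq2 (dirac A (ψ p.1) p.2) := by
  unfold sq2 dirac
  refine Finset.measurable_sum _ fun s _ => Measurable.pow_const (Measurable.enorm ?_) 2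
  refine Finset.measurable_sum _ fun k _ => Finset.measurable_sum _ fun t _ => ?_
  refine Measurable.const_mul (((h.meas_pdv k t).const_mul _).add (Measurable.mul ?_ (h.meas t))) _
  exact Complex.measurable_ofReal.comp (((continuous_apply k).comp hA).measurable.comp measurable_snd)

theorem measurable_dens [SFinite μ] (h : BFam μ ψ) : Measurable (dens μ ψ) :=
  h.measurable_sq2.lintegral_prod_left'

theorem measurable_kinD [SFinite μ] (h : BFam μ ψ) {A : E3 → Fin 3 → ℝ} (hA : Continuous A) :
    Measurable (kinD μ A ψ) := (h.measurable_dirac hA).lintegral_prod_left'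

theorem measurable_gradD [SFinite μ] (h : BFam μ ψ) : Measurable (gradD μ ψ) :=
  h.measurable_gradS.lintegral_prod_left'

theorem mul (h : BFam μ ψ) {a : E3 → ℂ} (ha : ContDiff ℝ 2 a) (ha1 : ∀ x, ‖a x‖ ≤ 1) :
    BFam μ fun ω x s => a x * ψ ω x s where
  smooth ω s := ha.mul (h.smooth ω s)
  meas s := (ha.continuous.measurable.comp measurable_snd).mul (h.meas s)
  meas_pdv k s := by
    have e : (fun p : Ω × E3 => pdv k (fun y => a y * ψ p.1 y s) p.2) = fun p =>
        a p.2 * pdv k (fun y => ψ p.1 y s) p.2 + pdv k a p.2 * ψ p.1 p.2 s := by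
      ext p
      exact pdv_mul (ha.differentiable (by norm_num) _)
        ((h.smooth p.1 s).differentiable (by norm_num) _) k
    rw [e]
    refine ((ha.continuous.measurable.comp measurable_snd).mul (h.meas_pdv k s)).add
      (Measurable.mul ?_ (h.meas s))
    exact (continuous_pdv (ha.of_le (by norm_num)) k).measurable.comp measurable_snd
  bessel v hv hb hs := by
    obtain ⟨C, hC⟩ := hb
    obtain ⟨R, hR⟩ := hs
    have h1 := h.bessel (fun x s => (starRingEnd ℂ) (a x) * v x s)
      (fun s => (Complex.continuous_conj.comp ha.continuous).measurable.mul (hv s))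
      ⟨C, fun x s => by
        rw [norm_mul, RCLike.norm_conj]
        exact (mul_le_of_le_one_left (norm_nonneg _) (ha1 x)).trans (hC x s)⟩
      ⟨R, fun x hx => by ext s; simp [hR x hx]⟩
    refine le_trans (le_of_eq ?_) (h1.trans (lintegral_mono fun x => ?_))
    · refine lintegral_congr fun ω => ?_
      congr 3
      ext x
      refine Finset.sum_congr rfl fun s _ => ?_
      simp only [map_mul, Complex.conj_conj]
      ring
    · rw [sq2_mul]
      refine mul_le_of_le_one_left' (pow_le_one₀ (by simp) (enorm_le_one_of_norm ?_))
      rw [RCLike.norm_conj]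
      exact ha1 x

/-- Local exclusion principle on cubes. -/
theorem exclusion [SFinite μ] (hψ : BFam μ ψ) (w : E3) {h : ℝ} (hh : 0 < h) :
    ∫⁻ x in Metric.closedBall w h, dens μ ψ x ≤
      4 + ENNReal.ofReal (192 * h ^ 2) * ∫⁻ x in Metric.closedBall w h, gradD μ ψ x := by
  set B := Metric.closedBall w h with hBdef
  have hB : MeasurableSet B := Metric.isClosed_closedBall.measurableSet
  set b : ℝ := (2 * h) ^ 3 with hb
  have hb0 : 0 < b := by positivity
  have hBv : volume B = ENNReal.ofReal b := by
    rw [hBdef, Real.volume_pi_closedBall _ hh.le, Fintype.card_fin]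
  have hBr : volume.real B = b := by
    rw [Measure.real, hBv, ENNReal.toReal_ofReal hb0.le]
  set v : Fin 2 → E3 → Fin 2 → ℂ := fun s x t => if t = s then B.indicator (fun _ => ((√b)⁻¹ : ℂ)) x else 0
  have hvm : ∀ s t, Measurable fun x => v s x t := by
    intro s t
    simp only [v]
    split_ifs
    · exact measurable_const.indicator hB
    · exact measurable_const
  have hsq : ‖((√b)⁻¹ : ℂ)‖ₑ ^ 2 = ENNReal.ofReal b⁻¹ := by
    rw [enorm_sq_eq_ofReal, norm_inv, Complex.norm_real, inv_pow, Real.norm_of_nonneg (by positivity),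
      Real.sq_sqrt hb0.le]
  have hvn : ∀ s, ∫⁻ x, sq2 (v s x) = 1 := by
    intro s
    have : ∀ x, sq2 (v s x) = B.indicator (fun _ => ENNReal.ofReal b⁻¹) x := by
      intro x
      have : sq2 (v s x) = ‖B.indicator (fun _ => ((√b)⁻¹ : ℂ)) x‖ₑ ^ 2 := by
        simp only [sq2, v]
        rw [Finset.sum_eq_single s]
        · simp
        · intro t _ ht; simp [ht]
        · simp
      rw [this]
      by_cases hx : x ∈ B
      · simp only [indicator_of_mem hx, hsq]
      · simp [hx]
    simp_rw [this]
    rw [lintegral_indicator hB, setLIntegral_const, hBv, ← ENNReal.ofReal_mul (by positivity),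
      inv_mul_cancel₀ hb0.ne', ENNReal.ofReal_one]
  have hbes : ∀ s, ∫⁻ ω, ‖∫ x, ∑ t, (starRingEnd ℂ) (v s x t) * ψ ω x t‖ₑ ^ 2 ∂μ ≤ 1 := by
    intro s
    refine (hψ.bessel (v s) (hvm s) ⟨(√b)⁻¹, fun x t => ?_⟩ ⟨‖w‖ + h, fun x hx => ?_⟩).trans_eq (hvn s)
    · simp only [v]
      split_ifs
      · by_cases hx : x ∈ B
        · simp [hx, abs_of_nonneg (Real.sqrt_nonneg b)]
        · simp [hx]
      · simp
    · ext t
      have hxB : x ∉ B := by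
        intro hxB
        apply hx
        rw [mem_closedBall_zero_iff]
        have := mem_closedBall_iff_norm.1 hxB
        calc ‖x‖ = ‖w + (x - w)‖ := by congr 1; abel
          _ ≤ ‖w‖ + ‖x - w‖ := norm_add_le _ _
          _ ≤ _ := by linarith
      simp [v, hxB]
  have hpt : ∀ ω s, ∫⁻ x in B, ‖ψ ω x s‖ₑ ^ 2 ≤
      ENNReal.ofReal (192 * h ^ 2) * (∫⁻ x in B, gradE (fun y => ψ ω y s) x) +
        2 * ‖∫ x, ∑ t, (starRingEnd ℂ) (v s x t) * ψ ω x t‖ₑ ^ 2 := by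
    intro ω s
    set u : E3 → ℂ := fun x => ψ ω x s
    have hu : ContDiff ℝ 1 u := (hψ.smooth ω s).of_le (by norm_num)
    set c := ⨍ y in B, u y with hc
    have e1 : ∫ x, ∑ t, (starRingEnd ℂ) (v s x t) * ψ ω x t = ((√b)⁻¹ : ℂ) * ∫ x in B, u x := by
      rw [← integral_const_mul, ← integral_indicator hB]
      refine integral_congr_ae (Eventually.of_forall fun x => ?_)
      simp only [v]
      rw [Finset.sum_eq_single s]
      · by_cases hx : x ∈ B
        · simp [hx, u]
        · simp [hx]
      · intro t _ ht; simp [ht]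
      · simp
    have e2 : volume B * ‖c‖ₑ ^ 2 = ‖∫ x, ∑ t, (starRingEnd ℂ) (v s x t) * ψ ω x t‖ₑ ^ 2 := by
      rw [e1, hc, setAverage_eq, hBr, hBv, enorm_smul, enorm_mul, mul_pow, mul_pow, hsq, ← mul_assoc,
        enorm_sq_eq_ofReal, ← ENNReal.ofReal_mul hb0.le]
      congr 2
      rw [norm_inv, Real.norm_of_nonneg hb0.le]
      field_simp
    have e3 : ∫⁻ x in B, ‖u x‖ₑ ^ 2 ≤ ∫⁻ x in B, 2 * (‖u x - c‖ₑ ^ 2 + ‖c‖ₑ ^ 2) := by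
      refine lintegral_mono fun x => ?_
      calc ‖u x‖ₑ ^ 2 ≤ (‖u x - c‖ₑ + ‖c‖ₑ) ^ 2 := by
            gcongr
            simpa using enorm_add_le (u x - c) c
        _ ≤ _ := ENNReal.add_sq_le_two _ _
    refine e3.trans ?_
    rw [lintegral_const_mul' _ _ (by simp), lintegral_add_right _ measurable_const, setLIntegral_const,
      mul_comm (‖c‖ₑ ^ 2), e2, mul_add]
    refine add_le_add ?_ le_rfl
    calc 2 * ∫⁻ x in B, ‖u x - c‖ₑ ^ 2 ≤ 2 * (ENNReal.ofReal (96 * h ^ 2) * ∫⁻ x in B, gradE u x) := by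
          gcongr
          exact poincare hu w hh
      _ = _ := by
          rw [← mul_assoc, show (2 : ℝ≥0∞) = ENNReal.ofReal 2 by simp, ← ENNReal.ofReal_mul (by norm_num)]
          congr 2
          ring
  have hswap : ∀ g : Ω × E3 → ℝ≥0∞, Measurable g →
      ∫⁻ x in B, (∫⁻ ω, g (ω, x) ∂μ) = ∫⁻ ω, (∫⁻ x in B, g (ω, x)) ∂μ := fun g hg =>
    lintegral_lintegral_swap (f := fun x ω => g (ω, x)) (hg.comp measurable_swap).aemeasurable
  have hmg : Measurable fun ω => ∫⁻ x in B, gradS (ψ ω) x := hψ.measurable_gradS.lintegral_prod_right'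
  calc ∫⁻ x in B, dens μ ψ x = ∫⁻ ω, (∫⁻ x in B, sq2 (ψ ω x)) ∂μ := hswap _ hψ.measurable_sq2
    _ ≤ ∫⁻ ω, (ENNReal.ofReal (192 * h ^ 2) * (∫⁻ x in B, gradS (ψ ω) x) +
        2 * ∑ s, ‖∫ x, ∑ t, (starRingEnd ℂ) (v s x t) * ψ ω x t‖ₑ ^ 2) ∂μ := by
      refine lintegral_mono fun ω => ?_
      simp only [sq2, gradS]
      rw [lintegral_finsetSum _ fun s _ =>
        ((hψ.smooth ω s).continuous.enorm.measurable.pow_const 2),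
        lintegral_finsetSum _ fun s _ => measurable_gradE ((hψ.smooth ω s).of_le (by norm_num)),
        Finset.mul_sum, Finset.mul_sum, ← Finset.sum_add_distrib]
      exact Finset.sum_le_sum fun s _ => hpt ω s
    _ ≤ ENNReal.ofReal (192 * h ^ 2) * (∫⁻ x in B, gradD μ ψ x) + 2 * ∑ s : Fin 2, 1 := by
      rw [lintegral_add_left (hmg.const_mul _), lintegral_const_mul _ hmg,
        lintegral_const_mul' _ _ (by simp)]
      unfold gradD
      rw [hswap _ hψ.measurable_gradS]
      gcongr
      rw [lintegral_finsetSum]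
      · exact Finset.sum_le_sum fun s _ => hbes s
      · intro s _
        refine Measurable.pow_const (Measurable.enorm ?_) 2
        refine StronglyMeasurable.measurable (StronglyMeasurable.integral_prod_right'
          (f := fun p : Ω × E3 => ∑ t, (starRingEnd ℂ) (v s p.2 t) * ψ p.1 p.2 t) ?_)
        refine Measurable.stronglyMeasurable (Finset.measurable_sum _ fun t _ => ?_)
        exact (Complex.continuous_conj.measurable.comp ((hvm s t).comp measurable_snd)).mul (hψ.meas t)
    _ = _ := by
      rw [add_comm]
      congr 1
      norm_num

end BFam

end

section

/-- Averaging over translates of a cube. -/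
theorem lintegral_lintegral_closedBall {g : E3 → ℝ≥0∞} (hg : Measurable g) {h : ℝ} (hh : 0 ≤ h) :
    ∫⁻ w : E3, (∫⁻ x in Metric.closedBall w h, g x) = ENNReal.ofReal ((2 * h) ^ 3) * ∫⁻ x, g x := by
  have h1 : ∀ w : E3, ∫⁻ x in Metric.closedBall w h, g x =
      ∫⁻ x, {p : E3 × E3 | dist p.2 p.1 ≤ h}.indicator (fun p => g p.2) (w, x) := by
    intro w
    rw [← lintegral_indicator Metric.isClosed_closedBall.measurableSet]
    rfl
  have hm : Measurable ({p : E3 × E3 | dist p.2 p.1 ≤ h}.indicator fun p => g p.2) := by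
    refine (hg.comp measurable_snd).indicator ?_
    exact (isClosed_le (continuous_snd.dist continuous_fst) continuous_const).measurableSet
  simp_rw [h1]
  rw [lintegral_lintegral_swap (f := fun w x => {p : E3 × E3 | dist p.2 p.1 ≤ h}.indicator
    (fun p => g p.2) (w, x)) hm.aemeasurable, ← lintegral_const_mul _ hg]
  refine lintegral_congr fun x => ?_
  have h2 : ∀ w : E3, {p : E3 × E3 | dist p.2 p.1 ≤ h}.indicator (fun p => g p.2) (w, x) =
      (Metric.closedBall x h).indicator (fun _ => g x) w := by
    intro w
    by_cases hw : dist x w ≤ h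
    · rw [indicator_of_mem (show (w, x) ∈ {p : E3 × E3 | dist p.2 p.1 ≤ h} from hw),
        indicator_of_mem (by rwa [Metric.mem_closedBall, dist_comm])]
    · rw [indicator_of_notMem (show (w, x) ∉ {p : E3 × E3 | dist p.2 p.1 ≤ h} from hw),
        indicator_of_notMem (by rwa [Metric.mem_closedBall, dist_comm])]
  simp_rw [h2]
  rw [lintegral_indicator Metric.isClosed_closedBall.measurableSet, setLIntegral_const,
    Real.volume_pi_closedBall _ hh, Fintype.card_fin, mul_comm]

variable {Ω : Type} [MeasurableSpace Ω] {μ : Measure Ω} {ψ : Ω → E3 → Fin 2 → ℂ}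

/-- Particle number bound for a family supported in a cube. -/
theorem BFam.number_le [SFinite μ] (hψ : BFam μ ψ) (z : E3) {h m : ℝ} (hh : 0 < h) (hm : 1 ≤ m)
    (hs : ∀ ω x, x ∉ Metric.closedBall z (2 * h) → ψ ω x = 0) :
    ∫⁻ x, dens μ ψ x ≤ ENNReal.ofReal (108 * m ^ 3) +
      ENNReal.ofReal (192 / m ^ 2) * (ENNReal.ofReal (h ^ 2) * ∫⁻ x, gradD μ ψ x) := by
  have hm0 : 0 < m := by linarith
  set k := h / m with hk
  have hk0 : 0 < k := by positivity
  have hd0 : ∀ x, x ∉ Metric.closedBall z (2 * h) → dens μ ψ x = 0 := by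
    intro x hx
    simp [dens, sq2, hs _ x hx]
  have hb : ENNReal.ofReal ((2 * k) ^ 3) ≠ 0 := by
    simp only [ne_eq, ENNReal.ofReal_eq_zero, not_le]; positivity
  have h1 : ENNReal.ofReal ((2 * k) ^ 3) * ∫⁻ x, dens μ ψ x ≤ ENNReal.ofReal ((2 * k) ^ 3) *
      (ENNReal.ofReal (4 * (2 * m + 1) ^ 3) +
        ENNReal.ofReal (192 * k ^ 2) * ∫⁻ x, gradD μ ψ x) := by
    rw [← lintegral_lintegral_closedBall hψ.measurable_dens hk0.le]
    calc _ ≤ ∫⁻ w, ((Metric.closedBall z (2 * h + k)).indicator (fun _ => (4 : ℝ≥0∞)) w +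
          ENNReal.ofReal (192 * k ^ 2) * ∫⁻ x in Metric.closedBall w k, gradD μ ψ x) := by
          refine lintegral_mono fun w => ?_
          by_cases hw : w ∈ Metric.closedBall z (2 * h + k)
          · rw [indicator_of_mem hw]
            exact hψ.exclusion w hk0
          · rw [setLIntegral_congr_fun (g := fun _ => 0) Metric.isClosed_closedBall.measurableSet]
            · simp
            · intro x hx
              apply hd0
              intro hx2
              apply hw
              rw [Metric.mem_closedBall] at *
              rw [dist_comm] at hx
              linarith [dist_triangle w x z]
      _ = _ := by
          rw [lintegral_add_left (measurable_const.indicator Metric.isClosed_closedBall.measurableSet),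
            lintegral_const_mul' _ _ ENNReal.ofReal_ne_top,
            lintegral_lintegral_closedBall hψ.measurable_gradD hk0.le,
            lintegral_indicator Metric.isClosed_closedBall.measurableSet, setLIntegral_const,
            Real.volume_pi_closedBall _ (by positivity), Fintype.card_fin, mul_add (ENNReal.ofReal _),
            ← ENNReal.ofReal_mul (p := (2 * k) ^ 3) (by positivity)]
          congr 1
          · rw [show (4 : ℝ≥0∞) = ENNReal.ofReal 4 by simp, ← ENNReal.ofReal_mul (by norm_num)]
            congr 1
            rw [hk]
            field_simp
          · ring
  have h2 := (ENNReal.mul_le_mul_iff_right hb (by simp)).1 h1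
  refine h2.trans (add_le_add (ENNReal.ofReal_le_ofReal ?_) (le_of_eq ?_))
  · have : (2 * m + 1) ^ 3 ≤ (3 * m) ^ 3 := by gcongr; linarith
    nlinarith
  · rw [← mul_assoc, ← ENNReal.ofReal_mul (by positivity)]
    congr 2
    rw [hk]
    field_simp

theorem dirac_smul {A : E3 → Fin 3 → ℝ} {φ : E3 → ℝ} (hφ : Differentiable ℝ φ) {u : E3 → Fin 2 → ℂ}
    (hu : ∀ s, Differentiable ℝ fun x => u x s) (x : E3) (s : Fin 2) :
    dirac A (fun y t => (φ y : ℂ) * u y t) x s = φ x * dirac A u x s +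
      -Complex.I * ∑ k, ∑ t, pauli k s t * (((pdv k φ x : ℝ) : ℂ) * u x t) := by
  have h : ∀ k t, pdv k (fun y => (φ y : ℂ) * u y t) x =
      φ x * pdv k (fun y => u y t) x + (pdv k φ x : ℝ) * u x t := by
    intro k t
    have hφ' : HasFDerivAt (fun y => (φ y : ℂ)) (Complex.ofRealCLM.comp (fderiv ℝ φ x)) x :=
      Complex.ofRealCLM.hasFDerivAt.comp x (hφ x).hasFDerivAt
    rw [pdv_mul hφ'.differentiableAt (hu t x)]
    congr 2
    unfold pdv
    rw [hφ'.fderiv]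
    rfl
  unfold dirac
  simp only [Finset.mul_sum]
  rw [← Finset.sum_add_distrib]
  refine Finset.sum_congr rfl fun k _ => ?_
  rw [← Finset.sum_add_distrib]
  refine Finset.sum_congr rfl fun t _ => ?_
  rw [h]
  ring

theorem sq2_add_le (v w : Fin 2 → ℂ) : sq2 (fun s => v s + w s) ≤ 2 * (sq2 v + sq2 w) := by
  unfold sq2
  rw [← Finset.sum_add_distrib, Finset.mul_sum]
  refine Finset.sum_le_sum fun s _ => le_trans ?_ (ENNReal.add_sq_le_two _ _)
  gcongr
  exact enorm_add_le _ _

theorem enorm_ofReal_complex (r : ℝ) : ‖(r : ℂ)‖ₑ = ‖r‖ₑ := by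
  rw [← ofReal_norm, Complex.norm_real, ofReal_norm]

theorem sq2_dirac_smul_le {A : E3 → Fin 3 → ℝ} {φ : E3 → ℝ} (hφ : Differentiable ℝ φ)
    {u : E3 → Fin 2 → ℂ} (hu : ∀ s, Differentiable ℝ fun x => u x s) (x : E3) :
    sq2 (dirac A (fun y t => (φ y : ℂ) * u y t) x) ≤
      2 * (‖φ x‖ₑ ^ 2 * sq2 (dirac A u x) + 12 * (gradE φ x * sq2 (u x))) := by
  have e : dirac A (fun y t => (φ y : ℂ) * u y t) x = fun s => φ x * dirac A u x s +
      -Complex.I * ∑ k, ∑ t, pauli k s t * (((pdv k φ x : ℝ) : ℂ) * u x t) := by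
    ext s; exact dirac_smul hφ hu x s
  rw [e]
  refine (sq2_add_le _ _).trans ?_
  rw [sq2_mul, sq2_mul, enorm_ofReal_complex]
  refine mul_le_mul' le_rfl (add_le_add le_rfl ?_)
  rw [show ‖-Complex.I‖ₑ = 1 by rw [← ofReal_norm]; simp, one_pow, one_mul]
  refine (sq2_pauli_le _ _).trans (le_of_eq ?_)
  simp only [gradE, sq2, Finset.sum_mul, Finset.mul_sum]
  exact Finset.sum_comm

theorem gradE_eq_zero_of_notMem {F : Type*} [NormedAddCommGroup F] [NormedSpace ℝ F] {u : E3 → F}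
    {z : E3} {r : ℝ} (h : ∀ x, x ∉ Metric.closedBall z r → u x = 0) {x : E3}
    (hx : x ∉ Metric.closedBall z r) : gradE u x = 0 := by
  have : u =ᶠ[𝓝 x] fun _ => 0 := by
    filter_upwards [Metric.isClosed_closedBall.isOpen_compl.mem_nhds hx] with y hy
    exact h y hy
  simp [gradE, this.fderiv_eq]

/-- Local cutoff of a family together with gauge fixing. -/
theorem local_family : ∃ η C : ℝ, 0 < η ∧ 0 < C ∧ ∀ {Ω : Type} [MeasurableSpace Ω] (μ : Measure Ω)
    [SFinite μ] (ψ : Ω → E3 → Fin 2 → ℂ), BFam μ ψ → ∀ A : E3 → Fin 3 → ℝ, ContDiff ℝ 1 A →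
    ∀ (z : E3) (h : ℝ), 0 < h →
    ENNReal.ofReal h * (∫⁻ x in Metric.closedBall z (4 * h), fieldE A x) ≤ ENNReal.ofReal η →
    ∃ Φ : Ω → E3 → Fin 2 → ℂ, BFam μ Φ ∧ (∀ ω x, x ∉ Metric.closedBall z (2 * h) → Φ ω x = 0) ∧
      (∀ ω, ∀ x ∈ Metric.closedBall z h, sq2 (Φ ω x) = sq2 (ψ ω x)) ∧
      ENNReal.ofReal (h ^ 2) * ∫⁻ x, gradD μ Φ x ≤ ENNReal.ofReal C *
        ((∫⁻ x in Metric.closedBall z (2 * h), dens μ ψ x) +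
          ENNReal.ofReal (h ^ 2) * ∫⁻ x in Metric.closedBall z (2 * h), kinD μ A ψ x) := by
  obtain ⟨C1, hC1, H1⟩ := local_gauge
  obtain ⟨C2, hC2, H2⟩ := exists_cutoff
  refine ⟨(1 / 4) ^ 2 / C1, 48 * C2 + 4, by positivity, by positivity, ?_⟩
  intro Ω _ μ _ ψ hψ A hA z h hh hF
  obtain ⟨c, hc⟩ := H1 A hA z h (1 / 4) hh (by norm_num) le_rfl hF
  obtain ⟨φ, hφ, hφ0, hφ1, hφone, hφsupp, hφg⟩ := H2 z h hh
  set B := Metric.closedBall z (2 * h) with hBdef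
  have hB : MeasurableSet B := Metric.isClosed_closedBall.measurableSet
  have hφ2 : ContDiff ℝ 2 φ := mod_cast contDiff_infty.1 hφ 2
  have hφn : ∀ x, ‖φ x‖ₑ ≤ 1 := fun x => by
    rw [← ofReal_norm, Real.norm_of_nonneg (hφ0 x)]
    exact ENNReal.ofReal_le_one.2 (hφ1 x)
  have hφc : ContDiff ℝ 2 fun x => (φ x : ℂ) := Complex.ofRealCLM.contDiff.comp hφ2
  have h1 := hψ.mul hφc fun x => by
    rw [Complex.norm_real, Real.norm_of_nonneg (hφ0 x)]; exact hφ1 x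
  have h2 := h1.mul (contDiff_phase c) fun x => (norm_phase c x).le
  refine ⟨_, h2, ?_, ?_, ?_⟩
  · intro ω x hx
    ext s
    simp [hφsupp x hx]
  · intro ω x hx
    rw [sq2_mul, enorm_phase]
    simp [hφone x hx]
  have hpt : ∀ ω, ∫⁻ x, gradS (fun y s => phase c y * ((φ y : ℂ) * ψ ω y s)) x ≤
      4 * (∫⁻ x in B, sq2 (dirac A (ψ ω) x)) +
        ENNReal.ofReal (48 * C2 / h ^ 2) * ∫⁻ x in B, sq2 (ψ ω x) := by
    intro ω
    have hm1 : Measurable fun x => sq2 (dirac A (ψ ω) x) :=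
      Finset.measurable_sum _ fun s _ => (continuous_dirac hA.continuous
        (fun t => (hψ.smooth ω t).of_le (by norm_num)) s).enorm.measurable.pow_const 2
    calc _ ≤ ENNReal.ofReal (1 + 4 * (1 / 4)) * ∫⁻ x, sq2 (dirac A (fun y s => (φ y : ℂ) * ψ ω y s) x) :=
          hc (fun y s => (φ y : ℂ) * ψ ω y s) (h1.smooth ω) fun x hx => by ext s; simp [hφsupp x hx]
      _ ≤ 2 * ∫⁻ x in B, 2 * (sq2 (dirac A (ψ ω) x) + ENNReal.ofReal (12 * C2 / h ^ 2) * sq2 (ψ ω x)) := by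
          rw [show (1 + 4 * (1 / 4) : ℝ) = 2 by norm_num, ENNReal.ofReal_ofNat, ← lintegral_indicator hB]
          gcongr with x
          refine (sq2_dirac_smul_le (hφ2.differentiable (by norm_num))
            (fun s => (hψ.smooth ω s).differentiable (by norm_num)) x).trans ?_
          by_cases hx : x ∈ B
          · rw [indicator_of_mem hx]
            refine mul_le_mul' le_rfl (add_le_add ?_ ?_)
            · exact mul_le_of_le_one_left' (pow_le_one₀ (by simp) (hφn x))
            · rw [← mul_assoc]
              refine mul_le_mul' ?_ le_rfl
              refine (mul_le_mul' le_rfl (hφg x)).trans (le_of_eq ?_)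
              rw [mul_div_assoc, ENNReal.ofReal_mul (by norm_num), ENNReal.ofReal_ofNat]
          · simp [hφsupp x hx, gradE_eq_zero_of_notMem hφsupp hx]
      _ = _ := by
          rw [lintegral_const_mul' _ _ (by simp), lintegral_add_left hm1,
            lintegral_const_mul' _ _ ENNReal.ofReal_ne_top]
          rw [show 48 * C2 / h ^ 2 = 2 * (2 * (12 * C2 / h ^ 2)) by ring,
            ENNReal.ofReal_mul (by norm_num), ENNReal.ofReal_mul (by norm_num), ENNReal.ofReal_ofNat]
          ring
  have hsw : ∀ {ν : Measure E3} [SFinite ν] (g : Ω × E3 → ℝ≥0∞), Measurable g →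
      ∫⁻ x, (∫⁻ ω, g (ω, x) ∂μ) ∂ν = ∫⁻ ω, (∫⁻ x, g (ω, x) ∂ν) ∂μ := fun g hg =>
    lintegral_lintegral_swap (f := fun x ω => g (ω, x)) (hg.comp measurable_swap).aemeasurable
  have hK := hψ.measurable_dirac hA.continuous
  have hX : ∫⁻ x, gradD μ (fun ω y s => phase c y * ((φ y : ℂ) * ψ ω y s)) x ≤
      4 * (∫⁻ x in B, kinD μ A ψ x) + ENNReal.ofReal (48 * C2 / h ^ 2) * ∫⁻ x in B, dens μ ψ x := by
    unfold gradD kinD dens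
    rw [hsw _ h2.measurable_gradS, hsw _ hK, hsw _ hψ.measurable_sq2, ← lintegral_const_mul,
      ← lintegral_const_mul, ← lintegral_add_left]
    · exact lintegral_mono hpt
    · exact hK.lintegral_prod_right'.const_mul _
    · exact hψ.measurable_sq2.lintegral_prod_right'
    · exact hK.lintegral_prod_right'
  calc _ ≤ ENNReal.ofReal (h ^ 2) * (4 * (∫⁻ x in B, kinD μ A ψ x) +
        ENNReal.ofReal (48 * C2 / h ^ 2) * ∫⁻ x in B, dens μ ψ x) := by gcongr
    _ = ENNReal.ofReal (48 * C2) * (∫⁻ x in B, dens μ ψ x) +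
        4 * (ENNReal.ofReal (h ^ 2) * ∫⁻ x in B, kinD μ A ψ x) := by
      rw [mul_add, ← mul_assoc (ENNReal.ofReal (h ^ 2)) (ENNReal.ofReal _),
        ← ENNReal.ofReal_mul (by positivity), mul_div_cancel₀ _ (by positivity)]
      ring
    _ ≤ ENNReal.ofReal (48 * C2 + 4) * (∫⁻ x in B, dens μ ψ x) +
        ENNReal.ofReal (48 * C2 + 4) * (ENNReal.ofReal (h ^ 2) * ∫⁻ x in B, kinD μ A ψ x) := by
      gcongr
      · linarith
      · rw [show (4 : ℝ≥0∞) = ENNReal.ofReal 4 by simp]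
        apply ENNReal.ofReal_le_ofReal
        linarith
    _ = _ := by rw [mul_add]

end

section

variable {Ω : Type} [MeasurableSpace Ω] {μ : Measure Ω} {ψ : Ω → E3 → Fin 2 → ℂ}

theorem BFam.coulomb_ball_le [SFinite μ] {C : ℝ} (hC : ∀ u : E3 → ℂ, ContDiff ℝ 1 u →
    HasCompactSupport u → ∀ a : ℝ, 0 < a →
    ∫⁻ x in Metric.closedBall 0 a, ‖u x‖ₑ ^ 2 * ENNReal.ofReal ‖x‖⁻¹ ≤
      ENNReal.ofReal (C * a) * ∫⁻ x, gradE u x) (hψ : BFam μ ψ) {z : E3} {r : ℝ}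
    (hs : ∀ ω x, x ∉ Metric.closedBall z r → ψ ω x = 0) {a : ℝ} (ha : 0 < a) :
    ∫⁻ x in Metric.closedBall 0 a, dens μ ψ x * ENNReal.ofReal ‖x‖⁻¹ ≤
      ENNReal.ofReal (C * a) * ∫⁻ x, gradD μ ψ x := by
  have hsw : ∀ {ν : Measure E3} [SFinite ν] (g : Ω × E3 → ℝ≥0∞), Measurable g →
      ∫⁻ x, (∫⁻ ω, g (ω, x) ∂μ) ∂ν = ∫⁻ ω, (∫⁻ x, g (ω, x) ∂ν) ∂μ := fun g hg =>
    lintegral_lintegral_swap (f := fun x ω => g (ω, x)) (hg.comp measurable_swap).aemeasurable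
  have hw : Measurable fun x : E3 => ENNReal.ofReal ‖x‖⁻¹ := by fun_prop
  have e1 : ∀ x, dens μ ψ x * ENNReal.ofReal ‖x‖⁻¹ =
      ∫⁻ ω, sq2 (ψ ω x) * ENNReal.ofReal ‖x‖⁻¹ ∂μ := fun x =>
    (lintegral_mul_const' _ _ ENNReal.ofReal_ne_top).symm
  simp_rw [e1]
  rw [hsw (fun p => sq2 (ψ p.1 p.2) * ENNReal.ofReal ‖p.2‖⁻¹)
    (hψ.measurable_sq2.mul (hw.comp measurable_snd))]
  unfold gradD
  rw [hsw (fun p => gradS (ψ p.1) p.2) hψ.measurable_gradS,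
    ← lintegral_const_mul' _ _ ENNReal.ofReal_ne_top]
  refine lintegral_mono fun ω => ?_
  simp only [sq2, gradS, Finset.sum_mul]
  rw [lintegral_finsetSum, lintegral_finsetSum, Finset.mul_sum]
  · refine Finset.sum_le_sum fun s _ => hC _ ((hψ.smooth ω s).of_le (by norm_num)) ?_ a ha
    exact hasCompactSupport_of_closedBall (z := z) (r := r) fun x hx => by simp [hs ω x hx]
  · exact fun s _ => measurable_gradE ((hψ.smooth ω s).of_le (by norm_num))
  · exact fun s _ => ((hψ.smooth ω s).continuous.enorm.measurable.pow_const 2).mul hw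

/-- Local bound of the nuclear attraction by kinetic energy and particle number. -/
theorem local_coulomb : ∃ η C : ℝ, 0 < η ∧ 0 < C ∧ ∀ {Ω : Type} [MeasurableSpace Ω] (μ : Measure Ω)
    [SFinite μ] (ψ : Ω → E3 → Fin 2 → ℂ), BFam μ ψ → ∀ A : E3 → Fin 3 → ℝ, ContDiff ℝ 1 A →
    ∀ (z : E3) (h m : ℝ), 0 < h → 1 ≤ m →
    ENNReal.ofReal h * (∫⁻ x in Metric.closedBall z (4 * h), fieldE A x) ≤ ENNReal.ofReal η →
    ∫⁻ x in Metric.closedBall z h, dens μ ψ x * ENNReal.ofReal ‖x‖⁻¹ ≤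
      ENNReal.ofReal (‖z‖ + h)⁻¹ * (ENNReal.ofReal (C * m ^ 4) + ENNReal.ofReal (C / m) *
        ((∫⁻ x in Metric.closedBall z (2 * h), dens μ ψ x) +
          ENNReal.ofReal (h ^ 2) * ∫⁻ x in Metric.closedBall z (2 * h), kinD μ A ψ x)) := by
  obtain ⟨η, C1, hη, hC1, H1⟩ := local_family
  obtain ⟨C2, hC2, H2⟩ := coulomb_ball
  refine ⟨η, 648 + (1152 + 6 * C2) * C1, hη, by positivity, ?_⟩
  intro Ω _ μ _ ψ hψ A hA z h m hh hm hF
  have hm0 : 0 < m := by linarith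
  obtain ⟨Φ, hΦ, hΦs, hΦe, hΦX⟩ := H1 μ ψ hψ A hA z h hh hF
  set Q := (∫⁻ x in Metric.closedBall z (2 * h), dens μ ψ x) +
          ENNReal.ofReal (h ^ 2) * ∫⁻ x in Metric.closedBall z (2 * h), kinD μ A ψ x
  set Y := ENNReal.ofReal (h ^ 2) * ∫⁻ x, gradD μ Φ x with hY
  set n := ∫⁻ x, dens μ Φ x with hn
  have hnle : n ≤ ENNReal.ofReal (108 * m ^ 3) + ENNReal.ofReal (192 / m ^ 2) * Y :=
    hΦ.number_le z hh hm hΦs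
  have hzh : 0 < ‖z‖ + h := by positivity
  have hcl : MeasurableSet (Metric.closedBall z h) := Metric.isClosed_closedBall.measurableSet
  have e0 : ∫⁻ x in Metric.closedBall z h, dens μ ψ x * ENNReal.ofReal ‖x‖⁻¹ =
      ∫⁻ x in Metric.closedBall z h, dens μ Φ x * ENNReal.ofReal ‖x‖⁻¹ := by
    refine setLIntegral_congr_fun hcl fun x hx => ?_
    have : dens μ Φ x = dens μ ψ x := lintegral_congr fun ω => hΦe ω x hx
    simp only [this]
  have key : ∫⁻ x in Metric.closedBall z h, dens μ Φ x * ENNReal.ofReal ‖x‖⁻¹ ≤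
      ENNReal.ofReal (‖z‖ + h)⁻¹ * (ENNReal.ofReal (6 * m) * n + ENNReal.ofReal (6 * C2 / m) * Y) := by
    by_cases hz : 5 * h < ‖z‖
    · calc _ ≤ ∫⁻ x in Metric.closedBall z h, dens μ Φ x * ENNReal.ofReal ((‖z‖ + h)⁻¹ * (6 * m)) := by
            refine setLIntegral_mono' hcl fun x hx => ?_
            gcongr
            rw [← div_eq_inv_mul, inv_eq_one_div]
            have h1 : ‖z‖ - h ≤ ‖x‖ := by
              have := mem_closedBall_iff_norm'.1 hx
              linarith [norm_sub_norm_le z x]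
            rw [div_le_div_iff₀ (by linarith) hzh]
            nlinarith
        _ ≤ ∫⁻ x, dens μ Φ x * ENNReal.ofReal ((‖z‖ + h)⁻¹ * (6 * m)) := setLIntegral_le_lintegral _ _
        _ = ENNReal.ofReal (‖z‖ + h)⁻¹ * (ENNReal.ofReal (6 * m) * n) := by
            rw [lintegral_mul_const' _ _ ENNReal.ofReal_ne_top, ENNReal.ofReal_mul (by positivity), ← hn]
            ring
        _ ≤ _ := by
            gcongr
            exact le_self_add
    · have hinv : (6 * h)⁻¹ ≤ (‖z‖ + h)⁻¹ := by
        apply inv_anti₀ hzh; linarith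
      have ha : 0 < h / m := by positivity
      have hcl0 : MeasurableSet (Metric.closedBall (0 : E3) (h / m)) :=
        Metric.isClosed_closedBall.measurableSet
      calc _ ≤ ∫⁻ x, dens μ Φ x * ENNReal.ofReal ‖x‖⁻¹ := setLIntegral_le_lintegral _ _
        _ = (∫⁻ x in (Metric.closedBall (0 : E3) (h / m))ᶜ, dens μ Φ x * ENNReal.ofReal ‖x‖⁻¹) +
            ∫⁻ x in Metric.closedBall (0 : E3) (h / m), dens μ Φ x * ENNReal.ofReal ‖x‖⁻¹ := by
          rw [add_comm]; exact (lintegral_add_compl _ hcl0).symm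
        _ ≤ ENNReal.ofReal (m / h) * n + ENNReal.ofReal (C2 * (h / m)) * ∫⁻ x, gradD μ Φ x := by
          refine add_le_add ?_ (hΦ.coulomb_ball_le H2 hΦs ha)
          calc _ ≤ ∫⁻ x in (Metric.closedBall (0 : E3) (h / m))ᶜ, dens μ Φ x * ENNReal.ofReal (m / h) := by
                refine setLIntegral_mono' hcl0.compl fun x hx => ?_
                gcongr
                rw [mem_compl_iff, mem_closedBall_zero_iff, not_le] at hx
                rw [← inv_div]
                exact inv_anti₀ ha hx.le
            _ ≤ ∫⁻ x, dens μ Φ x * ENNReal.ofReal (m / h) := setLIntegral_le_lintegral _ _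
            _ = _ := by rw [lintegral_mul_const' _ _ ENNReal.ofReal_ne_top, mul_comm]
        _ = ENNReal.ofReal (6 * h)⁻¹ * (ENNReal.ofReal (6 * m) * n + ENNReal.ofReal (6 * C2 / m) * Y) := by
          have e1 : ENNReal.ofReal (m / h) = ENNReal.ofReal (6 * h)⁻¹ * ENNReal.ofReal (6 * m) := by
            rw [← ENNReal.ofReal_mul (by positivity)]
            congr 1
            field_simp
          have e2 : ENNReal.ofReal (C2 * (h / m)) =
              ENNReal.ofReal (6 * h)⁻¹ * ENNReal.ofReal (6 * C2 / m) * ENNReal.ofReal (h ^ 2) := by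
            rw [← ENNReal.ofReal_mul (by positivity), ← ENNReal.ofReal_mul (by positivity)]
            congr 1
            field_simp
          rw [e1, e2, hY]
          ring
        _ ≤ _ := by gcongr
  rw [e0]
  refine key.trans (mul_le_mul' le_rfl ?_)
  calc _ ≤ ENNReal.ofReal (6 * m) * (ENNReal.ofReal (108 * m ^ 3) + ENNReal.ofReal (192 / m ^ 2) * Y) +
        ENNReal.ofReal (6 * C2 / m) * Y := by gcongr
    _ = ENNReal.ofReal (648 * m ^ 4) + ENNReal.ofReal ((1152 + 6 * C2) / m) * Y := by
      have e1 : ENNReal.ofReal (6 * m) * ENNReal.ofReal (108 * m ^ 3) = ENNReal.ofReal (648 * m ^ 4) := by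
        rw [← ENNReal.ofReal_mul (by positivity)]
        congr 1
        ring
      have e2 : ENNReal.ofReal ((1152 + 6 * C2) / m) =
          ENNReal.ofReal (6 * m) * ENNReal.ofReal (192 / m ^ 2) + ENNReal.ofReal (6 * C2 / m) := by
        rw [← ENNReal.ofReal_mul (by positivity), ← ENNReal.ofReal_add (by positivity) (by positivity)]
        congr 1
        field_simp
        ring
      rw [← e1, e2]
      ring
    _ ≤ ENNReal.ofReal (648 * m ^ 4) + ENNReal.ofReal ((1152 + 6 * C2) / m) * (ENNReal.ofReal C1 * Q) := by
      gcongr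
    _ ≤ _ := by
      rw [← mul_assoc, ← ENNReal.ofReal_mul (by positivity)]
      gcongr
      · have : 0 ≤ (1152 + 6 * C2) * C1 := by positivity
        linarith
      · rw [div_mul_eq_mul_div]
        gcongr
        linarith

end

theorem lintegral_mul_setLIntegral_closedBall {r : E3 → ℝ} (hr : Continuous r) {w g : E3 → ℝ≥0∞}
    (hw : Measurable w) (hg : Measurable g) :
    ∫⁻ z, (w z * ∫⁻ x in Metric.closedBall z (r z), g x) =
      ∫⁻ x, (g x * ∫⁻ z in {z | dist x z ≤ r z}, w z) := by
  have hS : MeasurableSet {p : E3 × E3 | dist p.2 p.1 ≤ r p.1} :=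
    (isClosed_le (by fun_prop) (by fun_prop)).measurableSet
  have h1 : ∀ z, w z * ∫⁻ x in Metric.closedBall z (r z), g x =
      ∫⁻ x, {p : E3 × E3 | dist p.2 p.1 ≤ r p.1}.indicator (fun p => w p.1 * g p.2) (z, x) := by
    intro z
    rw [← lintegral_indicator Metric.isClosed_closedBall.measurableSet,
      ← lintegral_const_mul _ (hg.indicator Metric.isClosed_closedBall.measurableSet)]
    refine lintegral_congr fun x => ?_
    by_cases h : dist x z ≤ r z
    · rw [indicator_of_mem (by simpa using h), indicator_of_mem (by simpa using h)]
    · rw [indicator_of_notMem (by simpa using h), indicator_of_notMem (by simpa using h), mul_zero]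
  have h2 : ∀ x, g x * ∫⁻ z in {z | dist x z ≤ r z}, w z =
      ∫⁻ z, {p : E3 × E3 | dist p.2 p.1 ≤ r p.1}.indicator (fun p => w p.1 * g p.2) (z, x) := by
    intro x
    have hm : MeasurableSet {z | dist x z ≤ r z} :=
      (isClosed_le (by fun_prop) (by fun_prop)).measurableSet
    rw [← lintegral_indicator hm, ← lintegral_const_mul _ (hw.indicator hm)]
    refine lintegral_congr fun z => ?_
    by_cases h : dist x z ≤ r z
    · rw [indicator_of_mem (by simpa using h), indicator_of_mem (by simpa using h), mul_comm]
    · rw [indicator_of_notMem (by simpa using h), indicator_of_notMem (by simpa using h), mul_zero]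
  simp only [h1, h2]
  exact lintegral_lintegral_swap (f := fun z x => {p : E3 × E3 | dist p.2 p.1 ≤ r p.1}.indicator
    (fun p => w p.1 * g p.2) (z, x)) (((hw.comp measurable_fst).mul
      (hg.comp measurable_snd)).indicator hS).aemeasurable

theorem volume_closedBall_E3 (x : E3) {r : ℝ} (hr : 0 ≤ r) :
    volume (Metric.closedBall x r) = ENNReal.ofReal ((2 * r) ^ 3) := by
  rw [Real.volume_pi_closedBall x hr]
  simp

/-- A covering of space by balls of slowly varying radius. -/
theorem lintegral_le_covering {l : E3 → ℝ} (hl : ∀ x, 0 < l x)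
    (hL : ∀ x y, |l x - l y| ≤ dist x y / 8) {g : E3 → ℝ≥0∞} (hg : Measurable g) :
    ∫⁻ x, g x ≤ ENNReal.ofReal 4 *
      ∫⁻ z, (ENNReal.ofReal ((l z)⁻¹ ^ 3) * ∫⁻ x in Metric.closedBall z (l z), g x) := by
  have hc : Continuous l := by
    have : LipschitzWith (1 / 8) l := LipschitzWith.of_dist_le_mul fun x y => by
      rw [Real.dist_eq]
      have := hL x y
      push_cast
      linarith
    exact this.continuous
  have hw : Measurable fun z => ENNReal.ofReal ((l z)⁻¹ ^ 3) := by fun_prop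
  rw [lintegral_mul_setLIntegral_closedBall hc hw hg,
    ← lintegral_const_mul' _ _ ENNReal.ofReal_ne_top]
  refine lintegral_mono fun x => ?_
  have hx := hl x
  have key : 1 ≤ ENNReal.ofReal 4 * ∫⁻ z in {z | dist x z ≤ l z}, ENNReal.ofReal ((l z)⁻¹ ^ 3) := by
    calc (1 : ℝ≥0∞) ≤ ENNReal.ofReal 4 * ∫⁻ z in Metric.closedBall x (l x / 2),
          ENNReal.ofReal ((3 / 2 * l x)⁻¹ ^ 3) := by
          rw [setLIntegral_const, volume_closedBall_E3 _ (by positivity),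
            ← ENNReal.ofReal_mul (by positivity), ← ENNReal.ofReal_mul (by positivity),
            ENNReal.one_le_ofReal]
          have : 4 * ((3 / 2 * l x)⁻¹ ^ 3 * (2 * (l x / 2)) ^ 3) = 32 / 27 := by
            field_simp
            norm_num
          rw [this]; norm_num
      _ ≤ ENNReal.ofReal 4 * ∫⁻ z in Metric.closedBall x (l x / 2), ENNReal.ofReal ((l z)⁻¹ ^ 3) := by
          refine mul_le_mul' le_rfl ?_
          refine setLIntegral_mono' Metric.isClosed_closedBall.measurableSet fun z hz => ?_
          have h1 := hL z x
          rw [Metric.mem_closedBall] at hz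
          have h2 := hl z
          gcongr
          have := le_abs_self (l z - l x)
          linarith
      _ ≤ _ := by
          refine mul_le_mul' le_rfl ?_
          refine lintegral_mono_set fun z hz => ?_
          rw [Metric.mem_closedBall] at hz
          have h1 := hL z x
          have := neg_abs_le (l z - l x)
          simp only [mem_ofPred_eq, dist_comm x z]
          linarith
  calc g x = g x * 1 := (mul_one _).symm
    _ ≤ g x * (ENNReal.ofReal 4 * ∫⁻ z in {z | dist x z ≤ l z}, ENNReal.ofReal ((l z)⁻¹ ^ 3)) := by
      gcongr
    _ = _ := by ring

theorem covering_le_lintegral {l : E3 → ℝ} (hl : ∀ x, 0 < l x)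
    (hL : ∀ x y, |l x - l y| ≤ dist x y / 8) {g : E3 → ℝ≥0∞} (hg : Measurable g) :
    ∫⁻ z, (ENNReal.ofReal ((l z)⁻¹ ^ 3) * ∫⁻ x in Metric.closedBall z (2 * l z), g x) ≤
      ENNReal.ofReal 300 * ∫⁻ x, g x := by
  have hc : Continuous l := by
    have : LipschitzWith (1 / 8) l := LipschitzWith.of_dist_le_mul fun x y => by
      rw [Real.dist_eq]
      have := hL x y
      push_cast
      linarith
    exact this.continuous
  have hw : Measurable fun z => ENNReal.ofReal ((l z)⁻¹ ^ 3) := by fun_prop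
  rw [lintegral_mul_setLIntegral_closedBall (r := fun z => 2 * l z) (continuous_const.mul hc) hw hg,
    ← lintegral_const_mul' _ _ ENNReal.ofReal_ne_top]
  refine lintegral_mono fun x => ?_
  have hx := hl x
  have key : ∫⁻ z in {z | dist x z ≤ 2 * l z}, ENNReal.ofReal ((l z)⁻¹ ^ 3) ≤ ENNReal.ofReal 300 := by
    have hm : MeasurableSet {z | dist x z ≤ 2 * l z} :=
      (isClosed_le (by fun_prop) (by fun_prop)).measurableSet
    calc _ ≤ ∫⁻ z in {z | dist x z ≤ 2 * l z}, ENNReal.ofReal ((4 / 5 * l x)⁻¹ ^ 3) := by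
          refine setLIntegral_mono' hm fun z hz => ?_
          have h1 := hL z x
          simp only [mem_ofPred_eq, dist_comm x z] at hz
          have h2 := hl z
          gcongr
          have := neg_abs_le (l z - l x)
          linarith
      _ ≤ ∫⁻ z in Metric.closedBall x (8 / 3 * l x), ENNReal.ofReal ((4 / 5 * l x)⁻¹ ^ 3) := by
          refine lintegral_mono_set fun z hz => ?_
          have h1 := hL z x
          simp only [mem_ofPred_eq, dist_comm x z] at hz
          rw [Metric.mem_closedBall]
          have := le_abs_self (l z - l x)
          linarith
      _ ≤ _ := by
          rw [setLIntegral_const, volume_closedBall_E3 _ (by positivity),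
            ← ENNReal.ofReal_mul (by positivity)]
          apply ENNReal.ofReal_le_ofReal
          have : (4 / 5 * l x)⁻¹ ^ 3 * (2 * (8 / 3 * l x)) ^ 3 = (20 / 3) ^ 3 := by
            field_simp
            norm_num
          rw [this]; norm_num
  rw [mul_comm]
  gcongr

/-- The largest radius up to `H z` whose ball carries scale invariant field energy at most one. -/
def fieldScale (H : E3 → ℝ) (f : E3 → ℝ≥0∞) (z : E3) : ℝ :=
  sSup {t | 0 ≤ t ∧ t ≤ H z ∧ ENNReal.ofReal t * ∫⁻ x in Metric.closedBall z t, f x ≤ 1}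

theorem fieldScale_mem_nonneg {H : E3 → ℝ} {f : E3 → ℝ≥0∞} {z : E3} {t : ℝ} (h0 : 0 ≤ t) (hH : t ≤ H z)
    (h : ENNReal.ofReal t * ∫⁻ x in Metric.closedBall z t, f x ≤ 1) : t ≤ fieldScale H f z :=
  le_csSup ⟨H z, fun _ hs => hs.2.1⟩ ⟨h0, hH, h⟩

theorem fieldScale_le {H : E3 → ℝ} {f : E3 → ℝ≥0∞} {z : E3} (hH : 0 ≤ H z) : fieldScale H f z ≤ H z :=
  csSup_le ⟨0, le_rfl, hH, by simp⟩ fun _ hs => hs.2.1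

theorem fieldScale_pos {H : E3 → ℝ} {f : E3 → ℝ≥0∞} {z : E3} (hH : 0 < H z) (hf : ∫⁻ x, f x ≠ ∞) : 0 < fieldScale H f z := by
  set F := (∫⁻ x, f x).toReal
  have hF : 0 ≤ F := ENNReal.toReal_nonneg
  have : 0 < min (H z) (1 / (F + 1)) := lt_min hH (by positivity)
  refine this.trans_le (fieldScale_mem_nonneg this.le (min_le_left _ _) ?_)
  calc _ ≤ ENNReal.ofReal (1 / (F + 1)) * ENNReal.ofReal (F + 1) := by
        gcongr
        · exact min_le_right _ _
        · refine (setLIntegral_le_lintegral _ _).trans ?_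
          rw [← ENNReal.ofReal_toReal hf]
          exact ENNReal.ofReal_le_ofReal (by simp [F])
    _ = 1 := by
        rw [← ENNReal.ofReal_mul (by positivity), one_div_mul_cancel (by positivity), ENNReal.ofReal_one]

theorem energy_le_of_lt_fieldScale {H : E3 → ℝ} {f : E3 → ℝ≥0∞} {z : E3} {t : ℝ} (hH : 0 ≤ H z) (ht : t < fieldScale H f z) :
    ENNReal.ofReal t * ∫⁻ x in Metric.closedBall z t, f x ≤ 1 := by
  obtain ⟨s, hs, hts⟩ := exists_lt_of_lt_csSup (by exact ⟨0, le_rfl, hH, by simp⟩) ht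
  refine le_trans ?_ hs.2.2
  gcongr ENNReal.ofReal ?_ * ?_
  exact lintegral_mono_set (Metric.closedBall_subset_closedBall hts.le)

theorem one_lt_energy_of_fieldScale_lt {H : E3 → ℝ} {f : E3 → ℝ≥0∞} {z : E3} {t : ℝ} (h0 : 0 ≤ t) (hH : t ≤ H z)
    (ht : fieldScale H f z < t) :
    1 < ENNReal.ofReal t * ∫⁻ x in Metric.closedBall z t, f x := by
  by_contra! h
  exact absurd (fieldScale_mem_nonneg h0 hH h) (not_le.2 ht)

theorem fieldScale_le_add {H : E3 → ℝ} {f : E3 → ℝ≥0∞} (hH : ∀ x, 0 ≤ H x) (hL : ∀ x y, H x ≤ H y + dist x y) (x y : E3) :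
    fieldScale H f x ≤ fieldScale H f y + dist x y := by
  refine csSup_le ⟨0, le_rfl, hH x, by simp⟩ fun t ht => ?_
  rcases le_total t (dist x y) with h | h
  · have : 0 ≤ fieldScale H f y := fieldScale_mem_nonneg le_rfl (hH y) (by simp)
    linarith
  · have : t - dist x y ≤ fieldScale H f y := by
      refine fieldScale_mem_nonneg (by linarith) (by linarith [hL x y, ht.2.1]) ?_
      refine le_trans ?_ ht.2.2
      gcongr ENNReal.ofReal ?_ * ?_
      · linarith [dist_nonneg (x := x) (y := y)]
      · refine lintegral_mono_set (Metric.closedBall_subset_closedBall' ?_)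
        rw [dist_comm y x]; linarith
    linarith

/-- The Thomas–Fermi length scale at `z`. -/
def tfScale (Z : ℝ) (z : E3) : ℝ := √((‖z‖ + 1 / Z) / Z)

theorem tfScale_sq {Z : ℝ} (hZ : 0 < Z) (z : E3) : tfScale Z z ^ 2 = (‖z‖ + 1 / Z) / Z :=
  Real.sq_sqrt (by positivity)

theorem inv_le_tfScale {Z : ℝ} (hZ : 0 < Z) (z : E3) : 1 / Z ≤ tfScale Z z := by
  apply Real.le_sqrt_of_sq_le
  rw [div_pow, one_pow, sq, ← div_div]
  gcongr
  linarith [norm_nonneg z]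

theorem tfScale_pos {Z : ℝ} (hZ : 0 < Z) (z : E3) : 0 < tfScale Z z :=
  lt_of_lt_of_le (by positivity) (inv_le_tfScale hZ z)

theorem norm_le_norm_add_dist (x y : E3) : ‖x‖ ≤ ‖y‖ + dist x y := by
  rw [dist_eq_norm]
  linarith [norm_sub_norm_le x y]

theorem tfScale_le_add {Z : ℝ} (hZ : 0 < Z) (x y : E3) : tfScale Z x ≤ tfScale Z y + dist x y := by
  have h1 := inv_le_tfScale hZ y
  have hd := dist_nonneg (x := x) (y := y)
  have h0 := (tfScale_pos hZ y).le
  refine Real.sqrt_le_iff.2 ⟨by positivity, ?_⟩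
  have h2 := tfScale_sq hZ y
  have h3 : (‖x‖ + 1 / Z) / Z ≤ (‖y‖ + 1 / Z) / Z + dist x y * (1 / Z) := by
    rw [← mul_one_div (‖x‖ + 1 / Z), ← mul_one_div (‖y‖ + 1 / Z), ← add_mul]
    refine mul_le_mul_of_nonneg_right ?_ (by positivity)
    linarith [norm_le_norm_add_dist x y]
  nlinarith [mul_le_mul_of_nonneg_left h1 hd]

/-- The radius of the ball around the nucleus in which the field is not strong. -/
def coreScale (Z : ℝ) (f : E3 → ℝ≥0∞) : ℝ := fieldScale (fun _ => 1 / Z) f 0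

/-- The maximal length scale used for the localization at `z`. -/
def maxScale (Z : ℝ) (f : E3 → ℝ≥0∞) (z : E3) : ℝ := min (tfScale Z z) ((‖z‖ + coreScale Z f) / 10)

/-- The length scale used for the localization at `z`. -/
def locScale (Z : ℝ) (f : E3 → ℝ≥0∞) (z : E3) : ℝ := fieldScale (maxScale Z f) f z

section
variable {Z : ℝ} {f : E3 → ℝ≥0∞}

theorem coreScale_pos (hZ : 0 < Z) (hf : ∫⁻ x, f x ≠ ∞) : 0 < coreScale Z f :=
  fieldScale_pos (by positivity) hf

theorem inv_coreScale_le (hZ : 0 < Z) (hf : ∫⁻ x, f x ≠ ∞) :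
    ENNReal.ofReal (coreScale Z f)⁻¹ ≤ ENNReal.ofReal Z + 2 * ∫⁻ x, f x := by
  have hr := coreScale_pos hZ hf
  have hle : coreScale Z f ≤ 1 / Z := fieldScale_le (H := fun _ => 1 / Z) (z := 0) (by positivity)
  rcases hle.eq_or_lt with h | h
  · rw [h, one_div, inv_inv]
    exact le_self_add
  · refine le_trans ?_ le_add_self
    obtain ⟨t, h1, h2⟩ : ∃ t, coreScale Z f < t ∧ t < min (1 / Z) (2 * coreScale Z f) :=
      exists_between (lt_min h (by linarith))
    have h3 := one_lt_energy_of_fieldScale_lt (H := fun _ => 1 / Z) (f := f) (z := 0)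
      (by linarith) (h2.le.trans (min_le_left _ _)) h1
    calc ENNReal.ofReal (coreScale Z f)⁻¹ = ENNReal.ofReal (coreScale Z f)⁻¹ * 1 := (mul_one _).symm
      _ ≤ ENNReal.ofReal (coreScale Z f)⁻¹ * (ENNReal.ofReal (2 * coreScale Z f) * ∫⁻ x, f x) := by
        gcongr
        refine h3.le.trans ?_
        gcongr
        · exact h2.le.trans (min_le_right _ _)
        · exact Measure.restrict_le_self
      _ = _ := by
        rw [← mul_assoc, ← ENNReal.ofReal_mul (by positivity),
          show (coreScale Z f)⁻¹ * (2 * coreScale Z f) = 2 by field_simp, ENNReal.ofReal_ofNat]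

theorem maxScale_pos (hZ : 0 < Z) (hf : ∫⁻ x, f x ≠ ∞) (z : E3) : 0 < maxScale Z f z :=
  lt_min (tfScale_pos hZ z) (by have := coreScale_pos hZ hf; positivity)

theorem maxScale_le_add (hZ : 0 < Z) (x y : E3) :
    maxScale Z f x ≤ maxScale Z f y + dist x y := by
  have h1 := tfScale_le_add hZ x y
  have h2 := norm_le_norm_add_dist x y
  have hd := dist_nonneg (x := x) (y := y)
  unfold maxScale
  rw [← min_add_add_right]
  refine min_le_min h1 ?_
  linarith

theorem locScale_pos (hZ : 0 < Z) (hf : ∫⁻ x, f x ≠ ∞) (z : E3) : 0 < locScale Z f z :=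
  fieldScale_pos (maxScale_pos hZ hf z) hf

theorem locScale_le_maxScale (hZ : 0 < Z) (hf : ∫⁻ x, f x ≠ ∞) (z : E3) :
    locScale Z f z ≤ maxScale Z f z := fieldScale_le (maxScale_pos hZ hf z).le

theorem locScale_le_add (hZ : 0 < Z) (hf : ∫⁻ x, f x ≠ ∞) (x y : E3) :
    locScale Z f x ≤ locScale Z f y + dist x y :=
  fieldScale_le_add (fun x => (maxScale_pos hZ hf x).le) (maxScale_le_add hZ) x y

theorem continuous_locScale (hZ : 0 < Z) (hf : ∫⁻ x, f x ≠ ∞) : Continuous (locScale Z f) := by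
  have : LipschitzWith 1 (locScale Z f) := LipschitzWith.of_le_add fun x y => by
    simpa using locScale_le_add hZ hf x y
  exact this.continuous

theorem core_le_of_locScale_lt (hZ : 0 < Z) (hf : ∫⁻ x, f x ≠ ∞) {z : E3}
    (h : locScale Z f z < maxScale Z f z) : 9 / 11 * coreScale Z f ≤ ‖z‖ := by
  by_contra! hz
  have hr := coreScale_pos hZ hf
  have h1 := maxScale_pos hZ hf z
  have h2 : maxScale Z f z ≤ (‖z‖ + coreScale Z f) / 10 := min_le_right _ _
  have h3 := one_lt_energy_of_fieldScale_lt h1.le le_rfl h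
  have h4 := energy_le_of_lt_fieldScale (H := fun _ => 1 / Z) (f := f) (z := 0)
    (t := ‖z‖ + maxScale Z f z) (by positivity) (by change _ < coreScale Z f; linarith)
  refine absurd (h3.trans_le (le_trans ?_ h4)) (lt_irrefl _)
  gcongr ENNReal.ofReal ?_ * ?_
  · linarith [norm_nonneg z]
  · refine lintegral_mono_set (Metric.closedBall_subset_closedBall' ?_)
    rw [dist_zero_right]; linarith

theorem locScale_pointwise (hZ : 0 < Z) (hf : ∫⁻ x, f x ≠ ∞) (z : E3) :
    ENNReal.ofReal ((locScale Z f z)⁻¹ ^ 3 * (‖z‖ + locScale Z f z)⁻¹) ≤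
      ENNReal.ofReal (tfScale Z z ^ 3 * (‖z‖ + 1 / Z))⁻¹ +
      ENNReal.ofReal (10 ^ 4 * (‖z‖ + coreScale Z f)⁻¹ ^ 4) +
      ENNReal.ofReal (5 * (locScale Z f z)⁻¹ ^ 2 * (‖z‖ + coreScale Z f)⁻¹) *
        ∫⁻ x in Metric.closedBall z (2 * locScale Z f z), f x := by
  have hr := coreScale_pos hZ hf
  have hl := locScale_pos hZ hf z
  have hz := norm_nonneg z
  rcases (locScale_le_maxScale hZ hf z).eq_or_lt with h | h
  · refine le_trans ?_ le_self_add
    rcases min_choice (tfScale Z z) ((‖z‖ + coreScale Z f) / 10) with h' | h'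
    · refine le_trans ?_ le_self_add
      have ht := tfScale_pos hZ z
      rw [h, maxScale, h', mul_inv, inv_pow]
      gcongr
      exact inv_le_tfScale hZ z
    · refine le_trans ?_ le_add_self
      rw [h, maxScale, h']
      apply ENNReal.ofReal_le_ofReal
      have : (‖z‖ + (‖z‖ + coreScale Z f) / 10)⁻¹ ≤ ((‖z‖ + coreScale Z f) / 10)⁻¹ := by
        gcongr; linarith
      calc _ ≤ ((‖z‖ + coreScale Z f) / 10)⁻¹ ^ 3 * ((‖z‖ + coreScale Z f) / 10)⁻¹ := by gcongr
        _ = _ := by field_simp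
  · refine le_trans ?_ le_add_self
    have hc := core_le_of_locScale_lt hZ hf h
    set l := locScale Z f z
    obtain ⟨t, h1, h2⟩ : ∃ t, l < t ∧ t < min (maxScale Z f z) (2 * l) :=
      exists_between (lt_min h (by linarith))
    have h3 := one_lt_energy_of_fieldScale_lt (f := f) (by linarith) (h2.le.trans (min_le_left _ _)) h1
    calc ENNReal.ofReal (l⁻¹ ^ 3 * (‖z‖ + l)⁻¹)
        ≤ ENNReal.ofReal (l⁻¹ ^ 3 * (9 / 20 * (‖z‖ + coreScale Z f))⁻¹) := by
          gcongr
          linarith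
      _ ≤ ENNReal.ofReal (l⁻¹ ^ 3 * (9 / 20 * (‖z‖ + coreScale Z f))⁻¹) *
          (ENNReal.ofReal (2 * l) * ∫⁻ x in Metric.closedBall z (2 * l), f x) := by
          conv_lhs => rw [← mul_one (ENNReal.ofReal _)]
          gcongr
          refine h3.le.trans ?_
          have h4 := h2.le.trans (min_le_right _ _)
          gcongr ENNReal.ofReal ?_ * ?_
          exact lintegral_mono_set (Metric.closedBall_subset_closedBall h4)
      _ ≤ _ := by
          rw [← mul_assoc, ← ENNReal.ofReal_mul (by positivity)]
          gcongr ENNReal.ofReal ?_ * _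
          have : l⁻¹ ^ 3 * (9 / 20 * (‖z‖ + coreScale Z f))⁻¹ * (2 * l) =
              40 / 9 * l⁻¹ ^ 2 * (‖z‖ + coreScale Z f)⁻¹ := by
            field_simp
            norm_num
          rw [this]
          gcongr
          norm_num
end

theorem lintegral_inv_add_norm_pow_four : ∃ C : ℝ, 0 < C ∧ ∀ r : ℝ, 0 < r →
    ∫⁻ z : E3, ENNReal.ofReal ((‖z‖ + r)⁻¹ ^ 4) ≤ ENNReal.ofReal (C * r⁻¹) := by
  have h0 : ∫⁻ z : E3, ENNReal.ofReal ((‖z‖ + 1)⁻¹ ^ 4) < ∞ := by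
    have := finite_integral_one_add_norm (E := E3) (μ := volume) (r := 4) (by simp; norm_num)
    refine lt_of_le_of_lt (lintegral_mono fun z => ?_) this
    rw [add_comm, inv_pow, Real.rpow_neg (by positivity)]
    norm_cast
  set c := (∫⁻ z : E3, ENNReal.ofReal ((‖z‖ + 1)⁻¹ ^ 4)).toReal
  have hc : 0 ≤ c := ENNReal.toReal_nonneg
  refine ⟨c + 1, by positivity, fun r hr => ?_⟩
  have h1 := lintegral_comp_affine (fun z : E3 => ENNReal.ofReal ((‖z‖ + 1)⁻¹ ^ 4)) (by fun_prop)
    (t := r⁻¹) (by positivity) 0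
  have h2 : ∀ z : E3, ENNReal.ofReal ((‖z‖ + r)⁻¹ ^ 4) =
      ENNReal.ofReal (r⁻¹ ^ 4) * ENNReal.ofReal ((‖r⁻¹ • z + 0‖ + 1)⁻¹ ^ 4) := by
    intro z
    rw [← ENNReal.ofReal_mul (by positivity), add_zero, norm_smul, Real.norm_of_nonneg (by positivity)]
    congr 1
    field_simp
  simp_rw [h2]
  rw [lintegral_const_mul' _ _ ENNReal.ofReal_ne_top, h1, inv_inv, ← mul_assoc,
    ← ENNReal.ofReal_mul (by positivity)]
  calc _ ≤ ENNReal.ofReal (r⁻¹ ^ 4 * r ^ 3) * ENNReal.ofReal (c + 1) := by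
        gcongr
        rw [← ENNReal.ofReal_toReal h0.ne]
        exact ENNReal.ofReal_le_ofReal (by linarith)
    _ = _ := by
        rw [← ENNReal.ofReal_mul (by positivity)]
        congr 1
        field_simp

theorem lintegral_locScale_field : ∃ C : ℝ, 0 < C ∧ ∀ (Z : ℝ) (f : E3 → ℝ≥0∞), 0 < Z → Measurable f →
    ∫⁻ x, f x ≠ ∞ →
    ∫⁻ z, (ENNReal.ofReal (5 * (locScale Z f z)⁻¹ ^ 2 * (‖z‖ + coreScale Z f)⁻¹) *
        ∫⁻ x in Metric.closedBall z (2 * locScale Z f z), f x) ≤ ENNReal.ofReal C * ∫⁻ x, f x := by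
  obtain ⟨C, hC, H⟩ := lintegral_norm_rpow (p := 2) (by norm_num)
  refine ⟨6 * C, by positivity, fun Z f hZ hm hf => ?_⟩
  have hr := coreScale_pos hZ hf
  have hc := continuous_locScale hZ hf
  rw [lintegral_mul_setLIntegral_closedBall (r := fun z => 2 * locScale Z f z)
    (w := fun z => ENNReal.ofReal (5 * (locScale Z f z)⁻¹ ^ 2 * (‖z‖ + coreScale Z f)⁻¹))
    (continuous_const.mul hc) (by fun_prop) hm, ← lintegral_const_mul' _ _ ENNReal.ofReal_ne_top]
  refine lintegral_mono fun x => ?_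
  rw [mul_comm]
  gcongr
  set a := (‖x‖ + coreScale Z f) / 4 with ha
  have hx := norm_nonneg x
  have ha0 : 0 < a := by positivity
  have hms : MeasurableSet {z | dist x z ≤ 2 * locScale Z f z} :=
    (isClosed_le (by fun_prop) (by fun_prop)).measurableSet
  have hle : ∀ z ∈ {z | dist x z ≤ 2 * locScale Z f z}, dist x z ≤ (‖z‖ + coreScale Z f) / 5 := by
    intro z hz
    have h1 := locScale_le_maxScale hZ hf z
    have h2 : maxScale Z f z ≤ (‖z‖ + coreScale Z f) / 10 := min_le_right _ _
    simp only [mem_ofPred_eq] at hz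
    linarith
  calc _ ≤ ∫⁻ z in {z | dist x z ≤ 2 * locScale Z f z} \ {x},
        ENNReal.ofReal (5 * (locScale Z f z)⁻¹ ^ 2 * (‖z‖ + coreScale Z f)⁻¹) := by
        apply le_of_eq
        refine setLIntegral_congr ?_
        exact (sdiff_null_ae_eq_self (by simp)).symm
    _ ≤ ∫⁻ z in {z | dist x z ≤ 2 * locScale Z f z} \ {x},
        ENNReal.ofReal (6 * a⁻¹) * ENNReal.ofReal (‖z - x‖ ^ (-2 : ℝ)) := by
        refine setLIntegral_mono' (hms.diff (measurableSet_singleton x)) fun z hz => ?_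
        have h1 := hle z hz.1
        have h2 : 0 < dist x z := dist_pos.2 (Ne.symm hz.2)
        have h3 := norm_le_norm_add_dist x z
        have h4 : dist x z ≤ 2 * locScale Z f z := hz.1
        have h5 : 0 < locScale Z f z := locScale_pos hZ hf z
        have hz0 := norm_nonneg z
        rw [← ENNReal.ofReal_mul (by positivity), ← dist_eq_norm, dist_comm z x,
          Real.rpow_neg h2.le, Real.rpow_ofNat]
        apply ENNReal.ofReal_le_ofReal
        calc _ ≤ 5 * (dist x z / 2)⁻¹ ^ 2 * (10 / 3 * a)⁻¹ := by
              gcongr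
              · linarith
              · rw [ha]; linarith
          _ = 6 * a⁻¹ * (dist x z ^ 2)⁻¹ := by
              field_simp
              norm_num
    _ ≤ ∫⁻ z in Metric.closedBall x a, ENNReal.ofReal (6 * a⁻¹) * ENNReal.ofReal (‖z - x‖ ^ (-2 : ℝ)) := by
        refine lintegral_mono_set fun z hz => ?_
        have h1 := hle z hz.1
        have h3 := norm_le_norm_add_dist z x
        rw [dist_comm] at h3
        rw [Metric.mem_closedBall, dist_comm, ha]
        linarith
    _ = ENNReal.ofReal (6 * a⁻¹) * ∫⁻ z in Metric.closedBall (0 : E3) a,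
          ENNReal.ofReal (‖z‖ ^ (-2 : ℝ)) := by
        rw [lintegral_const_mul' _ _ ENNReal.ofReal_ne_top]
        congr 1
        rw [← lintegral_indicator Metric.isClosed_closedBall.measurableSet,
          ← lintegral_indicator Metric.isClosed_closedBall.measurableSet]
        rw [← lintegral_sub_right_eq_self ((Metric.closedBall (0 : E3) a).indicator _) x]
        refine lintegral_congr fun z => ?_
        by_cases hz : ‖z - x‖ ≤ a
        · rw [indicator_of_mem (by simpa [dist_eq_norm] using hz), indicator_of_mem (by simpa using hz)]
        · rw [indicator_of_notMem (by simpa [dist_eq_norm] using hz), indicator_of_notMem (by simpa using hz)]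
    _ ≤ ENNReal.ofReal (6 * a⁻¹) * ENNReal.ofReal (C * a ^ ((3 : ℝ) - 2)) := by
        gcongr
        exact H a ha0
    _ = ENNReal.ofReal (6 * C) := by
        rw [← ENNReal.ofReal_mul (by positivity)]
        congr 1
        rw [show (3 : ℝ) - 2 = 1 by norm_num, Real.rpow_one]
        field_simp

theorem lintegral_locScale : ∃ C : ℝ, 0 < C ∧ ∀ (Z : ℝ) (f : E3 → ℝ≥0∞) (T : Set E3), 0 < Z →
    Measurable f → ∫⁻ x, f x ≠ ∞ → 
    ∫⁻ z in T, ENNReal.ofReal ((locScale Z f z)⁻¹ ^ 3 * (‖z‖ + locScale Z f z)⁻¹) ≤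
      ENNReal.ofReal C * (ENNReal.ofReal Z + (∫⁻ x, f x) +
        ∫⁻ z in T, ENNReal.ofReal (tfScale Z z ^ 3 * (‖z‖ + 1 / Z))⁻¹) := by
  obtain ⟨C1, hC1, H1⟩ := lintegral_inv_add_norm_pow_four
  obtain ⟨C2, hC2, H2⟩ := lintegral_locScale_field
  refine ⟨1 + 2 * 10 ^ 4 * C1 + C2, by positivity, fun Z f T hZ hm hf => ?_⟩
  have hr := coreScale_pos hZ hf
  have hc := continuous_locScale hZ hf
  have hct : Continuous (tfScale Z) := by unfold tfScale; fun_prop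
  set F := ∫⁻ x, f x
  set D := ∫⁻ z in T, ENNReal.ofReal (tfScale Z z ^ 3 * (‖z‖ + 1 / Z))⁻¹
  calc _ ≤ ∫⁻ z in T, (ENNReal.ofReal (tfScale Z z ^ 3 * (‖z‖ + 1 / Z))⁻¹ +
      ENNReal.ofReal (10 ^ 4 * (‖z‖ + coreScale Z f)⁻¹ ^ 4) +
      ENNReal.ofReal (5 * (locScale Z f z)⁻¹ ^ 2 * (‖z‖ + coreScale Z f)⁻¹) *
        ∫⁻ x in Metric.closedBall z (2 * locScale Z f z), f x) :=
        lintegral_mono fun z => locScale_pointwise hZ hf z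
    _ = D + (∫⁻ z in T, ENNReal.ofReal (10 ^ 4 * (‖z‖ + coreScale Z f)⁻¹ ^ 4)) +
        ∫⁻ z in T, (ENNReal.ofReal (5 * (locScale Z f z)⁻¹ ^ 2 * (‖z‖ + coreScale Z f)⁻¹) *
        ∫⁻ x in Metric.closedBall z (2 * locScale Z f z), f x) := by
        rw [lintegral_add_left (by fun_prop), lintegral_add_left (by fun_prop)]
    _ ≤ D + ENNReal.ofReal (10 ^ 4 * C1) * (ENNReal.ofReal Z + 2 * F) + ENNReal.ofReal C2 * F := by
        gcongr
        · refine (setLIntegral_le_lintegral _ _).trans ?_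
          have : ∀ z : E3, ENNReal.ofReal (10 ^ 4 * (‖z‖ + coreScale Z f)⁻¹ ^ 4) =
            ENNReal.ofReal (10 ^ 4) * ENNReal.ofReal ((‖z‖ + coreScale Z f)⁻¹ ^ 4) := fun z =>
              ENNReal.ofReal_mul (by positivity)
          simp_rw [this]
          rw [lintegral_const_mul' _ _ ENNReal.ofReal_ne_top, ENNReal.ofReal_mul (by positivity), mul_assoc]
          refine mul_le_mul' le_rfl ((H1 _ hr).trans ?_)
          rw [ENNReal.ofReal_mul hC1.le]
          exact mul_le_mul' le_rfl (inv_coreScale_le hZ hf)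
        · exact (setLIntegral_le_lintegral _ _).trans (H2 Z f hZ hm hf)
    _ ≤ _ := by
        rw [ENNReal.ofReal_add (by positivity) (by positivity),
          ENNReal.ofReal_add (by positivity) (by positivity), ENNReal.ofReal_one,
          mul_assoc (2 : ℝ), ENNReal.ofReal_mul (p := 2) (by positivity), ENNReal.ofReal_ofNat]
        set c := ENNReal.ofReal (10 ^ 4 * C1)
        set d := ENNReal.ofReal C2
        set e := ENNReal.ofReal Z
        have : (1 + 2 * c + d) * (e + F + D) = (D + c * (e + 2 * F) + d * F) +
          (e + F + c * e + 2 * c * D + d * e + d * D) := by ring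
        rw [this]
        exact le_self_add

theorem ENNReal.le_two_mul_of_le_add_half {a b : ℝ≥0∞} (ha : a ≠ ∞)
    (h : a ≤ b + ENNReal.ofReal (1 / 2) * a) : a ≤ 2 * b := by
  have h2 : ENNReal.ofReal (1 / 2) * a + ENNReal.ofReal (1 / 2) * a = a := by
    rw [← add_mul, ← ENNReal.ofReal_add (by positivity) (by positivity)]
    norm_num
  have h3 : ENNReal.ofReal (1 / 2) * a ≠ ∞ := ENNReal.mul_ne_top ENNReal.ofReal_ne_top ha
  have h4 : ENNReal.ofReal (1 / 2) * a ≤ b := by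
    rw [← ENNReal.add_le_add_iff_right h3, h2]
    exact h
  calc a = 2 * (ENNReal.ofReal (1 / 2) * a) := by rw [two_mul, h2]
    _ ≤ _ := by gcongr

/-- The local Coulomb estimate, as a property of a density, a kinetic energy density and a field
energy density. -/
def LocalCoulomb (η C : ℝ) (ρ k f : E3 → ℝ≥0∞) : Prop :=
  ∀ (z : E3) (h m : ℝ), 0 < h → 1 ≤ m →
    ENNReal.ofReal h * ∫⁻ x in Metric.closedBall z (4 * h), f x ≤ ENNReal.ofReal η →
    ∫⁻ x in Metric.closedBall z h, ρ x * ENNReal.ofReal ‖x‖⁻¹ ≤ ENNReal.ofReal (‖z‖ + h)⁻¹ *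
      (ENNReal.ofReal (C * m ^ 4) + ENNReal.ofReal (C / m) *
        ((∫⁻ x in Metric.closedBall z (2 * h), ρ x) +
          ENNReal.ofReal (h ^ 2) * ∫⁻ x in Metric.closedBall z (2 * h), k x))

theorem LocalCoulomb.attraction_le {η C₀ : ℝ} (hη : 0 < η) (hC₀ : 0 < C₀) : ∃ C : ℝ, 0 < C ∧
    ∀ (ρ k f : E3 → ℝ≥0∞), Measurable ρ → Measurable k → Measurable f → LocalCoulomb η C₀ ρ k f →
    ∫⁻ x, f x ≠ ∞ → ∫⁻ x, ρ x * ENNReal.ofReal ‖x‖⁻¹ ≠ ∞ →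
    ∀ (Z : ℝ) (T : Set E3), 0 < Z → MeasurableSet T →
    (∀ x, ρ x ≠ 0 → ∀ z, dist x z ≤ tfScale Z z → z ∈ T) →
    ENNReal.ofReal Z * ∫⁻ x, ρ x * ENNReal.ofReal ‖x‖⁻¹ ≤ ENNReal.ofReal (1 / 2) * (∫⁻ x, k x) +
      ENNReal.ofReal (C * Z) * (ENNReal.ofReal Z + (∫⁻ x, f x) +
        ∫⁻ z in T, ENNReal.ofReal (tfScale Z z ^ 3 * (‖z‖ + 1 / Z))⁻¹) := by
  obtain ⟨C1, hC1, H1⟩ := lintegral_locScale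
  set c := min (1 / 8) (η / 2) with hc
  have hc0 : 0 < c := by positivity
  have hc8 : c ≤ 1 / 8 := min_le_left _ _
  have hcη : c ≤ η / 2 := min_le_right _ _
  set m := 1 + 9600 * C₀ with hm
  have hm1 : 1 ≤ m := by rw [hm]; linarith
  have hm0 : 0 < m := by linarith
  refine ⟨2 * (4 * (C₀ * m ^ 4 * c⁻¹ ^ 4 * C1)), by positivity, ?_⟩
  intro ρ k f hρ hk hf hloc hF ha Z T hZ hT hS
  set a := ∫⁻ x, ρ x * ENNReal.ofReal ‖x‖⁻¹ with hadef
  set K := ∫⁻ x, k x with hK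
  set L := locScale Z f with hLdef
  set l : E3 → ℝ := fun z => c * L z with hl
  have hL0 : ∀ z, 0 < L z := locScale_pos hZ hF
  have hl0 : ∀ z, 0 < l z := fun z => mul_pos hc0 (hL0 z)
  have hLc : Continuous L := continuous_locScale hZ hF
  have hlc : Continuous l := continuous_const.mul hLc
  have hlip : ∀ x y, |l x - l y| ≤ dist x y / 8 := by
    intro x y
    have h1 := locScale_le_add hZ hF x y
    have h2 := locScale_le_add hZ hF y x
    rw [dist_comm y x] at h2
    have h3 : |L x - L y| ≤ dist x y := abs_le.2 ⟨by linarith, by linarith⟩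
    rw [hl, ← mul_sub, abs_mul, abs_of_pos hc0]
    nlinarith [abs_nonneg (L x - L y)]
  have hltf : ∀ z, L z ≤ tfScale Z z := fun z => (locScale_le_maxScale hZ hF z).trans (min_le_left _ _)
  have hlL : ∀ z, l z ≤ L z := fun z => by
    have := hL0 z
    rw [hl]
    nlinarith
  have hcond : ∀ z, ENNReal.ofReal (l z) * ∫⁻ x in Metric.closedBall z (4 * l z), f x ≤
      ENNReal.ofReal η := by
    intro z
    have h0 := hL0 z
    have h1 := energy_le_of_lt_fieldScale (H := maxScale Z f) (f := f) (z := z) (t := L z / 2)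
      (maxScale_pos hZ hF z).le (by change _ < L z; linarith)
    calc _ ≤ ENNReal.ofReal (l z) * ∫⁻ x in Metric.closedBall z (L z / 2), f x := by
          refine mul_le_mul' le_rfl (lintegral_mono_set (Metric.closedBall_subset_closedBall ?_))
          rw [hl]
          nlinarith
      _ = ENNReal.ofReal (2 * c) *
          (ENNReal.ofReal (L z / 2) * ∫⁻ x in Metric.closedBall z (L z / 2), f x) := by
          rw [← mul_assoc, ← ENNReal.ofReal_mul (by positivity)]
          congr 2
          rw [hl]
          ring
      _ ≤ ENNReal.ofReal (2 * c) * 1 := by gcongr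
      _ ≤ _ := by
          rw [mul_one]
          exact ENNReal.ofReal_le_ofReal (by linarith)
  have hkin : ∀ z, (‖z‖ + l z)⁻¹ * l z ^ 2 ≤ 2 / Z := by
    intro z
    have h0 := hl0 z
    have h1 : l z ^ 2 ≤ (‖z‖ + 1 / Z) / Z := by
      rw [← tfScale_sq hZ]
      have := (hlL z).trans (hltf z)
      gcongr
    have hz := norm_nonneg z
    rw [inv_mul_le_iff₀ (by positivity)]
    rcases le_total (1 / Z) (‖z‖ + l z) with h | h
    · refine h1.trans ?_
      rw [mul_div_assoc', div_le_div_iff_of_pos_right hZ]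
      linarith
    · have h2 : l z ≤ 1 / Z := by linarith
      calc l z ^ 2 = l z * l z := sq _
        _ ≤ (‖z‖ + l z) * (1 / Z) := by gcongr; linarith
        _ ≤ _ := by gcongr; norm_num
  have hdens : ∀ z, ENNReal.ofReal (‖z‖ + l z)⁻¹ * ∫⁻ x in Metric.closedBall z (2 * l z), ρ x ≤
      ENNReal.ofReal 2 * ∫⁻ x in Metric.closedBall z (2 * l z), ρ x * ENNReal.ofReal ‖x‖⁻¹ := by
    intro z
    have h0 := hl0 z
    rw [← lintegral_const_mul' _ _ ENNReal.ofReal_ne_top, ← lintegral_const_mul' _ _ ENNReal.ofReal_ne_top]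
    refine lintegral_mono_ae ?_
    rw [ae_restrict_iff' Metric.isClosed_closedBall.measurableSet]
    filter_upwards [Measure.ae_ne volume (0 : E3)] with x hx hxz
    rw [mul_left_comm, mul_comm (ENNReal.ofReal _), ← ENNReal.ofReal_mul (by positivity)]
    gcongr
    have h1 := norm_pos_iff.2 hx
    rw [Metric.mem_closedBall] at hxz
    have h2 := norm_le_norm_add_dist x z
    rw [← div_eq_mul_inv, inv_eq_one_div, div_le_div_iff₀ (by positivity) h1]
    linarith [norm_nonneg z]
  have hpt : ∀ z, ENNReal.ofReal ((l z)⁻¹ ^ 3) *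
      ∫⁻ x in Metric.closedBall z (l z), ρ x * ENNReal.ofReal ‖x‖⁻¹ ≤
      T.indicator (fun z => ENNReal.ofReal (C₀ * m ^ 4 * c⁻¹ ^ 4) *
        ENNReal.ofReal ((L z)⁻¹ ^ 3 * (‖z‖ + L z)⁻¹)) z +
      (ENNReal.ofReal (2 * C₀ / m) * (ENNReal.ofReal ((l z)⁻¹ ^ 3) *
        ∫⁻ x in Metric.closedBall z (2 * l z), ρ x * ENNReal.ofReal ‖x‖⁻¹) +
      ENNReal.ofReal (2 * C₀ / m / Z) * (ENNReal.ofReal ((l z)⁻¹ ^ 3) *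
        ∫⁻ x in Metric.closedBall z (2 * l z), k x)) := by
    intro z
    have h0 := hl0 z
    have hLz := hL0 z
    by_cases hz : z ∈ T
    · rw [indicator_of_mem hz]
      refine (mul_le_mul' le_rfl (hloc z (l z) m h0 hm1 (hcond z))).trans ?_
      simp only [mul_add]
      refine add_le_add ?_ (add_le_add ?_ ?_)
      · rw [← ENNReal.ofReal_mul (by positivity), ← ENNReal.ofReal_mul (by positivity),
          ← ENNReal.ofReal_mul (by positivity)]
        apply ENNReal.ofReal_le_ofReal
        have h1 : (‖z‖ + l z)⁻¹ ≤ (c * (‖z‖ + L z))⁻¹ := by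
          gcongr
          rw [mul_add]
          have : c * ‖z‖ ≤ ‖z‖ := by nlinarith [norm_nonneg z]
          exact add_le_add this le_rfl
        calc _ ≤ (l z)⁻¹ ^ 3 * ((c * (‖z‖ + L z))⁻¹ * (C₀ * m ^ 4)) := by gcongr
          _ = _ := by
            rw [hl, mul_inv, mul_inv]
            ring
      · calc _ = ENNReal.ofReal ((l z)⁻¹ ^ 3) * ENNReal.ofReal (C₀ / m) *
              (ENNReal.ofReal (‖z‖ + l z)⁻¹ * ∫⁻ x in Metric.closedBall z (2 * l z), ρ x) := by ring
          _ ≤ ENNReal.ofReal ((l z)⁻¹ ^ 3) * ENNReal.ofReal (C₀ / m) *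
              (ENNReal.ofReal 2 * ∫⁻ x in Metric.closedBall z (2 * l z), ρ x * ENNReal.ofReal ‖x‖⁻¹) :=
            mul_le_mul' le_rfl (hdens z)
          _ = _ := by
            rw [mul_div_assoc, ENNReal.ofReal_mul (p := 2) (by norm_num)]
            ring
      · calc _ = ENNReal.ofReal ((l z)⁻¹ ^ 3) * ENNReal.ofReal (C₀ / m) *
              (ENNReal.ofReal (‖z‖ + l z)⁻¹ * ENNReal.ofReal (l z ^ 2)) *
                ∫⁻ x in Metric.closedBall z (2 * l z), k x := by ring
          _ ≤ ENNReal.ofReal ((l z)⁻¹ ^ 3) * ENNReal.ofReal (C₀ / m) *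
              ENNReal.ofReal (2 / Z) * ∫⁻ x in Metric.closedBall z (2 * l z), k x := by
            rw [← ENNReal.ofReal_mul (p := (‖z‖ + l z)⁻¹) (by positivity)]
            gcongr
            exact hkin z
          _ = _ := by
            rw [show 2 * C₀ / m / Z = C₀ / m * (2 / Z) by ring,
              ENNReal.ofReal_mul (p := C₀ / m) (by positivity)]
            ring
    · have : ∫⁻ x in Metric.closedBall z (l z), ρ x * ENNReal.ofReal ‖x‖⁻¹ = 0 := by
        rw [setLIntegral_congr_fun (g := fun _ => 0) Metric.isClosed_closedBall.measurableSet]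
        · simp
        · intro x hx
          rw [Metric.mem_closedBall] at hx
          have : ρ x = 0 := by
            by_contra h
            exact hz (hS x h z (hx.trans ((hlL z).trans (hltf z))))
          simp [this]
      rw [this, mul_zero]
      exact zero_le
  set D := ∫⁻ z in T, ENNReal.ofReal (tfScale Z z ^ 3 * (‖z‖ + 1 / Z))⁻¹
  set B := ENNReal.ofReal Z + (∫⁻ x, f x) + D with hB
  have hρa : Measurable fun x : E3 => ρ x * ENNReal.ofReal ‖x‖⁻¹ := by fun_prop
  have hmain : a ≤ ENNReal.ofReal 4 * (ENNReal.ofReal (C₀ * m ^ 4 * c⁻¹ ^ 4) * (ENNReal.ofReal C1 * B) +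
      (ENNReal.ofReal (2 * C₀ / m) * (ENNReal.ofReal 300 * a) +
      ENNReal.ofReal (2 * C₀ / m / Z) * (ENNReal.ofReal 300 * K))) := by
    refine (lintegral_le_covering hl0 hlip hρa).trans (mul_le_mul' le_rfl ?_)
    have hball : ∀ g : E3 → ℝ≥0∞, Measurable g →
        Measurable fun z => ENNReal.ofReal ((l z)⁻¹ ^ 3) * ∫⁻ x in Metric.closedBall z (2 * l z), g x := by
      intro g hg
      have hS : MeasurableSet {p : E3 × E3 | dist p.2 p.1 ≤ 2 * l p.1} :=
        (isClosed_le (by fun_prop) (by fun_prop)).measurableSet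
      refine Measurable.mul (by fun_prop) ?_
      have : (fun z => ∫⁻ x in Metric.closedBall z (2 * l z), g x) = fun z =>
          ∫⁻ x, {p : E3 × E3 | dist p.2 p.1 ≤ 2 * l p.1}.indicator (fun p => g p.2) (z, x) := by
        ext z
        rw [← lintegral_indicator Metric.isClosed_closedBall.measurableSet]
        rfl
      rw [this]
      exact ((hg.comp measurable_snd).indicator hS).lintegral_prod_right'
    refine (lintegral_mono hpt).trans ?_
    rw [lintegral_add_left, lintegral_add_left ((hball _ hρa).const_mul _),
      lintegral_const_mul' _ _ ENNReal.ofReal_ne_top, lintegral_const_mul' _ _ ENNReal.ofReal_ne_top,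
      lintegral_indicator hT, lintegral_const_mul' _ _ ENNReal.ofReal_ne_top]
    · refine add_le_add (mul_le_mul' le_rfl (H1 Z f T hZ hf hF)) (add_le_add ?_ ?_)
      · exact mul_le_mul' le_rfl (covering_le_lintegral hl0 hlip hρa)
      · exact mul_le_mul' le_rfl (covering_le_lintegral hl0 hlip hk)
    · refine Measurable.indicator ?_ hT
      fun_prop
  set δ := 2400 * C₀ / m with hδ
  have hδ0 : 0 ≤ δ := by positivity
  have hδ4 : δ ≤ 1 / 4 := by
    rw [hδ, div_le_iff₀ hm0, hm]
    linarith
  have h3 : a ≤ (ENNReal.ofReal (4 * (C₀ * m ^ 4 * c⁻¹ ^ 4 * C1)) * B + ENNReal.ofReal (δ / Z) * K) +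
      ENNReal.ofReal (1 / 2) * a := by
    refine hmain.trans ?_
    have e1 : ENNReal.ofReal (4 * (C₀ * m ^ 4 * c⁻¹ ^ 4 * C1)) =
      ENNReal.ofReal 4 * (ENNReal.ofReal (C₀ * m ^ 4 * c⁻¹ ^ 4) * ENNReal.ofReal C1) := by
      rw [← ENNReal.ofReal_mul (by positivity), ← ENNReal.ofReal_mul (by positivity)]
    have e2 : ENNReal.ofReal (δ / Z) =
        ENNReal.ofReal 4 * (ENNReal.ofReal (2 * C₀ / m / Z) * ENNReal.ofReal 300) := by
      rw [← ENNReal.ofReal_mul (by positivity), ← ENNReal.ofReal_mul (by positivity), hδ]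
      congr 1
      ring
    have e3 : ENNReal.ofReal 4 * (ENNReal.ofReal (2 * C₀ / m) * ENNReal.ofReal 300) ≤
        ENNReal.ofReal (1 / 2) := by
      rw [← ENNReal.ofReal_mul (by positivity), ← ENNReal.ofReal_mul (by positivity)]
      apply ENNReal.ofReal_le_ofReal
      have : 4 * (2 * C₀ / m * 300) = δ := by rw [hδ]; ring
      linarith
    calc _ = ENNReal.ofReal 4 * (ENNReal.ofReal (C₀ * m ^ 4 * c⁻¹ ^ 4) * ENNReal.ofReal C1) * B +
          ENNReal.ofReal 4 * (ENNReal.ofReal (2 * C₀ / m / Z) * ENNReal.ofReal 300) * K +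
          ENNReal.ofReal 4 * (ENNReal.ofReal (2 * C₀ / m) * ENNReal.ofReal 300) * a := by ring
      _ ≤ _ := by
        rw [e1, e2]
        gcongr
  have h4 := ENNReal.le_two_mul_of_le_add_half ha h3
  calc _ ≤ ENNReal.ofReal Z * (2 * (ENNReal.ofReal (4 * (C₀ * m ^ 4 * c⁻¹ ^ 4 * C1)) * B +
        ENNReal.ofReal (δ / Z) * K)) := by gcongr
    _ = ENNReal.ofReal (2 * δ) * K + ENNReal.ofReal (2 * (4 * (C₀ * m ^ 4 * c⁻¹ ^ 4 * C1)) * Z) * B := by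
      have e1 : ENNReal.ofReal (2 * δ) = ENNReal.ofReal Z * 2 * ENNReal.ofReal (δ / Z) := by
        rw [← ENNReal.ofReal_ofNat 2, ← ENNReal.ofReal_mul (by positivity),
          ← ENNReal.ofReal_mul (by positivity)]
        congr 1
        field_simp
      have e2 : ENNReal.ofReal (2 * (4 * (C₀ * m ^ 4 * c⁻¹ ^ 4 * C1)) * Z) =
          2 * ENNReal.ofReal (4 * (C₀ * m ^ 4 * c⁻¹ ^ 4 * C1)) * ENNReal.ofReal Z := by
        rw [← ENNReal.ofReal_ofNat 2, ← ENNReal.ofReal_mul (by positivity),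
          ← ENNReal.ofReal_mul (by positivity)]
      rw [e1, e2]
      ring
    _ ≤ _ := by
      gcongr
      linarith

theorem sum_lt_eq_half_sum_ne {N : ℕ} (g : Fin N → Fin N → ℝ) (hg : ∀ i j, g i j = g j i) :
    2 * ∑ i, ∑ j, (if i < j then g i j else 0) = ∑ i, ∑ j, if i ≠ j then g i j else 0 := by
  have h1 : ∑ i, ∑ j, (if i < j then g i j else 0) = ∑ i, ∑ j, if j < i then g i j else 0 := by
    rw [Finset.sum_comm]
    refine Finset.sum_congr rfl fun i _ => Finset.sum_congr rfl fun j _ => ?_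
    rw [hg j i]
  rw [two_mul]
  nth_rewrite 2 [h1]
  rw [← Finset.sum_add_distrib]
  refine Finset.sum_congr rfl fun i _ => ?_
  rw [← Finset.sum_add_distrib]
  refine Finset.sum_congr rfl fun j _ => ?_
  rcases lt_trichotomy i j with h | h | h
  · simp [h, h.ne, h.le]
  · simp [h]
  · simp [h, h.ne', h.le]

/-- Screening: charges outside a ball of radius `R` repel each other more than they are attracted by
a charge `Z` at the origin, up to an error of order `Z ^ 2 / R`. -/
theorem outer_attraction_le {N : ℕ} {a p : Fin N → ℝ} {b : Fin N → Fin N → ℝ} {Z R : ℝ} (hZ : 1 ≤ Z)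
    (hR : 0 < R) (hp0 : ∀ i, 0 ≤ p i) (hp1 : ∀ i, p i ≤ 1) (hpa : ∀ i, p i ≠ 0 → R ≤ a i)
    (hbs : ∀ i j, b i j = b j i) (hb0 : ∀ i j, i ≠ j → 0 < b i j) (hb : ∀ i j, b i j ≤ a i + a j) :
    Z * ∑ i, p i * (a i)⁻¹ ≤
      (∑ i, ∑ j, if i < j then p i * p j * (b i j)⁻¹ else 0) + 5 * Z ^ 2 / R := by
  set P : Fin N → ℝ := fun i => ∑ j, if i ≠ j ∧ a j ≤ a i then p j else 0 with hP
  have hP0 : ∀ i, 0 ≤ P i := fun i => Finset.sum_nonneg fun j _ => by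
    split_ifs
    · exact hp0 j
    · exact le_rfl
  have h1 : ∑ i, p i * (a i)⁻¹ * P i ≤
      4 * ∑ i, ∑ j, if i < j then p i * p j * (b i j)⁻¹ else 0 := by
    have e := sum_lt_eq_half_sum_ne (fun i j => p i * p j * (b i j)⁻¹) fun i j => by
      rw [hbs i j, mul_comm (p i)]
    rw [show (4 : ℝ) = 2 * 2 by norm_num, mul_assoc, e, Finset.mul_sum]
    refine Finset.sum_le_sum fun i _ => ?_
    rw [hP, Finset.mul_sum, Finset.mul_sum]
    refine Finset.sum_le_sum fun j _ => ?_
    by_cases hij : i = j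
    · simp [hij]
    · rw [if_pos hij]
      have hbp := hb0 i j hij
      have hq : 0 ≤ 2 * (p i * p j * (b i j)⁻¹) := by
        have := hp0 i; have := hp0 j; positivity
      by_cases hle : a j ≤ a i
      · rw [if_pos ⟨hij, hle⟩]
        by_cases hpi : p i = 0
        · simp [hpi]
        · have hai : 0 < a i := hR.trans_le (hpa i hpi)
          have h2 : (a i)⁻¹ ≤ 2 * (b i j)⁻¹ := by
            rw [← div_eq_mul_inv, inv_eq_one_div, div_le_div_iff₀ hai hbp]
            linarith [hb i j]
          calc p i * (a i)⁻¹ * p j = p i * p j * (a i)⁻¹ := by ring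
            _ ≤ p i * p j * (2 * (b i j)⁻¹) :=
              mul_le_mul_of_nonneg_left h2 (mul_nonneg (hp0 i) (hp0 j))
            _ = _ := by ring
      · rw [if_neg (by tauto), mul_zero]
        exact hq
  set J := Finset.univ.filter fun i => p i ≠ 0 ∧ P i < 4 * Z with hJ
  have h2 : ∑ i ∈ J, p i ≤ 5 * Z := by
    rcases J.eq_empty_or_nonempty with h | h
    · rw [h, Finset.sum_empty]; positivity
    · obtain ⟨m, hm, hmax⟩ := J.exists_max_image a h
      rw [← Finset.add_sum_erase _ _ hm]
      have h3 : ∑ j ∈ J.erase m, p j ≤ P m := by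
        rw [hP]
        calc _ = ∑ j ∈ J.erase m, if m ≠ j ∧ a j ≤ a m then p j else 0 := by
              refine Finset.sum_congr rfl fun j hj => ?_
              rw [Finset.mem_erase] at hj
              rw [if_pos ⟨hj.1.symm, hmax j hj.2⟩]
          _ ≤ _ := Finset.sum_le_sum_of_subset_of_nonneg (Finset.subset_univ _) fun j _ _ => by
              split_ifs
              · exact hp0 j
              · exact le_rfl
      have h4 : P m < 4 * Z := (Finset.mem_filter.1 hm).2.2
      linarith [hp1 m]
  have h5 : ∑ i, p i * (a i)⁻¹ * (Z - P i / 4) ≤ Z / R * ∑ i ∈ J, p i := by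
    rw [Finset.mul_sum, hJ, Finset.sum_filter]
    refine Finset.sum_le_sum fun i _ => ?_
    by_cases hpi : p i = 0
    · simp [hpi]
    have hai : 0 < a i := hR.trans_le (hpa i hpi)
    by_cases hPi : P i < 4 * Z
    · rw [if_pos ⟨hpi, hPi⟩]
      have h6 : (a i)⁻¹ ≤ R⁻¹ := inv_anti₀ hR (hpa i hpi)
      calc _ ≤ p i * R⁻¹ * Z := by
            have := hp0 i
            have := hP0 i
            gcongr
            · linarith
            · linarith
        _ = _ := by ring
    · rw [if_neg (by tauto)]
      refine mul_nonpos_of_nonneg_of_nonpos (mul_nonneg (hp0 i) (by positivity)) (by linarith)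
  have h6 : ∑ i, p i * (a i)⁻¹ * (Z - P i / 4) =
      Z * (∑ i, p i * (a i)⁻¹) - (∑ i, p i * (a i)⁻¹ * P i) / 4 := by
    rw [Finset.mul_sum, Finset.sum_div, ← Finset.sum_sub_distrib]
    refine Finset.sum_congr rfl fun i _ => ?_
    ring
  have h7 : Z / R * ∑ i ∈ J, p i ≤ 5 * Z ^ 2 / R := by
    calc _ ≤ Z / R * (5 * Z) := by gcongr
      _ = _ := by ring
  linarith

section Update

variable {ι X : Type} [Fintype ι] [DecidableEq ι] [MeasurableSpace X]

/-- The product measure in which the factor `j` is replaced by a point mass. -/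
def sliceMeas (m : Measure X) (x₀ : X) (j : ι) : Measure (ι → X) :=
  Measure.pi fun i => if i = j then Measure.dirac x₀ else m

instance sigmaFinite_ite_dirac (m : Measure X) [SigmaFinite m] (x₀ : X) (j i : ι) :
    SigmaFinite (if i = j then Measure.dirac x₀ else m) := by
  split_ifs <;> infer_instance

instance (m : Measure X) [SigmaFinite m] (x₀ : X) (j : ι) : SigmaFinite (sliceMeas m x₀ j) := by
  unfold sliceMeas; infer_instance

theorem measurePreserving_update (m : Measure X) [SigmaFinite m] (x₀ : X) (j : ι) :
    MeasurePreserving (fun p : (ι → X) × X => Function.update p.1 j p.2)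
      ((sliceMeas m x₀ j).prod m) (Measure.pi fun _ => m) := by
  refine ⟨measurable_update', ?_⟩
  symm
  refine Measure.pi_eq fun s hs => ?_
  rw [Measure.map_apply measurable_update' (MeasurableSet.univ_pi hs)]
  have : (fun p : (ι → X) × X => Function.update p.1 j p.2) ⁻¹' (univ.pi s) =
      (univ.pi (Function.update s j univ)) ×ˢ (s j) := by
    ext p
    simp only [mem_preimage, mem_univ_pi, mem_prod]
    constructor
    · intro h
      refine ⟨fun i => ?_, by simpa using h j⟩
      by_cases hi : i = j
      · subst hi; simp
      · simpa [hi] using h i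
    · rintro ⟨h1, h2⟩ i
      by_cases hi : i = j
      · subst hi; simpa using h2
      · simpa [hi] using h1 i
  rw [this, Measure.prod_prod, sliceMeas, Measure.pi_pi, ← Finset.mul_prod_erase _ _ (Finset.mem_univ j),
    ← Finset.mul_prod_erase _ (fun i => m (s i)) (Finset.mem_univ j)]
  simp only [if_true, Function.update_self, measure_univ, one_mul]
  rw [mul_comm]
  congr 1
  refine Finset.prod_congr rfl fun i hi => ?_
  have hi := Finset.ne_of_mem_erase hi
  simp [hi]

theorem lintegral_pi_update (m : Measure X) [SigmaFinite m] (x₀ : X) (j : ι) {F : (ι → X) → ℝ≥0∞}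
    (hF : Measurable F) :
    ∫⁻ ξ, F ξ ∂(Measure.pi fun _ => m) =
      ∫⁻ ω, (∫⁻ η, F (Function.update ω j η) ∂m) ∂(sliceMeas m x₀ j) := by
  rw [← (measurePreserving_update m x₀ j).lintegral_comp hF]
  exact lintegral_prod _ (hF.comp measurable_update').aemeasurable

theorem integral_pi_update {F : (ι → X) → ℂ} (m : Measure X) [SigmaFinite m] (x₀ : X) (j : ι) 
    (hF : Integrable F (Measure.pi fun _ => m)) :
    ∫ ξ, F ξ ∂(Measure.pi fun _ => m) =
      ∫ ω, (∫ η, F (Function.update ω j η) ∂m) ∂(sliceMeas m x₀ j) := by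
  have h := measurePreserving_update m x₀ j
  have h2 : Integrable (fun p : (ι → X) × X => F (Function.update p.1 j p.2))
      ((sliceMeas m x₀ j).prod m) := h.integrable_comp_of_integrable hF
  rw [← integral_prod _ h2, ← h.map_eq, integral_map h.measurable.aemeasurable]
  rw [h.map_eq]
  exact hF.aestronglyMeasurable

end Update

/-- One-particle position–spin space. -/
abbrev XS := E3 × Fin 2

/-- The reference measure on the one-particle space. -/
def mXS : Measure XS := (volume : Measure E3).prod Measure.count

instance : SigmaFinite mXS := by unfold mXS; infer_instance

theorem pi_count (N : ℕ) :
    Measure.pi (fun _ : Fin N => (Measure.count : Measure (Fin 2))) = Measure.count := by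
  refine Measure.ext_iff_singleton.2 fun a => ?_
  rw [Measure.count_singleton, ← univ_pi_singleton, Measure.pi_pi]
  simp only [Measure.count_singleton, Finset.prod_const_one]

theorem lintegral_mXS {F : XS → ℝ≥0∞} (hF : Measurable F) :
    ∫⁻ η, F η ∂mXS = ∫⁻ x, ∑ s, F (x, s) := by
  rw [mXS, lintegral_prod _ hF.aemeasurable]
  simp only [lintegral_count, tsum_fintype]

theorem lintegral_flat {N : ℕ} {F : (Fin N → E3) → (Fin N → Fin 2) → ℝ≥0∞}
    (hF : ∀ s, Measurable fun x => F x s) :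
    ∫⁻ ξ, F (fun i => (ξ i).1) (fun i => (ξ i).2) ∂(Measure.pi fun _ : Fin N => mXS) =
      ∑ s, ∫⁻ x, F x s := by
  have h := measurePreserving_arrowProdEquivProdArrow E3 (Fin 2) (Fin N)
    (fun _ => (volume : Measure E3)) (fun _ => Measure.count)
  have hm : Measurable fun p : (Fin N → E3) × (Fin N → Fin 2) => F p.1 p.2 :=
    measurable_from_prod_countable_left hF
  have h1 := h.lintegral_comp hm
  rw [pi_count, lintegral_prod_symm _ hm.aemeasurable, lintegral_count, tsum_fintype] at h1
  exact h1

/-- Parameter space of the one-particle slices of an `N`-body function. -/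
abbrev Slice (N : ℕ) := Fin N × (Fin N → XS)

/-- The measure on slices: every particle in turn is singled out. -/
def sliceSum (N : ℕ) : Measure (Slice N) :=
  Measure.sum fun j => (sliceMeas mXS (0, 0) j).map (Prod.mk j)

instance (N : ℕ) : SFinite (sliceSum N) := by unfold sliceSum; infer_instance

theorem lintegral_sliceSum {N : ℕ} {F : Slice N → ℝ≥0∞} (hF : Measurable F) :
    ∫⁻ p, F p ∂(sliceSum N) = ∑ j, ∫⁻ ω, F (j, ω) ∂(sliceMeas mXS (0, 0) j) := by
  rw [sliceSum, lintegral_sum_measure, tsum_fintype]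
  exact Finset.sum_congr rfl fun j _ => lintegral_map hF measurable_prodMk_left

/-- Positions of a slice with the distinguished particle put at `x`. -/
def slicePos {N : ℕ} (p : Slice N) (x : E3) : Fin N → E3 := Function.update (fun i => (p.2 i).1) p.1 x

/-- Spins of a slice with the distinguished particle in state `s`. -/
def sliceSpin {N : ℕ} (p : Slice N) (s : Fin 2) : Fin N → Fin 2 :=
  Function.update (fun i => (p.2 i).2) p.1 s

theorem measurable_slice {N : ℕ} {β : Type} [MeasurableSpace β]
    {G : Fin N → (Fin N → E3) → (Fin N → Fin 2) → β} (hG : ∀ j s, Measurable fun x => G j x s)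
    (s : Fin 2) : Measurable fun q : Slice N × E3 => G q.1.1 (slicePos q.1 q.2) (sliceSpin q.1 s) := by
  have h1 : Measurable fun r : (Fin N → E3) × (Fin N × (Fin N → Fin 2)) => G r.2.1 r.1 r.2.2 :=
    measurable_from_prod_countable_left fun r => hG r.1 r.2
  have h2 : Measurable fun q : Slice N × E3 => slicePos q.1 q.2 := by
    refine measurable_pi_iff.2 fun i => ?_
    simp only [slicePos, Function.update_apply]
    refine Measurable.ite ?_ measurable_snd
      (measurable_fst.comp ((measurable_pi_apply i).comp (measurable_snd.comp measurable_fst)))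
    exact (measurable_fst.comp measurable_fst) (measurableSet_singleton i) |>.congr (by ext; simp [eq_comm])
  have h3 : Measurable fun q : Slice N × E3 => sliceSpin q.1 s := by
    refine measurable_pi_iff.2 fun i => ?_
    simp only [sliceSpin, Function.update_apply]
    refine Measurable.ite ?_ measurable_const
      (measurable_snd.comp ((measurable_pi_apply i).comp (measurable_snd.comp measurable_fst)))
    exact (measurable_fst.comp measurable_fst) (measurableSet_singleton i) |>.congr (by ext; simp [eq_comm])
  exact h1.comp (h2.prodMk ((measurable_fst.comp measurable_fst).prodMk h3))

theorem lintegral_slice {N : ℕ} {G : Fin N → (Fin N → E3) → (Fin N → Fin 2) → ℝ≥0∞}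
    (hG : ∀ j s, Measurable fun x => G j x s) :
    ∫⁻ x : E3, (∫⁻ p, (∑ s, G p.1 (slicePos p x) (sliceSpin p s)) ∂(sliceSum N)) =
      ∑ j, ∑ s, ∫⁻ x, G j x s := by
  have hm : Measurable fun q : Slice N × E3 => ∑ s, G q.1.1 (slicePos q.1 q.2) (sliceSpin q.1 s) :=
    Finset.measurable_fun_sum _ fun s _ => measurable_slice hG s
  rw [lintegral_lintegral_swap
    (f := fun (x : E3) (p : Slice N) => ∑ s, G p.1 (slicePos p x) (sliceSpin p s))
    (hm.comp measurable_swap).aemeasurable, lintegral_sliceSum hm.lintegral_prod_right']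
  refine Finset.sum_congr rfl fun j _ => ?_
  have hfl : Measurable fun ξ : Fin N → XS => G j (fun i => (ξ i).1) (fun i => (ξ i).2) := by
    have h1 : Measurable fun r : (Fin N → E3) × (Fin N → Fin 2) => G j r.1 r.2 :=
      measurable_from_prod_countable_left fun r => hG j r
    exact h1.comp ((measurable_pi_iff.2 fun i => measurable_fst.comp (measurable_pi_apply i)).prodMk
      (measurable_pi_iff.2 fun i => measurable_snd.comp (measurable_pi_apply i)))
  rw [← lintegral_flat (hG j), lintegral_pi_update mXS (0, 0) j hfl]
  refine lintegral_congr fun ω => ?_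
  refine Eq.trans ?_ (lintegral_mXS (hfl.comp (measurable_update ω))).symm
  refine lintegral_congr fun x => Finset.sum_congr rfl fun s _ => ?_
  congr 1 <;>
  · ext i
    by_cases hi : i = j
    · subst hi; simp [slicePos, sliceSpin]
    · simp [slicePos, sliceSpin, hi]

/-- The one-particle family of slices of an `N`-body function. -/
def oneFam {N : ℕ} (Ψ : (Fin N → E3) → (Fin N → Fin 2) → ℂ) (p : Slice N) (x : E3) (s : Fin 2) : ℂ :=
  Ψ (slicePos p x) (sliceSpin p s)

/-- The `N`-body Pauli operator in the variable `j`. -/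
def diracN {N : ℕ} (A : E3 → Fin 3 → ℝ) (j : Fin N) (Ψ : (Fin N → E3) → (Fin N → Fin 2) → ℂ)
    (x : Fin N → E3) (s : Fin N → Fin 2) : ℂ :=
  ∑ k : Fin 3, ∑ t : Fin 2, pauli k (s j) t *
      (-Complex.I * fderiv ℝ (fun y => Ψ y (Function.update s j t)) x (eVec N j k)
        + (A (x j) k : ℂ) * Ψ x (Function.update s j t))

theorem sliceSpin_update {N : ℕ} (p : Slice N) (s t : Fin 2) :
    Function.update (sliceSpin p s) p.1 t = sliceSpin p t := by
  simp [sliceSpin]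

@[simp] theorem sliceSpin_self {N : ℕ} (p : Slice N) (s : Fin 2) : sliceSpin p s p.1 = s := by
  simp [sliceSpin]

@[simp] theorem slicePos_self {N : ℕ} (p : Slice N) (x : E3) : slicePos p x p.1 = x := by
  simp [slicePos]

theorem contDiff_slicePos {N : ℕ} (p : Slice N) {n : WithTop ℕ∞} : ContDiff ℝ n (slicePos p) := by
  refine contDiff_pi.2 fun i => ?_
  simp only [slicePos, Function.update_apply]
  split_ifs
  · exact contDiff_id
  · exact contDiff_const

theorem pdv_slice {N : ℕ} {Φ : (Fin N → E3) → ℂ} (p : Slice N) (x : E3)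
    (h : DifferentiableAt ℝ Φ (slicePos p x)) (k : Fin 3) :
    pdv k (fun y => Φ (slicePos p y)) x = fderiv ℝ Φ (slicePos p x) (eVec N p.1 k) := by
  have h1 : HasFDerivAt (slicePos p) (ContinuousLinearMap.pi (Pi.single p.1 (.id ℝ E3))) x :=
    hasFDerivAt_update (i := p.1) (fun i => (p.2 i).1) x
  have h2 := h.hasFDerivAt.comp x h1
  unfold pdv
  rw [show (fun y => Φ (slicePos p y)) = Φ ∘ slicePos p from rfl, h2.fderiv,
    ContinuousLinearMap.comp_apply]
  congr 1
  ext i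
  simp only [eVec, ContinuousLinearMap.coe_pi']
  by_cases hi : i = p.1
  · subst hi; simp
  · simp [hi]

theorem dirac_oneFam {N : ℕ} {Ψ : (Fin N → E3) → (Fin N → Fin 2) → ℂ} {A : E3 → Fin 3 → ℝ}
    (hΨ : ∀ s, Differentiable ℝ fun x => Ψ x s) (p : Slice N) (x : E3) (s : Fin 2) :
    dirac A (oneFam Ψ p) x s = diracN A p.1 Ψ (slicePos p x) (sliceSpin p s) := by
  unfold dirac diracN oneFam
  simp only [sliceSpin_self, slicePos_self, sliceSpin_update]
  refine Finset.sum_congr rfl fun k _ => Finset.sum_congr rfl fun t _ => ?_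
  rw [pdv_slice p x (hΨ _ _)]

theorem lintegral_mul_dens_oneFam {N : ℕ} {Ψ : (Fin N → E3) → (Fin N → Fin 2) → ℂ}
    (hΨ : ∀ s, Continuous fun x => Ψ x s) {g : E3 → ℝ≥0∞} (hg : Measurable g) :
    ∫⁻ x, g x * dens (sliceSum N) (oneFam Ψ) x =
      ∑ j, ∑ s, ∫⁻ x : Fin N → E3, g (x j) * ‖Ψ x s‖ₑ ^ 2 := by
  rw [← lintegral_slice (G := fun j x s => g (x j) * ‖Ψ x s‖ₑ ^ 2) fun j s =>
    (hg.comp (measurable_pi_apply j)).mul ((hΨ s).measurable.enorm.pow_const 2)]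
  refine lintegral_congr fun x => ?_
  rw [dens, ← lintegral_const_mul]
  · refine lintegral_congr fun p => ?_
    simp only [slicePos_self, sq2, Finset.mul_sum, oneFam]
  · refine Finset.measurable_fun_sum _ fun s _ => Measurable.pow_const (Measurable.enorm ?_) 2
    exact (measurable_slice (G := fun _ => Ψ) (fun _ s => (hΨ s).measurable) s).comp
      (measurable_id.prodMk measurable_const)

theorem lintegral_kinD_oneFam {N : ℕ} {Ψ : (Fin N → E3) → (Fin N → Fin 2) → ℂ}
    (hΨ : ∀ s, ContDiff ℝ 1 fun x => Ψ x s) {A : E3 → Fin 3 → ℝ} (hA : Continuous A)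
    {a : E3 → ℂ} (ha : ContDiff ℝ 1 a) :
    ∫⁻ x, kinD (sliceSum N) A (fun p x s => a x * oneFam Ψ p x s) x =
      ∑ j, ∑ s, ∫⁻ x, ‖diracN A j (fun y t => a (y j) * Ψ y t) x s‖ₑ ^ 2 := by
  have hc : ∀ j : Fin N, ∀ s, ContDiff ℝ 1 fun y : Fin N → E3 => a (y j) * Ψ y s := fun j s =>
    (ha.comp (contDiff_apply ℝ E3 j)).mul (hΨ s)
  rw [← lintegral_slice (G := fun j x s => ‖diracN A j (fun y t => a (y j) * Ψ y t) x s‖ₑ ^ 2)]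
  · refine lintegral_congr fun x => lintegral_congr fun p => ?_
    refine Finset.sum_congr rfl fun s _ => ?_
    rw [← dirac_oneFam (fun s => (hc p.1 s).differentiable (by norm_num))]
    congr 3
    ext x s
    simp only [oneFam, slicePos_self]
  · intro j s
    refine Measurable.pow_const (Measurable.enorm ?_) 2
    refine Continuous.measurable ?_
    unfold diracN
    refine continuous_finsetSum _ fun k _ => continuous_finsetSum _ fun t _ => ?_
    refine continuous_const.mul ((continuous_const.mul
      (((hc j _).continuous_fderiv (by norm_num)).clm_apply continuous_const)).add
      (Continuous.mul ?_ (hc j _).continuous))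
    exact Complex.continuous_ofReal.comp ((continuous_apply k).comp (hA.comp (continuous_apply j)))

theorem bessel_of_orthogonal {H ι : Type} [NormedAddCommGroup H] [InnerProductSpace ℂ H] [Fintype ι]
    [DecidableEq ι] {f : H} {p : ι → H} {I : ι → ℝ} {V : ℝ} (hV : 0 ≤ V)
    (h1 : ∀ i j, i ≠ j → inner ℂ (p i) (p j) = 0) (h2 : ∀ j, inner ℂ (p j) f = (I j : ℂ))
    (h3 : ∀ j, inner ℂ (p j) (p j) = ((V * I j : ℝ) : ℂ)) : ∑ j, I j ≤ V * ‖f‖ ^ 2 := by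
  rcases hV.eq_or_lt with h0 | h0
  · have : ∀ j, I j = 0 := by
      intro j
      have h4 : p j = 0 := by
        rw [← inner_self_eq_zero (𝕜 := ℂ), h3, ← h0]; simp
      have := h2 j
      rw [h4, inner_zero_left] at this
      exact_mod_cast this.symm
    simp [this, ← h0]
  · have h4 : inner ℂ ((V : ℂ) • f - ∑ j, p j) ((V : ℂ) • f - ∑ j, p j) =
        ((V ^ 2 * ‖f‖ ^ 2 - V * ∑ j, I j : ℝ) : ℂ) := by
      have e1 : inner ℂ (∑ j, p j) f = ((∑ j, I j : ℝ) : ℂ) := by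
        rw [sum_inner]; push_cast; exact Finset.sum_congr rfl fun j _ => h2 j
      have e2 : inner ℂ f (∑ j, p j) = ((∑ j, I j : ℝ) : ℂ) := by
        rw [← inner_conj_symm, e1, Complex.conj_ofReal]
      have e3 : inner ℂ (∑ j, p j) (∑ j, p j) = ((V * ∑ j, I j : ℝ) : ℂ) := by
        rw [sum_inner, Finset.mul_sum]
        push_cast
        refine Finset.sum_congr rfl fun i _ => ?_
        rw [inner_sum, Finset.sum_eq_single i (fun j _ hj => h1 i j hj.symm) (by simp), h3]
        push_cast; rfl
      rw [inner_sub_sub_self, inner_smul_left, inner_smul_right, inner_smul_left, inner_smul_right,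
        e1, e2, e3, inner_self_eq_norm_sq_to_K, Complex.conj_ofReal]
      push_cast
      simp only [Complex.coe_algebraMap]
      ring
    have h5 : 0 ≤ V ^ 2 * ‖f‖ ^ 2 - V * ∑ j, I j := by
      have := inner_self_nonneg (𝕜 := ℂ) (x := (V : ℂ) • f - ∑ j, p j)
      rw [h4] at this
      exact this
    nlinarith

set_option linter.unusedSectionVars false

section Slices

variable {ι X : Type} [Fintype ι] [DecidableEq ι] [MeasurableSpace X]

/-- Bounded measurable functions on a power of `X` that vanish outside the power of `B`. -/
structure IsNice (B : Set X) (F : (ι → X) → ℂ) : Prop where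
  meas : Measurable F
  bdd : ∃ C, ∀ ξ, ‖F ξ‖ ≤ C
  supp : ∀ ξ i, ξ i ∉ B → F ξ = 0

theorem integrable_of_bdd_supp {Y : Type} [MeasurableSpace Y] {μ : Measure Y} {F : Y → ℂ} {S : Set Y}
    (hF : Measurable F) {C : ℝ} (hC : ∀ y, ‖F y‖ ≤ C) (hS : μ S ≠ ∞) (h0 : ∀ y, y ∉ S → F y = 0) :
    Integrable F μ := by
  refine (integrableOn_iff_integrable_of_support_subset (s := S) fun y hy => ?_).1 ?_
  · by_contra h; exact hy (h0 y h)
  · exact Measure.integrableOn_of_bounded hS hF.aestronglyMeasurable (Eventually.of_forall hC)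

theorem IsNice.integrable {B : Set X} {F : (ι → X) → ℂ} (h : IsNice B F) (m : Measure X) [SigmaFinite m]
    (hB : m B ≠ ∞) : Integrable F (Measure.pi fun _ => m) := by
  obtain ⟨C, hC⟩ := h.bdd
  refine integrable_of_bdd_supp (S := univ.pi fun _ => B) h.meas hC ?_ fun y hy => ?_
  · rw [Measure.pi_pi]
    exact ENNReal.prod_ne_top fun _ _ => hB
  · simp only [mem_univ_pi, not_forall] at hy
    obtain ⟨i, hi⟩ := hy
    exact h.supp y i hi

theorem IsNice.conj_mul {B : Set X} {F G : (ι → X) → ℂ} (hF : IsNice B F) (hG : IsNice B G) :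
    IsNice B fun ξ => (starRingEnd ℂ) (F ξ) * G ξ where
  meas := (Complex.continuous_conj.measurable.comp hF.meas).mul hG.meas
  bdd := by
    obtain ⟨C, hC⟩ := hF.bdd
    obtain ⟨D, hD⟩ := hG.bdd
    refine ⟨C * D, fun ξ => ?_⟩
    rw [norm_mul, RCLike.norm_conj]
    exact mul_le_mul (hC ξ) (hD ξ) (norm_nonneg _) ((norm_nonneg _).trans (hC ξ))
  supp ξ i h := by simp [hF.supp ξ i h]

theorem IsNice.memLp {B : Set X} {F : (ι → X) → ℂ} (h : IsNice B F) (m : Measure X) [SigmaFinite m]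
    (hB : m B ≠ ∞) : MemLp F 2 (Measure.pi fun _ => m) := by
  rw [memLp_two_iff_integrable_sq_norm h.meas.aestronglyMeasurable]
  have := ((h.conj_mul h).integrable m hB).norm
  refine this.congr (Eventually.of_forall fun ξ => ?_)
  simp [sq]

/-- Partial inner product with a one-particle function in the variable `j`. -/
def partialInner (m : Measure X) (v : X → ℂ) (f : (ι → X) → ℂ) (j : ι) (ξ : ι → X) : ℂ :=
  ∫ η, (starRingEnd ℂ) (v η) * f (Function.update ξ j η) ∂m

variable {m : Measure X} [SigmaFinite m] {B : Set X} {v : X → ℂ} {f : (ι → X) → ℂ}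

theorem partialInner_update (j : ι) (ξ : ι → X) (η : X) :
    partialInner m v f j (Function.update ξ j η) = partialInner m v f j ξ := by
  simp [partialInner]

theorem measurable_partialInner (hv : Measurable v) (hf : IsNice B f) (j : ι) :
    Measurable (partialInner m v f j) := by
  have : StronglyMeasurable fun p : (ι → X) × X => (starRingEnd ℂ) (v p.2) * f (Function.update p.1 j p.2) :=
    ((Complex.continuous_conj.measurable.comp (hv.comp measurable_snd)).mul
      (hf.meas.comp measurable_update')).stronglyMeasurable
  exact this.integral_prod_right'.measurable

theorem partialInner_bdd (hB : m B ≠ ∞) {Cv : ℝ} (hvb : ∀ x, ‖v x‖ ≤ Cv)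
    (hvs : ∀ x, x ∉ B → v x = 0) (hf : IsNice B f) (j : ι) : ∃ C, ∀ ξ, ‖partialInner m v f j ξ‖ ≤ C := by
  obtain ⟨C, hC⟩ := hf.bdd
  refine ⟨Cv * C * m.real B, fun ξ => ?_⟩
  have : partialInner m v f j ξ = ∫ η in B, (starRingEnd ℂ) (v η) * f (Function.update ξ j η) ∂m := by
    symm
    refine setIntegral_eq_integral_of_forall_compl_eq_zero fun x hx => ?_
    simp [hvs x hx]
  rw [this]
  refine norm_setIntegral_le_of_norm_le_const (lt_top_iff_ne_top.2 hB) fun x _ => ?_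
  rw [norm_mul, RCLike.norm_conj]
  exact mul_le_mul (hvb x) (hC _) (norm_nonneg _) ((norm_nonneg _).trans (hvb x))

theorem partialInner_supp (hf : IsNice B f) (j : ι) (ξ : ι → X) (i : ι) (hij : i ≠ j) (hi : ξ i ∉ B) :
    partialInner m v f j ξ = 0 := by
  unfold partialInner
  have : ∀ η, f (Function.update ξ j η) = 0 := fun η => hf.supp _ i (by simpa [hij] using hi)
  simp [this]

theorem isNice_mul_partialInner (hB : m B ≠ ∞) (hv : Measurable v) {Cv : ℝ} (hvb : ∀ x, ‖v x‖ ≤ Cv)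
    (hvs : ∀ x, x ∉ B → v x = 0) (hf : IsNice B f) (j : ι) :
    IsNice B fun ξ => v (ξ j) * partialInner m v f j ξ where
  meas := (hv.comp (measurable_pi_apply j)).mul (measurable_partialInner hv hf j)
  bdd := by
    obtain ⟨C, hC⟩ := partialInner_bdd hB hvb hvs hf j
    refine ⟨Cv * C, fun ξ => ?_⟩
    rw [norm_mul]
    exact mul_le_mul (hvb _) (hC ξ) (norm_nonneg _) ((norm_nonneg _).trans (hvb (ξ j)))
  supp ξ i h := by
    by_cases hij : i = j
    · subst hij; simp [hvs _ h]
    · simp [partialInner_supp hf j ξ i hij h]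

theorem integrable_sq_partialInner (hB : m B ≠ ∞) (hv : Measurable v) {Cv : ℝ} (hvb : ∀ x, ‖v x‖ ≤ Cv)
    (hvs : ∀ x, x ∉ B → v x = 0) (hf : IsNice B f) (j : ι) (x₀ : X) :
    Integrable (fun ω => ‖partialInner m v f j ω‖ ^ 2) (sliceMeas m x₀ j) := by
  obtain ⟨C, hC⟩ := partialInner_bdd hB hvb hvs hf j
  have hm := measurable_partialInner (m := m) hv hf j
  have : Integrable (fun ω => (starRingEnd ℂ) (partialInner m v f j ω) * partialInner m v f j ω)
      (sliceMeas m x₀ j) := by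
    refine integrable_of_bdd_supp (S := univ.pi (Function.update (fun _ => B) j univ)) (C := C * C)
      ((Complex.continuous_conj.measurable.comp hm).mul hm) (fun ξ => ?_) ?_ fun ξ hξ => ?_
    · rw [norm_mul, RCLike.norm_conj]
      exact mul_le_mul (hC ξ) (hC ξ) (norm_nonneg _) ((norm_nonneg _).trans (hC ξ))
    · rw [sliceMeas, Measure.pi_pi]
      refine ENNReal.prod_ne_top fun i _ => ?_
      by_cases hi : i = j
      · subst hi; simp
      · simpa [hi] using hB
    · simp only [mem_univ_pi, not_forall] at hξ
      obtain ⟨i, hi⟩ := hξ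
      by_cases hij : i = j
      · subst hij; simp at hi
      · simp only [ne_eq, hij, not_false_eq_true, Function.update_of_ne] at hi
        simp [partialInner_supp hf j ξ i hij hi]
  refine this.norm.congr (Eventually.of_forall fun ξ => ?_)
  simp [sq]

theorem partialInner_partialInner (hB : m B ≠ ∞) (hv : Measurable v) {Cv : ℝ} (hvb : ∀ x, ‖v x‖ ≤ Cv)
    (hvs : ∀ x, x ∉ B → v x = 0) (hf : IsNice B f)
    (hanti : ∀ i j, i ≠ j → ∀ ξ, f (ξ ∘ Equiv.swap i j) = -f ξ) {i j : ι} (hij : i ≠ j) (ω : ι → X) :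
    ∫ η, (starRingEnd ℂ) (v η) * partialInner m v f j (Function.update ω i η) ∂m = 0 := by
  obtain ⟨C, hC⟩ := hf.bdd
  set G : X → X → ℂ := fun η η' => (starRingEnd ℂ) (v η) *
    ((starRingEnd ℂ) (v η') * f (Function.update (Function.update ω i η) j η'))
  have hGm : Measurable (Function.uncurry G) := by
    refine (Complex.continuous_conj.measurable.comp (hv.comp measurable_fst)).mul
      ((Complex.continuous_conj.measurable.comp (hv.comp measurable_snd)).mul (hf.meas.comp ?_))
    exact measurable_update'.comp
      (((measurable_update ω).comp measurable_fst).prodMk measurable_snd)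
  have hGi : Integrable (Function.uncurry G) (m.prod m) := by
    refine integrable_of_bdd_supp (S := B ×ˢ B) (C := Cv * (Cv * C)) hGm ?_ ?_ ?_
    · intro p
      simp only [Function.uncurry, G, norm_mul, RCLike.norm_conj]
      have h0 : 0 ≤ Cv := (norm_nonneg _).trans (hvb p.1)
      have h1 : 0 ≤ C := (norm_nonneg _).trans (hC ω)
      gcongr
      · exact hvb _
      · exact hvb _
      · exact hC _
    · rw [Measure.prod_prod]; exact ENNReal.mul_ne_top hB hB
    · intro p hp
      simp only [mem_prod, not_and_or] at hp
      rcases hp with h | h <;> simp [Function.uncurry, G, hvs _ h]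
  have hsw : ∀ η η', G η' η = -G η η' := by
    intro η η'
    have h1 : f (Function.update (Function.update ω i η') j η) =
        -f (Function.update (Function.update ω i η) j η') := by
      rw [← hanti i j hij]
      congr 1
      ext l
      simp only [Function.comp]
      by_cases hl : l = i
      · subst hl; simp [hij]
      · by_cases hl2 : l = j
        · subst hl2; simp [hij]
        · simp [hl, hl2, Equiv.swap_apply_of_ne_of_ne hl hl2]
    simp only [G, h1]
    ring
  have e : ∫ η, (starRingEnd ℂ) (v η) * partialInner m v f j (Function.update ω i η) ∂m =
      ∫ η, (∫ η', G η η' ∂m) ∂m := by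
    refine integral_congr_ae (Eventually.of_forall fun η => ?_)
    simp only [partialInner, G]
    rw [integral_const_mul]
  rw [e]
  have h2 : ∫ η, (∫ η', G η η' ∂m) ∂m = -∫ η, (∫ η', G η η' ∂m) ∂m := by
    conv_lhs => rw [integral_integral_swap hGi]
    rw [← integral_neg]
    refine integral_congr_ae (Eventually.of_forall fun η => ?_)
    simp only
    rw [← integral_neg]
    exact integral_congr_ae (Eventually.of_forall fun η' => hsw _ _)
  exact self_eq_neg.1 h2

/-- The one-particle density matrix of an antisymmetric function is bounded by its norm squared. -/
theorem antisymm_bessel (x₀ : X) (hB : m B ≠ ∞) (hv : Measurable v) {Cv : ℝ} (hvb : ∀ x, ‖v x‖ ≤ Cv)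
    (hvs : ∀ x, x ∉ B → v x = 0) (hf : IsNice B f)
    (hanti : ∀ i j, i ≠ j → ∀ ξ, f (ξ ∘ Equiv.swap i j) = -f ξ) :
    ∑ j, ∫⁻ ω, ‖partialInner m v f j ω‖ₑ ^ 2 ∂(sliceMeas m x₀ j) ≤
      (∫⁻ η, ‖v η‖ₑ ^ 2 ∂m) * ∫⁻ ξ, ‖f ξ‖ₑ ^ 2 ∂(Measure.pi fun _ => m) := by
  have hvi : Integrable (fun η => ‖v η‖ ^ 2) m := by
    have : Integrable (fun η => (starRingEnd ℂ) (v η) * v η) m := by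
      refine integrable_of_bdd_supp (S := B) (C := Cv * Cv)
        ((Complex.continuous_conj.measurable.comp hv).mul hv) (fun x => ?_) hB fun x hx => by
          simp [hvs x hx]
      rw [norm_mul, RCLike.norm_conj]
      exact mul_le_mul (hvb x) (hvb x) (norm_nonneg _) ((norm_nonneg _).trans (hvb x))
    refine this.norm.congr (Eventually.of_forall fun ξ => ?_)
    simp [sq]
  set c := partialInner m v f with hc
  set p : ι → (ι → X) → ℂ := fun j ξ => v (ξ j) * c j ξ
  have hp : ∀ j, IsNice B (p j) := isNice_mul_partialInner hB hv hvb hvs hf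
  set I : ι → ℝ := fun j => ∫ ω, ‖c j ω‖ ^ 2 ∂(sliceMeas m x₀ j)
  set V : ℝ := ∫ η, ‖v η‖ ^ 2 ∂m
  have hI : ∀ j, ∫⁻ ω, ‖c j ω‖ₑ ^ 2 ∂(sliceMeas m x₀ j) = ENNReal.ofReal (I j) := by
    intro j
    rw [ofReal_integral_eq_lintegral_ofReal (integrable_sq_partialInner hB hv hvb hvs hf j x₀)
      (Eventually.of_forall fun _ => by positivity)]
    exact lintegral_congr fun ω => enorm_sq_eq_ofReal _
  have hV : ∫⁻ η, ‖v η‖ₑ ^ 2 ∂m = ENNReal.ofReal V := by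
    rw [ofReal_integral_eq_lintegral_ofReal hvi (Eventually.of_forall fun _ => by positivity)]
    exact lintegral_congr fun ω => enorm_sq_eq_ofReal _
  have hcc : ∀ z : ℂ, (starRingEnd ℂ) z * z = ((‖z‖ ^ 2 : ℝ) : ℂ) := fun z => by
    rw [mul_comm, Complex.mul_conj']; push_cast; rfl
  have hinner : ∀ F G : (ι → X) → ℂ, ∀ hF : IsNice B F, ∀ hG : IsNice B G,
      inner ℂ ((hF.memLp m hB).toLp F) ((hG.memLp m hB).toLp G) =
        ∫ ξ, (starRingEnd ℂ) (F ξ) * G ξ ∂(Measure.pi fun _ => m) := by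
    intro F G hF hG
    rw [L2.inner_def]
    refine integral_congr_ae ?_
    filter_upwards [(hF.memLp m hB).coeFn_toLp, (hG.memLp m hB).coeFn_toLp] with ξ h1 h2
    rw [h1, h2, RCLike.inner_apply, mul_comm]
  have key := bessel_of_orthogonal (f := (hf.memLp m hB).toLp f) (p := fun j => ((hp j).memLp m hB).toLp (p j))
    (I := I) (V := V) (integral_nonneg fun _ => by positivity) ?_ ?_ ?_
  · have hn : ENNReal.ofReal (‖(hf.memLp m hB).toLp f‖ ^ 2) = ∫⁻ ξ, ‖f ξ‖ₑ ^ 2 ∂(Measure.pi fun _ => m) := by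
      have h1 := hinner f f hf hf
      rw [inner_self_eq_norm_sq_to_K] at h1
      have h2 : (‖(hf.memLp m hB).toLp f‖ ^ 2 : ℝ) = ∫ ξ, ‖f ξ‖ ^ 2 ∂(Measure.pi fun _ => m) := by
        have : ((‖(hf.memLp m hB).toLp f‖ ^ 2 : ℝ) : ℂ) = ((∫ ξ, ‖f ξ‖ ^ 2 ∂(Measure.pi fun _ => m) : ℝ) : ℂ) := by
          rw [← integral_complex_ofReal]
          simp only [hcc] at h1
          rw [← h1]
          push_cast; rfl
        exact_mod_cast this
      rw [h2, ofReal_integral_eq_lintegral_ofReal ((memLp_two_iff_integrable_sq_norm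
          hf.meas.aestronglyMeasurable).1 (hf.memLp m hB))
        (Eventually.of_forall fun _ => by positivity)]
      exact lintegral_congr fun ω => (enorm_sq_eq_ofReal _).symm
    rw [Finset.sum_congr rfl fun j _ => hI j, ← ENNReal.ofReal_sum_of_nonneg fun j _ =>
      integral_nonneg fun _ => by positivity, hV, ← hn, ← ENNReal.ofReal_mul (integral_nonneg fun _ => by positivity)]
    exact ENNReal.ofReal_le_ofReal key
  · intro i j hij
    simp only [hinner _ _ (hp i) (hp j)]
    rw [integral_pi_update m x₀ i (((hp i).conj_mul (hp j)).integrable m hB)]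
    refine integral_eq_zero_of_ae (Eventually.of_forall fun ω => ?_)
    simp only [p, Function.update_self, hc, partialInner_update, Function.update_of_ne hij.symm, map_mul,
      Pi.zero_apply]
    have := partialInner_partialInner hB hv hvb hvs hf hanti hij ω
    rw [← mul_zero ((starRingEnd ℂ) (partialInner m v f i ω) * v (ω j)), ← this, ← integral_const_mul]
    refine integral_congr_ae (Eventually.of_forall fun η => ?_)
    simp only
    ring
  · intro j
    simp only [hinner _ _ (hp j) hf]
    rw [integral_pi_update m x₀ j (((hp j).conj_mul hf).integrable m hB)]
    simp only [I]
    rw [← integral_complex_ofReal]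
    refine integral_congr_ae (Eventually.of_forall fun ω => ?_)
    simp only [p, Function.update_self, hc, partialInner_update, map_mul]
    rw [← hcc]
    conv_rhs => rw [partialInner, ← integral_const_mul]
    refine integral_congr_ae (Eventually.of_forall fun η => ?_)
    simp only [partialInner]
    ring
  · intro j
    simp only [hinner _ _ (hp j) (hp j)]
    rw [integral_pi_update m x₀ j (((hp j).conj_mul (hp j)).integrable m hB)]
    simp only [I, V]
    rw [← integral_const_mul, ← integral_complex_ofReal]
    refine integral_congr_ae (Eventually.of_forall fun ω => ?_)
    simp only [p, Function.update_self, hc, partialInner_update, map_mul]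
    rw [Complex.ofReal_mul, ← hcc (partialInner m v f j ω), ← integral_complex_ofReal, ← integral_mul_const]
    refine integral_congr_ae (Eventually.of_forall fun η => ?_)
    simp only
    rw [← hcc]
    ring

end Slices

/-- Smooth compactly supported `N`-body functions. -/
structure IsTest (N : ℕ) (Ψ : (Fin N → E3) → (Fin N → Fin 2) → ℂ) : Prop where
  smooth : ∀ s, ContDiff ℝ (⊤ : ℕ∞) fun x => Ψ x s
  compactSupport : ∀ s, HasCompactSupport fun x => Ψ x s

theorem IsWaveFun.isTest {N : ℕ} {Ψ : (Fin N → E3) → (Fin N → Fin 2) → ℂ} (h : IsWaveFun N Ψ) :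
    IsTest N Ψ := ⟨h.smooth, h.compactSupport⟩

namespace IsTest

variable {N : ℕ} {Ψ : (Fin N → E3) → (Fin N → Fin 2) → ℂ}

theorem continuous (h : IsTest N Ψ) (s) : Continuous fun x => Ψ x s := (h.smooth s).continuous

theorem exists_radius (h : IsTest N Ψ) : ∃ R : ℝ, 0 < R ∧ ∀ x s, R < ‖x‖ → Ψ x s = 0 := by
  have : ∀ s, ∃ R : ℝ, ∀ x, R < ‖x‖ → Ψ x s = 0 := by
    intro s
    obtain ⟨R, hR⟩ := (h.compactSupport s).isCompact.isBounded.subset_closedBall 0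
    refine ⟨R, fun x hx => ?_⟩
    by_contra h0
    have := hR (subset_tsupport _ (Function.mem_support.2 h0))
    rw [mem_closedBall_zero_iff] at this
    linarith
  choose R hR using this
  refine ⟨1 + ∑ s, |R s|, by positivity, fun x s hx => hR s x ?_⟩
  have := Finset.single_le_sum (f := fun s => |R s|) (fun _ _ => abs_nonneg _) (Finset.mem_univ s)
  have h2 := le_abs_self (R s)
  linarith

theorem exists_bound (h : IsTest N Ψ) : ∃ C : ℝ, ∀ x s, ‖Ψ x s‖ ≤ C := by
  choose C hC using fun s => (h.compactSupport s).exists_bound_of_continuous (h.continuous s)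
  refine ⟨∑ s, |C s|, fun x s => (hC s x).trans ((le_abs_self _).trans ?_)⟩
  exact Finset.single_le_sum (f := fun s => |C s|) (fun _ _ => abs_nonneg _) (Finset.mem_univ s)

theorem contDiff_two (h : IsTest N Ψ) (s) : ContDiff ℝ 2 fun x => Ψ x s :=
  mod_cast contDiff_infty.1 (h.smooth s) 2

end IsTest

theorem measurable_flat {N : ℕ} {β : Type} [MeasurableSpace β]
    {F : (Fin N → E3) → (Fin N → Fin 2) → β} (hF : ∀ s, Measurable fun x => F x s) :
    Measurable fun ξ : Fin N → XS => F (fun i => (ξ i).1) (fun i => (ξ i).2) := by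
  have h1 : Measurable fun r : (Fin N → E3) × (Fin N → Fin 2) => F r.1 r.2 :=
    measurable_from_prod_countable_left hF
  exact h1.comp ((measurable_pi_iff.2 fun i => measurable_fst.comp (measurable_pi_apply i)).prodMk
    (measurable_pi_iff.2 fun i => measurable_snd.comp (measurable_pi_apply i)))

theorem integral_mXS {F : XS → ℂ} (hF : Integrable F mXS) : ∫ η, F η ∂mXS = ∫ x, ∑ s, F (x, s) := by
  rw [mXS] at hF ⊢
  rw [integral_prod _ hF]
  refine integral_congr_ae (Eventually.of_forall fun x => ?_)
  simp only
  rw [integral_fintype Integrable.of_finite]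
  simp [Measure.real]

theorem integral_integrable_sq_eq {N : ℕ} {Ψ : (Fin N → E3) → (Fin N → Fin 2) → ℂ} (h : IsTest N Ψ) (s) :
    ∫⁻ x, ‖Ψ x s‖ₑ ^ 2 = ENNReal.ofReal (∫ x, ‖Ψ x s‖ ^ 2) := by
  have hi : Integrable fun x => ‖Ψ x s‖ ^ 2 := by
    refine Continuous.integrable_of_hasCompactSupport ((h.continuous s).norm.pow 2) ?_
    exact (h.compactSupport s).comp_left (g := fun z : ℂ => ‖z‖ ^ 2) (by simp)
  rw [ofReal_integral_eq_lintegral_ofReal hi (Eventually.of_forall fun _ => by positivity)]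
  exact lintegral_congr fun ω => enorm_sq_eq_ofReal _

theorem IsWaveFun.lintegral_sq {N : ℕ} {Ψ : (Fin N → E3) → (Fin N → Fin 2) → ℂ} (h : IsWaveFun N Ψ) :
    ∑ s, ∫⁻ x, ‖Ψ x s‖ₑ ^ 2 = 1 := by
  rw [Finset.sum_congr rfl fun s _ => integral_integrable_sq_eq h.isTest s,
    ← ENNReal.ofReal_sum_of_nonneg fun s _ => integral_nonneg fun _ => by positivity, h.normalized,
    ENNReal.ofReal_one]

/-- The slices of a normalized wave function obey the exclusion principle. -/
theorem IsWaveFun.bFam {N : ℕ} {Ψ : (Fin N → E3) → (Fin N → Fin 2) → ℂ} (h : IsWaveFun N Ψ) :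
    BFam (sliceSum N) (oneFam Ψ) where
  smooth p s := (h.isTest.contDiff_two _).comp (contDiff_slicePos p)
  meas s := measurable_slice (G := fun _ => Ψ) (fun _ s => (h.isTest.continuous s).measurable) s
  meas_pdv k s := by
    have : (fun q : Slice N × E3 => pdv k (fun y => oneFam Ψ q.1 y s) q.2) = fun q =>
        fderiv ℝ (fun y => Ψ y (sliceSpin q.1 s)) (slicePos q.1 q.2) (eVec N q.1.1 k) := by
      ext q
      exact pdv_slice (Φ := fun y => Ψ y (sliceSpin q.1 s)) q.1 q.2
        ((h.isTest.contDiff_two _).differentiable (by norm_num) _) k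
    rw [this]
    refine measurable_slice (G := fun j x s => fderiv ℝ (fun y => Ψ y s) x (eVec N j k)) (fun j s => ?_) s
    exact (((h.isTest.contDiff_two s).continuous_fderiv (by norm_num)).clm_apply
      continuous_const).measurable
  bessel v hv hb hs := by
    obtain ⟨Cv, hCv⟩ := hb
    obtain ⟨R, hR⟩ := hs
    obtain ⟨R', hR'0, hR'⟩ := h.isTest.exists_radius
    obtain ⟨C, hC⟩ := h.isTest.exists_bound
    set B : Set XS := Metric.closedBall 0 (max R R') ×ˢ univ
    have hB : mXS B ≠ ∞ := by
      rw [mXS, Measure.prod_prod]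
      refine ENNReal.mul_ne_top measure_closedBall_lt_top.ne ?_
      exact (Measure.count_apply_lt_top.2 finite_univ).ne
    set f : (Fin N → XS) → ℂ := fun ξ => Ψ (fun i => (ξ i).1) (fun i => (ξ i).2)
    have hf : IsNice B f := by
      refine ⟨measurable_flat fun s => (h.isTest.continuous s).measurable, ⟨C, fun ξ => hC _ _⟩,
        fun ξ i hi => hR' _ _ ?_⟩
      have : max R R' < ‖(ξ i).1‖ := by
        by_contra h0
        exact hi ⟨mem_closedBall_zero_iff.2 (not_lt.1 h0), mem_univ _⟩
      exact ((le_max_right _ _).trans_lt this).trans_le (norm_le_pi_norm (fun i => (ξ i).1) i)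
    have hanti : ∀ i j, i ≠ j → ∀ ξ, f (ξ ∘ Equiv.swap i j) = -f ξ := by
      intro i j hij ξ
      have := h.antisymm (Equiv.swap i j) (fun i => (ξ i).1) (fun i => (ξ i).2)
      rw [Equiv.Perm.sign_swap hij] at this
      rw [Units.val_neg, Units.val_one, Int.cast_neg, Int.cast_one, neg_one_mul] at this
      exact this
    set w : XS → ℂ := fun η => v η.1 η.2
    have hw : Measurable w := measurable_from_prod_countable_left hv
    have hws : ∀ x, x ∉ B → w x = 0 := by
      intro x hx
      have : x.1 ∉ Metric.closedBall (0 : E3) R := fun h0 =>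
        hx ⟨Metric.closedBall_subset_closedBall (le_max_left _ _) h0, mem_univ _⟩
      simp only [w, hR _ this, Pi.zero_apply]
    have hw1 : ∀ x, ‖w x‖ ≤ Cv := fun x => hCv _ _
    have key := antisymm_bessel (m := mXS) (0, 0) hB hw hw1 hws hf hanti
    rw [lintegral_mXS (hw.enorm.pow_const 2)] at key
    have hone : ∫⁻ ξ, ‖f ξ‖ₑ ^ 2 ∂(Measure.pi fun _ => mXS) = 1 := by
      rw [← h.lintegral_sq]
      exact lintegral_flat (F := fun x s => ‖Ψ x s‖ₑ ^ 2)
        fun s => (h.isTest.continuous s).measurable.enorm.pow_const 2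
    rw [hone, mul_one] at key
    have hpi : ∀ p : Slice N, ∫ x, ∑ s, (starRingEnd ℂ) (v x s) * oneFam Ψ p x s =
        partialInner mXS w f p.1 p.2 := by
      intro p
      rw [partialInner, integral_mXS]
      · refine integral_congr_ae (Eventually.of_forall fun x => ?_)
        refine Finset.sum_congr rfl fun s _ => ?_
        simp only [w, f, oneFam, slicePos, sliceSpin]
        congr 2 <;>
        · ext i
          by_cases hi : i = p.1
          · subst hi; simp
          · simp [hi]
      · refine integrable_of_bdd_supp (S := B) (C := Cv * C)
          ((Complex.continuous_conj.measurable.comp hw).mul (hf.meas.comp (measurable_update _))) ?_ hB ?_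
        · intro x
          rw [norm_mul, RCLike.norm_conj]
          exact mul_le_mul (hw1 x) (hC _ _) (norm_nonneg _) ((norm_nonneg _).trans (hw1 x))
        · intro x hx
          simp [hws x hx]
    simp_rw [hpi]
    rw [lintegral_sliceSum]
    · exact key
    · refine Measurable.pow_const (Measurable.enorm ?_) 2
      exact measurable_from_prod_countable_right fun j => measurable_partialInner hw hf j

theorem measurable_fix_snd {α β γ : Type} [MeasurableSpace α] [MeasurableSpace β] [MeasurableSpace γ]
    {f : α × β → γ} (hf : Measurable f) (y : β) : Measurable fun p => f (p, y) :=
  hf.comp (measurable_id.prodMk measurable_const)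

section Localize

variable {Ω : Type} [MeasurableSpace Ω] {I : Type} [Fintype I] [MeasurableSpace I]
  [DiscreteMeasurableSpace I]

theorem lintegral_count_prod {μ : Measure Ω} [SFinite μ] {F : I × Ω → ℝ≥0∞} (hF : Measurable F) :
    ∫⁻ p, F p ∂((Measure.count : Measure I).prod μ) = ∑ i, ∫⁻ ω, F (i, ω) ∂μ := by
  rw [lintegral_prod _ hF.aemeasurable, lintegral_count, tsum_fintype]

/-- Localizing a family by a partition of unity keeps the exclusion principle. -/
theorem BFam.localize {μ : Measure Ω} [SFinite μ] {ψ : Ω → E3 → Fin 2 → ℂ} (h : BFam μ ψ)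
    {a : I → E3 → ℂ} (ha : ∀ i, ContDiff ℝ 2 (a i)) (ha1 : ∀ x, ∑ i, ‖a i x‖ₑ ^ 2 ≤ 1) :
    BFam ((Measure.count : Measure I).prod μ) fun p x s => a p.1 x * ψ p.2 x s := by
  have hb : ∀ i x, ‖a i x‖ ≤ 1 := by
    intro i x
    have h1 : ‖a i x‖ₑ ^ 2 ≤ 1 :=
      (Finset.single_le_sum (f := fun i => ‖a i x‖ₑ ^ 2) (fun _ _ => zero_le) (Finset.mem_univ i)).trans (ha1 x)
    rw [enorm_sq_eq_ofReal, ENNReal.ofReal_le_one] at h1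
    nlinarith [norm_nonneg (a i x)]
  have hm : ∀ {F : I → Ω × E3 → ℂ}, (∀ i, Measurable (F i)) →
      Measurable fun q : (I × Ω) × E3 => F q.1.1 (q.1.2, q.2) := by
    intro F hF
    have : Measurable fun r : I × (Ω × E3) => F r.1 r.2 := measurable_from_prod_countable_right hF
    exact this.comp ((measurable_fst.comp measurable_fst).prodMk
      ((measurable_snd.comp measurable_fst).prodMk measurable_snd))
  refine ⟨fun p s => ((h.mul (ha p.1) (hb p.1)).smooth p.2 s), fun s => ?_, fun k s => ?_, ?_⟩
  · exact hm (F := fun i r => a i r.2 * ψ r.1 r.2 s) fun i => (h.mul (ha i) (hb i)).meas s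
  · exact hm (F := fun i r => pdv k (fun y => a i y * ψ r.1 y s) r.2) fun i =>
      (h.mul (ha i) (hb i)).meas_pdv k s
  · intro v hv hvb hvs
    obtain ⟨C, hC⟩ := hvb
    obtain ⟨R, hR⟩ := hvs
    have hmeas : Measurable fun p : I × Ω => ‖∫ x, ∑ s, (starRingEnd ℂ) (v x s) * (a p.1 x * ψ p.2 x s)‖ₑ ^ 2 := by
      refine Measurable.pow_const (Measurable.enorm ?_) 2
      refine measurable_from_prod_countable_right fun i => ?_
      have : StronglyMeasurable fun q : Ω × E3 => ∑ s, (starRingEnd ℂ) (v q.2 s) * (a i q.2 * ψ q.1 q.2 s) := by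
        refine (Finset.measurable_fun_sum _ fun s _ => ?_).stronglyMeasurable
        exact (Complex.continuous_conj.measurable.comp ((hv s).comp measurable_snd)).mul
          ((h.mul (ha i) (hb i)).meas s)
      exact this.integral_prod_right'.measurable
    rw [lintegral_count_prod hmeas]
    calc ∑ i, ∫⁻ ω, ‖∫ x, ∑ s, (starRingEnd ℂ) (v x s) * (a i x * ψ ω x s)‖ₑ ^ 2 ∂μ
        ≤ ∑ i, ∫⁻ x, ‖a i x‖ₑ ^ 2 * sq2 (v x) := by
          refine Finset.sum_le_sum fun i _ => ?_
          have h1 := h.bessel (fun x s => (starRingEnd ℂ) (a i x) * v x s)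
            (fun s => (Complex.continuous_conj.comp (ha i).continuous).measurable.mul (hv s))
            ⟨C, fun x s => by
              rw [norm_mul, RCLike.norm_conj]
              exact (mul_le_of_le_one_left (norm_nonneg _) (hb i x)).trans (hC x s)⟩
            ⟨R, fun x hx => by ext s; simp [hR x hx]⟩
          refine le_trans (le_of_eq ?_) (h1.trans (le_of_eq ?_))
          · refine lintegral_congr fun ω => ?_
            congr 3
            ext x
            refine Finset.sum_congr rfl fun s _ => ?_
            simp only [map_mul, Complex.conj_conj]
            ring
          · refine lintegral_congr fun x => ?_
            rw [sq2_mul]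
            congr 2
            rw [← ofReal_norm, RCLike.norm_conj, ofReal_norm]
      _ = ∫⁻ x, (∑ i, ‖a i x‖ₑ ^ 2) * sq2 (v x) := by
          simp_rw [Finset.sum_mul]
          rw [lintegral_finsetSum]
          intro i _
          exact ((ha i).continuous.measurable.enorm.pow_const 2).mul
            (Finset.measurable_fun_sum _ fun s _ => (hv s).enorm.pow_const 2)
      _ ≤ _ := lintegral_mono fun x => mul_le_of_le_one_left' (ha1 x)

theorem BFam.dens_localize {μ : Measure Ω} [SFinite μ] {ψ : Ω → E3 → Fin 2 → ℂ} (h : BFam μ ψ)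
    {a : I → E3 → ℂ} (ha : ∀ i, ContDiff ℝ 2 (a i)) (ha1 : ∀ x, ∑ i, ‖a i x‖ₑ ^ 2 ≤ 1) (x : E3) :
    dens ((Measure.count : Measure I).prod μ) (fun p x s => a p.1 x * ψ p.2 x s) x =
      (∑ i, ‖a i x‖ₑ ^ 2) * dens μ ψ x := by
  have hm : Measurable fun p : I × Ω => sq2 fun s => a p.1 x * ψ p.2 x s :=
    by
    have h0 := (h.localize ha ha1).measurable_sq2
    simpa only using measurable_fix_snd h0 x
  unfold dens
  rw [lintegral_count_prod hm, Finset.sum_mul]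
  refine Finset.sum_congr rfl fun i _ => ?_
  simp only [sq2_mul]
  rw [lintegral_const_mul' _ _ (by simp)]

theorem BFam.kinD_localize {μ : Measure Ω} [SFinite μ] {ψ : Ω → E3 → Fin 2 → ℂ} (h : BFam μ ψ)
    {a : I → E3 → ℂ} (ha : ∀ i, ContDiff ℝ 2 (a i)) (ha1 : ∀ x, ∑ i, ‖a i x‖ₑ ^ 2 ≤ 1)
    {A : E3 → Fin 3 → ℝ} (hA : Continuous A) (x : E3) :
    kinD ((Measure.count : Measure I).prod μ) A (fun p x s => a p.1 x * ψ p.2 x s) x =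
      ∑ i, kinD μ A (fun ω x s => a i x * ψ ω x s) x := by
  have hm : Measurable fun p : I × Ω => sq2 (dirac A (fun x s => a p.1 x * ψ p.2 x s) x) :=
    by
    have h0 := (h.localize ha ha1).measurable_dirac hA
    simpa only using measurable_fix_snd h0 x
  unfold kinD
  rw [lintegral_count_prod hm]

end Localize

theorem enorm3_eq (x : E3) : enorm3 x = ‖WithLp.toLp 2 x‖ := by
  rw [EuclideanSpace.norm_eq]
  simp [enorm3]

theorem enorm3_nonneg (x : E3) : 0 ≤ enorm3 x := Real.sqrt_nonneg _

theorem norm_le_enorm3 (x : E3) : ‖x‖ ≤ enorm3 x := by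
  refine (pi_norm_le_iff_of_nonneg (enorm3_nonneg x)).2 fun i => ?_
  refine Real.le_sqrt_of_sq_le ?_
  rw [Real.norm_eq_abs, sq_abs]
  exact Finset.single_le_sum (f := fun i => x i ^ 2) (fun _ _ => sq_nonneg _) (Finset.mem_univ i)

theorem enorm3_le (x : E3) : enorm3 x ≤ 2 * ‖x‖ := by
  refine Real.sqrt_le_iff.2 ⟨by positivity, ?_⟩
  have : ∀ i, x i ^ 2 ≤ ‖x‖ ^ 2 := fun i => by
    rw [← sq_abs, ← Real.norm_eq_abs]
    exact pow_le_pow_left₀ (norm_nonneg _) (norm_le_pi_norm x i) 2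
  rw [Fin.sum_univ_three]
  nlinarith [this 0, this 1, this 2, sq_nonneg ‖x‖]

theorem enorm3_sub_le (x y : E3) : enorm3 (x - y) ≤ enorm3 x + enorm3 y := by
  simp only [enorm3_eq, WithLp.toLp_sub]
  exact norm_sub_le _ _

theorem enorm3_add_le (x y : E3) : enorm3 (x + y) ≤ enorm3 x + enorm3 y := by
  simp only [enorm3_eq, WithLp.toLp_add]
  exact norm_add_le _ _

theorem enorm3_pos {x : E3} (hx : x ≠ 0) : 0 < enorm3 x := (norm_pos_iff.2 hx).trans_le (norm_le_enorm3 x)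

theorem enorm3_sub_comm (x y : E3) : enorm3 (x - y) = enorm3 (y - x) := by
  simp only [enorm3_eq, WithLp.toLp_sub]
  exact norm_sub_rev _ _

theorem continuous_enorm3 : Continuous enorm3 := by
  unfold enorm3
  fun_prop

theorem enorm3_inv_le (x : E3) : (enorm3 x)⁻¹ ≤ ‖x‖⁻¹ := by
  rcases eq_or_ne x 0 with rfl | hx
  · simp [enorm3]
  · exact inv_anti₀ (norm_pos_iff.2 hx) (norm_le_enorm3 x)

theorem inv_norm_le_enorm3 (x : E3) : ‖x‖⁻¹ ≤ 2 * (enorm3 x)⁻¹ := by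
  rcases eq_or_ne x 0 with rfl | hx
  · simp [enorm3]
  · have h1 := enorm3_pos hx
    have h2 := norm_pos_iff.2 hx
    rw [← div_eq_mul_inv, inv_le_comm₀ h2 (by positivity), inv_div, div_le_iff₀ (by norm_num)]
    linarith [enorm3_le x]

/-- The Coulomb kernel. -/
def coul (x : E3) : ℝ≥0∞ := ENNReal.ofReal (enorm3 x)⁻¹

theorem measurable_coul : Measurable coul :=
  (continuous_enorm3.measurable.inv).ennreal_ofReal

theorem coul_le (x : E3) : coul x ≤ ENNReal.ofReal ‖x‖⁻¹ := ENNReal.ofReal_le_ofReal (enorm3_inv_le x)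

theorem inv_norm_le_coul (x : E3) : ENNReal.ofReal ‖x‖⁻¹ ≤ 2 * coul x := by
  rw [coul, ← ENNReal.ofReal_ofNat 2, ← ENNReal.ofReal_mul (by norm_num)]
  exact ENNReal.ofReal_le_ofReal (inv_norm_le_enorm3 x)

theorem coul_sub_comm (x y : E3) : coul (x - y) = coul (y - x) := by
  unfold coul; rw [enorm3_sub_comm]

theorem coul_closedBall_le : ∃ D : ℝ, 0 < D ∧ ∀ a : E3,
    ∀ S : Set E3, ∫⁻ x in S, coul (x - a) ≤ volume S + ENNReal.ofReal D := by
  obtain ⟨D, hD, h⟩ := lintegral_norm_rpow (p := 1) (by norm_num)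
  refine ⟨D, hD, fun a S => ?_⟩
  have hb := h 1 one_pos
  rw [Real.one_rpow, mul_one] at hb
  have hpt : ∀ x : E3, coul (x - a) ≤
      1 + (Metric.closedBall (0 : E3) 1).indicator (fun y => ENNReal.ofReal (‖y‖ ^ (-1 : ℝ))) (x - a) := by
    intro x
    refine (coul_le _).trans ?_
    by_cases hx : x - a ∈ Metric.closedBall (0 : E3) 1
    · rw [indicator_of_mem hx, Real.rpow_neg_one]
      exact le_add_self
    · rw [indicator_of_notMem hx, add_zero, ENNReal.ofReal_le_one]
      rw [mem_closedBall_zero_iff, not_le] at hx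
      exact inv_le_one_of_one_le₀ hx.le
  calc ∫⁻ x in S, coul (x - a) ≤ ∫⁻ x in S, (1 + (Metric.closedBall (0 : E3) 1).indicator
        (fun y => ENNReal.ofReal (‖y‖ ^ (-1 : ℝ))) (x - a)) := lintegral_mono hpt
    _ = volume S + ∫⁻ x in S, (Metric.closedBall (0 : E3) 1).indicator
        (fun y => ENNReal.ofReal (‖y‖ ^ (-1 : ℝ))) (x - a) := by
        rw [lintegral_add_left measurable_const, setLIntegral_one]
    _ ≤ volume S + ∫⁻ x, (Metric.closedBall (0 : E3) 1).indicator
        (fun y => ENNReal.ofReal (‖y‖ ^ (-1 : ℝ))) (x - a) := by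
        gcongr
        exact Measure.restrict_le_self
    _ ≤ _ := by
        gcongr
        rw [lintegral_sub_right_eq_self (fun y => (Metric.closedBall (0 : E3) 1).indicator
          (fun y => ENNReal.ofReal (‖y‖ ^ (-1 : ℝ))) y) a,
          lintegral_indicator Metric.isClosed_closedBall.measurableSet]
        exact hb

section

variable {N : ℕ} {Ψ : (Fin N → E3) → (Fin N → Fin 2) → ℂ}

/-- The position distribution of an `N`-body function. -/
def wfMeas (Ψ : (Fin N → E3) → (Fin N → Fin 2) → ℂ) : Measure (Fin N → E3) :=
  volume.withDensity fun x => ∑ s, ‖Ψ x s‖ₑ ^ 2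

theorem IsTest.measurable_dens (h : IsTest N Ψ) : Measurable fun x => ∑ s, ‖Ψ x s‖ₑ ^ 2 :=
  Finset.measurable_fun_sum _ fun s _ => (h.continuous s).measurable.enorm.pow_const 2

theorem IsTest.lintegral_wfMeas (h : IsTest N Ψ) {G : (Fin N → E3) → ℝ≥0∞} (hG : Measurable G) :
    ∫⁻ x, G x ∂(wfMeas Ψ) = ∑ s, ∫⁻ x, G x * ‖Ψ x s‖ₑ ^ 2 := by
  rw [wfMeas, lintegral_withDensity_eq_lintegral_mul _ h.measurable_dens hG]
  refine Eq.trans ?_ (lintegral_finsetSum (f := fun s x => G x * ‖Ψ x s‖ₑ ^ 2) _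
    fun s _ => hG.mul ((h.continuous s).measurable.enorm.pow_const 2))
  refine lintegral_congr fun x => ?_
  simp only [Pi.mul_apply, Finset.sum_mul]
  exact Finset.sum_congr rfl fun s _ => mul_comm _ _

theorem IsTest.sum_lintegral_wfMeas (h : IsTest N Ψ) {g : E3 → ℝ≥0∞} (hg : Measurable g) :
    ∑ j, ∫⁻ x, g (x j) ∂(wfMeas Ψ) = ∫⁻ x, g x * dens (sliceSum N) (oneFam Ψ) x := by
  rw [lintegral_mul_dens_oneFam h.continuous hg]
  exact Finset.sum_congr rfl fun j _ => h.lintegral_wfMeas (hg.comp (measurable_pi_apply j))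

theorem IsWaveFun.wfMeas_univ (h : IsWaveFun N Ψ) : wfMeas Ψ univ = 1 := by
  rw [← lintegral_one, h.isTest.lintegral_wfMeas measurable_const]
  simpa using h.lintegral_sq

theorem IsTest.wfMeas_le (h : IsTest N Ψ) : ∃ C R : ℝ, 0 < C ∧ 0 < R ∧
    ∀ G : (Fin N → E3) → ℝ≥0∞, Measurable G → ∫⁻ x, G x ∂(wfMeas Ψ) ≤ ENNReal.ofReal C *
      ∫⁻ x, G x ∂(Measure.pi fun _ : Fin N => (volume : Measure E3).restrict (Metric.closedBall 0 R)) := by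
  obtain ⟨R, hR0, hR⟩ := h.exists_radius
  obtain ⟨C, hC⟩ := h.exists_bound
  set D : ℝ := ∑ _s : Fin N → Fin 2, C ^ 2 + 1
  refine ⟨D, R, by positivity, hR0, fun G hG => ?_⟩
  have e : (Measure.pi fun _ : Fin N => (volume : Measure E3).restrict (Metric.closedBall 0 R)) =
      (volume : Measure (Fin N → E3)).restrict (univ.pi fun _ => Metric.closedBall 0 R) :=
    (Measure.restrict_pi_pi _ _).symm
  have hS : MeasurableSet (univ.pi fun _ : Fin N => Metric.closedBall (0 : E3) R) :=
    MeasurableSet.univ_pi fun _ => Metric.isClosed_closedBall.measurableSet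
  rw [e, ← lintegral_const_mul _ hG, ← lintegral_indicator hS, wfMeas,
    lintegral_withDensity_eq_lintegral_mul _ h.measurable_dens hG]
  refine lintegral_mono fun x => ?_
  simp only [Pi.mul_apply]
  by_cases hx : x ∈ univ.pi fun _ : Fin N => Metric.closedBall (0 : E3) R
  · rw [indicator_of_mem hx]
    gcongr
    calc ∑ s, ‖Ψ x s‖ₑ ^ 2 ≤ ∑ _s : Fin N → Fin 2, ENNReal.ofReal (C ^ 2) := by
          refine Finset.sum_le_sum fun s _ => ?_
          rw [enorm_sq_eq_ofReal]
          exact ENNReal.ofReal_le_ofReal (pow_le_pow_left₀ (norm_nonneg _) (hC x s) 2)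
      _ = ENNReal.ofReal (∑ _s : Fin N → Fin 2, C ^ 2) :=
          (ENNReal.ofReal_sum_of_nonneg fun _ _ => by positivity).symm
      _ ≤ _ := ENNReal.ofReal_le_ofReal (by simp [D])
  · simp only [mem_univ_pi, not_forall, mem_closedBall_zero_iff, not_le] at hx
    obtain ⟨i, hi⟩ := hx
    have : ∀ s, Ψ x s = 0 := fun s => hR x s (hi.trans_le (norm_le_pi_norm x i))
    simp [this]

theorem measurable_coul_sub (i j : Fin N) : Measurable fun x : Fin N → E3 => coul (x i - x j) :=
  measurable_coul.comp ((measurable_pi_apply i).sub (measurable_pi_apply j))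

theorem lintegral_pair_ne_top {i j : Fin N} (hij : i ≠ j) (R : ℝ) :
    ∫⁻ x, coul (x i - x j) ∂(Measure.pi fun _ : Fin N =>
      (volume : Measure E3).restrict (Metric.closedBall 0 R)) ≠ ∞ := by
  obtain ⟨D, hD, h⟩ := coul_closedBall_le
  rw [lintegral_pi_update (F := fun x : Fin N → E3 => coul (x i - x j)) _ 0 i (measurable_coul_sub i j)]
  simp only [Function.update_self, Function.update_of_ne hij.symm]
  refine ne_top_of_le_ne_top ?_ (lintegral_mono fun ω => h (ω j) (Metric.closedBall 0 R))
  rw [lintegral_const]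
  refine ENNReal.mul_ne_top (ENNReal.add_ne_top.2 ⟨measure_closedBall_lt_top.ne, ENNReal.ofReal_ne_top⟩) ?_
  rw [sliceMeas, Measure.pi_univ]
  refine ENNReal.prod_ne_top fun l _ => ?_
  split_ifs
  · simp
  · rw [Measure.restrict_apply_univ]
    exact measure_closedBall_lt_top.ne

theorem lintegral_single_ne_top (j : Fin N) (R : ℝ) :
    ∫⁻ x, coul (x j) ∂(Measure.pi fun _ : Fin N =>
      (volume : Measure E3).restrict (Metric.closedBall 0 R)) ≠ ∞ := by
  obtain ⟨D, hD, h⟩ := coul_closedBall_le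
  rw [lintegral_pi_update (F := fun x : Fin N → E3 => coul (x j)) _ 0 j
    (measurable_coul.comp (measurable_pi_apply j))]
  simp only [Function.update_self]
  have h0 := h 0 (Metric.closedBall 0 R)
  simp only [sub_zero] at h0
  refine ne_top_of_le_ne_top ?_ (lintegral_mono fun ω => h0)
  rw [lintegral_const]
  refine ENNReal.mul_ne_top (ENNReal.add_ne_top.2 ⟨measure_closedBall_lt_top.ne, ENNReal.ofReal_ne_top⟩) ?_
  rw [sliceMeas, Measure.pi_univ]
  refine ENNReal.prod_ne_top fun l _ => ?_
  split_ifs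
  · simp
  · rw [Measure.restrict_apply_univ]
    exact measure_closedBall_lt_top.ne

theorem IsTest.lintegral_coul_ne_top (h : IsTest N Ψ) (j : Fin N) :
    ∫⁻ x, coul (x j) ∂(wfMeas Ψ) ≠ ∞ := by
  obtain ⟨C, R, hC, hR, hle⟩ := h.wfMeas_le
  exact ne_top_of_le_ne_top (ENNReal.mul_ne_top ENNReal.ofReal_ne_top (lintegral_single_ne_top j R))
    (hle _ (measurable_coul.comp (measurable_pi_apply j)))

theorem IsTest.lintegral_coul_sub_ne_top (h : IsTest N Ψ) {i j : Fin N} (hij : i ≠ j) :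
    ∫⁻ x, coul (x i - x j) ∂(wfMeas Ψ) ≠ ∞ := by
  obtain ⟨C, R, hC, hR, hle⟩ := h.wfMeas_le
  exact ne_top_of_le_ne_top (ENNReal.mul_ne_top ENNReal.ofReal_ne_top (lintegral_pair_ne_top hij R))
    (hle _ (measurable_coul_sub i j))

theorem ae_wfMeas_ne : ∀ᵐ x ∂(wfMeas Ψ), ∀ i j, i ≠ j → x i ≠ x j := by
  refine (withDensity_absolutelyContinuous _ _).ae_le ?_
  show ∀ᵐ x ∂(volume : Measure (Fin N → E3)), ∀ i j, i ≠ j → x i ≠ x j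
  refine ae_all_iff.2 fun i => ae_all_iff.2 fun j => ae_all_iff.2 fun hij => ?_
  have hS : MeasurableSet {x : Fin N → E3 | x i = x j} :=
    measurableSet_eq_fun (measurable_pi_apply i) (measurable_pi_apply j)
  rw [ae_iff]
  simp only [not_not]
  have := lintegral_pi_update (F := {x : Fin N → E3 | x i = x j}.indicator fun _ => (1 : ℝ≥0∞))
    (volume : Measure E3) 0 i (measurable_const.indicator hS)
  rw [lintegral_indicator hS, setLIntegral_one] at this
  refine Eq.trans this ?_
  refine (lintegral_congr fun ω => ?_).trans lintegral_zero
  have e : ∀ η : E3, {x : Fin N → E3 | x i = x j}.indicator (fun _ => (1 : ℝ≥0∞)) (Function.update ω i η) =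
      ({ω j} : Set E3).indicator (fun _ => 1) η := by
    intro η
    simp only [indicator, mem_ofPred_eq, Function.update_self, Function.update_of_ne hij.symm, mem_singleton_iff]
  simp_rw [e]
  rw [lintegral_indicator (measurableSet_singleton _)]
  simp

theorem IsTest.ofReal_potInt (h : IsTest N Ψ) {W : (Fin N → E3) → ℝ} (hW : Measurable W) (hW0 : ∀ x, 0 ≤ W x)
    (hfin : ∫⁻ x, ENNReal.ofReal (W x) ∂(wfMeas Ψ) ≠ ∞) :
    ENNReal.ofReal (potInt N W Ψ) = ∫⁻ x, ENNReal.ofReal (W x) ∂(wfMeas Ψ) := by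
  rw [h.lintegral_wfMeas hW.ennreal_ofReal] at hfin ⊢
  rw [potInt, ENNReal.ofReal_sum_of_nonneg fun s _ => integral_nonneg fun x => mul_nonneg (hW0 x) (by positivity)]
  refine Finset.sum_congr rfl fun s hs => ?_
  have h1 : ∀ x, ENNReal.ofReal (W x * ‖Ψ x s‖ ^ 2) = ENNReal.ofReal (W x) * ‖Ψ x s‖ₑ ^ 2 := fun x => by
    rw [ENNReal.ofReal_mul (hW0 x), enorm_sq_eq_ofReal]
  rw [integral_eq_lintegral_of_nonneg_ae (Eventually.of_forall fun x => mul_nonneg (hW0 x) (by positivity))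
    (hW.mul ((h.continuous s).measurable.norm.pow_const 2)).aestronglyMeasurable]
  simp_rw [h1]
  exact ENNReal.ofReal_toReal (ENNReal.sum_ne_top.1 hfin s hs)

/-- Total kinetic energy. -/
def kinT (A : E3 → Fin 3 → ℝ) (Ψ : (Fin N → E3) → (Fin N → Fin 2) → ℂ) : ℝ≥0∞ :=
  ∫⁻ x, kinD (sliceSum N) A (oneFam Ψ) x

/-- Total expectation of the inverse distance to the nucleus. -/
def attT (Ψ : (Fin N → E3) → (Fin N → Fin 2) → ℂ) : ℝ≥0∞ := ∑ j, ∫⁻ x, coul (x j) ∂(wfMeas Ψ)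

/-- The pair Coulomb kernel. -/
def pairCoul (x : Fin N → E3) : ℝ≥0∞ := ∑ i, ∑ j, if i < j then coul (x i - x j) else 0

/-- Total electron repulsion. -/
def repT (Ψ : (Fin N → E3) → (Fin N → Fin 2) → ℂ) : ℝ≥0∞ := ∫⁻ x, pairCoul x ∂(wfMeas Ψ)

theorem measurable_pairCoul : Measurable (pairCoul (N := N)) := by
  unfold pairCoul
  refine Finset.measurable_fun_sum _ fun i _ => Finset.measurable_fun_sum _ fun j _ => ?_
  split_ifs
  · exact measurable_coul_sub i j
  · exact measurable_const

theorem repT_eq : repT Ψ = ∑ i, ∑ j, if i < j then ∫⁻ x, coul (x i - x j) ∂(wfMeas Ψ) else 0 := by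
  unfold repT pairCoul
  rw [lintegral_finsetSum]
  · refine Finset.sum_congr rfl fun i _ => ?_
    rw [lintegral_finsetSum]
    · refine Finset.sum_congr rfl fun j _ => ?_
      split_ifs <;> simp
    · intro j _
      split_ifs
      · exact measurable_coul_sub i j
      · exact measurable_const
  · refine fun i _ => Finset.measurable_fun_sum _ fun j _ => ?_
    split_ifs
    · exact measurable_coul_sub i j
    · exact measurable_const

theorem IsTest.attT_ne_top (h : IsTest N Ψ) : attT Ψ ≠ ∞ :=
  ENNReal.sum_ne_top.2 fun j _ => h.lintegral_coul_ne_top j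

theorem IsTest.repT_ne_top (h : IsTest N Ψ) : repT Ψ ≠ ∞ := by
  rw [repT_eq]
  refine ENNReal.sum_ne_top.2 fun i _ => ENNReal.sum_ne_top.2 fun j _ => ?_
  split_ifs with hij
  · exact h.lintegral_coul_sub_ne_top hij.ne
  · simp

theorem diracN_continuous (h : IsTest N Ψ) {A : E3 → Fin 3 → ℝ} (hA : Continuous A) (j : Fin N)
    (s : Fin N → Fin 2) : Continuous fun x => diracN A j Ψ x s := by
  unfold diracN
  refine continuous_finsetSum _ fun k _ => continuous_finsetSum _ fun t _ => ?_
  refine continuous_const.mul ((continuous_const.mul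
    (((h.contDiff_two _).continuous_fderiv (by norm_num)).clm_apply continuous_const)).add
    (Continuous.mul ?_ (h.continuous _)))
  exact Complex.continuous_ofReal.comp ((continuous_apply k).comp (hA.comp (continuous_apply j)))

theorem hasCompactSupport_of_radius {ι F : Type} [Fintype ι] [Zero F] {u : (ι → E3) → F} {R : ℝ}
    (h : ∀ x, R < ‖x‖ → u x = 0) : HasCompactSupport u := by
  refine HasCompactSupport.of_support_subset_isCompact (isCompact_closedBall 0 R) fun x hx => ?_
  rw [mem_closedBall_zero_iff]
  by_contra h0
  exact hx (h x (not_le.1 h0))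

theorem diracN_eq_zero {R : ℝ} (hR : ∀ x s, R < ‖x‖ → Ψ x s = 0) (A : E3 → Fin 3 → ℝ) (j : Fin N)
    (s : Fin N → Fin 2) (x : Fin N → E3) (hx : R < ‖x‖) : diracN A j Ψ x s = 0 := by
  unfold diracN
  refine Finset.sum_eq_zero fun k _ => Finset.sum_eq_zero fun t _ => ?_
  have h1 : (fun y => Ψ y (Function.update s j t)) =ᶠ[𝓝 x] fun _ => 0 := by
    filter_upwards [(isOpen_lt continuous_const continuous_norm).mem_nhds hx] with y hy
    exact hR y _ hy
  rw [h1.fderiv_eq, hR x _ hx]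
  simp

theorem IsTest.ofReal_pauliKin (h : IsTest N Ψ) {A : E3 → Fin 3 → ℝ} (hA : Continuous A) (j : Fin N) :
    ENNReal.ofReal (pauliKin N A j Ψ) = ∑ s, ∫⁻ x, ‖diracN A j Ψ x s‖ₑ ^ 2 := by
  obtain ⟨R, hR0, hR⟩ := h.exists_radius
  rw [pauliKin, ENNReal.ofReal_sum_of_nonneg fun s _ => integral_nonneg fun x => by positivity]
  refine Finset.sum_congr rfl fun s _ => ?_
  have hi : Integrable fun x => ‖diracN A j Ψ x s‖ ^ 2 := by
    refine Continuous.integrable_of_hasCompactSupport ((diracN_continuous h hA j s).norm.pow 2) ?_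
    exact hasCompactSupport_of_radius fun x hx => by rw [diracN_eq_zero hR A j s x hx]; simp
  rw [show (∫ x : Fin N → E3, ‖∑ k : Fin 3, ∑ t : Fin 2, pauli k (s j) t *
      (-Complex.I * fderiv ℝ (fun y => Ψ y (Function.update s j t)) x (eVec N j k)
        + (A (x j) k : ℂ) * Ψ x (Function.update s j t))‖ ^ 2) = ∫ x, ‖diracN A j Ψ x s‖ ^ 2 from rfl,
    ofReal_integral_eq_lintegral_ofReal hi (Eventually.of_forall fun _ => by positivity)]
  exact lintegral_congr fun ω => (enorm_sq_eq_ofReal _).symm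

theorem pauliKin_nonneg (A : E3 → Fin 3 → ℝ) (j : Fin N) : 0 ≤ pauliKin N A j Ψ :=
  Finset.sum_nonneg fun s _ => integral_nonneg fun x => by positivity

theorem potInt_nonneg {W : (Fin N → E3) → ℝ} (hW0 : ∀ x, 0 ≤ W x) : 0 ≤ potInt N W Ψ :=
  Finset.sum_nonneg fun s _ => integral_nonneg fun x => mul_nonneg (hW0 x) (by positivity)

theorem IsTest.kinT_eq (h : IsTest N Ψ) {A : E3 → Fin 3 → ℝ} (hA : Continuous A) :
    kinT A Ψ = ENNReal.ofReal (∑ j, pauliKin N A j Ψ) := by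
  rw [ENNReal.ofReal_sum_of_nonneg fun j _ => pauliKin_nonneg A j]
  rw [Finset.sum_congr rfl fun j _ => h.ofReal_pauliKin hA j]
  have := lintegral_kinD_oneFam (fun s => (h.contDiff_two s).of_le (by norm_num)) hA
    (a := fun _ => 1) contDiff_const
  simp only [one_mul] at this
  exact this

theorem IsTest.attT_eq (h : IsTest N Ψ) :
    attT Ψ = ENNReal.ofReal (∑ j, potInt N (fun x => (enorm3 (x j))⁻¹) Ψ) := by
  rw [ENNReal.ofReal_sum_of_nonneg fun j _ => potInt_nonneg fun x => inv_nonneg.2 (enorm3_nonneg _), attT]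
  refine Finset.sum_congr rfl fun j _ => (h.ofReal_potInt ?_ (fun x => inv_nonneg.2 (enorm3_nonneg _))
    (h.lintegral_coul_ne_top j)).symm
  exact (continuous_enorm3.measurable.comp (measurable_pi_apply j)).inv

theorem IsTest.repT_eq_ofReal (h : IsTest N Ψ) :
    repT Ψ = ENNReal.ofReal (∑ i : Fin N, ∑ j : Fin N,
        if i < j then potInt N (fun x => (enorm3 (x i - x j))⁻¹) Ψ else 0) := by
  have h0 : ∀ i j : Fin N, 0 ≤ if i < j then potInt N (fun x => (enorm3 (x i - x j))⁻¹) Ψ else 0 := by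
    intro i j
    split_ifs
    · exact potInt_nonneg fun x => inv_nonneg.2 (enorm3_nonneg _)
    · exact le_rfl
  rw [repT_eq, ENNReal.ofReal_sum_of_nonneg fun i _ => Finset.sum_nonneg fun j _ => h0 i j]
  refine Finset.sum_congr rfl fun i _ => ?_
  rw [ENNReal.ofReal_sum_of_nonneg fun j _ => h0 i j]
  refine Finset.sum_congr rfl fun j _ => ?_
  split_ifs with hij
  · refine (h.ofReal_potInt ?_ (fun x => inv_nonneg.2 (enorm3_nonneg _))
      (h.lintegral_coul_sub_ne_top hij.ne)).symm
    exact (continuous_enorm3.measurable.comp ((measurable_pi_apply i).sub (measurable_pi_apply j))).inv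
  · simp

/-- The energy in terms of the total kinetic, attraction and repulsion terms. -/
theorem IsTest.clPauliEnergy_eq (h : IsTest N Ψ) {A : E3 → Fin 3 → ℝ} (hA : Continuous A) (Z α : ℝ) :
    clPauliEnergy N Z α A Ψ = (kinT A Ψ).toReal - Z * (attT Ψ).toReal + (repT Ψ).toReal +
      (8 * Real.pi * α ^ 2)⁻¹ * ∫ x, curlSq A x := by
  rw [h.kinT_eq hA, h.attT_eq, h.repT_eq_ofReal, ENNReal.toReal_ofReal, ENNReal.toReal_ofReal,
    ENNReal.toReal_ofReal, clPauliEnergy, Finset.sum_sub_distrib, Finset.mul_sum]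
  · refine Finset.sum_nonneg fun i _ => Finset.sum_nonneg fun j _ => ?_
    split_ifs
    · exact potInt_nonneg fun x => inv_nonneg.2 (enorm3_nonneg _)
    · exact le_rfl
  · exact Finset.sum_nonneg fun j _ => potInt_nonneg fun x => inv_nonneg.2 (enorm3_nonneg _)
  · exact Finset.sum_nonneg fun j _ => pauliKin_nonneg A j

end

theorem IsVecPot.lintegral_fieldE {A : E3 → Fin 3 → ℝ} (hA : IsVecPot A) :
    ∫⁻ x, fieldE A x = ENNReal.ofReal (∫ x, curlSq A x) := by
  have hd : ContDiff ℝ 1 A := hA.1.of_le (by exact_mod_cast le_top)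
  rw [integral_curlSq hA]
  have hc : Continuous fun x => gradSq A x := by
    unfold gradSq pdVec
    refine continuous_finsetSum _ fun i _ => continuous_finsetSum _ fun j _ => Continuous.pow ?_ 2
    exact (continuous_apply j).comp ((hd.continuous_fderiv (by norm_num)).clm_apply continuous_const)
  have hs : HasCompactSupport fun x => gradSq A x := by
    refine (hA.2.1.fderiv (𝕜 := ℝ)).comp_left (g := fun L : E3 →L[ℝ] (Fin 3 → ℝ) =>
      ∑ i, ∑ j, (L (Pi.single i 1) j) ^ 2) (by simp)
  rw [ofReal_integral_eq_lintegral_ofReal (hc.integrable_of_hasCompactSupport hs)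
    (Eventually.of_forall fun x => Finset.sum_nonneg fun i _ => Finset.sum_nonneg fun j _ => sq_nonneg _)]
  refine lintegral_congr fun x => ?_
  unfold gradSq fieldE gradE
  rw [ENNReal.ofReal_sum_of_nonneg fun i _ => Finset.sum_nonneg fun j _ => sq_nonneg _, Finset.sum_comm]
  refine Finset.sum_congr rfl fun i _ => ?_
  rw [ENNReal.ofReal_sum_of_nonneg fun j _ => sq_nonneg _]
  refine Finset.sum_congr rfl fun j _ => ?_
  rw [pdVec_eq_pdv (hd.differentiable (by norm_num)), pdv, ← ofReal_norm, ← ENNReal.ofReal_pow (norm_nonneg _),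
    Real.norm_eq_abs, sq_abs]

section

theorem measurable_fieldE {A : E3 → Fin 3 → ℝ} (hA : ContDiff ℝ 1 A) : Measurable (fieldE A) := by
  unfold fieldE
  exact Finset.measurable_fun_sum _ fun j _ => measurable_gradE (contDiff_pi.1 hA j)

/-- Magnetic stability estimate for a localized one-particle family. -/
theorem BFam.attraction_le : ∃ C : ℝ, 0 < C ∧ ∀ {Ω : Type} [MeasurableSpace Ω] (μ : Measure Ω)
    [SFinite μ] (ψ : Ω → E3 → Fin 2 → ℂ), BFam μ ψ → ∀ A : E3 → Fin 3 → ℝ, ContDiff ℝ 1 A →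
    ∫⁻ x, fieldE A x ≠ ∞ → ∫⁻ x, dens μ ψ x * ENNReal.ofReal ‖x‖⁻¹ ≠ ∞ →
    ∀ (Z : ℝ) (T : Set E3), 0 < Z → MeasurableSet T →
    (∀ x, dens μ ψ x ≠ 0 → ∀ z, dist x z ≤ tfScale Z z → z ∈ T) →
    ENNReal.ofReal Z * ∫⁻ x, dens μ ψ x * ENNReal.ofReal ‖x‖⁻¹ ≤
      ENNReal.ofReal (1 / 2) * (∫⁻ x, kinD μ A ψ x) +
      ENNReal.ofReal (C * Z) * (ENNReal.ofReal Z + (∫⁻ x, fieldE A x) +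
        ∫⁻ z in T, ENNReal.ofReal (tfScale Z z ^ 3 * (‖z‖ + 1 / Z))⁻¹) := by
  obtain ⟨η, C0, hη, hC0, H0⟩ := local_coulomb
  obtain ⟨C, hC, H⟩ := LocalCoulomb.attraction_le hη hC0
  refine ⟨C, hC, fun {Ω} _ μ _ ψ hψ A hA hF hfin => ?_⟩
  exact H _ _ _ hψ.measurable_dens (hψ.measurable_kinD hA.continuous) (measurable_fieldE hA)
    (fun z h m => H0 μ ψ hψ A hA z h m) hF hfin

theorem tfScale_cube_inv_le {Z : ℝ} (hZ : 0 < Z) {r : ℝ} (hr : 0 < r) {z : E3} (hz : r ≤ ‖z‖) :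
    (tfScale Z z ^ 3 * (‖z‖ + 1 / Z))⁻¹ ≤ Z ^ (3 / 2 : ℝ) * r ^ (-(5 / 2) : ℝ) := by
  set t := ‖z‖ + 1 / Z with ht
  have hZ1 : 0 < 1 / Z := by positivity
  have ht0 : 0 < t := by have := norm_nonneg z; positivity
  have e : tfScale Z z ^ 3 * t = t ^ (5 / 2 : ℝ) * Z ^ (-(3 / 2) : ℝ) := by
    rw [tfScale, ← ht, Real.sqrt_eq_rpow, ← Real.rpow_natCast, ← Real.rpow_mul (by positivity),
      Real.div_rpow ht0.le hZ.le, Real.rpow_neg hZ.le, show (5 / 2 : ℝ) = 3 / 2 + 1 by norm_num,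
      Real.rpow_add ht0, Real.rpow_one]
    norm_num
    ring
  rw [e, mul_inv, ← Real.rpow_neg ht0.le, ← Real.rpow_neg hZ.le, neg_neg, mul_comm]
  exact mul_le_mul_of_nonneg_left (Real.rpow_le_rpow_of_nonpos hr (by linarith) (by norm_num))
    (by positivity)

theorem lintegral_tfScale_le : ∃ C : ℝ, 0 < C ∧ ∀ Z a : ℝ, 0 < Z → 0 < a →
    ∫⁻ z in Metric.closedBall (0 : E3) a, ENNReal.ofReal (tfScale Z z ^ 3 * (‖z‖ + 1 / Z))⁻¹ ≤
      ENNReal.ofReal (C * (Z ^ (3 / 2 : ℝ) * a ^ (1 / 2 : ℝ))) := by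
  obtain ⟨C, hC, H⟩ := lintegral_norm_rpow (p := 5 / 2) (by norm_num)
  refine ⟨C, hC, fun Z a hZ ha => ?_⟩
  calc ∫⁻ z in Metric.closedBall (0 : E3) a, ENNReal.ofReal (tfScale Z z ^ 3 * (‖z‖ + 1 / Z))⁻¹
      ≤ ∫⁻ z in Metric.closedBall (0 : E3) a, ENNReal.ofReal (Z ^ (3 / 2 : ℝ)) *
          ENNReal.ofReal (‖z‖ ^ (-(5 / 2) : ℝ)) := by
        refine lintegral_mono_ae ?_
        refine ae_restrict_of_ae ?_
        have h0 : ∀ᵐ z : E3, z ≠ 0 := by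
          rw [ae_iff]
          simp
        filter_upwards [h0] with z hz
        rw [← ENNReal.ofReal_mul (by positivity)]
        exact ENNReal.ofReal_le_ofReal (tfScale_cube_inv_le hZ (norm_pos_iff.2 hz) le_rfl)
    _ ≤ _ := by
        rw [lintegral_const_mul' _ _ ENNReal.ofReal_ne_top]
        refine (mul_le_mul_right (H a ha) _).trans ?_
        rw [← ENNReal.ofReal_mul (by positivity)]
        refine ENNReal.ofReal_le_ofReal (le_of_eq ?_)
        norm_num
        ring

variable {N : ℕ} {Ψ : (Fin N → E3) → (Fin N → Fin 2) → ℂ}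

theorem IsWaveFun.outer_le (h : IsWaveFun N Ψ) {p : E3 → ℝ} (hp : Measurable p) (hp0 : ∀ x, 0 ≤ p x)
    (hp1 : ∀ x, p x ≤ 1) {Z R : ℝ} (hZ : 1 ≤ Z) (hR : 0 < R) (hpR : ∀ x, p x ≠ 0 → R ≤ ‖x‖) :
    ENNReal.ofReal Z * (∫⁻ x, ENNReal.ofReal (p x) * coul x * dens (sliceSum N) (oneFam Ψ) x) ≤
      (∫⁻ x, (∑ i, ∑ j, if i < j then ENNReal.ofReal (p (x i) * p (x j)) * coul (x i - x j) else 0)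
        ∂(wfMeas Ψ)) + ENNReal.ofReal (5 * Z ^ 2 / R) := by
  have hm : Measurable fun x => ENNReal.ofReal (p x) * coul x := hp.ennreal_ofReal.mul measurable_coul
  have h1 : ∫⁻ _x : Fin N → E3, ENNReal.ofReal (5 * Z ^ 2 / R) ∂(wfMeas Ψ) = ENNReal.ofReal (5 * Z ^ 2 / R) := by
    rw [lintegral_const, h.wfMeas_univ, mul_one]
  rw [← h.isTest.sum_lintegral_wfMeas hm, ← h1, ← lintegral_add_right _ measurable_const,
    ← lintegral_finsetSum (f := fun j (x : Fin N → E3) => ENNReal.ofReal (p (x j)) * coul (x j)) _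
      fun j _ => hm.comp (measurable_pi_apply j),
    ← lintegral_const_mul' _ _ ENNReal.ofReal_ne_top]
  refine lintegral_mono_ae ?_
  filter_upwards [ae_wfMeas_ne] with x hx
  have h2 := outer_attraction_le (a := fun i => enorm3 (x i)) (p := fun i => p (x i))
    (b := fun i j => enorm3 (x i - x j)) hZ hR (fun i => hp0 _) (fun i => hp1 _)
    (fun i hi => (hpR _ hi).trans (norm_le_enorm3 _)) (fun i j => enorm3_sub_comm _ _)
    (fun i j hij => enorm3_pos (sub_ne_zero.2 (hx i j hij))) (fun i j => enorm3_sub_le _ _)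
  have h3 := ENNReal.ofReal_le_ofReal h2
  have e1 : ∀ i j, 0 ≤ if i < j then p (x i) * p (x j) * (enorm3 (x i - x j))⁻¹ else 0 := by
    intro i j
    split_ifs
    · exact mul_nonneg (mul_nonneg (hp0 _) (hp0 _)) (inv_nonneg.2 (enorm3_nonneg _))
    · exact le_rfl
  rw [ENNReal.ofReal_add (Finset.sum_nonneg fun i _ => Finset.sum_nonneg fun j _ => e1 i j) (by positivity),
    ENNReal.ofReal_mul (by linarith), ENNReal.ofReal_sum_of_nonneg fun i _ => mul_nonneg (hp0 _)
      (inv_nonneg.2 (enorm3_nonneg _)),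
    ENNReal.ofReal_sum_of_nonneg fun i _ => Finset.sum_nonneg fun j _ => e1 i j] at h3
  refine (le_of_eq ?_).trans (h3.trans (le_of_eq ?_))
  · congr 1
    exact Finset.sum_congr rfl fun i _ => (ENNReal.ofReal_mul (hp0 _)).symm
  · congr 1
    refine Finset.sum_congr rfl fun i _ => ?_
    rw [ENNReal.ofReal_sum_of_nonneg fun j _ => e1 i j]
    refine Finset.sum_congr rfl fun j _ => ?_
    split_ifs
    · rw [coul, ENNReal.ofReal_mul (mul_nonneg (hp0 _) (hp0 _))]
    · simp

theorem rpow_estimates {Z : ℝ} (hZ : 1 ≤ Z) : Z ^ (-(1 / 3) : ℝ) ≤ 1 ∧ 0 < Z ^ (-(1 / 3) : ℝ) ∧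
    Z⁻¹ ≤ Z ^ (-(1 / 3) : ℝ) ∧ (Z ^ (-(1 / 3) : ℝ))⁻¹ ≤ Z ∧ Z ^ 2 * (Z ^ (-(1 / 3) : ℝ))⁻¹ = Z ^ (7 / 3 : ℝ) ∧
    Z ^ 2 ≤ Z ^ (7 / 3 : ℝ) ∧
    Z * (Z ^ (3 / 2 : ℝ) * (Z ^ (-(1 / 3) : ℝ)) ^ (1 / 2 : ℝ)) = Z ^ (7 / 3 : ℝ) := by
  have h0 : 0 < Z := by linarith
  refine ⟨Real.rpow_le_one_of_one_le_of_nonpos hZ (by norm_num), by positivity, ?_, ?_, ?_, ?_, ?_⟩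
  · rw [← Real.rpow_neg_one]
    exact Real.rpow_le_rpow_of_exponent_le hZ (by norm_num)
  · rw [← Real.rpow_neg h0.le]
    calc Z ^ (- -(1 / 3) : ℝ) ≤ Z ^ (1 : ℝ) := Real.rpow_le_rpow_of_exponent_le hZ (by norm_num)
      _ = Z := Real.rpow_one Z
  · rw [← Real.rpow_neg h0.le, ← Real.rpow_natCast, ← Real.rpow_add h0]
    norm_num
  · rw [← Real.rpow_natCast]
    exact Real.rpow_le_rpow_of_exponent_le hZ (by norm_num)
  · rw [← Real.rpow_mul h0.le, ← Real.rpow_add h0]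
    nth_rw 1 [← Real.rpow_one Z]
    rw [← Real.rpow_add h0]
    norm_num

theorem IsWaveFun.lintegral_coul (h : IsWaveFun N Ψ) :
    ∫⁻ x, coul x * dens (sliceSum N) (oneFam Ψ) x = attT Ψ :=
  (h.isTest.sum_lintegral_wfMeas measurable_coul).symm

theorem IsWaveFun.lintegral_inv_norm_ne_top (h : IsWaveFun N Ψ) :
    ∫⁻ x, dens (sliceSum N) (oneFam Ψ) x * ENNReal.ofReal ‖x‖⁻¹ ≠ ∞ := by
  refine ne_top_of_le_ne_top (ENNReal.mul_ne_top (by simp : (2 : ℝ≥0∞) ≠ ∞) h.isTest.attT_ne_top) ?_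
  rw [← h.lintegral_coul, ← lintegral_const_mul' _ _ (by simp)]
  refine lintegral_mono fun x => ?_
  rw [mul_comm, ← mul_assoc]
  exact mul_le_mul_left (inv_norm_le_coul x) _

theorem kinD_cutoff_le {Ω : Type} [MeasurableSpace Ω] {μ : Measure Ω} [SFinite μ] {ψ : Ω → E3 → Fin 2 → ℂ}
    (hψ : BFam μ ψ) {A : E3 → Fin 3 → ℝ} (hA : Continuous A) {φ : E3 → ℝ} (hφ : Differentiable ℝ φ)
    (hφ0 : ∀ x, 0 ≤ φ x) (hφ1 : ∀ x, φ x ≤ 1) (x : E3) :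
    kinD μ A (fun ω x s => (φ x : ℂ) * ψ ω x s) x ≤
      2 * kinD μ A ψ x + 24 * (gradE φ x * dens μ ψ x) := by
  have hm1 : Measurable fun ω => sq2 (dirac A (ψ ω) x) := by
    simpa only using measurable_fix_snd (hψ.measurable_dirac hA) x
  unfold kinD dens
  have hc : gradE φ x ≠ ∞ := by
    unfold gradE
    exact ENNReal.sum_ne_top.2 fun k _ => by simp
  rw [← lintegral_const_mul' _ _ hc, ← lintegral_const_mul' _ _ (by simp), ← lintegral_const_mul' _ _ (by simp),
    ← lintegral_add_left (hm1.const_mul 2)]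
  refine lintegral_mono fun ω => ?_
  refine (sq2_dirac_smul_le hφ (fun s => (hψ.smooth ω s).differentiable (by norm_num)) x).trans ?_
  rw [mul_add, ← mul_assoc, ← mul_assoc]
  refine add_le_add (mul_le_mul_left ?_ _) (le_of_eq ?_)
  · refine (mul_le_mul_right (pow_le_one₀ (n := 2) (by simp) ?_) 2).trans (mul_one _).le
    rw [← ofReal_norm, Real.norm_of_nonneg (hφ0 x)]
    exact ENNReal.ofReal_le_one.2 (hφ1 x)
  · norm_num

/-- Magnetic stability of the atom, with a field energy proportional to the nuclear charge. -/
theorem stability : ∃ Λ C : ℝ, 0 < Λ ∧ 0 < C ∧ ∀ {N : ℕ} {Ψ : (Fin N → E3) → (Fin N → Fin 2) → ℂ},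
    IsWaveFun N Ψ → ∀ A : E3 → Fin 3 → ℝ, IsVecPot A → ∀ Z M : ℝ, 1 ≤ Z → Λ * Z ≤ M →
    ENNReal.ofReal (2 * Z) * attT Ψ ≤ kinT A Ψ + ENNReal.ofReal M * (∫⁻ x, fieldE A x) + repT Ψ +
      ENNReal.ofReal (C * Z ^ (7 / 3 : ℝ)) := by
  obtain ⟨Cφ, hCφ, Hφ⟩ := exists_cutoff
  obtain ⟨C1, hC1, H1⟩ := BFam.attraction_le
  obtain ⟨C2, hC2, H2⟩ := lintegral_tfScale_le
  set B : ℝ := 2 + 48 * Cφ with hB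
  refine ⟨2 * C1, 4 * C1 + 2 * C1 * (C2 * (2 ^ (3 / 2 : ℝ) * 5 ^ (1 / 2 : ℝ))) + 5 * B ^ 2, by positivity,
    by positivity, ?_⟩
  intro N Ψ hΨ A hA Z M hZ hM
  obtain ⟨hr1, hr0, hrZ, hrZ', hrZ2, hZ2, hZ3⟩ := rpow_estimates hZ
  set r := Z ^ (-(1 / 3) : ℝ) with hr
  have hZ0 : 0 < Z := by linarith
  have hAc : ContDiff ℝ 1 A := hA.1.of_le (by exact_mod_cast le_top)
  obtain ⟨φ, hφ, hφ0, hφ1, hφi, hφo, hφg⟩ := Hφ 0 r hr0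
  have hφd : Differentiable ℝ φ := hφ.differentiable (by simp)
  set ρ := dens (sliceSum N) (oneFam Ψ) with hρ
  have hbase := hΨ.bFam
  have hfam : BFam (sliceSum N) fun ω x s => (φ x : ℂ) * oneFam Ψ ω x s := by
    refine hbase.mul (Complex.ofRealCLM.contDiff.comp (mod_cast contDiff_infty.1 hφ 2)) fun x => ?_
    rw [Complex.norm_real, Real.norm_of_nonneg (hφ0 x)]
    exact hφ1 x
  have hdens : ∀ x, dens (sliceSum N) (fun ω x s => (φ x : ℂ) * oneFam Ψ ω x s) x =
      ENNReal.ofReal (φ x ^ 2) * ρ x := by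
    intro x
    have hz : ‖(φ x : ℂ)‖ₑ ^ 2 = ENNReal.ofReal (φ x ^ 2) := by
      rw [enorm_sq_eq_ofReal, Complex.norm_real, Real.norm_eq_abs, sq_abs]
    rw [hρ, dens, dens, ← lintegral_const_mul' _ _ ENNReal.ofReal_ne_top, ← hz]
    exact lintegral_congr fun ω => sq2_mul _ _
  set p : E3 → ℝ := {x : E3 | r ≤ ‖x‖}.indicator fun _ => 1 with hp
  have hpm : Measurable p := measurable_const.indicator (measurableSet_le measurable_const measurable_norm)
  have hp0 : ∀ x, 0 ≤ p x := fun x => indicator_nonneg (fun _ _ => zero_le_one) x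
  have hp1 : ∀ x, p x ≤ 1 := fun x => indicator_le_self' (fun _ _ => zero_le_one) x
  have hpr : ∀ x, p x ≠ 0 → r ≤ ‖x‖ := fun x hx => by
    by_contra h0
    exact hx (indicator_of_notMem (s := {x : E3 | r ≤ ‖x‖}) h0 _)
  set Wi := ∫⁻ x, dens (sliceSum N) (fun ω x s => (φ x : ℂ) * oneFam Ψ ω x s) x * ENNReal.ofReal ‖x‖⁻¹ with hWi
  set Wo := ∫⁻ x, ENNReal.ofReal (p x) * coul x * ρ x with hWo
  set F := ∫⁻ x, fieldE A x with hF
  have hsplit : attT Ψ ≤ Wi + Wo := by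
    have hm : Measurable fun x => dens (sliceSum N) (fun ω x s => (φ x : ℂ) * oneFam Ψ ω x s) x *
        ENNReal.ofReal ‖x‖⁻¹ := hfam.measurable_dens.mul measurable_norm.inv.ennreal_ofReal
    rw [← hΨ.lintegral_coul, hWi, hWo, ← lintegral_add_left hm]
    refine lintegral_mono fun x => ?_
    rw [hdens]
    by_cases hx : r ≤ ‖x‖
    · have : p x = 1 := indicator_of_mem (s := {x : E3 | r ≤ ‖x‖}) hx _
      rw [this, ENNReal.ofReal_one, one_mul]
      exact le_add_self
    · rw [hφi x (by rw [mem_closedBall_zero_iff]; linarith), one_pow, ENNReal.ofReal_one, one_mul, mul_comm]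
      exact (mul_le_mul_right (coul_le x) _).trans le_self_add
  have hgrad : ∀ x, gradE φ x ≤ ENNReal.ofReal (4 * Cφ * Z) * (ENNReal.ofReal (p x) * coul x) := by
    intro x
    by_cases hx : r ≤ ‖x‖
    · by_cases hx2 : ‖x‖ ≤ 2 * r
      · have : p x = 1 := indicator_of_mem (s := {x : E3 | r ≤ ‖x‖}) hx _
        have hx0 : x ≠ 0 := norm_pos_iff.1 (hr0.trans_le hx)
        rw [this, ENNReal.ofReal_one, one_mul, coul, ← ENNReal.ofReal_mul (by positivity)]
        refine (hφg x).trans (ENNReal.ofReal_le_ofReal ?_)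
        have h1 : (4 * r)⁻¹ ≤ (enorm3 x)⁻¹ := inv_anti₀ (enorm3_pos hx0) (by linarith [enorm3_le x])
        calc Cφ / r ^ 2 = 4 * Cφ * r⁻¹ * (4 * r)⁻¹ := by field_simp
          _ ≤ 4 * Cφ * Z * (enorm3 x)⁻¹ := by gcongr
      · rw [gradE_eq_zero_of_notMem hφo (by rw [mem_closedBall_zero_iff]; exact hx2)]
        exact zero_le
    · have h1 : φ =ᶠ[𝓝 x] fun _ => 1 := by
        filter_upwards [(isOpen_lt continuous_norm continuous_const).mem_nhds (not_le.1 hx)] with y hy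
        exact hφi y (by rw [mem_closedBall_zero_iff]; exact le_of_lt hy)
      have : gradE φ x = 0 := by
        unfold gradE
        simp [h1.fderiv_eq]
      rw [this]
      exact zero_le
  have hkin : ENNReal.ofReal (1 / 2) * (∫⁻ x, kinD (sliceSum N) A
      (fun ω x s => (φ x : ℂ) * oneFam Ψ ω x s) x) ≤ kinT A Ψ + ENNReal.ofReal (48 * Cφ * Z) * Wo := by
    have h1 : ∫⁻ x, kinD (sliceSum N) A (fun ω x s => (φ x : ℂ) * oneFam Ψ ω x s) x ≤
        2 * kinT A Ψ + 24 * (ENNReal.ofReal (4 * Cφ * Z) * Wo) := by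
      rw [kinT, hWo, ← lintegral_const_mul' _ _ ENNReal.ofReal_ne_top, ← lintegral_const_mul' _ _ (by simp),
        ← lintegral_const_mul' _ _ (by simp),
        ← lintegral_add_left ((hbase.measurable_kinD hAc.continuous).const_mul 2)]
      refine lintegral_mono fun x => (kinD_cutoff_le hbase hAc.continuous hφd hφ0 hφ1 x).trans ?_
      refine add_le_add le_rfl (mul_le_mul_right ?_ _)
      rw [← mul_assoc]
      exact mul_le_mul_left (hgrad x) _
    refine (mul_le_mul_right h1 _).trans (le_of_eq ?_)
    rw [mul_add, ← mul_assoc, ← mul_assoc, ← mul_assoc]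
    have e2 : (2 : ℝ≥0∞) = ENNReal.ofReal 2 := by norm_num
    have e24 : (24 : ℝ≥0∞) = ENNReal.ofReal 24 := by norm_num
    rw [e2, e24, ← ENNReal.ofReal_mul (by norm_num), ← ENNReal.ofReal_mul (by norm_num),
      ← ENNReal.ofReal_mul (by norm_num), show (1 / 2 * 2 : ℝ) = 1 by norm_num, ENNReal.ofReal_one, one_mul]
    congr 3
    ring
  have hFtop : F ≠ ∞ := by rw [hF, hA.lintegral_fieldE]; exact ENNReal.ofReal_ne_top
  have hWitop : Wi ≠ ∞ := by
    refine ne_top_of_le_ne_top hΨ.lintegral_inv_norm_ne_top (lintegral_mono fun x => ?_)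
    refine mul_le_mul_left ?_ _
    rw [hdens]
    refine mul_le_of_le_one_left' (ENNReal.ofReal_le_one.2 (pow_le_one₀ (hφ0 x) (hφ1 x)))
  have hatt := H1 (sliceSum N) _ hfam A hAc hFtop hWitop (2 * Z) (Metric.closedBall 0 (5 * r)) (by positivity)
    Metric.isClosed_closedBall.measurableSet (by
      intro x hx z hz
      have hx2 : ‖x‖ ≤ 2 * r := by
        by_contra h0
        apply hx
        rw [hdens, hφo x (by rw [mem_closedBall_zero_iff]; exact h0)]
        simp
      have h1 := norm_le_norm_add_dist z x
      rw [dist_comm] at h1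
      rw [mem_closedBall_zero_iff]
      by_contra h0
      push Not at h0
      have h2 := tfScale_sq (Z := 2 * Z) (by positivity) z
      have h3 := tfScale_pos (Z := 2 * Z) (by positivity) z
      have h4 : 1 / (2 * Z) ≤ r := by
        refine le_trans ?_ hrZ
        rw [one_div]
        exact inv_anti₀ hZ0 (by linarith)
      have h5 : tfScale (2 * Z) z ^ 2 ≤ (‖z‖ + r) * r := by
        rw [h2, div_eq_mul_one_div]
        gcongr
      nlinarith)
  have hI := H2 (2 * Z) (5 * r) (by positivity) (by positivity)
  have hout := hΨ.outer_le hpm hp0 hp1 (Z := B * Z) (R := r) (by nlinarith) hr0 hpr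
  rw [← hWo] at hout
  have hrep : ∫⁻ x, (∑ i, ∑ j, if i < j then ENNReal.ofReal (p (x i) * p (x j)) * coul (x i - x j) else 0)
      ∂(wfMeas Ψ) ≤ repT Ψ := by
    refine lintegral_mono fun x => Finset.sum_le_sum fun i _ => Finset.sum_le_sum fun j _ => ?_
    split_ifs
    · exact mul_le_of_le_one_left' (ENNReal.ofReal_le_one.2 (mul_le_one₀ (hp1 _) (hp0 _) (hp1 _)))
    · exact le_rfl
  set I := ∫⁻ z in Metric.closedBall (0 : E3) (5 * r),
    ENNReal.ofReal (tfScale (2 * Z) z ^ 3 * (‖z‖ + 1 / (2 * Z)))⁻¹ with hIdef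
  have eI : C1 * (2 * Z) * (C2 * ((2 * Z) ^ (3 / 2 : ℝ) * (5 * r) ^ (1 / 2 : ℝ))) =
      2 * C1 * (C2 * (2 ^ (3 / 2 : ℝ) * 5 ^ (1 / 2 : ℝ))) * Z ^ (7 / 3 : ℝ) := by
    rw [← hZ3, Real.mul_rpow (by norm_num) hZ0.le, Real.mul_rpow (by norm_num) hr0.le]
    ring
  calc ENNReal.ofReal (2 * Z) * attT Ψ ≤ ENNReal.ofReal (2 * Z) * Wi + ENNReal.ofReal (2 * Z) * Wo := by
        rw [← mul_add]
        exact mul_le_mul_right hsplit _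
    _ ≤ (kinT A Ψ + ENNReal.ofReal (48 * Cφ * Z) * Wo + ENNReal.ofReal (C1 * (2 * Z)) *
          (ENNReal.ofReal (2 * Z) + F + I)) + ENNReal.ofReal (2 * Z) * Wo :=
        add_le_add (hatt.trans (add_le_add hkin le_rfl)) le_rfl
    _ = kinT A Ψ + ENNReal.ofReal (C1 * (2 * Z)) * F + ENNReal.ofReal (B * Z) * Wo +
          (ENNReal.ofReal (C1 * (2 * Z) * (2 * Z)) + ENNReal.ofReal (C1 * (2 * Z)) * I) := by
        rw [hB, add_mul (2 : ℝ), ENNReal.ofReal_add (by positivity) (by positivity),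
          ENNReal.ofReal_mul (p := C1 * (2 * Z)) (by positivity)]
        ring
    _ ≤ kinT A Ψ + ENNReal.ofReal M * F + (repT Ψ + ENNReal.ofReal (5 * (B * Z) ^ 2 / r)) +
          (ENNReal.ofReal (C1 * (2 * Z) * (2 * Z)) +
            ENNReal.ofReal (C1 * (2 * Z) * (C2 * ((2 * Z) ^ (3 / 2 : ℝ) * (5 * r) ^ (1 / 2 : ℝ))))) := by
        refine add_le_add (add_le_add (add_le_add le_rfl (mul_le_mul_left
          (ENNReal.ofReal_le_ofReal (by linarith)) _)) (hout.trans (add_le_add hrep le_rfl)))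
          (add_le_add le_rfl ?_)
        rw [ENNReal.ofReal_mul (p := C1 * (2 * Z)) (by positivity)]
        exact mul_le_mul_right hI _
    _ ≤ _ := by
        rw [eI, ← ENNReal.ofReal_add (by positivity) (by positivity), ← add_assoc _ (repT Ψ), add_assoc,
          ← ENNReal.ofReal_add (by positivity) (by positivity)]
        refine add_le_add le_rfl (ENNReal.ofReal_le_ofReal ?_)
        have e1 : 5 * (B * Z) ^ 2 / r = 5 * B ^ 2 * Z ^ (7 / 3 : ℝ) := by
          rw [← hrZ2]
          field_simp
        rw [e1]
        nlinarith

end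

section

variable {N : ℕ} {I : Type} {Ψ : (Fin N → E3) → (Fin N → Fin 2) → ℂ}

/-- The affine change of variables sending each particle according to its label. -/
def pullPos (μ : I → ℝ) (d : I → E3) (i : Fin N → I) (x : Fin N → E3) : Fin N → E3 :=
  fun k => μ (i k) • x k + d (i k)

/-- The inverse of `pullPos`. -/
def pushPos (μ : I → ℝ) (d : I → E3) (i : Fin N → I) (y : Fin N → E3) : Fin N → E3 :=
  fun k => (μ (i k))⁻¹ • (y k - d (i k))

theorem push_pullPos {μ : I → ℝ} (hμ : ∀ i, 0 < μ i) (d : I → E3) (i : Fin N → I) (x : Fin N → E3) :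
    pushPos μ d i (pullPos μ d i x) = x := by
  funext k
  simp [pushPos, pullPos, smul_smul, inv_mul_cancel₀ (hμ (i k)).ne']

theorem measurable_pushPos (μ : I → ℝ) (d : I → E3) (i : Fin N → I) : Measurable (pushPos μ d i) := by
  unfold pushPos
  fun_prop

/-- The normalization of a labelled term. -/
def labelAmp (μ : I → ℝ) (i : Fin N → I) : ℝ := ∏ k, √(μ (i k) ^ 3)

theorem map_affine {t : ℝ} (ht : 0 < t) (a : E3) :
    (volume : Measure E3).map (fun x => t • x + a) = ENNReal.ofReal (t⁻¹ ^ 3) • volume := by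
  have hm : Measurable fun x : E3 => t • x + a := by fun_prop
  refine Measure.ext fun S hS => ?_
  rw [Measure.map_apply hm hS, ← lintegral_indicator_one (hm hS), Measure.smul_apply, smul_eq_mul,
    ← lintegral_indicator_one hS, ← lintegral_comp_affine _ (measurable_one.indicator hS) ht a]
  rfl

theorem map_pullPos {μ : I → ℝ} (hμ : ∀ i, 0 < μ i) (d : I → E3) (i : Fin N → I) :
    (volume : Measure (Fin N → E3)).map (pullPos μ d i) =
      ENNReal.ofReal (∏ k, (μ (i k))⁻¹ ^ 3) • volume := by
  have hs : ∀ k, SigmaFinite ((volume : Measure E3).map fun x => μ (i k) • x + d (i k)) := fun k => by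
    rw [map_affine (hμ _)]
    exact SMul.sigmaFinite (Real.toNNReal ((μ (i k))⁻¹ ^ 3))
  have h1 : (volume : Measure (Fin N → E3)).map (pullPos μ d i) =
      Measure.pi fun k => (volume : Measure E3).map fun x => μ (i k) • x + d (i k) := by
    exact Measure.pi_map_pi (f := fun k (x : E3) => μ (i k) • x + d (i k))
      (fun k => (by fun_prop : Measurable fun x : E3 => μ (i k) • x + d (i k)).aemeasurable)
  rw [h1]
  refine Measure.pi_eq fun S hS => ?_
  simp only [map_affine (hμ _), Measure.smul_apply, smul_eq_mul]
  rw [volume_pi, Measure.pi_pi, Finset.prod_mul_distrib, ENNReal.ofReal_prod_of_nonneg]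
  intro k _
  have := (hμ (i k)).le
  positivity

theorem lintegral_pullPos {μ : I → ℝ} (hμ : ∀ i, 0 < μ i) (d : I → E3) (i : Fin N → I)
    {G : (Fin N → E3) → ℝ≥0∞} (hG : Measurable G) :
    ENNReal.ofReal (labelAmp μ i ^ 2) * ∫⁻ x, G (pullPos μ d i x) = ∫⁻ x, G x := by
  have hm : Measurable (pullPos μ d i) := by
    unfold pullPos
    fun_prop
  rw [← lintegral_map hG hm, map_pullPos hμ, lintegral_smul_measure, smul_eq_mul, ← mul_assoc,
    ← ENNReal.ofReal_mul (sq_nonneg _)]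
  have : labelAmp μ i ^ 2 * ∏ k, (μ (i k))⁻¹ ^ 3 = 1 := by
    rw [labelAmp, ← Finset.prod_pow, ← Finset.prod_mul_distrib]
    refine Finset.prod_eq_one fun k _ => ?_
    have := hμ (i k)
    rw [Real.sq_sqrt (by positivity)]
    field_simp
  rw [this, ENNReal.ofReal_one, one_mul]

/-- The weight of a labelled term. -/
def labelProd (b : I → E3 → ℂ) (i : Fin N → I) (y : Fin N → E3) : ℂ := ∏ k, b (i k) (y k)

/-- A labelled term of the trial function. -/
def trialTerm (b : I → E3 → ℂ) (μ : I → ℝ) (d : I → E3) (Ψ : (Fin N → E3) → (Fin N → Fin 2) → ℂ)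
    (i : Fin N → I) (x : Fin N → E3) (s : Fin N → Fin 2) : ℂ :=
  (labelAmp μ i : ℂ) * (labelProd b i (pullPos μ d i x) * Ψ (pullPos μ d i x) s)

/-- The function obtained from `Ψ` by cutting space into pieces and moving the pieces. -/
def trial [Fintype I] [DecidableEq I] (b : I → E3 → ℂ) (μ : I → ℝ) (d : I → E3)
    (Ψ : (Fin N → E3) → (Fin N → Fin 2) → ℂ) (x : Fin N → E3) (s : Fin N → Fin 2) : ℂ :=
  ∑ i : Fin N → I, trialTerm b μ d Ψ i x s

theorem enorm_sum_sq_of_unique {ι : Type} [Fintype ι] {f : ι → ℂ}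
    (h : ∀ i j, f i ≠ 0 → f j ≠ 0 → i = j) : ‖∑ i, f i‖ₑ ^ 2 = ∑ i, ‖f i‖ₑ ^ 2 := by
  classical
  by_cases h0 : ∃ i, f i ≠ 0
  · obtain ⟨i, hi⟩ := h0
    have hj : ∀ j, j ≠ i → f j = 0 := fun j hj => by
      by_contra h1
      exact hj (h j i h1 hi)
    rw [Finset.sum_eq_single i (fun j _ hne => hj j hne) (by simp),
      Finset.sum_eq_single i (fun j _ hne => by rw [hj j hne]; simp) (by simp)]
  · push Not at h0
    simp [h0]

theorem contDiff_labelProd {b : I → E3 → ℂ} (hb : ∀ i, ContDiff ℝ (⊤ : ℕ∞) (b i)) (i : Fin N → I) :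
    ContDiff ℝ (⊤ : ℕ∞) (labelProd b i) := by
  unfold labelProd
  exact contDiff_prod fun k _ => (hb (i k)).comp (contDiff_apply ℝ E3 k)

theorem contDiff_pullPos (μ : I → ℝ) (d : I → E3) (i : Fin N → I) {n : WithTop ℕ∞} :
    ContDiff ℝ n (pullPos μ d i) := by
  unfold pullPos
  fun_prop

theorem isTest_trialTerm (h : IsTest N Ψ) {b : I → E3 → ℂ} (hb : ∀ i, ContDiff ℝ (⊤ : ℕ∞) (b i))
    {μ : I → ℝ} (hμ : ∀ i, 0 < μ i) (d : I → E3) (i : Fin N → I) : IsTest N (trialTerm b μ d Ψ i) := by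
  refine ⟨fun s => ?_, fun s => ?_⟩
  · unfold trialTerm
    exact contDiff_const.mul (((contDiff_labelProd hb i).comp (contDiff_pullPos μ d i)).mul
      ((h.smooth s).comp (contDiff_pullPos μ d i)))
  · have hc : Continuous (pushPos μ d i : (Fin N → E3) → _) := by
      unfold pushPos
      fun_prop
    refine HasCompactSupport.of_support_subset_isCompact ((h.compactSupport s).isCompact.image hc) ?_
    intro x hx
    refine ⟨pullPos μ d i x, subset_closure ?_, push_pullPos hμ d i x⟩
    intro h0
    apply hx
    simp only at h0
    simp [trialTerm, h0]

theorem isTest_trial [Fintype I] [DecidableEq I] (h : IsTest N Ψ) {b : I → E3 → ℂ}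
    (hb : ∀ i, ContDiff ℝ (⊤ : ℕ∞) (b i)) {μ : I → ℝ} (hμ : ∀ i, 0 < μ i) (d : I → E3) :
    IsTest N (trial b μ d Ψ) := by
  refine ⟨fun s => ?_, fun s => ?_⟩
  · unfold trial
    exact ContDiff.sum fun i _ => (isTest_trialTerm h hb hμ d i).smooth s
  · unfold trial
    have : ∀ S : Finset (Fin N → I), HasCompactSupport fun x => ∑ i ∈ S, trialTerm b μ d Ψ i x s := by
      intro S
      induction S using Finset.induction_on with
      | empty =>
        simp only [Finset.sum_empty]
        exact HasCompactSupport.zero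
      | insert i S hi ih =>
        simp only [Finset.sum_insert hi]
        exact ((isTest_trialTerm h hb hμ d i).compactSupport s).add ih
    exact this _

theorem trial_antisymm [Fintype I] [DecidableEq I] (h : IsWaveFun N Ψ) (b : I → E3 → ℂ) (μ : I → ℝ)
    (d : I → E3) (π : Equiv.Perm (Fin N)) (x : Fin N → E3) (s : Fin N → Fin 2) :
    trial b μ d Ψ (fun k => x (π k)) (fun k => s (π k)) =
      ((Equiv.Perm.sign π : ℤ) : ℂ) * trial b μ d Ψ x s := by
  unfold trial
  rw [Finset.mul_sum]
  refine (Fintype.sum_equiv (Equiv.arrowCongr π.symm (Equiv.refl I)) _ _ fun i => ?_).symm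
  have e1 : ∀ k, (Equiv.arrowCongr π.symm (Equiv.refl I) i) k = i (π k) := fun k => rfl
  have e2 : pullPos μ d (Equiv.arrowCongr π.symm (Equiv.refl I) i) (fun k => x (π k)) =
      fun k => pullPos μ d i x (π k) := rfl
  have e3 : labelAmp μ (Equiv.arrowCongr π.symm (Equiv.refl I) i) = labelAmp μ i := by
    unfold labelAmp
    simp only [e1]
    exact Equiv.prod_comp π fun k => √(μ (i k) ^ 3)
  have e4 : labelProd b (Equiv.arrowCongr π.symm (Equiv.refl I) i) (fun k => pullPos μ d i x (π k)) =
      labelProd b i (pullPos μ d i x) := by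
    unfold labelProd
    simp only [e1]
    exact Equiv.prod_comp π fun k => b (i k) (pullPos μ d i x k)
  unfold trialTerm
  rw [e2, e3, e4, h.antisymm]
  ring

theorem fderiv_comp_pullPos (μ : I → ℝ) (d : I → E3) (i : Fin N → I) {F : (Fin N → E3) → ℂ}
    (hF : Differentiable ℝ F) (x : Fin N → E3) (j : Fin N) (k : Fin 3) :
    fderiv ℝ (fun y => F (pullPos μ d i y)) x (eVec N j k) =
      μ (i j) * fderiv ℝ F (pullPos μ d i x) (eVec N j k) := by
  have h1 : HasFDerivAt (pullPos μ d i) (ContinuousLinearMap.pi fun l =>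
      μ (i l) • (ContinuousLinearMap.proj l : (Fin N → E3) →L[ℝ] E3)) x := by
    refine hasFDerivAt_pi.2 fun l => ?_
    exact (((ContinuousLinearMap.proj l : (Fin N → E3) →L[ℝ] E3).hasFDerivAt (x := x)).const_smul
      (μ (i l))).add_const (d (i l))
  have h2 := (hF (pullPos μ d i x)).hasFDerivAt.comp x h1
  have h3 : (ContinuousLinearMap.pi fun l =>
      μ (i l) • (ContinuousLinearMap.proj l : (Fin N → E3) →L[ℝ] E3)) (eVec N j k) =
        μ (i j) • eVec N j k := by
    funext l
    simp only [ContinuousLinearMap.coe_pi', eVec, Pi.smul_apply, _root_.smul_apply,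
      ContinuousLinearMap.proj_apply]
    by_cases hl : l = j
    · subst hl; simp
    · simp [hl]
  rw [show (fun y => F (pullPos μ d i y)) = F ∘ pullPos μ d i from rfl, h2.fderiv,
    ContinuousLinearMap.comp_apply, h3, map_smul]
  simp

/-- The weight of the particles other than `j`. -/
def labelRest (b : I → E3 → ℂ) (i : Fin N → I) (j : Fin N) (y : Fin N → E3) : ℂ :=
  ∏ k ∈ Finset.univ.erase j, b (i k) (y k)

theorem labelProd_eq (b : I → E3 → ℂ) (i : Fin N → I) (j : Fin N) (y : Fin N → E3) :
    labelProd b i y = labelRest b i j y * b (i j) (y j) :=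
  (Finset.prod_erase_mul _ _ (Finset.mem_univ j)).symm

theorem differentiable_labelRest {b : I → E3 → ℂ} (hb : ∀ i, ContDiff ℝ (⊤ : ℕ∞) (b i)) (i : Fin N → I)
    (j : Fin N) : Differentiable ℝ (labelRest b i j) := by
  have : ContDiff ℝ (⊤ : ℕ∞) (labelRest b i j) := by
    unfold labelRest
    exact contDiff_prod fun k _ => (hb (i k)).comp (contDiff_apply ℝ E3 k)
  exact this.differentiable (by simp)

theorem fderiv_labelRest {b : I → E3 → ℂ} (hb : ∀ i, ContDiff ℝ (⊤ : ℕ∞) (b i)) (i : Fin N → I)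
    (j : Fin N) (y : Fin N → E3) (k : Fin 3) : fderiv ℝ (labelRest b i j) y (eVec N j k) = 0 := by
  rw [← (differentiable_labelRest hb i j y).lineDeriv_eq_fderiv, lineDeriv]
  have : (fun t : ℝ => labelRest b i j (y + t • eVec N j k)) = fun _ => labelRest b i j y := by
    funext t
    unfold labelRest
    refine Finset.prod_congr rfl fun l hl => ?_
    simp [eVec, Finset.ne_of_mem_erase hl]
  rw [this, deriv_const]

theorem diracN_trialTerm (h : IsTest N Ψ) {b : I → E3 → ℂ} (hb : ∀ i, ContDiff ℝ (⊤ : ℕ∞) (b i))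
    (μ : I → ℝ) (d : I → E3) (i : Fin N → I) (j : Fin N) (x : Fin N → E3) (s : Fin N → Fin 2) :
    diracN (fun _ => 0) j (trialTerm b μ d Ψ i) x s =
      (labelAmp μ i * μ (i j) : ℂ) * labelRest b i j (pullPos μ d i x) *
        diracN (fun _ => 0) j (fun y t => b (i j) (y j) * Ψ y t) (pullPos μ d i x) s := by
  have hG : ∀ s, Differentiable ℝ fun y : Fin N → E3 => b (i j) (y j) * Ψ y s := fun s =>
    (((hb (i j)).comp (contDiff_apply ℝ E3 j)).mul (h.smooth s)).differentiable (by simp)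
  have hR := differentiable_labelRest hb i j
  have key : ∀ s k, fderiv ℝ (fun y => trialTerm b μ d Ψ i y s) x (eVec N j k) =
      (labelAmp μ i * μ (i j) : ℂ) * labelRest b i j (pullPos μ d i x) *
        fderiv ℝ (fun y : Fin N → E3 => b (i j) (y j) * Ψ y s) (pullPos μ d i x) (eVec N j k) := fun s k => by
    have e : (fun y => trialTerm b μ d Ψ i y s) = fun y => (fun y => (labelAmp μ i : ℂ) *
        (labelRest b i j y * (b (i j) (y j) * Ψ y s))) (pullPos μ d i y) := by
      funext y
      simp only [trialTerm, labelProd_eq b i j, mul_assoc]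
    have hd : Differentiable ℝ fun y => labelRest b i j y * (b (i j) (y j) * Ψ y s) := hR.mul (hG s)
    rw [e, fderiv_comp_pullPos μ d i (F := fun y => (labelAmp μ i : ℂ) *
        (labelRest b i j y * (b (i j) (y j) * Ψ y s))) (hd.const_mul _),
      fderiv_const_mul (hd _), fderiv_fun_mul (hR _) (hG s _)]
    simp only [_root_.smul_apply, _root_.add_apply, smul_eq_mul,
      fderiv_labelRest hb i j, mul_zero, add_zero]
    ring
  unfold diracN
  simp only [key, Pi.zero_apply, Complex.ofReal_zero, zero_mul, add_zero, Finset.mul_sum]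
  refine Finset.sum_congr rfl fun k _ => Finset.sum_congr rfl fun t _ => ?_
  ring

theorem diracN_trial [Fintype I] [DecidableEq I] (h : IsTest N Ψ) {b : I → E3 → ℂ}
    (hb : ∀ i, ContDiff ℝ (⊤ : ℕ∞) (b i)) {μ : I → ℝ} (hμ : ∀ i, 0 < μ i) (d : I → E3) (j : Fin N)
    (x : Fin N → E3) (s : Fin N → Fin 2) : diracN (fun _ => 0) j (trial b μ d Ψ) x s =
      ∑ i, diracN (fun _ => 0) j (trialTerm b μ d Ψ i) x s := by
  unfold diracN trial
  have : ∀ s k, fderiv ℝ (fun y => ∑ i : Fin N → I, trialTerm b μ d Ψ i y s) x (eVec N j k) =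
      ∑ i : Fin N → I, fderiv ℝ (fun y => trialTerm b μ d Ψ i y s) x (eVec N j k) := fun s k => by
    rw [fderiv_fun_sum fun i _ => ((isTest_trialTerm h hb hμ d i).smooth s).differentiable (by simp) x]
    simp
  simp only [this, Pi.zero_apply, Complex.ofReal_zero, zero_mul, add_zero, Finset.mul_sum]
  symm
  rw [Finset.sum_comm]
  refine Finset.sum_congr rfl fun k _ => ?_
  rw [Finset.sum_comm]
  refine Finset.sum_congr rfl fun t _ => ?_
  rw [Finset.sum_const_zero, add_zero, Finset.mul_sum]

/-- The data of a cut-and-move construction: the pieces stay disjoint. -/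
structure CutData (Ψ : (Fin N → E3) → (Fin N → Fin 2) → ℂ) (b : I → E3 → ℂ) (μ : I → ℝ) (d : I → E3)
    (R : ℝ) [Fintype I] : Prop where
  smooth : ∀ i, ContDiff ℝ (⊤ : ℕ∞) (b i)
  flat : ∀ i y, b i y = 0 → fderiv ℝ (b i) y = 0
  unit : ∀ y, ∑ i, ‖b i y‖ₑ ^ 2 = 1
  pos : ∀ i, 0 < μ i
  radius : ∀ x s, R < ‖x‖ → Ψ x s = 0
  disjoint : ∀ i j, i ≠ j → ∀ x y, ‖x‖ ≤ R → ‖y‖ ≤ R → b i x ≠ 0 → b j y ≠ 0 →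
    (μ i)⁻¹ • (x - d i) ≠ (μ j)⁻¹ • (y - d j)

namespace CutData

variable [Fintype I] {b : I → E3 → ℂ} {μ : I → ℝ} {d : I → E3} {R : ℝ}

theorem unique (hc : CutData Ψ b μ d R) {x : Fin N → E3} {i j : Fin N → I}
    (hi : ∀ k, b (i k) (pullPos μ d i x k) ≠ 0) (hi' : ‖pullPos μ d i x‖ ≤ R)
    (hj : ∀ k, b (j k) (pullPos μ d j x k) ≠ 0) (hj' : ‖pullPos μ d j x‖ ≤ R) : i = j := by
  funext k
  by_contra hne
  refine hc.disjoint _ _ hne _ _ ((norm_le_pi_norm _ k).trans hi') ((norm_le_pi_norm _ k).trans hj')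
    (hi k) (hj k) ?_
  have h1 := congrFun (push_pullPos hc.pos d i x) k
  have h2 := congrFun (push_pullPos hc.pos d j x) k
  exact h1.trans h2.symm

theorem active (hc : CutData Ψ b μ d R) {x : Fin N → E3} {s} {i : Fin N → I}
    (hi : trialTerm b μ d Ψ i x s ≠ 0) :
    (∀ k, b (i k) (pullPos μ d i x k) ≠ 0) ∧ ‖pullPos μ d i x‖ ≤ R := by
  unfold trialTerm labelProd at hi
  refine ⟨fun k h0 => hi ?_, ?_⟩
  · rw [Finset.prod_eq_zero (Finset.mem_univ k) h0]
    simp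
  · by_contra! hR
    exact hi (by rw [hc.radius _ _ hR]; simp)

theorem active_diracN (hc : CutData Ψ b μ d R) (h : IsTest N Ψ) {x : Fin N → E3} {s} {i : Fin N → I}
    {j : Fin N} (hi : diracN (fun _ => 0) j (trialTerm b μ d Ψ i) x s ≠ 0) :
    (∀ k, b (i k) (pullPos μ d i x k) ≠ 0) ∧ ‖pullPos μ d i x‖ ≤ R := by
  rw [diracN_trialTerm h hc.smooth] at hi
  have h1 := right_ne_zero_of_mul hi
  have h2 := right_ne_zero_of_mul (left_ne_zero_of_mul hi)
  refine ⟨fun k h0 => ?_, ?_⟩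
  · by_cases hk : k = j
    · subst hk
      apply h1
      have hf : ∀ t, fderiv ℝ (fun y : Fin N → E3 => b (i k) (y k) * Ψ y t) (pullPos μ d i x) = 0 := fun t => by
        have hd : HasFDerivAt (fun y : Fin N → E3 => b (i k) (y k)) (0 : (Fin N → E3) →L[ℝ] ℂ)
            (pullPos μ d i x) := by
          have := (((hc.smooth (i k)).differentiable (by simp)) (pullPos μ d i x k)).hasFDerivAt.comp
            (pullPos μ d i x) (ContinuousLinearMap.proj (R := ℝ) (φ := fun _ : Fin N => E3) k).hasFDerivAt
          rw [hc.flat _ _ h0, ContinuousLinearMap.zero_comp] at this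
          exact this
        have hg := ((h.smooth t).differentiable (by simp) (pullPos μ d i x)).hasFDerivAt
        have := (hd.mul hg).fderiv
        rw [h0] at this
        refine Eq.trans this (ContinuousLinearMap.ext fun v => ?_)
        show (0 : ℂ) * _ + _ * (0 : ℂ) = 0
        ring
      unfold diracN
      simp [hf, h0]
    · apply h2
      exact Finset.prod_eq_zero (Finset.mem_erase.2 ⟨hk, Finset.mem_univ k⟩) h0
  · by_contra! hR
    refine h1 (diracN_eq_zero (R := R) (fun y t hy => ?_) _ j s _ hR)
    rw [hc.radius y t hy, mul_zero]

variable [DecidableEq I]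

theorem enorm_trial_sq (hc : CutData Ψ b μ d R) (x : Fin N → E3) (s) :
    ‖trial b μ d Ψ x s‖ₑ ^ 2 = ∑ i, ‖trialTerm b μ d Ψ i x s‖ₑ ^ 2 :=
  enorm_sum_sq_of_unique fun i j hi hj => by
    obtain ⟨h1, h2⟩ := hc.active hi
    obtain ⟨h3, h4⟩ := hc.active hj
    exact hc.unique h1 h2 h3 h4

theorem enorm_diracN_trial_sq (hc : CutData Ψ b μ d R) (h : IsTest N Ψ) (j : Fin N) (x : Fin N → E3) (s) :
    ‖diracN (fun _ => 0) j (trial b μ d Ψ) x s‖ₑ ^ 2 =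
      ∑ i, ‖diracN (fun _ => 0) j (trialTerm b μ d Ψ i) x s‖ₑ ^ 2 := by
  rw [diracN_trial h hc.smooth hc.pos]
  exact enorm_sum_sq_of_unique fun i j hi hj => by
    obtain ⟨h1, h2⟩ := hc.active_diracN h hi
    obtain ⟨h3, h4⟩ := hc.active_diracN h hj
    exact hc.unique h1 h2 h3 h4

end CutData

end

section

variable {N : ℕ} {I : Type} [Fintype I]

theorem sum_prod_eq_prod_sum (v : Fin N → I → ℝ≥0∞) :
    ∑ i : Fin N → I, ∏ k, v k (i k) = ∏ k, ∑ β, v k β := by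
  classical
  rw [Finset.prod_univ_sum, Fintype.piFinset_univ]

theorem sum_prod_marginal {w : Fin N → I → ℝ≥0∞} (hw : ∀ k, ∑ β, w k β = 1) (j : Fin N)
    (g : I → ℝ≥0∞) : ∑ i : Fin N → I, (∏ k, w k (i k)) * g (i j) = ∑ β, w j β * g β := by
  have h1 : ∀ i : Fin N → I, (∏ k, w k (i k)) * g (i j) =
      ∏ k, w k (i k) * (if k = j then g (i k) else 1) := fun i => by
    rw [Finset.prod_mul_distrib]
    congr 1
    rw [Finset.prod_eq_single j] <;> simp +contextual
  simp only [h1]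
  rw [sum_prod_eq_prod_sum fun k β => w k β * (if k = j then g β else 1), Finset.prod_eq_single j]
  · simp
  · intro k _ hk
    simp [hk, hw]
  · simp

variable [DecidableEq I]

theorem sum_prod_marginal_pair {w : Fin N → I → ℝ≥0∞} (hw : ∀ k, ∑ β, w k β = 1) {j l : Fin N}
    (hjl : j ≠ l) (g : I → I → ℝ≥0∞) : ∑ i : Fin N → I, (∏ k, w k (i k)) * g (i j) (i l) =
      ∑ β, ∑ γ, w j β * w l γ * g β γ := by
  have h1 : ∀ i : Fin N → I, g (i j) (i l) = ∑ β, ∑ γ, g β γ *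
      ((if i j = β then 1 else 0) * (if i l = γ then 1 else 0)) := fun i => by simp
  simp only [h1, Finset.mul_sum]
  rw [Finset.sum_comm]
  refine Finset.sum_congr rfl fun β _ => ?_
  rw [Finset.sum_comm]
  refine Finset.sum_congr rfl fun γ _ => ?_
  have h2 : ∀ i : Fin N → I, (∏ k, w k (i k)) * (g β γ *
      ((if i j = β then 1 else 0) * (if i l = γ then 1 else 0))) = g β γ * ∏ k, w k (i k) *
        ((if k = j then (if i k = β then 1 else 0) else 1) *
          (if k = l then (if i k = γ then 1 else 0) else 1)) := fun i => by
    rw [Finset.prod_mul_distrib, Finset.prod_mul_distrib, mul_left_comm]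
    congr 3
    · rw [Finset.prod_eq_single j] <;> simp +contextual
    · rw [Finset.prod_eq_single l] <;> simp +contextual
  simp only [h2]
  rw [← Finset.mul_sum, sum_prod_eq_prod_sum fun k δ => w k δ *
    ((if k = j then (if δ = β then 1 else 0) else 1) * (if k = l then (if δ = γ then 1 else 0) else 1)),
    Finset.prod_eq_mul j l hjl]
  · simp [hjl, hjl.symm, mul_comm]
  · intro k _ hk
    simp [hk.1, hk.2, hw]
  · simp
  · simp

end

theorem IsTest.kinT_eq_diracN {N : ℕ} {Ψ : (Fin N → E3) → (Fin N → Fin 2) → ℂ} (h : IsTest N Ψ)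
    {A : E3 → Fin 3 → ℝ} (hA : Continuous A) :
    kinT A Ψ = ∑ j, ∑ s, ∫⁻ x, ‖diracN A j Ψ x s‖ₑ ^ 2 := by
  have := lintegral_kinD_oneFam (fun s => (h.contDiff_two s).of_le (by norm_num)) hA
    (a := fun _ => 1) contDiff_const
  simp only [one_mul] at this
  exact this

theorem enorm_prod_complex {ι : Type} (S : Finset ι) (f : ι → ℂ) : ‖∏ k ∈ S, f k‖ₑ = ∏ k ∈ S, ‖f k‖ₑ := by
  simp [enorm_eq_nnnorm, nnnorm_prod]

theorem ofReal_labelAmp {N : ℕ} {I : Type} (μ : I → ℝ) (i : Fin N → I) :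
    ‖(labelAmp μ i : ℂ)‖ₑ ^ 2 = ENNReal.ofReal (labelAmp μ i ^ 2) := by
  rw [enorm_sq_eq_ofReal, Complex.norm_real, Real.norm_eq_abs, sq_abs]

namespace CutData

variable {N : ℕ} {I : Type} [Fintype I] {Ψ : (Fin N → E3) → (Fin N → Fin 2) → ℂ}
  {b : I → E3 → ℂ} {μ : I → ℝ} {d : I → E3} {R : ℝ}

theorem measurable_weight (hc : CutData Ψ b μ d R) (i : I) (k : Fin N) :
    Measurable fun y : Fin N → E3 => ‖b i (y k)‖ₑ ^ 2 :=
  (((hc.smooth i).continuous.measurable.comp (measurable_pi_apply k)).enorm.pow_const 2)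

variable [DecidableEq I]

theorem lintegral_wfMeas_trial (hc : CutData Ψ b μ d R) (h : IsTest N Ψ) {G : (Fin N → E3) → ℝ≥0∞}
    (hG : Measurable G) : ∫⁻ x, G x ∂(wfMeas (trial b μ d Ψ)) =
      ∫⁻ y, ∑ i : Fin N → I, (∏ k, ‖b (i k) (y k)‖ₑ ^ 2) * G (pushPos μ d i y) ∂(wfMeas Ψ) := by
  have hm : ∀ i : Fin N → I, Measurable fun y => (∏ k, ‖b (i k) (y k)‖ₑ ^ 2) * G (pushPos μ d i y) :=
    fun i => (Finset.measurable_fun_prod _ fun k _ => hc.measurable_weight (i k) k).mul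
      (hG.comp (measurable_pushPos μ d i))
  have hΨ : ∀ s, Measurable fun y => ‖Ψ y s‖ₑ ^ 2 := fun s => (h.continuous s).measurable.enorm.pow_const 2
  rw [(isTest_trial h hc.smooth hc.pos d).lintegral_wfMeas hG,
    h.lintegral_wfMeas (Finset.measurable_fun_sum _ fun i _ => hm i)]
  refine Finset.sum_congr rfl fun s _ => ?_
  have e1 : ∀ x, G x * ‖trial b μ d Ψ x s‖ₑ ^ 2 = ∑ i : Fin N → I, ENNReal.ofReal (labelAmp μ i ^ 2) *
      ((fun y => (∏ k, ‖b (i k) (y k)‖ₑ ^ 2) * G (pushPos μ d i y) * ‖Ψ y s‖ₑ ^ 2) (pullPos μ d i x)) :=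
      fun x => by
    rw [hc.enorm_trial_sq, Finset.mul_sum]
    refine Finset.sum_congr rfl fun i _ => ?_
    simp only [trialTerm, enorm_mul, mul_pow, ofReal_labelAmp, labelProd, push_pullPos hc.pos]
    rw [enorm_prod_complex, Finset.prod_pow]
    ring
  simp only [e1, Finset.sum_mul]
  rw [lintegral_finsetSum, lintegral_finsetSum]
  · refine Finset.sum_congr rfl fun i _ => ?_
    rw [lintegral_const_mul' _ _ ENNReal.ofReal_ne_top]
    exact lintegral_pullPos hc.pos d i ((hm i).mul (hΨ s))
  · exact fun i _ => (hm i).mul (hΨ s)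
  · refine fun i _ => Measurable.const_mul ?_ _
    exact ((hm i).mul (hΨ s)).comp ((contDiff_pullPos μ d i (n := 0)).continuous.measurable)

theorem kinT_trial (hc : CutData Ψ b μ d R) (h : IsTest N Ψ) : kinT (fun _ => 0) (trial b μ d Ψ) =
    ∑ β, ENNReal.ofReal (μ β ^ 2) *
      ∫⁻ x, kinD (sliceSum N) (fun _ => 0) (fun p x s => b β x * oneFam Ψ p x s) x := by
  have hT : ∀ (β : I) (j : Fin N), IsTest N fun y s => b β (y j) * Ψ y s := fun β j =>
    ⟨fun s => ((hc.smooth β).comp (contDiff_apply ℝ E3 j)).mul (h.smooth s),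
      fun s => (h.compactSupport s).mul_left⟩
  have hD : ∀ (β : I) (j : Fin N) (s : Fin N → Fin 2), Measurable fun y =>
      ‖diracN (fun _ => 0) j (fun y t => b β (y j) * Ψ y t) y s‖ₑ ^ 2 := fun β j s =>
    (diracN_continuous (hT β j) continuous_const j s).measurable.enorm.pow_const 2
  rw [(isTest_trial h hc.smooth hc.pos d).kinT_eq_diracN continuous_const]
  have hb1 : ∀ β, ContDiff ℝ 1 (b β) := fun β => (hc.smooth β).of_le (by exact_mod_cast le_top)
  simp only [lintegral_kinD_oneFam (fun s => (h.contDiff_two s).of_le (by norm_num)) continuous_const (hb1 _),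
    Finset.mul_sum]
  symm
  rw [Finset.sum_comm]
  refine Finset.sum_congr rfl fun j _ => ?_
  rw [Finset.sum_comm]
  refine Finset.sum_congr rfl fun s _ => Eq.symm ?_
  obtain ⟨Φ, hΦ⟩ : ∃ Φ : (Fin N → I) → (Fin N → E3) → ℝ≥0∞, ∀ i, Φ i = fun y => ∏ k, if k = j then ENNReal.ofReal (μ (i k) ^ 2) *
        ‖diracN (fun _ => 0) j (fun y t => b (i k) (y j) * Ψ y t) y s‖ₑ ^ 2 else ‖b (i k) (y k)‖ₑ ^ 2 :=
    ⟨_, fun _ => rfl⟩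
  have e0 : ∀ (i : Fin N → I) x, ‖diracN (fun _ => 0) j (trialTerm b μ d Ψ i) x s‖ₑ ^ 2 =
      ENNReal.ofReal (labelAmp μ i ^ 2) * Φ i (pullPos μ d i x) := fun i x => by
    rw [diracN_trialTerm h hc.smooth, hΦ]
    simp only
    rw [← Finset.mul_prod_erase _ _ (Finset.mem_univ j), if_pos rfl,
      Finset.prod_congr rfl fun k hk => if_neg (Finset.ne_of_mem_erase hk)]
    simp only [enorm_mul, mul_pow, ofReal_labelAmp, labelRest, enorm_prod_complex, Finset.prod_pow]
    rw [show ‖((μ (i j) : ℝ) : ℂ)‖ₑ ^ 2 = ENNReal.ofReal (μ (i j) ^ 2) by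
      rw [enorm_sq_eq_ofReal, Complex.norm_real, Real.norm_eq_abs, sq_abs]]
    ring
  have hm : ∀ i, Measurable (Φ i) := by
    intro i
    rw [hΦ]
    refine Finset.measurable_fun_prod _ fun k _ => ?_
    split_ifs
    · exact (hD _ j s).const_mul _
    · exact hc.measurable_weight _ _
  simp only [hc.enorm_diracN_trial_sq h, e0]
  have hm' : ∀ i, Measurable fun x => Φ i (pullPos μ d i x) := fun i =>
    (hm i).comp (contDiff_pullPos μ d i (n := 0)).continuous.measurable
  rw [lintegral_finsetSum _ fun i _ => (hm' i).const_mul _]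
  simp only [lintegral_const_mul' _ _ ENNReal.ofReal_ne_top]
  rw [Finset.sum_congr rfl fun i _ => lintegral_pullPos hc.pos d i (hm i),
    ← lintegral_finsetSum _ fun i _ => hm i]
  have e3 : ∀ y : Fin N → E3, ∑ i : Fin N → I, Φ i y =
      ∑ β, ENNReal.ofReal (μ β ^ 2) *
        ‖diracN (fun _ => 0) j (fun y t => b β (y j) * Ψ y t) y s‖ₑ ^ 2 := fun y => by
    simp only [hΦ]
    rw [sum_prod_eq_prod_sum fun k β => if k = j then ENNReal.ofReal (μ β ^ 2) *
      ‖diracN (fun _ => 0) j (fun y t => b β (y j) * Ψ y t) y s‖ₑ ^ 2 else ‖b β (y k)‖ₑ ^ 2,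
      Finset.prod_eq_single j]
    · simp
    · intro k _ hk
      simp [hk, hc.unit]
    · simp
  simp only [e3]
  rw [lintegral_finsetSum _ fun β _ => (hD β j s).const_mul _]
  simp only [lintegral_const_mul' _ _ ENNReal.ofReal_ne_top]

end CutData

theorem coul_smul {L : ℝ} (hL : 0 < L) (v : E3) : coul (L • v) = ENNReal.ofReal L⁻¹ * coul v := by
  unfold coul enorm3
  rw [← ENNReal.ofReal_mul (by positivity), ← mul_inv]
  congr 2
  rw [← Real.sqrt_sq hL.le, ← Real.sqrt_mul (sq_nonneg L), Real.sqrt_sq hL.le, Finset.mul_sum]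
  simp [mul_pow]

/-- The image of a point of a piece. -/
def pushOne {I : Type} (μ : I → ℝ) (d : I → E3) (i : I) (x : E3) : E3 := (μ i)⁻¹ • (x - d i)

theorem far_pieces {I : Type} [Fintype I] (K : Finset I) (c : I → E3) {R : ℝ} (hR : 0 < R) :
    ∃ L₀ : ℝ, 1 ≤ L₀ ∧ ∀ L, L₀ ≤ L → ∃ (μ : I → ℝ) (d : I → E3),
      (∀ i ∈ K, μ i = 1 ∧ ∀ x, pushOne μ d i x = x + c i) ∧ (∀ i ∉ K, μ i = L⁻¹) ∧
      ∀ i j, ¬ (i ∈ K ∧ j ∈ K) → ∀ x y, ‖x‖ ≤ R → ‖y‖ ≤ R → (i ≠ j → pushOne μ d i x ≠ pushOne μ d j y) ∧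
        coul (pushOne μ d i x - pushOne μ d j y) ≤ ENNReal.ofReal L⁻¹ * (1 + coul (x - y)) := by
  classical
  have hc0 : 0 ≤ ∑ i, ‖c i‖ := Finset.sum_nonneg fun i _ => norm_nonneg (c i)
  refine ⟨R + 1 + ∑ i, ‖c i‖, by linarith, fun L hL => ?_⟩
  have hcL : ∀ i, R + 1 + ‖c i‖ ≤ L := fun i => by
    have := Finset.single_le_sum (f := fun i => ‖c i‖) (fun i _ => norm_nonneg _) (Finset.mem_univ i)
    linarith
  have hL1 : 1 ≤ L := by linarith
  have hL0 : 0 < L := by linarith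
  obtain ⟨r, hr⟩ : ∃ r : I → ℝ, ∀ i, r i = ((Fintype.equivFin I i : ℕ) : ℝ) := ⟨_, fun _ => rfl⟩
  have hr0 : ∀ i, 0 ≤ r i := fun i => by rw [hr]; positivity
  have hr1 : ∀ i j, i ≠ j → 1 ≤ |r i - r j| := fun i j hij => by
    have h1 : (Fintype.equivFin I i : ℕ) ≠ (Fintype.equivFin I j : ℕ) := fun h =>
      hij ((Fintype.equivFin I).injective (Fin.ext h))
    rw [hr, hr]
    have h2 : (1 : ℤ) ≤ |((Fintype.equivFin I i : ℕ) : ℤ) - ((Fintype.equivFin I j : ℕ) : ℤ)| :=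
      Int.one_le_abs (by omega)
    exact_mod_cast h2
  set t : I → E3 := fun i => Pi.single 0 (4 * L * (R + 1) * (r i + 1)) with ht
  set μ : I → ℝ := fun i => if i ∈ K then 1 else L⁻¹ with hμ
  set d : I → E3 := fun i => if i ∈ K then -c i else -(L⁻¹ • t i) with hd
  have pK : ∀ i ∈ K, ∀ x, pushOne μ d i x = x + c i := fun i hi x => by simp [pushOne, hμ, hd, hi]
  have pn : ∀ i ∉ K, ∀ x, pushOne μ d i x = L • x + t i := fun i hi x => by
    simp [pushOne, hμ, hd, hi, smul_smul, hL0.ne']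
  have far : ∀ v : E3, L ≤ |v 0| → v ≠ 0 ∧ coul v ≤ ENNReal.ofReal L⁻¹ := fun v hv => by
    have h1 : L ≤ ‖v‖ := hv.trans (norm_le_pi_norm v 0)
    refine ⟨fun h0 => ?_, (coul_le v).trans (ENNReal.ofReal_le_ofReal (inv_anti₀ hL0 h1))⟩
    rw [h0, norm_zero] at h1
    linarith
  have hx0 : ∀ x : E3, ‖x‖ ≤ R → |x 0| ≤ R := fun x hx => (norm_le_pi_norm x 0).trans hx
  have t0 : ∀ i, t i 0 = 4 * L * (R + 1) * (r i + 1) := fun i => by simp [ht]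
  have mixed : ∀ i ∉ K, ∀ j ∈ K, ∀ x y, ‖x‖ ≤ R → ‖y‖ ≤ R →
      L ≤ |(pushOne μ d i x - pushOne μ d j y) 0| := fun i hi j hj x y hx hy => by
    rw [pn i hi, pK j hj]
    simp only [Pi.sub_apply, Pi.add_apply, Pi.smul_apply, smul_eq_mul, t0]
    have h1 := abs_le.1 (hx0 x hx)
    have h2 := abs_le.1 (hx0 y hy)
    have h3 := abs_le.1 (norm_le_pi_norm (c j) 0)
    have h4 := hcL j
    have h5 : L * (-R) ≤ L * x 0 := mul_le_mul_of_nonneg_left h1.1 hL0.le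
    have h6 : 4 * L * (R + 1) * 1 ≤ 4 * L * (R + 1) * (r i + 1) :=
      mul_le_mul_of_nonneg_left (by linarith [hr0 i]) (by positivity)
    have h7 : 0 < L * R := by positivity
    refine le_trans ?_ (le_abs_self _)
    nlinarith
  have step : ∀ v w : E3, L ≤ |v 0| → coul v ≤ ENNReal.ofReal L⁻¹ * (1 + coul w) := fun v w hv =>
    (far v hv).2.trans (le_mul_of_one_le_right' le_self_add)
  refine ⟨μ, d, fun i hi => ⟨by simp [hμ, hi], pK i hi⟩, fun i hi => by simp [hμ, hi], ?_⟩
  intro i j hij x y hx hy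
  by_cases hi : i ∈ K
  · have hj : j ∉ K := fun hj => hij ⟨hi, hj⟩
    have := mixed j hj i hi y x hy hx
    refine ⟨fun _ h => (far _ this).1 (sub_eq_zero.2 h.symm), ?_⟩
    rw [coul_sub_comm]
    exact step _ _ this
  · by_cases hj : j ∈ K
    · have := mixed i hi j hj x y hx hy
      exact ⟨fun _ h => (far _ this).1 (sub_eq_zero.2 h), step _ _ this⟩
    · by_cases h : i = j
      · subst h
        refine ⟨fun h => absurd rfl h, ?_⟩
        rw [pn i hi, pn i hi, add_sub_add_right_eq_sub, ← smul_sub, coul_smul hL0]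
        exact mul_le_mul' le_rfl le_add_self
      · have : L ≤ |(pushOne μ d i x - pushOne μ d j y) 0| := by
          rw [pn i hi, pn j hj]
          simp only [Pi.sub_apply, Pi.add_apply, Pi.smul_apply, smul_eq_mul, t0]
          have h1 := abs_le.1 (hx0 x hx)
          have h2 := abs_le.1 (hx0 y hy)
          have e : L * x 0 + 4 * L * (R + 1) * (r i + 1) - (L * y 0 + 4 * L * (R + 1) * (r j + 1)) =
              L * (x 0 - y 0 + 4 * (R + 1) * (r i - r j)) := by ring
          rw [e, abs_mul, abs_of_pos hL0]
          refine le_mul_of_one_le_right hL0.le ?_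
          rcases le_abs.1 (hr1 i j h) with h3 | h3
          · refine le_trans ?_ (le_abs_self _)
            nlinarith
          · refine le_trans ?_ (neg_le_abs _)
            nlinarith
        exact ⟨fun _ h => (far _ this).1 (sub_eq_zero.2 h), step _ _ this⟩

section

variable {N : ℕ} {I : Type} [Fintype I] [DecidableEq I] {Ψ : (Fin N → E3) → (Fin N → Fin 2) → ℂ}
  {b : I → E3 → ℂ} {μ : I → ℝ} {d : I → E3} {R : ℝ}

theorem CutData.isWaveFun (hc : CutData Ψ b μ d R) (h : IsWaveFun N Ψ) : IsWaveFun N (trial b μ d Ψ) := by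
  have ht := isTest_trial h.isTest hc.smooth hc.pos d
  refine ⟨ht.smooth, ht.compactSupport, trial_antisymm h b μ d, ?_⟩
  have h1 : ∑ s, ∫⁻ x, ‖trial b μ d Ψ x s‖ₑ ^ 2 = 1 := by
    have h2 := ht.lintegral_wfMeas (G := fun _ => 1) measurable_const
    simp only [one_mul] at h2
    rw [← h2, hc.lintegral_wfMeas_trial h.isTest measurable_const]
    have : ∀ y : Fin N → E3, ∑ i : Fin N → I, (∏ k, ‖b (i k) (y k)‖ₑ ^ 2) * 1 = 1 := fun y => by
      simp only [mul_one]
      rw [sum_prod_eq_prod_sum fun k β => ‖b β (y k)‖ₑ ^ 2]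
      simp [hc.unit]
    simp only [this, lintegral_one, h.wfMeas_univ]
  have h3 : ∀ s, ∫⁻ x, ‖trial b μ d Ψ x s‖ₑ ^ 2 = ENNReal.ofReal (∫ x, ‖trial b μ d Ψ x s‖ ^ 2) := fun s => by
    rw [ofReal_integral_eq_lintegral_ofReal]
    · exact lintegral_congr fun ω => enorm_sq_eq_ofReal _
    · exact integrable_norm_sq (ht.continuous s) (ht.compactSupport s)
    · exact Eventually.of_forall fun _ => by positivity
  simp only [h3] at h1
  rw [← ENNReal.ofReal_sum_of_nonneg fun s _ => integral_nonneg fun x => by positivity,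
    ENNReal.ofReal_eq_one] at h1
  exact h1

theorem ae_wfMeas_norm_le (hR : ∀ x s, R < ‖x‖ → Ψ x s = 0) (h : IsTest N Ψ) :
    ∀ᵐ x ∂(wfMeas Ψ), ‖x‖ ≤ R := by
  rw [wfMeas, ae_withDensity_iff h.measurable_dens]
  refine Eventually.of_forall fun x hx => ?_
  by_contra! hlt
  exact hx (Finset.sum_eq_zero fun s _ => by simp [hR x s hlt])

theorem CutData.attT_trial (hc : CutData Ψ b μ d R) (h : IsTest N Ψ) : attT (trial b μ d Ψ) =
    ∑ β, ∫⁻ x, ‖b β x‖ₑ ^ 2 * coul (pushOne μ d β x) * dens (sliceSum N) (oneFam Ψ) x := by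
  have hp : ∀ β, Measurable (pushOne μ d β) := fun β => by
    unfold pushOne
    fun_prop
  have hm : ∀ β, Measurable fun x => ‖b β x‖ₑ ^ 2 * coul (pushOne μ d β x) := fun β =>
    ((hc.smooth β).continuous.measurable.enorm.pow_const 2).mul (measurable_coul.comp (hp β))
  simp only [← h.sum_lintegral_wfMeas (hm _)]
  rw [Finset.sum_comm]
  refine Finset.sum_congr rfl fun j _ => ?_
  have hmj : ∀ β, Measurable fun x : Fin N → E3 => ‖b β (x j)‖ₑ ^ 2 * coul (pushOne μ d β (x j)) :=
    fun β => (hm β).comp (measurable_pi_apply j)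
  rw [hc.lintegral_wfMeas_trial h (G := fun x => coul (x j)) (measurable_coul.comp (measurable_pi_apply j)),
    ← lintegral_finsetSum _ fun β _ => hmj β]
  refine lintegral_congr fun y => ?_
  exact sum_prod_marginal (w := fun k β => ‖b β (y k)‖ₑ ^ 2) (fun k => hc.unit _) j
    fun β => coul (pushOne μ d β (y j))

theorem CutData.repT_trial_le (hc : CutData Ψ b μ d R) (h : IsTest N Ψ) (K : Finset I) {L : ℝ}
    (hK : ∀ i ∈ K, ∀ j ∈ K, ∀ x y, x ≠ y → b i x ≠ 0 → b j y ≠ 0 →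
      coul (pushOne μ d i x - pushOne μ d j y) ≤ coul (x - y))
    (hn : ∀ i j, ¬ (i ∈ K ∧ j ∈ K) → ∀ x y, ‖x‖ ≤ R → ‖y‖ ≤ R →
      coul (pushOne μ d i x - pushOne μ d j y) ≤ ENNReal.ofReal L⁻¹ * (1 + coul (x - y))) :
    repT (trial b μ d Ψ) ≤ (∫⁻ x : Fin N → E3, (∑ i, ∑ j, if i < j then
      (∑ β ∈ K, ‖b β (x i)‖ₑ ^ 2) * (∑ β ∈ K, ‖b β (x j)‖ₑ ^ 2) * coul (x i - x j) else 0) ∂(wfMeas Ψ)) +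
      ENNReal.ofReal L⁻¹ * ∫⁻ x : Fin N → E3, (∑ i, ∑ j, if i < j then 1 + coul (x i - x j) else 0)
        ∂(wfMeas Ψ) := by
  rw [repT, hc.lintegral_wfMeas_trial h measurable_pairCoul,
    ← lintegral_const_mul' _ _ ENNReal.ofReal_ne_top, ← lintegral_add_right]
  swap
  · refine Measurable.const_mul ?_ _
    refine Finset.measurable_fun_sum _ fun i _ => Finset.measurable_fun_sum _ fun j _ => ?_
    split_ifs
    · exact measurable_const.add (measurable_coul_sub i j)
    · exact measurable_const
  refine lintegral_mono_ae ?_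
  filter_upwards [ae_wfMeas_norm_le hc.radius h, ae_wfMeas_ne (Ψ := Ψ)] with y hy hne
  have hy' : ∀ k, ‖y k‖ ≤ R := fun k => (norm_le_pi_norm y k).trans hy
  set w : Fin N → I → ℝ≥0∞ := fun k β => ‖b β (y k)‖ₑ ^ 2 with hw
  have hw1 : ∀ k, ∑ β, w k β = 1 := fun k => hc.unit _
  have e1 : ∑ i : Fin N → I, (∏ k, ‖b (i k) (y k)‖ₑ ^ 2) * pairCoul (pushPos μ d i y) =
      ∑ j, ∑ l, if j < l then ∑ β, ∑ γ, w j β * w l γ *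
        coul (pushOne μ d β (y j) - pushOne μ d γ (y l)) else 0 := by
    unfold pairCoul
    simp only [Finset.mul_sum]
    rw [Finset.sum_comm]
    refine Finset.sum_congr rfl fun j _ => ?_
    rw [Finset.sum_comm]
    refine Finset.sum_congr rfl fun l _ => ?_
    split_ifs with hjl
    · exact sum_prod_marginal_pair (w := w) hw1 hjl.ne
        fun β γ => coul (pushOne μ d β (y j) - pushOne μ d γ (y l))
    · simp
  rw [e1, Finset.mul_sum, ← Finset.sum_add_distrib]
  refine Finset.sum_le_sum fun j _ => ?_
  rw [Finset.mul_sum, ← Finset.sum_add_distrib]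
  refine Finset.sum_le_sum fun l _ => ?_
  split_ifs with hjl
  swap
  · simp
  have e2 : (∑ β ∈ K, ‖b β (y j)‖ₑ ^ 2) * (∑ β ∈ K, ‖b β (y l)‖ₑ ^ 2) * coul (y j - y l) =
      ∑ β, ∑ γ, if β ∈ K ∧ γ ∈ K then w j β * w l γ * coul (y j - y l) else 0 := by
    have : ∀ β, (∑ γ, if β ∈ K ∧ γ ∈ K then w j β * w l γ * coul (y j - y l) else 0) =
        if β ∈ K then ∑ γ ∈ K, w j β * w l γ * coul (y j - y l) else 0 := fun β => by
      split_ifs with hβ <;> simp [hβ, Finset.sum_ite_mem]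
    simp only [this, Finset.sum_ite_mem, Finset.univ_inter]
    rw [Finset.sum_mul_sum, Finset.sum_mul]
    exact Finset.sum_congr rfl fun β _ => Finset.sum_mul _ _ _
  have e3 : ENNReal.ofReal L⁻¹ * (1 + coul (y j - y l)) =
      ∑ β, ∑ γ, w j β * w l γ * (ENNReal.ofReal L⁻¹ * (1 + coul (y j - y l))) := by
    simp only [← Finset.sum_mul, ← Finset.mul_sum, hw1, one_mul, mul_one]
  rw [e2, e3, ← Finset.sum_add_distrib]
  refine Finset.sum_le_sum fun β _ => ?_
  rw [← Finset.sum_add_distrib]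
  refine Finset.sum_le_sum fun γ _ => ?_
  split_ifs with hk
  · refine le_trans ?_ le_self_add
    by_cases h1 : b β (y j) = 0
    · simp [hw, h1]
    by_cases h2 : b γ (y l) = 0
    · simp [hw, h2]
    exact mul_le_mul' le_rfl (hK β hk.1 γ hk.2 _ _ (hne j l hjl.ne) h1 h2)
  · rw [zero_add]
    exact mul_le_mul' le_rfl (hn β γ hk _ _ (hy' j) (hy' l))

theorem nf_le_of_cut (h : IsWaveFun N Ψ) (hN : 1 ≤ N) (hb : ∀ i, ContDiff ℝ (⊤ : ℕ∞) (b i))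
    (hflat : ∀ i y, b i y = 0 → fderiv ℝ (b i) y = 0) (hunit : ∀ y, ∑ i, ‖b i y‖ₑ ^ 2 = 1) (K : Finset I)
    (c : I → E3) (hK : ∀ i ∈ K, ∀ j ∈ K, ∀ x y, b i x ≠ 0 → b j y ≠ 0 →
      (i ≠ j → x + c i ≠ y + c j) ∧ (x ≠ y → coul (x + c i - (y + c j)) ≤ coul (x - y)))
    {Z α E₀ : ℝ} (hZ : 0 ≤ Z) (hE : ∀ E ∈ nfSet Z α, E₀ ≤ E) :
    E₀ + Z * (∑ β ∈ K, ∫⁻ x, ‖b β x‖ₑ ^ 2 * coul (x + c β) * dens (sliceSum N) (oneFam Ψ) x).toReal ≤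
      (∑ β ∈ K, ∫⁻ x, kinD (sliceSum N) (fun _ => 0) (fun p x s => b β x * oneFam Ψ p x s) x).toReal +
      (∫⁻ x : Fin N → E3, (∑ i, ∑ j, if i < j then
      (∑ β ∈ K, ‖b β (x i)‖ₑ ^ 2) * (∑ β ∈ K, ‖b β (x j)‖ₑ ^ 2) * coul (x i - x j) else 0)
        ∂(wfMeas Ψ)).toReal := by
  obtain ⟨R, hR, hrad⟩ := h.isTest.exists_radius
  obtain ⟨L₀, hL₀, hfar⟩ := far_pieces K c hR
  obtain ⟨k, hk⟩ : ∃ k : I → ℝ≥0∞, ∀ β, k β =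
    ∫⁻ x, kinD (sliceSum N) (fun _ => 0) (fun p x s => b β x * oneFam Ψ p x s) x := ⟨_, fun _ => rfl⟩
  obtain ⟨Rk, hRk⟩ : ∃ q, q = ∫⁻ x : Fin N → E3, (∑ i, ∑ j, if i < j then
      (∑ β ∈ K, ‖b β (x i)‖ₑ ^ 2) * (∑ β ∈ K, ‖b β (x j)‖ₑ ^ 2) * coul (x i - x j) else 0)
        ∂(wfMeas Ψ) := ⟨_, rfl⟩
  obtain ⟨D, hD⟩ : ∃ q, q = ∫⁻ x : Fin N → E3, (∑ i, ∑ j, if i < j then 1 + coul (x i - x j) else 0)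
        ∂(wfMeas Ψ) := ⟨_, rfl⟩
  have hDtop : D ≠ ∞ := by
    rw [hD, lintegral_finsetSum _ fun i _ => ?_]
    · refine ENNReal.sum_ne_top.2 fun i _ => ?_
      rw [lintegral_finsetSum _ fun j _ => ?_]
      · refine ENNReal.sum_ne_top.2 fun j _ => ?_
        split_ifs with hij
        · rw [lintegral_add_left measurable_const]
          refine ENNReal.add_ne_top.2 ⟨by simp [h.wfMeas_univ], ?_⟩
          exact h.isTest.lintegral_coul_sub_ne_top hij.ne
        · simp
      · split_ifs
        · exact measurable_const.add (measurable_coul_sub i j)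
        · exact measurable_const
    · refine Finset.measurable_fun_sum _ fun j _ => ?_
      split_ifs
      · exact measurable_const.add (measurable_coul_sub i j)
      · exact measurable_const
  have hle1 : ∀ y, ∑ β ∈ K, ‖b β y‖ₑ ^ 2 ≤ 1 := fun y =>
    (Finset.sum_le_univ_sum_of_nonneg fun _ => zero_le).trans (hunit y).le
  have hRktop : Rk ≠ ∞ := by
    refine ne_top_of_le_ne_top hDtop ?_
    rw [hRk, hD]
    refine lintegral_mono fun x => Finset.sum_le_sum fun i _ => Finset.sum_le_sum fun j _ => ?_
    split_ifs
    · refine (mul_le_of_le_one_left' (mul_le_one' (hle1 _) (hle1 _))).trans le_add_self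
    · exact le_rfl
  simp only [← hk, ← hRk]
  have key : ∀ L, L₀ ≤ L → E₀ + Z * (∑ β ∈ K, ∫⁻ x, ‖b β x‖ₑ ^ 2 * coul (x + c β) *
      dens (sliceSum N) (oneFam Ψ) x).toReal ≤
      (∑ β ∈ K, k β).toReal + Rk.toReal + L⁻¹ * ((∑ β ∈ Kᶜ, k β).toReal + D.toReal) := by
    intro L hL
    have hL1 : 1 ≤ L := hL₀.trans hL
    have hL0 : 0 < L := by linarith
    obtain ⟨μ, d, h1, h2, h3⟩ := hfar L hL
    have hpos : ∀ i, 0 < μ i := fun i => by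
      by_cases hi : i ∈ K
      · rw [(h1 i hi).1]; exact one_pos
      · rw [h2 i hi]; positivity
    have hc : CutData Ψ b μ d R := by
      refine ⟨hb, hflat, hunit, hpos, hrad, fun i j hij x y hx hy hbx hby => ?_⟩
      by_cases hij' : i ∈ K ∧ j ∈ K
      · have := (hK i hij'.1 j hij'.2 x y hbx hby).1 hij
        rw [← (h1 i hij'.1).2, ← (h1 j hij'.2).2] at this
        exact this
      · exact (h3 i j hij' x y hx hy).1 hij
    have ht := (hc.isWaveFun h).isTest
    have hen := hE _ ⟨N, hN, trial b μ d Ψ, hc.isWaveFun h, rfl⟩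
    rw [ht.clPauliEnergy_eq continuous_const] at hen
    have hcurl : ∫ x, curlSq (fun _ => 0) x = 0 := by
      simp [curlSq, curl3, pdVec, Fin.sum_univ_three]
    rw [hcurl, mul_zero, add_zero] at hen
    have hkt : kinT (fun _ => 0) (trial b μ d Ψ) ≠ ∞ := by
      rw [ht.kinT_eq continuous_const]
      exact ENNReal.ofReal_ne_top
    have ekin := hc.kinT_trial h.isTest
    simp only [← hk] at ekin
    have hkfin : ∀ β, k β ≠ ∞ := fun β hβ => by
      refine hkt ?_
      rw [ekin, ENNReal.sum_eq_top]
      refine ⟨β, Finset.mem_univ β, ?_⟩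
      rw [hβ, ENNReal.mul_top]
      have := hpos β
      simpa using this.ne'
    have kle : kinT (fun _ => 0) (trial b μ d Ψ) ≤
        (∑ β ∈ K, k β) + ENNReal.ofReal L⁻¹ * ∑ β ∈ Kᶜ, k β := by
      rw [ekin, ← Finset.sum_add_sum_compl K, Finset.mul_sum]
      refine add_le_add (Finset.sum_le_sum fun β hβ => ?_) (Finset.sum_le_sum fun β hβ => ?_)
      · simp [(h1 β hβ).1]
      · rw [h2 β (Finset.mem_compl.1 hβ)]
        refine mul_le_mul' (ENNReal.ofReal_le_ofReal ?_) le_rfl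
        have : L⁻¹ ≤ 1 := inv_le_one_of_one_le₀ hL1
        have : 0 < L⁻¹ := by positivity
        nlinarith
    have fK : ∑ β ∈ K, k β ≠ ∞ := ENNReal.sum_ne_top.2 fun β _ => hkfin β
    have fKc : ∑ β ∈ Kᶜ, k β ≠ ∞ := ENNReal.sum_ne_top.2 fun β _ => hkfin β
    have kle' := ENNReal.toReal_mono (ENNReal.add_ne_top.2 ⟨fK, ENNReal.mul_ne_top ENNReal.ofReal_ne_top fKc⟩) kle
    rw [ENNReal.toReal_add fK (ENNReal.mul_ne_top ENNReal.ofReal_ne_top fKc), ENNReal.toReal_mul,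
      ENNReal.toReal_ofReal (by positivity)] at kle'
    have rle := hc.repT_trial_le h.isTest K (L := L) (fun i hi j hj x y hxy hx hy => by
      rw [(h1 i hi).2, (h1 j hj).2]
      exact (hK i hi j hj x y hx hy).2 hxy) fun i j hij x y hx hy => (h3 i j hij x y hx hy).2
    rw [← hRk, ← hD] at rle
    have rle' := ENNReal.toReal_mono (ENNReal.add_ne_top.2 ⟨hRktop, ENNReal.mul_ne_top ENNReal.ofReal_ne_top hDtop⟩) rle
    rw [ENNReal.toReal_add hRktop (ENNReal.mul_ne_top ENNReal.ofReal_ne_top hDtop), ENNReal.toReal_mul,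
      ENNReal.toReal_ofReal (by positivity)] at rle'
    have ale : (∑ β ∈ K, ∫⁻ x, ‖b β x‖ₑ ^ 2 * coul (x + c β) * dens (sliceSum N) (oneFam Ψ) x).toReal ≤
        (attT (trial b μ d Ψ)).toReal := by
      refine ENNReal.toReal_mono ht.attT_ne_top ?_
      rw [hc.attT_trial h.isTest]
      refine le_trans (Finset.sum_le_sum fun β hβ => ?_)
        (Finset.sum_le_univ_sum_of_nonneg (s := K) fun _ => zero_le)
      simp only [(h1 β hβ).2]
      exact le_rfl
    have := mul_le_mul_of_nonneg_left ale hZ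
    linarith
  have hlim : Tendsto (fun L : ℝ => (∑ β ∈ K, k β).toReal + Rk.toReal + L⁻¹ *
      ((∑ β ∈ Kᶜ, k β).toReal + D.toReal)) atTop
      (𝓝 ((∑ β ∈ K, k β).toReal + Rk.toReal + 0 * ((∑ β ∈ Kᶜ, k β).toReal + D.toReal))) :=
    tendsto_const_nhds.add (tendsto_inv_atTop_zero.mul_const _)
  rw [zero_mul, add_zero] at hlim
  exact ge_of_tendsto hlim (eventually_atTop.2 ⟨L₀, key⟩)

end

theorem exists_bump_line : ∃ C : ℝ, 0 < C ∧ ∀ δ : ℝ, 0 < δ → δ ≤ 1 / 8 → ∃ g : ℝ → ℝ,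
    ContDiff ℝ (⊤ : ℕ∞) g ∧ (∀ t, 0 ≤ g t) ∧ (∀ t, g t ≤ 1) ∧ (∀ t, g t ≠ 0 → |t| < 1 / 2 + δ) ∧
    (∀ t, |deriv g t| ≤ C / δ) ∧
    ∀ (K : ℕ) (t : ℝ), |t| ≤ K → ∑ m ∈ Finset.range (2 * K + 1), g (t + K - m) ^ 2 = 1 := by
  have hSc : ContDiff ℝ (⊤ : ℕ∞) Real.smoothTransition := Real.smoothTransition.contDiff
  have hSd : Differentiable ℝ Real.smoothTransition := hSc.differentiable (by simp)
  obtain ⟨B, hB⟩ := (isCompact_Icc (a := (0 : ℝ)) (b := 1)).exists_bound_of_continuousOn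
    (hSc.continuous_deriv (by simp)).continuousOn
  have hB' : ∀ x, |deriv Real.smoothTransition x| ≤ |B| := fun x => by
    rcases le_or_gt x 0 with hx | hx
    · have : IsLocalMin Real.smoothTransition x := Eventually.of_forall fun y => by
        rw [Real.smoothTransition.zero_of_nonpos hx]
        exact Real.smoothTransition.nonneg y
      rw [this.deriv_eq_zero, abs_zero]
      exact abs_nonneg B
    rcases le_or_gt 1 x with hx1 | hx1
    · have : IsLocalMax Real.smoothTransition x := Eventually.of_forall fun y => by
        rw [Real.smoothTransition.one_of_one_le hx1]
        exact Real.smoothTransition.le_one y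
      rw [this.deriv_eq_zero, abs_zero]
      exact abs_nonneg B
    · exact (hB x ⟨hx.le, hx1.le⟩).trans (le_abs_self B)
  have hpi := Real.pi_pos
  refine ⟨Real.pi * (|B| + 1), by positivity, fun δ hδ hδ' => ?_⟩
  set θ : ℝ → ℝ := fun t => Real.pi / 2 * Real.smoothTransition ((t + 1 / 2 + δ) / (2 * δ)) with hθ
  have θ0 : ∀ t, 0 ≤ θ t := fun t => mul_nonneg (by positivity) (Real.smoothTransition.nonneg _)
  have θ1 : ∀ t, θ t ≤ Real.pi / 2 := fun t =>
    mul_le_of_le_one_right (by positivity) (Real.smoothTransition.le_one _)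
  have θlo : ∀ t, t ≤ -(1 / 2 + δ) → θ t = 0 := fun t ht => by
    simp only [hθ]
    rw [Real.smoothTransition.zero_of_nonpos (div_nonpos_of_nonpos_of_nonneg (by linarith) (by linarith)),
      mul_zero]
  have θhi : ∀ t, -(1 / 2) + δ ≤ t → θ t = Real.pi / 2 := fun t ht => by
    simp only [hθ]
    rw [Real.smoothTransition.one_of_one_le ((one_le_div (by linarith)).2 (by linarith)), mul_one]
  have hs : ∀ t, 0 ≤ Real.sin (θ t) := fun t => Real.sin_nonneg_of_nonneg_of_le_pi (θ0 t)
    ((θ1 t).trans (by linarith))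
  have hcs : ∀ t, 0 ≤ Real.cos (θ t) := fun t => Real.cos_nonneg_of_neg_pi_div_two_le_of_le
    ((by linarith : -(Real.pi / 2) ≤ 0).trans (θ0 t)) (θ1 t)
  have hθc : ContDiff ℝ (⊤ : ℕ∞) θ := contDiff_const.mul (hSc.comp (by fun_prop))
  have hθd : ∀ t, ∃ v, |v| ≤ Real.pi / 4 * |B| / δ ∧ HasDerivAt θ v t := fun t => by
    have h1 : HasDerivAt (fun t : ℝ => (t + 1 / 2 + δ) / (2 * δ)) (1 / (2 * δ)) t :=
      (((hasDerivAt_id t).add_const _).add_const _).div_const _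
    have h2 := ((hSd ((t + 1 / 2 + δ) / (2 * δ))).hasDerivAt.comp t h1).const_mul (Real.pi / 2)
    refine ⟨_, ?_, h2⟩
    rw [abs_mul, abs_mul, abs_of_pos (by positivity : 0 < Real.pi / 2),
      abs_of_pos (by positivity : 0 < 1 / (2 * δ))]
    have := mul_le_mul_of_nonneg_left (hB' ((t + 1 / 2 + δ) / (2 * δ)))
      (by positivity : 0 ≤ Real.pi / 2 * (1 / (2 * δ)))
    calc _ = Real.pi / 2 * (1 / (2 * δ)) * |deriv Real.smoothTransition ((t + 1 / 2 + δ) / (2 * δ))| := by ring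
      _ ≤ _ := this
      _ = _ := by field_simp; ring
  refine ⟨fun t => Real.sin (θ t) * Real.cos (θ (t - 1)), ?_, fun t => mul_nonneg (hs t) (hcs _), fun t => ?_,
    fun t ht => ?_, fun t => ?_, fun K t ht => ?_⟩
  · exact (Real.contDiff_sin.comp hθc).mul (Real.contDiff_cos.comp (hθc.comp (by fun_prop)))
  · exact mul_le_one₀ (Real.sin_le_one _) (hcs _) (Real.cos_le_one _)
  · by_contra! hlt
    rcases le_abs.1 hlt with h | h
    · exact ht (by simp [θhi (t - 1) (by linarith)])
    · exact ht (by simp [θlo t (by linarith)])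
  · obtain ⟨v, hv, hv'⟩ := hθd t
    obtain ⟨w, hw, hw'⟩ := hθd (t - 1)
    have h1 := hv'.sin.mul (hw'.comp t ((hasDerivAt_id t).sub_const 1)).cos
    have h2 : deriv (fun t => Real.sin (θ t) * Real.cos (θ (t - 1))) t = _ := h1.deriv
    rw [h2]
    have e1 : |Real.cos (θ t) * v * Real.cos (θ (t - 1))| ≤ |v| := by
      rw [abs_mul, abs_mul]
      exact (mul_le_of_le_one_right (by positivity) (Real.abs_cos_le_one _)).trans
        (mul_le_of_le_one_left (abs_nonneg _) (Real.abs_cos_le_one _))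
    have e2 : |Real.sin (θ t) * (-Real.sin (θ (t - 1)) * (w * 1))| ≤ |w| := by
      rw [abs_mul, abs_mul, abs_neg, mul_one]
      exact (mul_le_of_le_one_left (by positivity) (Real.abs_sin_le_one _)).trans
        (mul_le_of_le_one_left (abs_nonneg _) (Real.abs_sin_le_one _))
    refine (abs_add_le _ _).trans ((add_le_add e1 e2).trans ?_)
    calc |v| + |w| ≤ Real.pi / 4 * |B| / δ + Real.pi / 4 * |B| / δ := add_le_add hv hw
      _ = Real.pi * |B| / 2 / δ := by ring
      _ ≤ _ := by
        gcongr
        nlinarith [abs_nonneg B]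
  · have tele : ∀ s, (Real.sin (θ s) * Real.cos (θ (s - 1))) ^ 2 =
        Real.sin (θ s) ^ 2 - Real.sin (θ (s - 1)) ^ 2 := fun s => by
      rcases le_or_gt (s - 1) (-(1 / 2 + δ)) with h | h
      · rw [θlo _ h]; simp
      · rw [θhi s (by linarith)]
        simp [Real.cos_sq']
    have h1 := abs_le.1 ht
    have h2 := Finset.sum_range_sub' (fun m : ℕ => Real.sin (θ (t + K - m)) ^ 2) (2 * K + 1)
    simp only [tele]
    push_cast at h2
    rw [θhi (t + K - 0) (by linarith), θlo (t + K - (2 * K + 1)) (by linarith)] at h2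
    simp only [Real.sin_pi_div_two, Real.sin_zero] at h2
    simp only [sub_sub]
    linarith

theorem exists_radial_partition : ∃ C : ℝ, 0 < C ∧ ∀ R : ℝ, 0 < R → ∃ p q : E3 → ℝ,
    ContDiff ℝ (⊤ : ℕ∞) p ∧ ContDiff ℝ (⊤ : ℕ∞) q ∧ (∀ x, 0 ≤ p x) ∧ (∀ x, 0 ≤ q x) ∧
    (∀ x, p x ^ 2 + q x ^ 2 = 1) ∧ (∀ x, p x ≠ 0 → ‖x‖ < 2 * R) ∧ (∀ x, q x ≠ 0 → R / 2 ≤ ‖x‖) ∧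
    (∀ x k, |fderiv ℝ p x (Pi.single k 1)| ≤ C / R) ∧ ∀ x k, |fderiv ℝ q x (Pi.single k 1)| ≤ C / R := by
  have hSc : ContDiff ℝ (⊤ : ℕ∞) Real.smoothTransition := Real.smoothTransition.contDiff
  set w : E3 → ℝ := fun x => Real.pi / 2 * Real.smoothTransition (∑ k, x k ^ 2 - 1) with hw
  have hwc : ContDiff ℝ (⊤ : ℕ∞) w := contDiff_const.mul (hSc.comp (by fun_prop))
  have hpi := Real.pi_pos
  have w0 : ∀ t, 0 ≤ w t := fun t => mul_nonneg (by positivity) (Real.smoothTransition.nonneg _)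
  have w1 : ∀ t, w t ≤ Real.pi / 2 := fun t =>
    mul_le_of_le_one_right (by positivity) (Real.smoothTransition.le_one _)
  have wlo : ∀ x : E3, ‖x‖ ≤ 1 / 2 → w x = 0 := fun x hx => by
    simp only [hw]
    rw [Real.smoothTransition.zero_of_nonpos, mul_zero]
    have : ∀ k, x k ^ 2 ≤ 1 / 4 := fun k => by
      have := abs_le.1 ((norm_le_pi_norm x k).trans hx)
      nlinarith
    rw [Fin.sum_univ_three]
    linarith [this 0, this 1, this 2]
  have whi : ∀ x : E3, 2 ≤ ‖x‖ → w x = Real.pi / 2 := fun x hx => by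
    simp only [hw]
    rw [Real.smoothTransition.one_of_one_le, mul_one]
    by_contra! hlt
    have h3 : ∀ k, x k ^ 2 < 2 := fun k => by
      have := Finset.single_le_sum (f := fun k => x k ^ 2) (fun k _ => sq_nonneg _) (Finset.mem_univ k)
      linarith
    have : ‖x‖ < 2 := (pi_norm_lt_iff two_pos).2 fun k => by
      rw [Real.norm_eq_abs]
      exact abs_lt_of_sq_lt_sq (by linarith [h3 k]) two_pos.le
    linarith
  have hP : ContDiff ℝ (⊤ : ℕ∞) fun x => Real.cos (w x) := Real.contDiff_cos.comp hwc
  have hQ : ContDiff ℝ (⊤ : ℕ∞) fun x => Real.sin (w x) := Real.contDiff_sin.comp hwc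
  have hP0 : ∀ x, 0 ≤ Real.cos (w x) := fun t => Real.cos_nonneg_of_neg_pi_div_two_le_of_le
    ((by linarith : -(Real.pi / 2) ≤ 0).trans (w0 t)) (w1 t)
  obtain ⟨B, hB⟩ := (isCompact_closedBall (0 : E3) 2).exists_bound_of_continuousOn
    (hP.continuous_fderiv (by simp)).continuousOn
  obtain ⟨B', hB'⟩ := (isCompact_closedBall (0 : E3) 2).exists_bound_of_continuousOn
    (hQ.continuous_fderiv (by simp)).continuousOn
  have bP : ∀ x, ‖fderiv ℝ (fun x => Real.cos (w x)) x‖ ≤ |B| + |B'| + 1 := fun x => by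
    rcases le_or_gt ‖x‖ 2 with hx | hx
    · have := hB x (by simpa using hx)
      linarith [le_abs_self B, abs_nonneg B']
    · have : IsLocalMin (fun x => Real.cos (w x)) x := Eventually.of_forall fun y => by
        simp only [whi x hx.le, Real.cos_pi_div_two]
        exact hP0 y
      rw [this.fderiv_eq_zero, norm_zero]
      positivity
  have bQ : ∀ x, ‖fderiv ℝ (fun x => Real.sin (w x)) x‖ ≤ |B| + |B'| + 1 := fun x => by
    rcases le_or_gt ‖x‖ 2 with hx | hx
    · have := hB' x (by simpa using hx)
      linarith [le_abs_self B', abs_nonneg B]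
    · have : IsLocalMax (fun x => Real.sin (w x)) x := Eventually.of_forall fun y => by
        simp only [whi x hx.le, Real.sin_pi_div_two]
        exact Real.sin_le_one _
      rw [this.fderiv_eq_zero, norm_zero]
      positivity
  refine ⟨|B| + |B'| + 1, by positivity, fun R hR => ?_⟩
  have scale : ∀ f : E3 → ℝ, (∀ x, ‖fderiv ℝ f x‖ ≤ |B| + |B'| + 1) → Differentiable ℝ f → ∀ x k,
      |fderiv ℝ (fun x => f (R⁻¹ • x)) x (Pi.single k 1)| ≤ (|B| + |B'| + 1) / R := fun f hf hd x k => by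
    have h1 : HasFDerivAt (fun x : E3 => R⁻¹ • x) (R⁻¹ • ContinuousLinearMap.id ℝ E3) x :=
      (hasFDerivAt_id x).const_smul R⁻¹
    have h2 := (hd (R⁻¹ • x)).hasFDerivAt.comp x h1
    have h3 : fderiv ℝ (fun x => f (R⁻¹ • x)) x = _ := h2.fderiv
    rw [h3, ← Real.norm_eq_abs]
    simp only [ContinuousLinearMap.coe_comp, Function.comp_apply, _root_.smul_apply,
      ContinuousLinearMap.id_apply, map_smul, norm_smul]
    rw [Real.norm_eq_abs, abs_of_pos (by positivity), inv_mul_eq_div]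
    gcongr
    refine (ContinuousLinearMap.le_opNorm _ _).trans ?_
    have : ‖(Pi.single k 1 : E3)‖ = 1 := by rw [Pi.norm_single]; simp
    rw [this, mul_one]
    exact hf _
  have hn : ∀ x : E3, ‖R⁻¹ • x‖ = ‖x‖ / R := fun x => by
    rw [norm_smul, Real.norm_eq_abs, abs_of_pos (by positivity), inv_mul_eq_div]
  refine ⟨fun x => Real.cos (w (R⁻¹ • x)), fun x => Real.sin (w (R⁻¹ • x)), hP.comp (by fun_prop),
    hQ.comp (by fun_prop), fun x => hP0 _, fun x => Real.sin_nonneg_of_nonneg_of_le_pi (w0 _)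
    ((w1 _).trans (by linarith)), fun x => Real.cos_sq_add_sin_sq _, fun x hx => ?_, fun x hx => ?_,
    scale _ bP (hP.differentiable (by simp)), scale _ bQ (hQ.differentiable (by simp))⟩
  · by_contra! h
    exact hx (by simp [whi (R⁻¹ • x) (by rw [hn]; exact (le_div_iff₀ hR).2 h)])
  · by_contra! h
    exact hx (by simp [wlo (R⁻¹ • x) (by rw [hn]; exact (div_le_iff₀ hR).2 (by linarith))])

theorem sum_ite_abs_sub_le (n : ℕ) (y : ℝ) {r : ℝ} (hr : 0 ≤ r) :
    ∑ m : Fin n, (if |y - ((m : ℕ) : ℝ)| ≤ r then (1 : ℝ≥0∞) else 0) ≤ ENNReal.ofReal (2 * r + 1) := by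
  classical
  rw [Finset.sum_boole, ← ENNReal.ofReal_natCast]
  refine ENNReal.ofReal_le_ofReal ?_
  have h1 : (Finset.univ.filter fun m : Fin n => |y - ((m : ℕ) : ℝ)| ≤ r).card ≤
      (Finset.Icc ⌈y - r⌉ ⌊y + r⌋).card := by
    refine Finset.card_le_card_of_injOn (fun m => ((m : ℕ) : ℤ)) (fun m hm => ?_) fun m _ m' _ h => ?_
    · have := abs_le.1 (Finset.mem_filter.1 hm).2
      rw [Finset.mem_coe, Finset.mem_Icc]
      exact ⟨Int.ceil_le.2 (by push_cast; linarith), Int.le_floor.2 (by push_cast; linarith)⟩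
    · exact Fin.ext (Int.ofNat.inj h)
  rw [Int.card_Icc] at h1
  have h2 : (((⌊y + r⌋ + 1 - ⌈y - r⌉).toNat : ℕ) : ℝ) ≤ 2 * r + 1 := by
    have h3 := Int.floor_le (y + r)
    have h4 := Int.le_ceil (y - r)
    rcases le_or_gt 0 (⌊y + r⌋ + 1 - ⌈y - r⌉) with h | h
    · have h5 : (((⌊y + r⌋ + 1 - ⌈y - r⌉).toNat : ℤ) : ℝ) = ((⌊y + r⌋ + 1 - ⌈y - r⌉ : ℤ) : ℝ) := by
        rw [Int.toNat_of_nonneg h]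
      push_cast at h5
      linarith
    · rw [Int.toNat_of_nonpos h.le]
      push_cast
      linarith
  exact le_trans (by exact_mod_cast h1) h2

/-- Centers of a cubic grid. -/
def gridPt {n : ℕ} (l : ℝ) (K : ℕ) (u : Fin 3 → Fin n) : E3 := fun k => l * (((u k : ℕ) : ℝ) - K)

theorem sum_gridPt_le {n : ℕ} {l : ℝ} (hl : 0 < l) (K : ℕ) {r : ℝ} (hr : 0 ≤ r) (x : E3) :
    ∑ u : Fin 3 → Fin n, (if ‖x - gridPt l K u‖ ≤ r * l then (1 : ℝ≥0∞) else 0) ≤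
      ENNReal.ofReal ((2 * r + 1) ^ 3) := by
  have h1 : ∀ u : Fin 3 → Fin n, (if ‖x - gridPt l K u‖ ≤ r * l then (1 : ℝ≥0∞) else 0) =
      ∏ k, if |x k / l + K - ((u k : ℕ) : ℝ)| ≤ r then (1 : ℝ≥0∞) else 0 := fun u => by
    have h2 : ‖x - gridPt l K u‖ ≤ r * l ↔ ∀ k, |x k / l + K - ((u k : ℕ) : ℝ)| ≤ r := by
      rw [pi_norm_le_iff_of_nonneg (by positivity)]
      refine forall_congr' fun k => ?_
      have e : (x - gridPt l K u) k = l * (x k / l + K - ((u k : ℕ) : ℝ)) := by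
        simp only [Pi.sub_apply, gridPt]
        field_simp
        ring
      rw [e, Real.norm_eq_abs, abs_mul, abs_of_pos hl, mul_comm, mul_le_mul_iff_left₀ hl]
    rw [Finset.prod_ite_zero]
    simp [h2]
  simp only [h1]
  rw [sum_prod_eq_prod_sum fun k (m : Fin n) => if |x k / l + K - ((m : ℕ) : ℝ)| ≤ r then (1 : ℝ≥0∞) else 0,
    ENNReal.ofReal_pow (by positivity)]
  refine (Finset.prod_le_prod' fun k _ => sum_ite_abs_sub_le n (x k / l + K) hr).trans ?_
  simp

theorem sum_setLIntegral_gridPt_le {n : ℕ} {l : ℝ} (hl : 0 < l) (K : ℕ) {f : E3 → ℝ≥0∞}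
    (hf : Measurable f) :
    ∑ u : Fin 3 → Fin n, ∫⁻ x in Metric.closedBall (gridPt l K u) (4 * l), f x ≤ 729 * ∫⁻ x, f x := by
  have hm : ∀ u : Fin 3 → Fin n, Measurable ((Metric.closedBall (gridPt l K u) (4 * l)).indicator f) :=
    fun u => hf.indicator Metric.isClosed_closedBall.measurableSet
  simp only [← lintegral_indicator Metric.isClosed_closedBall.measurableSet]
  rw [← lintegral_finsetSum _ fun u _ => hm u, ← lintegral_const_mul _ hf]
  refine lintegral_mono fun x => ?_
  have h1 : ∀ u : Fin 3 → Fin n, (Metric.closedBall (gridPt l K u) (4 * l)).indicator f x =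
      (if ‖x - gridPt l K u‖ ≤ 4 * l then 1 else 0) * f x := fun u => by
    by_cases hx : ‖x - gridPt l K u‖ ≤ 4 * l
    · rw [Set.indicator_of_mem (by rwa [Metric.mem_closedBall, dist_eq_norm]), if_pos hx, one_mul]
    · rw [Set.indicator_of_notMem (by rwa [Metric.mem_closedBall, dist_eq_norm]), if_neg hx, zero_mul]
  simp only [h1, ← Finset.sum_mul]
  refine mul_le_mul' ((sum_gridPt_le hl K (by norm_num) x).trans ?_) le_rfl
  rw [← ENNReal.ofReal_ofNat]
  exact ENNReal.ofReal_le_ofReal (by norm_num)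

theorem abs_fderiv_mul_le {f g : E3 → ℝ} {x : E3} (hf : DifferentiableAt ℝ f x)
    (hg : DifferentiableAt ℝ g x) (h1 : |f x| ≤ 1) (h2 : |g x| ≤ 1) (v : E3) :
    |fderiv ℝ (fun x => f x * g x) x v| ≤ |fderiv ℝ f x v| + |fderiv ℝ g x v| := by
  rw [show fderiv ℝ (fun x => f x * g x) x = _ from (hf.hasFDerivAt.mul hg.hasFDerivAt).fderiv]
  simp only [_root_.add_apply, _root_.smul_apply, smul_eq_mul]
  refine (abs_add_le _ _).trans ?_
  rw [abs_mul, abs_mul, add_comm]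
  exact add_le_add (mul_le_of_le_one_left (abs_nonneg _) h2) (mul_le_of_le_one_left (abs_nonneg _) h1)

theorem gradE_le_of_abs_le {f : E3 → ℝ} {x : E3} {B : ℝ}
    (h : ∀ k, |fderiv ℝ f x (Pi.single k 1)| ≤ B) : gradE f x ≤ ENNReal.ofReal (3 * B ^ 2) := by
  have hB : 0 ≤ B := (abs_nonneg _).trans (h 0)
  have h1 : ∀ k, ‖fderiv ℝ f x (Pi.single k 1)‖ₑ ^ 2 ≤ ENNReal.ofReal (B ^ 2) := fun k => by
    rw [← ofReal_norm, ← ENNReal.ofReal_pow (norm_nonneg _), Real.norm_eq_abs]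
    exact ENNReal.ofReal_le_ofReal (pow_le_pow_left₀ (abs_nonneg _) (h k) 2)
  refine (Finset.sum_le_sum fun k _ => h1 k).trans ?_
  rw [Finset.sum_const, Finset.card_univ, Fintype.card_fin, nsmul_eq_mul, ENNReal.ofReal_mul (by norm_num)]
  simp

theorem gradE_eq_zero_of_eq_zero {f : E3 → ℝ} {x : E3} (h : ∀ y, 0 ≤ f y) (hx : f x = 0) :
    gradE f x = 0 := by
  have : IsLocalMin f x := Eventually.of_forall fun y => hx.trans_le (h y)
  simp [gradE, this.fderiv_eq_zero]

theorem exists_partition : ∃ C : ℝ, 0 < C ∧ ∀ δ l R : ℝ, 0 < δ → δ ≤ 1 / 8 → 0 < l → l ≤ R →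
    ∃ (n K : ℕ) (a : Option (Fin 3 → Fin n) → E3 → ℝ), (∀ i, ContDiff ℝ (⊤ : ℕ∞) (a i)) ∧
    (∀ i x, 0 ≤ a i x) ∧ (∀ x, ∑ i, a i x ^ 2 = 1) ∧
    (∀ u x, a (some u) x ≠ 0 → ∀ k, |x k - gridPt l K u k| < (1 / 2 + δ) * l) ∧
    (∀ u x, a (some u) x ≠ 0 → ‖x‖ < 2 * R) ∧ (∀ x, a none x ≠ 0 → R / 2 ≤ ‖x‖) ∧
    ∀ x, ∑ i, gradE (a i) x ≤ if ‖x‖ < 2 * R then ENNReal.ofReal (C / (δ * l) ^ 2) else 0 := by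
  obtain ⟨C₁, hC₁, H₁⟩ := exists_bump_line
  obtain ⟨C₂, hC₂, H₂⟩ := exists_radial_partition
  refine ⟨3 * C₂ ^ 2 + 27 * (3 * (C₂ + (C₁ + (C₁ + C₁))) ^ 2), by positivity,
    fun δ l R hδ hδ' hl hlR => ?_⟩
  obtain ⟨g, gs, g0, g1, gsupp, gd, gsum⟩ := H₁ δ hδ hδ'
  have hR : 0 < R := hl.trans_le hlR
  obtain ⟨p, q, ps, qs, p0, q0, pq, psupp, qsupp, pd, qd⟩ := H₂ R hR
  set K := ⌈2 * R / l⌉₊ with hK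
  set n := 2 * K + 1 with hn
  have hδl : 0 < δ * l := by positivity
  have hδR : δ * l ≤ R := by nlinarith
  obtain ⟨h, hh⟩ : ∃ h : Fin n → Fin 3 → E3 → ℝ, ∀ m k, h m k = fun x => g (x k / l + K - ((m : ℕ) : ℝ)) :=
    ⟨_, fun _ _ => rfl⟩
  have hs : ∀ m k, ContDiff ℝ (⊤ : ℕ∞) (h m k) := fun m k => by
    rw [hh]
    exact gs.comp (by fun_prop)
  have hd : ∀ m k, Differentiable ℝ (h m k) := fun m k => (hs m k).differentiable (by simp)
  have h0 : ∀ m k x, 0 ≤ h m k x := fun m k x => by rw [hh]; exact g0 _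
  have h1 : ∀ m k x, |h m k x| ≤ 1 := fun m k x => by
    rw [abs_of_nonneg (h0 m k x), hh]; exact g1 _
  have p1 : ∀ x, p x ≤ 1 := fun x => by nlinarith [pq x, q0 x, p0 x]
  have q1 : ∀ x, q x ≤ 1 := fun x => by nlinarith [pq x, q0 x, p0 x]
  have hder : ∀ m k x j, |fderiv ℝ (h m k) x (Pi.single j 1)| ≤ C₁ / (δ * l) := fun m k x j => by
    have e1 : HasFDerivAt (fun x : E3 => x k / l + K - ((m : ℕ) : ℝ))
        (l⁻¹ • ContinuousLinearMap.proj (R := ℝ) (φ := fun _ : Fin 3 => ℝ) k) x := by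
      have := (((ContinuousLinearMap.proj (R := ℝ) (φ := fun _ : Fin 3 => ℝ) k).hasFDerivAt
        (x := x)).const_smul l⁻¹).add_const ((K : ℝ) - ((m : ℕ) : ℝ))
      refine this.congr_of_eventuallyEq (Eventually.of_forall fun y => ?_)
      simp only [Pi.smul_apply, ContinuousLinearMap.proj_apply, smul_eq_mul]
      ring
    have e2 := ((gs.differentiable (by simp)) (x k / l + K - ((m : ℕ) : ℝ))).hasDerivAt.comp_hasFDerivAt x e1
    rw [hh, show fderiv ℝ (fun x : E3 => g (x k / l + K - ((m : ℕ) : ℝ))) x = _ from e2.fderiv]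
    simp only [_root_.smul_apply, ContinuousLinearMap.proj_apply, smul_eq_mul, abs_mul]
    have e3 : |(Pi.single j 1 : E3) k| ≤ 1 := by
      rw [Pi.single_apply]
      split_ifs <;> simp
    rw [abs_of_pos (by positivity : 0 < l⁻¹)]
    calc _ ≤ C₁ / δ * (l⁻¹ * 1) := by
          gcongr
          exact gd _
      _ = _ := by field_simp
  obtain ⟨a, han, hau⟩ : ∃ a : Option (Fin 3 → Fin n) → E3 → ℝ, a none = q ∧ ∀ u, a (some u) =
      fun x => p x * (h (u 0) 0 x * (h (u 1) 1 x * h (u 2) 2 x)) :=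
    ⟨fun i => i.elim q fun u x => p x * (h (u 0) 0 x * (h (u 1) 1 x * h (u 2) 2 x)), rfl, fun _ => rfl⟩
  have as : ∀ i, ContDiff ℝ (⊤ : ℕ∞) (a i) := fun i => by
    rcases i with _ | u
    · rw [han]; exact qs
    · rw [hau]; exact ps.mul ((hs _ _).mul ((hs _ _).mul (hs _ _)))
  have a0 : ∀ i x, 0 ≤ a i x := fun i x => by
    rcases i with _ | u
    · rw [han]; exact q0 x
    · rw [hau]; exact mul_nonneg (p0 x) (mul_nonneg (h0 _ _ _) (mul_nonneg (h0 _ _ _) (h0 _ _ _)))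
  have supp : ∀ u x, a (some u) x ≠ 0 → ∀ k, |x k - gridPt l K u k| < (1 / 2 + δ) * l := fun u x hx => by
    rw [hau] at hx
    have e : ∀ k, h (u k) k x ≠ 0 → |x k - gridPt l K u k| < (1 / 2 + δ) * l := fun k hk => by
      rw [hh] at hk
      have e1 := gsupp _ hk
      have e2 : x k - gridPt l K u k = (x k / l + K - ((u k : ℕ) : ℝ)) * l := by
        simp only [gridPt]
        field_simp
        ring
      rw [e2, abs_mul, abs_of_pos hl]
      exact mul_lt_mul_of_pos_right e1 hl
    simp only [ne_eq, mul_eq_zero, not_or] at hx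
    intro k
    fin_cases k
    · exact e 0 hx.2.1
    · exact e 1 hx.2.2.1
    · exact e 2 hx.2.2.2
  refine ⟨n, K, a, as, a0, fun x => ?_, supp, fun u x hx => psupp x fun h => hx (by rw [hau]; simp [h]),
    fun x hx => qsupp x (by rwa [han] at hx), fun x => ?_⟩
  · rw [Fintype.sum_option, han]
    by_cases hp : p x = 0
    · have : ∀ u, a (some u) x = 0 := fun u => by rw [hau]; simp [hp]
      simp only [this]
      have := pq x
      rw [hp] at this
      simp at this ⊢
      exact this
    · have e1 : ∀ k, ∑ m : Fin n, h m k x ^ 2 = 1 := fun k => by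
        simp only [hh]
        rw [Fin.sum_univ_eq_sum_range (fun m : ℕ => g (x k / l + K - m) ^ 2) n]
        refine gsum K _ ?_
        rw [abs_div, abs_of_pos hl]
        refine le_trans ?_ (Nat.le_ceil _)
        have := (norm_le_pi_norm x k).trans (psupp x hp).le
        gcongr
        exact this
      have e2 : ∑ u : Fin 3 → Fin n, a (some u) x ^ 2 = p x ^ 2 := by
        have e3 : ∀ u, a (some u) x ^ 2 = p x ^ 2 * ∏ k, h (u k) k x ^ 2 := fun u => by
          rw [hau, Fin.prod_univ_three]
          ring
        simp only [e3, ← Finset.mul_sum]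
        have := Finset.prod_univ_sum (fun _ : Fin 3 => (Finset.univ : Finset (Fin n))) fun k m => h m k x ^ 2
        rw [Fintype.piFinset_univ] at this
        rw [← this]
        simp [e1]
      rw [e2]
      linarith [pq x]
  · split_ifs with hx
    · rw [Fintype.sum_option]
      have e1 : gradE (a none) x ≤ ENNReal.ofReal (3 * C₂ ^ 2 / (δ * l) ^ 2) := by
        rw [han]
        refine (gradE_le_of_abs_le fun k => (qd x k).trans
          (div_le_div_of_nonneg_left hC₂.le hδl hδR)).trans (le_of_eq ?_)
        rw [div_pow, mul_div_assoc]
      have e2 : ∀ u, gradE (a (some u)) x ≤ (if ‖x - gridPt l K u‖ ≤ 1 * l then 1 else 0) *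
          ENNReal.ofReal (3 * (C₂ + (C₁ + (C₁ + C₁))) ^ 2 / (δ * l) ^ 2) := fun u => by
        split_ifs with hxu
        · rw [one_mul, hau]
          refine (gradE_le_of_abs_le (B := (C₂ + (C₁ + (C₁ + C₁))) / (δ * l)) fun k => ?_).trans (le_of_eq ?_)
          · have d12 : DifferentiableAt ℝ (fun x => h (u 1) 1 x * h (u 2) 2 x) x := (hd (u 1) 1 x).mul (hd (u 2) 2 x)
            have d012 : DifferentiableAt ℝ (fun x => h (u 0) 0 x * (h (u 1) 1 x * h (u 2) 2 x)) x :=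
              (hd (u 0) 0 x).mul d12
            have b12 : |h (u 1) 1 x * h (u 2) 2 x| ≤ 1 := by
              rw [abs_mul]; exact mul_le_one₀ (h1 _ _ _) (abs_nonneg _) (h1 _ _ _)
            have b012 : |h (u 0) 0 x * (h (u 1) 1 x * h (u 2) 2 x)| ≤ 1 := by
              rw [abs_mul]; exact mul_le_one₀ (h1 _ _ _) (abs_nonneg _) b12
            have f1 := abs_fderiv_mul_le (ps.differentiable (by simp) x) d012
              (by rw [abs_of_nonneg (p0 x)]; exact p1 x) b012 (Pi.single k 1)
            have f2 := abs_fderiv_mul_le (hd (u 0) 0 x) d12 (h1 _ _ _) b12 (Pi.single k 1)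
            have f3 := abs_fderiv_mul_le (hd (u 1) 1 x) (hd (u 2) 2 x) (h1 _ _ _) (h1 _ _ _) (Pi.single k 1)
            have f4 := (pd x k).trans (div_le_div_of_nonneg_left hC₂.le hδl hδR)
            have f5 := hder (u 0) 0 x k
            have f6 := hder (u 1) 1 x k
            have f7 := hder (u 2) 2 x k
            simp only [add_div]
            refine f1.trans ?_
            linarith
          · rw [div_pow, mul_div_assoc]
        · rw [zero_mul, gradE_eq_zero_of_eq_zero (a0 _)]
          by_contra hne
          refine hxu ((pi_norm_le_iff_of_nonneg (by positivity)).2 fun k => ?_)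
          have := supp u x hne k
          rw [Pi.sub_apply, Real.norm_eq_abs]
          nlinarith
      refine (add_le_add e1 ((Finset.sum_le_sum fun u _ => e2 u).trans_eq (Finset.sum_mul _ _ _).symm)).trans ?_
      refine (add_le_add le_rfl (mul_le_mul' (sum_gridPt_le hl K zero_le_one x) le_rfl)).trans (le_of_eq ?_)
      rw [← ENNReal.ofReal_mul (by positivity), ← ENNReal.ofReal_add (by positivity) (by positivity)]
      congr 1
      ring
    · have hp : p x = 0 := by
        by_contra hne
        exact hx (psupp x hne)
      refine le_of_eq (Finset.sum_eq_zero fun i _ => ?_)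
      rcases i with _ | u
      · rw [han]
        have hq : q x = 1 := by nlinarith [pq x, q0 x]
        have : IsLocalMax q x := Eventually.of_forall fun y => by rw [hq]; exact q1 y
        simp [gradE, this.fderiv_eq_zero]
      · exact gradE_eq_zero_of_eq_zero (a0 _) (by rw [hau]; simp [hp])

theorem sum_enorm_sq_partition {I : Type} [Fintype I] {a : I → ℝ} {w : I → ℂ} (v : ℂ)
    (ha : ∑ i, a i ^ 2 = 1) (hw : ∑ i, (a i : ℂ) * w i = 0) :
    ∑ i, ‖(a i : ℂ) * v + w i‖ₑ ^ 2 = ‖v‖ₑ ^ 2 + ∑ i, ‖w i‖ₑ ^ 2 := by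
  simp only [enorm_sq_eq_ofReal]
  rw [← ENNReal.ofReal_sum_of_nonneg fun i _ => by positivity,
    ← ENNReal.ofReal_sum_of_nonneg fun i _ => by positivity,
    ← ENNReal.ofReal_add (by positivity) (Finset.sum_nonneg fun i _ => by positivity)]
  congr 1
  have hr : ∑ i, a i * (w i).re = 0 := by
    simpa using congrArg Complex.re hw
  have hi : ∑ i, a i * (w i).im = 0 := by
    simpa using congrArg Complex.im hw
  have h1 : ∀ i, ‖(a i : ℂ) * v + w i‖ ^ 2 =
      a i ^ 2 * ‖v‖ ^ 2 + 2 * v.re * (a i * (w i).re) + 2 * v.im * (a i * (w i).im) + ‖w i‖ ^ 2 := fun i => by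
    simp only [← Complex.normSq_eq_norm_sq, Complex.normSq_apply, Complex.add_re, Complex.add_im,
      Complex.mul_re, Complex.mul_im, Complex.ofReal_re, Complex.ofReal_im]
    ring
  simp only [h1, Finset.sum_add_distrib, ← Finset.sum_mul, ← Finset.mul_sum, ha, hr, hi]
  ring

theorem sum_mul_pdv_eq_zero {I : Type} [Fintype I] {a : I → E3 → ℝ} (ha : ∀ i, Differentiable ℝ (a i))
    (h1 : ∀ x, ∑ i, a i x ^ 2 = 1) (k : Fin 3) (x : E3) : ∑ i, a i x * pdv k (a i) x = 0 := by
  have h2 : HasFDerivAt (fun x => ∑ i, a i x ^ 2) (∑ i, (2 * a i x) • fderiv ℝ (a i) x) x := by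
    refine HasFDerivAt.fun_sum fun i _ => ?_
    simpa using ((ha i x).hasFDerivAt.pow 2)
  have h3 : HasFDerivAt (fun x => ∑ i, a i x ^ 2) (0 : E3 →L[ℝ] ℝ) x := by
    simp only [h1]; exact hasFDerivAt_const 1 x
  have h4 := congrArg (fun L : E3 →L[ℝ] ℝ => L (Pi.single k 1)) (h2.unique h3)
  simp only [_root_.sum_apply, _root_.smul_apply, smul_eq_mul, _root_.zero_apply, mul_assoc,
    ← Finset.mul_sum] at h4
  simpa using h4

theorem sum_sq2_dirac_le {I : Type} [Fintype I] {a : I → E3 → ℝ} (ha : ∀ i, Differentiable ℝ (a i))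
    (h1 : ∀ x, ∑ i, a i x ^ 2 = 1) {A : E3 → Fin 3 → ℝ} {u : E3 → Fin 2 → ℂ}
    (hu : ∀ s, Differentiable ℝ fun x => u x s) (x : E3) :
    ∑ i, sq2 (dirac A (fun y t => (a i y : ℂ) * u y t) x) ≤
      sq2 (dirac A u x) + 12 * (∑ i, gradE (a i) x) * sq2 (u x) := by
  have hw : ∀ s, ∑ i, (a i x : ℂ) * (-Complex.I * ∑ k, ∑ t, pauli k s t * (((pdv k (a i) x : ℝ) : ℂ) * u x t)) = 0 := by
    intro s
    have e : ∀ k t, ∑ i, (a i x : ℂ) * (-Complex.I * (pauli k s t * (((pdv k (a i) x : ℝ) : ℂ) * u x t))) = 0 := by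
      intro k t
      have h := congrArg (fun r : ℝ => (r : ℂ)) (sum_mul_pdv_eq_zero ha h1 k x)
      simp only [Complex.ofReal_sum, Complex.ofReal_mul, Complex.ofReal_zero] at h
      calc _ = (∑ i, (a i x : ℂ) * ((pdv k (a i) x : ℝ) : ℂ)) * (-Complex.I * (pauli k s t * u x t)) := by
            rw [Finset.sum_mul]; exact Finset.sum_congr rfl fun i _ => by ring
        _ = 0 := by rw [h, zero_mul]
    simp only [Finset.mul_sum]
    rw [Finset.sum_comm]
    refine Finset.sum_eq_zero fun k _ => ?_
    rw [Finset.sum_comm]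
    exact Finset.sum_eq_zero fun t _ => e k t
  have hg : ∀ i, sq2 (fun s => -Complex.I * ∑ k, ∑ t, pauli k s t * (((pdv k (a i) x : ℝ) : ℂ) * u x t)) ≤
      12 * (gradE (a i) x * sq2 (u x)) := by
    intro i
    rw [sq2_mul, show ‖-Complex.I‖ₑ = 1 by rw [← ofReal_norm]; simp, one_pow, one_mul]
    refine (sq2_pauli_le (fun k => pdv k (a i) x) (u x)).trans (mul_le_mul' le_rfl (le_of_eq ?_))
    simp only [gradE, sq2, Finset.sum_mul, Finset.mul_sum]
    exact Finset.sum_comm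
  calc _ = ∑ s, ∑ i, ‖(a i x : ℂ) * dirac A u x s +
        -Complex.I * ∑ k, ∑ t, pauli k s t * (((pdv k (a i) x : ℝ) : ℂ) * u x t)‖ₑ ^ 2 := by
        rw [Finset.sum_comm]
        refine Finset.sum_congr rfl fun i _ => ?_
        unfold sq2
        refine Finset.sum_congr rfl fun s _ => ?_
        rw [dirac_smul (ha i) hu]
    _ = sq2 (dirac A u x) + ∑ i, sq2 (fun s => -Complex.I *
          ∑ k, ∑ t, pauli k s t * (((pdv k (a i) x : ℝ) : ℂ) * u x t)) := by
        unfold sq2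
        rw [Finset.sum_comm (t := Finset.univ (α := Fin 2)), ← Finset.sum_add_distrib]
        exact Finset.sum_congr rfl fun s _ => sum_enorm_sq_partition _ (h1 x) (hw s)
    _ ≤ _ := by
        refine add_le_add le_rfl ((Finset.sum_le_sum fun i _ => hg i).trans (le_of_eq ?_))
        rw [← Finset.mul_sum, ← Finset.sum_mul, mul_assoc]


/-- Localization error for the Pauli kinetic energy density. -/
theorem BFam.sum_kinD_le {Ω : Type} [MeasurableSpace Ω] {μ : Measure Ω} {ψ : Ω → E3 → Fin 2 → ℂ}
    {I : Type} [Fintype I] (h : BFam μ ψ) {a : I → E3 → ℝ}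
    (ha : ∀ i, ContDiff ℝ 2 (a i)) (h1 : ∀ x, ∑ i, a i x ^ 2 = 1)
    {A : E3 → Fin 3 → ℝ} (hA : Continuous A) (x : E3) :
    ∑ i, kinD μ A (fun ω y t => (a i y : ℂ) * ψ ω y t) x ≤
      kinD μ A ψ x + 12 * (∑ i, gradE (a i) x) * dens μ ψ x := by
  have hm : ∀ i, BFam μ fun ω y t => (a i y : ℂ) * ψ ω y t := fun i =>
    h.mul (Complex.ofRealCLM.contDiff.comp (ha i)) fun x => by
      have : a i x ^ 2 ≤ 1 := (Finset.single_le_sum (f := fun i => a i x ^ 2)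
        (fun _ _ => sq_nonneg _) (Finset.mem_univ i)).trans (h1 x).le
      rw [Complex.norm_real, Real.norm_eq_abs]
      exact (sq_le_one_iff_abs_le_one _).1 this
  have hd : Measurable fun ω => sq2 (dirac A (ψ ω) x) := measurable_fix_snd (h.measurable_dirac hA) x
  have hdi : ∀ i, Measurable fun ω => sq2 (dirac A (fun y t => (a i y : ℂ) * ψ ω y t) x) := fun i =>
    measurable_fix_snd ((hm i).measurable_dirac hA) x
  have hs : Measurable fun ω => sq2 (ψ ω x) := measurable_fix_snd h.measurable_sq2 x
  unfold kinD dens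
  rw [← lintegral_finsetSum _ fun i _ => hdi i, ← lintegral_const_mul _ hs, ← lintegral_add_left hd]
  exact lintegral_mono fun ω => sum_sq2_dirac_le (fun i => (ha i).differentiable (by norm_num)) h1
    (fun s => (h.smooth ω s).differentiable (by norm_num)) x

/-- Gauge removal for a family of orbitals, given its orbitalwise form. -/
theorem BFam.lintegral_kinD_phase_le {Ω : Type} [MeasurableSpace Ω] {μ : Measure Ω} [SFinite μ]
    {ψ : Ω → E3 → Fin 2 → ℂ} (hψ : BFam μ ψ) {A : E3 → Fin 3 → ℝ} (hA : Continuous A) {z c : E3} {r ε : ℝ}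
    (hc : ∀ u : E3 → Fin 2 → ℂ, (∀ s, ContDiff ℝ 2 fun x => u x s) → (∀ x ∉ Metric.closedBall z r, u x = 0) →
      ∫⁻ x, gradS (fun y t => phase c y * u y t) x ≤ ENNReal.ofReal ε * ∫⁻ x, sq2 (dirac A u x))
    (hsupp : ∀ ω, ∀ x ∉ Metric.closedBall z r, ψ ω x = 0) :
    ∫⁻ x, kinD μ (fun _ => 0) (fun ω y t => phase c y * ψ ω y t) x ≤
      ENNReal.ofReal ε * ∫⁻ x, kinD μ A ψ x := by
  have h2 := hψ.mul (contDiff_phase c) fun x => (norm_phase c x).le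
  have hsw : ∀ {ν : Measure E3} [SFinite ν] (g : Ω × E3 → ℝ≥0∞), Measurable g →
      ∫⁻ x, (∫⁻ ω, g (ω, x) ∂μ) ∂ν = ∫⁻ ω, (∫⁻ x, g (ω, x) ∂ν) ∂μ := fun g hg =>
    lintegral_lintegral_swap (f := fun x ω => g (ω, x)) (hg.comp measurable_swap).aemeasurable
  have m1 := h2.measurable_dirac (A := fun _ => 0) continuous_const
  have m2 := hψ.measurable_dirac hA
  unfold kinD
  rw [hsw _ m1, hsw _ m2, ← lintegral_const_mul' _ _ ENNReal.ofReal_ne_top]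
  refine lintegral_mono fun ω => ?_
  have e := lintegral_dirac_zero (u := fun y t => phase c y * ψ ω y t) (h2.smooth ω) fun s => by
    refine HasCompactSupport.intro (isCompact_closedBall z r) fun x hx => ?_
    simp [hsupp ω x hx]
  exact e.le.trans (hc (ψ ω) (hψ.smooth ω) (hsupp ω))

theorem abs_shift_le {d l δ : ℝ} {m : ℤ} (hl : 0 < l) (hδ : 0 < δ)
    (h : |d - l * m| < (1 + 2 * δ) * l) :
    |d| ≤ |d + 4 * δ * (l * m)| ∧ (m ≠ 0 → d + 4 * δ * (l * m) ≠ 0) := by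
  have key : ∀ (d : ℝ) (m : ℤ), |d - l * m| < (1 + 2 * δ) * l → 1 ≤ m →
      |d| ≤ d + 4 * δ * (l * m) ∧ 0 < d + 4 * δ * (l * m) := by
    intro d m h hm
    have hm' : (1 : ℝ) ≤ m := by exact_mod_cast hm
    have hδl : 0 < δ * l := by positivity
    have h1 := (abs_lt.1 h).1
    have h2 : l ≤ l * m := by nlinarith
    have h3 : δ * l ≤ δ * (l * m) := by nlinarith
    have h4 : 0 < d + 2 * δ * (l * m) := by nlinarith
    exact ⟨abs_le.2 ⟨by nlinarith, by nlinarith⟩, by nlinarith⟩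
  rcases lt_trichotomy m 0 with hm | rfl | hm
  · have h5 : |(-d) - l * ((-m : ℤ) : ℝ)| < (1 + 2 * δ) * l := by
      rw [← abs_neg]; convert h using 2; push_cast; ring
    obtain ⟨h6, h7⟩ := key (-d) (-m) h5 (by omega)
    push_cast at h6 h7
    rw [abs_neg] at h6
    refine ⟨?_, fun _ => by intro h8; nlinarith⟩
    rw [← abs_neg (d + _)]
    exact h6.trans (le_trans (le_of_eq (by ring)) (le_abs_self _))
  · simp
  · obtain ⟨h6, h7⟩ := key d m h (by omega)
    exact ⟨h6.trans (le_abs_self _), fun _ => h7.ne'⟩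

theorem enorm3_le_enorm3 {x y : E3} (h : ∀ k, |x k| ≤ |y k|) : enorm3 x ≤ enorm3 y :=
  Real.sqrt_le_sqrt (Finset.sum_le_sum fun k _ => sq_le_sq.2 (h k))

/-- Dilating the grid cells apart keeps them disjoint and decreases the Coulomb repulsion. -/
theorem coul_shift_gridPt_le {n K : ℕ} {l δ : ℝ} (hl : 0 < l) (hδ : 0 < δ)
    {u v : Fin 3 → Fin n} {x y : E3} (hx : ∀ k, |x k - gridPt l K u k| < (1 / 2 + δ) * l)
    (hy : ∀ k, |y k - gridPt l K v k| < (1 / 2 + δ) * l) :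
    (u ≠ v → x + (4 * δ) • gridPt l K u ≠ y + (4 * δ) • gridPt l K v) ∧
    (x ≠ y → coul (x + (4 * δ) • gridPt l K u - (y + (4 * δ) • gridPt l K v)) ≤ coul (x - y)) := by
  have hk : ∀ k, |x k - y k| ≤ |(x + (4 * δ) • gridPt l K u - (y + (4 * δ) • gridPt l K v)) k| ∧
      (u k ≠ v k → (x + (4 * δ) • gridPt l K u - (y + (4 * δ) • gridPt l K v)) k ≠ 0) := by
    intro k
    have h1 : |(x k - y k) - l * (((u k : ℕ) - (v k : ℕ) : ℤ) : ℝ)| < (1 + 2 * δ) * l := by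
      have hx' := abs_lt.1 (hx k)
      have hy' := abs_lt.1 (hy k)
      simp only [gridPt] at hx' hy'
      push_cast
      rw [abs_lt]
      constructor <;> nlinarith
    have h2 := abs_shift_le hl hδ h1
    have e : (x + (4 * δ) • gridPt l K u - (y + (4 * δ) • gridPt l K v)) k =
        (x k - y k) + 4 * δ * (l * (((u k : ℕ) - (v k : ℕ) : ℤ) : ℝ)) := by
      simp only [Pi.sub_apply, Pi.add_apply, Pi.smul_apply, smul_eq_mul, gridPt]
      push_cast
      ring
    rw [e]
    refine ⟨h2.1, fun h => h2.2 fun h0 => h ?_⟩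
    apply Fin.ext
    omega
  refine ⟨fun huv he => ?_, fun hxy => ?_⟩
  · obtain ⟨k, hne⟩ := Function.ne_iff.1 huv
    refine (hk k).2 hne ?_
    rw [he, sub_self, Pi.zero_apply]
  · exact ENNReal.ofReal_le_ofReal (inv_anti₀ (enorm3_pos (sub_ne_zero.2 hxy))
      (enorm3_le_enorm3 fun k => (hk k).1))

theorem coul_shift_ge {l δ : ℝ} {x z : E3} (hl : 0 < l) (hδ : 0 < δ) (hz : 8 * l ≤ ‖z‖) (hx : ‖x - z‖ ≤ l) :
    ENNReal.ofReal (1 - 6 * δ) * coul x ≤ coul (x + (4 * δ) • z) := by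
  have h1 : 7 * l ≤ enorm3 x := by
    have := norm_sub_norm_le z (z - x)
    rw [sub_sub_cancel, norm_sub_rev z x] at this
    linarith [norm_le_enorm3 x]
  have h2 : enorm3 (x + (4 * δ) • z) ≤ (1 + 6 * δ) * enorm3 x := by
    have e : x + (4 * δ) • z = (1 + 4 * δ) • x - (4 * δ) • (x - z) := by module
    have hs : ∀ (r : ℝ) (y : E3), 0 ≤ r → enorm3 (r • y) = r * enorm3 y := fun r y hr => by
      rw [enorm3_eq, enorm3_eq, WithLp.toLp_smul, norm_smul, Real.norm_of_nonneg hr]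
    rw [e]
    refine (enorm3_sub_le _ _).trans ?_
    rw [hs _ _ (by positivity), hs _ _ (by positivity)]
    have := enorm3_le (x - z)
    nlinarith
  have h3 : 0 < enorm3 (x + (4 * δ) • z) := by
    refine enorm3_pos fun h0 => ?_
    have e : x - z = -(1 + 4 * δ) • z := by
      have : x = -((4 * δ) • z) := eq_neg_of_add_eq_zero_left h0
      rw [this]; module
    rw [e, norm_smul, norm_neg, Real.norm_of_nonneg (by positivity)] at hx
    nlinarith
  unfold coul
  rcases le_total (1 - 6 * δ) 0 with h | h
  · simp [ENNReal.ofReal_of_nonpos h]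
  rw [← ENNReal.ofReal_mul h]
  refine ENNReal.ofReal_le_ofReal ?_
  rw [← div_eq_mul_inv, inv_eq_one_div, div_le_div_iff₀ (by linarith) h3]
  nlinarith [mul_le_mul_of_nonneg_left h2 h, sq_nonneg δ, mul_nonneg (sq_nonneg δ) (by linarith : 0 ≤ enorm3 x)]

theorem norm_le_of_dist_le_tfScale {Z r : ℝ} {x z : E3} (hZ : 0 < Z) (hr : 1 / Z ≤ r) (hx : ‖x‖ ≤ 9 * r)
    (h : dist x z ≤ tfScale Z z) : ‖z‖ ≤ 20 * r := by
  have h1 := tfScale_sq hZ z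
  have h2 : tfScale Z z ^ 2 = (‖z‖ + 1 / Z) * (1 / Z) := by rw [h1]; ring
  have h3 := tfScale_pos hZ z
  have h5 : 0 < 1 / Z := by positivity
  have h4 : tfScale Z z ≤ (‖z‖ + 2 * (1 / Z)) / 2 := by
    refine abs_le_of_sq_le_sq' ?_ (by positivity) |>.2
    nlinarith [sq_nonneg ‖z‖, norm_nonneg z]
  have := norm_le_norm_add_dist z x
  rw [dist_comm] at this
  linarith

theorem tfScale_le_of_dist_le {Z R l : ℝ} {x z : E3} (hZ : 0 < Z) (hl : 1 / Z ≤ l) (hR : R / Z ≤ l ^ 2)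
    (hx : ‖x‖ ≤ 2 * R) (h : dist x z ≤ tfScale Z z) : tfScale Z z ≤ 3 * l := by
  have h2 : tfScale Z z ^ 2 = (‖z‖ + 1 / Z) * (1 / Z) := by rw [tfScale_sq hZ z]; ring
  have h3 := tfScale_pos hZ z
  have h5 : 0 < 1 / Z := by positivity
  have := norm_le_norm_add_dist z x
  rw [dist_comm] at this
  have h6 : tfScale Z z ^ 2 ≤ (2 * R + tfScale Z z + 1 / Z) * (1 / Z) := by
    rw [h2]; gcongr; linarith
  have h7 : R * (1 / Z) ≤ l ^ 2 := by rwa [mul_one_div]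
  by_contra! hc
  nlinarith [mul_le_mul_of_nonneg_left hl h3.le, mul_le_mul hl hl h5.le (h5.le.trans hl)]

/-- The phase-space error is controlled by the field energy on the cells with strong field. -/
theorem lintegral_strongField_le {n K : ℕ} {Z l r τ : ℝ} (hZ : 0 < Z) (hl : 0 < l) (hlr : l ≤ r) (hτ : 0 < τ)
    {f : E3 → ℝ≥0∞} (hf : Measurable f) (B : Finset (Fin 3 → Fin n))
    (hB : ∀ u ∈ B, 8 * r ≤ ‖gridPt l K u‖ ∧
      ENNReal.ofReal τ ≤ ENNReal.ofReal l * ∫⁻ x in Metric.closedBall (gridPt l K u) (4 * l), f x) :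
    ∫⁻ z in Metric.closedBall 0 (20 * r) ∪ ⋃ u ∈ B, Metric.closedBall (gridPt l K u) (4 * l),
        ENNReal.ofReal (tfScale Z z ^ 3 * (‖z‖ + 1 / Z))⁻¹ ≤
      (∫⁻ z in Metric.closedBall (0 : E3) (20 * r), ENNReal.ofReal (tfScale Z z ^ 3 * (‖z‖ + 1 / Z))⁻¹) +
      ENNReal.ofReal (512 * 729 * (l ^ 4 * (Z ^ (3 / 2 : ℝ) * r ^ (-(5 / 2) : ℝ))) / τ) * ∫⁻ x, f x := by
  have hr : 0 < r := hl.trans_le hlr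
  set P := Z ^ (3 / 2 : ℝ) * r ^ (-(5 / 2) : ℝ) with hP
  have hP0 : 0 ≤ P := by positivity
  refine (lintegral_union_le _ _ _).trans (add_le_add le_rfl ?_)
  refine (lintegral_iUnion_le _ _).trans ?_
  have h1 : ∀ u, ∫⁻ z in ⋃ (_ : u ∈ B), Metric.closedBall (gridPt l K u) (4 * l),
      ENNReal.ofReal (tfScale Z z ^ 3 * (‖z‖ + 1 / Z))⁻¹ ≤
      ENNReal.ofReal (512 * (l ^ 4 * P) / τ) * ∫⁻ x in Metric.closedBall (gridPt l K u) (4 * l), f x := by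
    intro u
    by_cases hu : u ∈ B
    · simp only [hu, iUnion_true]
      calc _ ≤ ∫⁻ _ in Metric.closedBall (gridPt l K u) (4 * l), ENNReal.ofReal P := by
            refine setLIntegral_mono' Metric.isClosed_closedBall.measurableSet fun z hz => ?_
            refine ENNReal.ofReal_le_ofReal (tfScale_cube_inv_le hZ hr ?_)
            have h2 := norm_le_norm_add_dist (gridPt l K u) z
            rw [Metric.mem_closedBall, dist_comm] at hz
            linarith [(hB u hu).1]
        _ = ENNReal.ofReal (512 * (l ^ 3 * P) / τ) * ENNReal.ofReal τ := by
            rw [setLIntegral_const, volume_closedBall_E3 _ (by positivity), ← ENNReal.ofReal_mul hP0,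
              ← ENNReal.ofReal_mul (by positivity)]
            congr 1
            field_simp
            ring
        _ ≤ _ := by
            refine (mul_le_mul_right (hB u hu).2 _).trans (le_of_eq ?_)
            rw [← mul_assoc, ← ENNReal.ofReal_mul (by positivity)]
            congr 2
            ring
    · simp [hu]
  rw [tsum_fintype]
  refine (Finset.sum_le_sum fun u _ => h1 u).trans ?_
  rw [← Finset.mul_sum]
  refine (mul_le_mul_right (sum_setLIntegral_gridPt_le hl K hf) _).trans (le_of_eq ?_)
  rw [← mul_assoc, ← ENNReal.ofReal_ofNat 729, ← ENNReal.ofReal_mul (by positivity)]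
  congr 2
  ring

/-- Integrated localization error for a partition of unity varying only in a ball. -/
theorem IsWaveFun.sum_kinD_le {N : ℕ} {Ψ : (Fin N → E3) → (Fin N → Fin 2) → ℂ} (h : IsWaveFun N Ψ)
    {I : Type} [Fintype I] {a : I → E3 → ℝ}
    (ha : ∀ i, ContDiff ℝ 2 (a i)) (h1 : ∀ x, ∑ i, a i x ^ 2 = 1) {G R : ℝ} (hG : 0 ≤ G) (hR : 0 < R)
    (hg : ∀ x, ∑ i, gradE (a i) x ≤ if ‖x‖ < 2 * R then ENNReal.ofReal G else 0)
    {A : E3 → Fin 3 → ℝ} (hA : Continuous A) :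
    ∑ i, ∫⁻ x, kinD (sliceSum N) A (fun p x s => (a i x : ℂ) * oneFam Ψ p x s) x ≤
      kinT A Ψ + ENNReal.ofReal (48 * (G * R)) * attT Ψ := by
  have hb := h.bFam
  have hm : ∀ i, BFam (sliceSum N) fun p x s => (a i x : ℂ) * oneFam Ψ p x s := fun i =>
    hb.mul (Complex.ofRealCLM.contDiff.comp (ha i)) fun x => by
      have : a i x ^ 2 ≤ 1 := (Finset.single_le_sum (f := fun i => a i x ^ 2)
        (fun _ _ => sq_nonneg _) (Finset.mem_univ i)).trans (h1 x).le
      rw [Complex.norm_real, Real.norm_eq_abs]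
      exact (sq_le_one_iff_abs_le_one _).1 this
  rw [← lintegral_finsetSum _ fun i _ => (hm i).measurable_kinD hA, ← h.lintegral_coul, kinT,
    ← lintegral_const_mul' _ _ ENNReal.ofReal_ne_top, ← lintegral_add_left (hb.measurable_kinD hA)]
  refine lintegral_mono_ae ?_
  have h0 : ∀ᵐ x : E3, x ≠ 0 := by simp [ae_iff]
  filter_upwards [h0] with x hx
  refine (hb.sum_kinD_le ha h1 hA x).trans (add_le_add le_rfl ?_)
  rw [← mul_assoc]
  refine mul_le_mul_left ((mul_le_mul_right (hg x) _).trans ?_) _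
  split_ifs with hxR
  · have hx0 := norm_pos_iff.2 hx
    have h3 : ENNReal.ofReal (12 * G) ≤ ENNReal.ofReal (24 * (G * R)) * ENNReal.ofReal ‖x‖⁻¹ := by
      rw [← ENNReal.ofReal_mul (by positivity)]
      refine ENNReal.ofReal_le_ofReal ?_
      rw [← div_eq_mul_inv, le_div_iff₀ hx0]
      nlinarith
    rw [← ENNReal.ofReal_ofNat 12, ← ENNReal.ofReal_mul (by norm_num)]
    refine (h3.trans (mul_le_mul_right (inv_norm_le_coul x) _)).trans (le_of_eq ?_)
    rw [← mul_assoc, ← ENNReal.ofReal_ofNat 2, ← ENNReal.ofReal_mul (by positivity)]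
    congr 2
    ring
  · simp

/-- Nuclear attraction of the pieces selected from a partition of unity. -/
theorem BFam.attraction_localized_le : ∃ C : ℝ, 0 < C ∧ ∀ {Ω : Type} [MeasurableSpace Ω] (μ : Measure Ω)
    [SFinite μ] (ψ : Ω → E3 → Fin 2 → ℂ), BFam μ ψ → ∀ A : E3 → Fin 3 → ℝ, ContDiff ℝ 1 A →
    ∫⁻ x, fieldE A x ≠ ∞ → ∫⁻ x, dens μ ψ x * ENNReal.ofReal ‖x‖⁻¹ ≠ ∞ →
    ∀ {I : Type} [Fintype I] (a : I → E3 → ℝ), (∀ i, ContDiff ℝ 2 (a i)) → (∀ x, ∑ i, a i x ^ 2 = 1) →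
    ∀ (D : Finset I) (Z : ℝ) (T : Set E3), 0 < Z → MeasurableSet T →
    (∀ i ∈ D, ∀ x, a i x ≠ 0 → ∀ z, dist x z ≤ tfScale Z z → z ∈ T) →
    ENNReal.ofReal Z * ∑ i ∈ D, ∫⁻ x, ‖(a i x : ℂ)‖ₑ ^ 2 * coul x * dens μ ψ x ≤
      ENNReal.ofReal (1 / 2) * (∑ i ∈ D, ∫⁻ x, kinD μ A (fun ω x s => (a i x : ℂ) * ψ ω x s) x) +
      ENNReal.ofReal (C * Z) * (ENNReal.ofReal Z + (∫⁻ x, fieldE A x) +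
        ∫⁻ z in T, ENNReal.ofReal (tfScale Z z ^ 3 * (‖z‖ + 1 / Z))⁻¹) := by
  obtain ⟨C, hC, H⟩ := BFam.attraction_le
  refine ⟨C, hC, fun {Ω} _ μ _ ψ hψ A hA hF hW {I} _ a ha h1 D Z T hZ hT hD => ?_⟩
  let _ : MeasurableSpace D := ⊤
  have : DiscreteMeasurableSpace D := ⟨fun _ => trivial⟩
  have hb2 : ∀ i : D, ContDiff ℝ 2 fun x => (a i x : ℂ) := fun i => Complex.ofRealCLM.contDiff.comp (ha i)
  have hb1 : ∀ x, ∑ i : D, ‖(a i x : ℂ)‖ₑ ^ 2 ≤ 1 := fun x => by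
    rw [Finset.sum_coe_sort D fun i => ‖(a i x : ℂ)‖ₑ ^ 2]
    refine (Finset.sum_le_univ_sum_of_nonneg (s := D) fun _ => zero_le).trans (le_of_eq ?_)
    simp only [enorm_sq_eq_ofReal, Complex.norm_real, Real.norm_eq_abs, sq_abs]
    rw [← ENNReal.ofReal_sum_of_nonneg fun i _ => by positivity, h1, ENNReal.ofReal_one]
  have hloc := hψ.localize hb2 hb1
  have hdens := hψ.dens_localize hb2 hb1
  have hkin := hψ.kinD_localize hb2 hb1 hA.continuous
  have hm : ∀ i : D, BFam μ fun p x s => (a i x : ℂ) * ψ p x s := fun i =>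
    hψ.mul (hb2 i) fun x => by
      have h2 : a i x ^ 2 ≤ 1 := (Finset.single_le_sum (f := fun i => a i x ^ 2)
        (fun _ _ => sq_nonneg _) (Finset.mem_univ i.1)).trans (h1 x).le
      rw [Complex.norm_real, Real.norm_eq_abs]
      exact (sq_le_one_iff_abs_le_one _).1 h2
  have h := H _ _ hloc A hA hF ?_ Z T hZ hT ?_
  · simp only [hkin] at h
    rw [lintegral_finsetSum _ fun i _ => (hm i).measurable_kinD hA.continuous,
      Finset.sum_coe_sort D fun i => ∫⁻ x, kinD μ A (fun ω x s => (a i x : ℂ) * ψ ω x s) x] at h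
    refine le_trans (mul_le_mul_right ?_ _) h
    have hmm : ∀ i ∈ D, Measurable fun x => ‖(a i x : ℂ)‖ₑ ^ 2 * coul x * dens μ ψ x := fun i _ =>
      (((hb2 ⟨i, ‹_›⟩).continuous.measurable.enorm.pow_const 2).mul measurable_coul).mul hψ.measurable_dens
    rw [← lintegral_finsetSum _ hmm]
    refine lintegral_mono fun x => ?_
    rw [hdens, Finset.sum_coe_sort D fun i => ‖(a i x : ℂ)‖ₑ ^ 2, ← Finset.sum_mul, ← Finset.sum_mul, mul_right_comm]
    exact mul_le_mul_right (coul_le x) _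
  · refine ne_top_of_le_ne_top hW (lintegral_mono fun x => mul_le_mul_left ?_ _)
    rw [hdens]
    exact mul_le_of_le_one_left' (hb1 x)
  · intro x hx z hz
    rw [hdens] at hx
    obtain ⟨i, -, hi⟩ := Finset.exists_ne_zero_of_sum_ne_zero (left_ne_zero_of_mul hx)
    exact hD i i.2 x (fun h0 => hi (by simp [h0])) z hz

theorem coul_shift_le {l δ : ℝ} {x z : E3} (hl : 0 < l) (hδ : 0 < δ) (hz : 8 * l ≤ ‖z‖) (hx : ‖x - z‖ ≤ l) :
    coul (x + (4 * δ) • z) ≤ coul x := by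
  have h1 : 7 * l ≤ enorm3 x := by
    have := norm_sub_norm_le z (z - x)
    rw [sub_sub_cancel, norm_sub_rev z x] at this
    linarith [norm_le_enorm3 x]
  have hs : ∀ (r : ℝ) (y : E3), 0 ≤ r → enorm3 (r • y) = r * enorm3 y := fun r y hr => by
    rw [enorm3_eq, enorm3_eq, WithLp.toLp_smul, norm_smul, Real.norm_of_nonneg hr]
  refine ENNReal.ofReal_le_ofReal (inv_anti₀ (by linarith) ?_)
  have h2 := enorm3_add_le (x + (4 * δ) • z) ((4 * δ) • (x - z))
  rw [show x + (4 * δ) • z + (4 * δ) • (x - z) = (1 + 4 * δ) • x by module, hs _ _ (by positivity),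
    hs _ _ (by positivity)] at h2
  have := enorm3_le (x - z)
  nlinarith

theorem fderiv_phase_mul_eq_zero {a : E3 → ℝ} (ha : ContDiff ℝ (⊤ : ℕ∞) a) (h0 : ∀ x, 0 ≤ a x) (c : E3) {y : E3}
    (hy : phase c y * (a y : ℂ) = 0) : fderiv ℝ (fun y => phase c y * (a y : ℂ)) y = 0 := by
  have hay : a y = 0 := by
    rcases mul_eq_zero.1 hy with h | h
    · have := norm_phase c y; rw [h, norm_zero] at this; norm_num at this
    · exact_mod_cast h
  have hmin : IsLocalMin a y := Eventually.of_forall fun x => by rw [hay]; exact h0 x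
  have h1 := hmin.fderiv_eq_zero
  have h2 : HasFDerivAt (fun x => (a x : ℂ)) (0 : E3 →L[ℝ] ℂ) y := by
    have h3 := (ha.differentiable (by simp) y).hasFDerivAt
    rw [h1] at h3
    have h5 := Complex.ofRealCLM.hasFDerivAt.comp y h3
    rwa [ContinuousLinearMap.comp_zero] at h5
  have h4 : HasFDerivAt (fun y => phase c y * (a y : ℂ)) _ y :=
    ((contDiff_phase c (n := 1)).differentiable (by norm_num) y).hasFDerivAt.mul h2
  rw [h4.fderiv, hay, Complex.ofReal_zero]
  ext v
  change phase c y * (0 : ℂ) + (0 : ℂ) * _ = 0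
  rw [mul_zero, zero_mul, add_zero]

theorem lintegral_pair_add_le {N : ℕ} (μ : Measure (Fin N → E3)) {k : E3 → ℝ≥0∞} {p : E3 → ℝ} (hp : ∀ x, 0 ≤ p x)
    (h : ∀ x, k x + ENNReal.ofReal (p x) ≤ 1) :
    (∫⁻ x : Fin N → E3, (∑ i, ∑ j, if i < j then k (x i) * k (x j) * coul (x i - x j) else 0) ∂μ) +
      (∫⁻ x : Fin N → E3, (∑ i, ∑ j, if i < j then ENNReal.ofReal (p (x i) * p (x j)) * coul (x i - x j) else 0) ∂μ) ≤
    ∫⁻ x, pairCoul x ∂μ := by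
  refine (le_lintegral_add _ _).trans (lintegral_mono fun x => ?_)
  unfold pairCoul
  beta_reduce
  rw [← Finset.sum_add_distrib]
  refine Finset.sum_le_sum fun i _ => ?_
  rw [← Finset.sum_add_distrib]
  refine Finset.sum_le_sum fun j _ => ?_
  split_ifs
  · rw [← add_mul, ENNReal.ofReal_mul (hp _)]
    refine mul_le_of_le_one_left' (le_trans (add_le_add ?_ ?_) (h (x i)))
    · exact mul_le_of_le_one_right' (le_self_add.trans (h _))
    · exact mul_le_of_le_one_right' (le_add_self.trans (h _))
  · simp

/-- Comparison of the energy in a magnetic field with the field-free ground state energy, with explicit localization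
parameters. -/
theorem nf_le_cl_of_scales : ∃ Cg Cp Ca Ct : ℝ, 0 < Cg ∧ 0 < Cp ∧ 0 < Ca ∧ 0 < Ct ∧
    ∀ {N : ℕ} {Ψ : (Fin N → E3) → (Fin N → Fin 2) → ℂ}, IsWaveFun N Ψ → 1 ≤ N → ∀ A, IsVecPot A →
    ∀ Z α E₀ : ℝ, 1 ≤ Z → (∀ E ∈ nfSet Z α, E₀ ≤ E) → ∀ δ θ l r R : ℝ, 0 < δ → δ ≤ 1 / 8 → 0 < θ → θ ≤ 1 / 4 →
    1 / Z ≤ l → l ≤ r → l ≤ R → R / Z ≤ l ^ 2 →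
    E₀ + (1 - 6 * δ) * (Z * (attT Ψ).toReal) ≤
      (1 + 4 * θ) * ((kinT A Ψ).toReal + 48 * (Cp / (δ * l) ^ 2 * R) * (attT Ψ).toReal) + (repT Ψ).toReal +
      10 * Z ^ 2 / R + Ca * Z * (Z + (∫⁻ x, fieldE A x).toReal +
        (Ct * (Z ^ (3 / 2 : ℝ) * (20 * r) ^ (1 / 2 : ℝ)) +
        512 * 729 * (l ^ 4 * (Z ^ (3 / 2 : ℝ) * r ^ (-(5 / 2) : ℝ))) / (θ ^ 2 / Cg) *
          (∫⁻ x, fieldE A x).toReal)) := by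
  classical
  obtain ⟨Cg, hCg, Hg⟩ := local_gauge
  obtain ⟨Cp, hCp, Hp⟩ := exists_partition
  obtain ⟨Ca, hCa, Ha⟩ := BFam.attraction_localized_le
  obtain ⟨Ct, hCt, Ht⟩ := lintegral_tfScale_le
  refine ⟨Cg, Cp, Ca, Ct, hCg, hCp, hCa, hCt, fun {N Ψ} h hN A hA Z α E₀ hZ hE δ θ l r R hδ hδ8 hθ hθ4 hZl hlr hlR hRl => ?_⟩
  have hZ0 : 0 < Z := by linarith
  have hl : 0 < l := lt_of_lt_of_le (by positivity) hZl
  have hr : 0 < r := hl.trans_le hlr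
  have hR : 0 < R := hl.trans_le hlR
  have hA1 : ContDiff ℝ 1 A := hA.1.of_le (by exact_mod_cast le_top)
  obtain ⟨n, K, a, as, a0, asum, asupp, asuppR, aout, agrad⟩ := Hp δ l R hδ hδ8 hl hlR
  have as2 : ∀ i, ContDiff ℝ 2 (a i) := fun i => mod_cast contDiff_infty.1 (as i) 2
  have asupp' : ∀ u x, a (some u) x ≠ 0 → ‖x - gridPt l K u‖ ≤ l := fun u x hx =>
    (pi_norm_le_iff_of_nonneg hl.le).2 fun k => by
      rw [Pi.sub_apply, Real.norm_eq_abs]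
      have := asupp u x hx k
      nlinarith
  have hF : ∫⁻ x, fieldE A x ≠ ∞ := by rw [hA.lintegral_fieldE]; exact ENNReal.ofReal_ne_top
  have hfam := h.bFam
  have hsq : ∀ i x, ‖(a i x : ℂ)‖ₑ ^ 2 = ENNReal.ofReal (a i x ^ 2) := fun i x => by
    rw [enorm_sq_eq_ofReal, Complex.norm_real, Real.norm_eq_abs, sq_abs]
  have hsq1 : ∀ x, ∑ i, ‖(a i x : ℂ)‖ₑ ^ 2 = 1 := fun x => by
    simp only [hsq]
    rw [← ENNReal.ofReal_sum_of_nonneg fun i _ => by positivity, asum, ENNReal.ofReal_one]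
  set kept : (Fin 3 → Fin n) → Prop := fun u => 8 * r ≤ ‖gridPt l K u‖ ∧
    ENNReal.ofReal l * (∫⁻ x in Metric.closedBall (gridPt l K u) (4 * l), fieldE A x) ≤
      ENNReal.ofReal (θ ^ 2 / Cg) with hkept
  have hgauge : ∀ i : Option (Fin 3 → Fin n), ∃ c : E3, ∀ u, i = some u → kept u →
      ∀ w : E3 → Fin 2 → ℂ, (∀ s, ContDiff ℝ 2 fun x => w x s) →
      (∀ x ∉ Metric.closedBall (gridPt l K u) (2 * l), w x = 0) →
      ∫⁻ x, gradS (fun y t => phase c y * w y t) x ≤ ENNReal.ofReal (1 + 4 * θ) * ∫⁻ x, sq2 (dirac A w x) := by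
    intro i
    by_cases hi : ∃ u, i = some u ∧ kept u
    · obtain ⟨u, hu, hk⟩ := hi
      obtain ⟨c, hc⟩ := Hg A hA1 (gridPt l K u) l θ hl hθ hθ4 hk.2
      refine ⟨c, fun v hv _ => ?_⟩
      obtain rfl : u = v := Option.some.inj (hu.symm.trans hv)
      exact hc
    · exact ⟨0, fun u hu hk => absurd ⟨u, hu, hk⟩ hi⟩
  choose c hc using hgauge
  set Kf : Finset (Option (Fin 3 → Fin n)) := (Finset.univ.filter kept).map Function.Embedding.some with hKf
  set Df : Finset (Option (Fin 3 → Fin n)) := (Finset.univ.filter fun u => ¬ kept u).map Function.Embedding.some with hDf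
  have memK : ∀ i ∈ Kf, ∃ u, i = some u ∧ kept u := fun i hi => by
    obtain ⟨u, hu, rfl⟩ := Finset.mem_map.1 hi
    exact ⟨u, rfl, (Finset.mem_filter.1 hu).2⟩
  have memD : ∀ i ∈ Df, ∃ u, i = some u ∧ ¬ kept u := fun i hi => by
    obtain ⟨u, hu, rfl⟩ := Finset.mem_map.1 hi
    exact ⟨u, rfl, (Finset.mem_filter.1 hu).2⟩
  have hsplit : ∀ g : Option (Fin 3 → Fin n) → ℝ≥0∞, ∑ i, g i = (∑ i ∈ Kf, g i) + (∑ i ∈ Df, g i) + g none := fun g => by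
    rw [Fintype.sum_option, hKf, hDf, Finset.sum_map, Finset.sum_map,
      ← Finset.sum_filter_add_sum_filter_not Finset.univ kept fun u => g (some u), add_comm]
    rfl
  set sh : Option (Fin 3 → Fin n) → E3 := fun i => i.elim 0 fun u => (4 * δ) • gridPt l K u with hsh
  set b : Option (Fin 3 → Fin n) → E3 → ℂ := fun i y => phase (c i) y * (a i y : ℂ) with hb
  have bn : ∀ i y, ‖b i y‖ₑ = ‖(a i y : ℂ)‖ₑ := fun i y => by
    simp only [hb]; rw [enorm_mul, enorm_phase, one_mul]
  have ab : ∀ i y, b i y ≠ 0 → a i y ≠ 0 := fun i y hy h0 => hy (by simp [hb, h0])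
  have hcut := nf_le_of_cut (b := b) h hN
    (fun i => (contDiff_phase (c i)).mul (Complex.ofRealCLM.contDiff.comp (as i)))
    (fun i y hy => fderiv_phase_mul_eq_zero (as i) (a0 i) (c i) hy)
    (fun y => by simp only [bn]; exact hsq1 y) Kf sh
    (fun i hi j hj x y hx hy => by
      obtain ⟨u, rfl, -⟩ := memK i hi
      obtain ⟨v, rfl, -⟩ := memK j hj
      have := coul_shift_gridPt_le hl hδ (asupp u x (ab _ _ hx)) (asupp v y (ab _ _ hy))
      exact ⟨fun hne => this.1 fun he => hne (by rw [he]), this.2⟩)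
    hZ0.le hE
  simp only [bn] at hcut
  obtain ⟨Y, hY⟩ : ∃ Y : Option (Fin 3 → Fin n) → ℝ≥0∞, ∀ i, Y i =
    ∫⁻ x, kinD (sliceSum N) A (fun p x s => (a i x : ℂ) * oneFam Ψ p x s) x := ⟨_, fun _ => rfl⟩
  obtain ⟨W, hW⟩ : ∃ W : Option (Fin 3 → Fin n) → ℝ≥0∞, ∀ i, W i =
    ∫⁻ x, ‖(a i x : ℂ)‖ₑ ^ 2 * coul x * dens (sliceSum N) (oneFam Ψ) x := ⟨_, fun _ => rfl⟩
  obtain ⟨W', hW'⟩ : ∃ q, q = ∑ i ∈ Kf, ∫⁻ x, ‖(a i x : ℂ)‖ₑ ^ 2 * coul (x + sh i) * dens (sliceSum N) (oneFam Ψ) x :=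
    ⟨_, rfl⟩
  obtain ⟨Y', hY'⟩ : ∃ q, q = ∑ i ∈ Kf, ∫⁻ x, kinD (sliceSum N) (fun _ => 0) (fun p x s => b i x * oneFam Ψ p x s) x :=
    ⟨_, rfl⟩
  rw [← hW', ← hY'] at hcut
  have hfar : ∀ i ∈ Kf, ∀ x, a i x ≠ 0 → ENNReal.ofReal (1 - 6 * δ) * coul x ≤ coul (x + sh i) ∧
      coul (x + sh i) ≤ coul x := fun i hi x hx => by
    obtain ⟨u, rfl, hu⟩ := memK i hi
    have h8 : 8 * l ≤ ‖gridPt l K u‖ := by linarith [hu.1]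
    exact ⟨coul_shift_ge hl hδ h8 (asupp' u x hx), coul_shift_le hl hδ h8 (asupp' u x hx)⟩
  have eW1 : ENNReal.ofReal (1 - 6 * δ) * ∑ i ∈ Kf, W i ≤ W' := by
    rw [hW', Finset.mul_sum]
    refine Finset.sum_le_sum fun i hi => ?_
    rw [hW, ← lintegral_const_mul' _ _ ENNReal.ofReal_ne_top]
    refine lintegral_mono fun x => ?_
    by_cases hx : a i x = 0
    · simp [hx]
    · rw [← mul_assoc, ← mul_assoc, mul_comm (ENNReal.ofReal _), mul_assoc (_ ^ 2)]
      exact mul_le_mul_left (mul_le_mul_right (hfar i hi x hx).1 _) _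
  have eW2 : W' ≤ ∑ i ∈ Kf, W i := by
    rw [hW']
    refine Finset.sum_le_sum fun i hi => ?_
    rw [hW]
    refine lintegral_mono fun x => ?_
    by_cases hx : a i x = 0
    · simp [hx]
    · exact mul_le_mul_left (mul_le_mul_right (hfar i hi x hx).2 _) _
  have ai1 : ∀ i x, a i x ^ 2 ≤ 1 := fun i x => (Finset.single_le_sum (f := fun i => a i x ^ 2)
      (fun _ _ => sq_nonneg _) (Finset.mem_univ i)).trans (asum x).le
  have hm : ∀ i, BFam (sliceSum N) fun p x s => (a i x : ℂ) * oneFam Ψ p x s := fun i =>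
    hfam.mul (Complex.ofRealCLM.contDiff.comp (as2 i)) fun x => by
      rw [Complex.norm_real, Real.norm_eq_abs]
      exact (sq_le_one_iff_abs_le_one _).1 (ai1 i x)
  have eY : Y' ≤ ENNReal.ofReal (1 + 4 * θ) * ∑ i ∈ Kf, Y i := by
    rw [hY', Finset.mul_sum]
    refine Finset.sum_le_sum fun i hi => ?_
    obtain ⟨u, rfl, hu⟩ := memK i hi
    rw [hY]
    have e := (hm (some u)).lintegral_kinD_phase_le hA1.continuous (hc (some u) u rfl hu) fun p x hx => by
      have : a (some u) x = 0 := by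
        by_contra hne
        refine hx ?_
        rw [Metric.mem_closedBall, dist_eq_norm]
        linarith [asupp' u x hne]
      ext s
      simp [this]
    simp only [← mul_assoc] at e
    exact e
  have eK : (∑ i ∈ Kf, Y i) + (∑ i ∈ Df, Y i) + Y none ≤
      kinT A Ψ + ENNReal.ofReal (48 * (Cp / (δ * l) ^ 2 * R)) * attT Ψ := by
    rw [← hsplit]
    simp only [hY]
    exact h.sum_kinD_le as2 asum (by positivity) hR agrad hA1.continuous
  have eW : (∑ i ∈ Kf, W i) + (∑ i ∈ Df, W i) + W none = attT Ψ := by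
    rw [← hsplit, ← h.lintegral_coul]
    simp only [hW]
    rw [← lintegral_finsetSum _ fun i _ => ?_]
    · refine lintegral_congr fun x => ?_
      rw [← Finset.sum_mul, ← Finset.sum_mul, hsq1, one_mul]
    · exact (((Complex.continuous_ofReal.comp (as i).continuous).measurable.enorm.pow_const 2).mul
        measurable_coul).mul hfam.measurable_dens
  set Bf : Finset (Fin 3 → Fin n) := Finset.univ.filter fun u => 8 * r ≤ ‖gridPt l K u‖ ∧ ¬ kept u with hBf
  set T : Set E3 := Metric.closedBall 0 (20 * r) ∪ ⋃ u ∈ Bf, Metric.closedBall (gridPt l K u) (4 * l) with hT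
  have hTm : MeasurableSet T := Metric.isClosed_closedBall.measurableSet.union
    (Finset.measurableSet_biUnion _ fun u _ => Metric.isClosed_closedBall.measurableSet)
  have eD := Ha _ _ hfam A hA1 hF h.lintegral_inv_norm_ne_top a as2 asum Df Z T hZ0 hTm fun i hi x hx z hz => by
    obtain ⟨u, rfl, hu⟩ := memD i hi
    by_cases h8 : 8 * r ≤ ‖gridPt l K u‖
    · right
      refine mem_biUnion (Finset.mem_filter.2 ⟨Finset.mem_univ u, h8, hu⟩) ?_
      have h1 := tfScale_le_of_dist_le hZ0 hZl hRl (asuppR u x hx).le hz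
      have h2 := asupp' u x hx
      rw [← dist_eq_norm] at h2
      have h3 := dist_triangle z x (gridPt l K u)
      rw [dist_comm z x] at h3
      rw [Metric.mem_closedBall]
      linarith
    · left
      have h1 := norm_le_norm_add_dist x (gridPt l K u)
      rw [dist_eq_norm] at h1
      rw [mem_closedBall_zero_iff]
      exact norm_le_of_dist_le_tfScale hZ0 (hZl.trans hlr) (by linarith [asupp' u x hx]) hz
  have eT := lintegral_strongField_le (K := K) hZ0 hl hlr (by positivity : 0 < θ ^ 2 / Cg) (measurable_fieldE hA1) Bf
    fun u hu => by
      obtain ⟨h1, h2⟩ := (Finset.mem_filter.1 hu).2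
      refine ⟨h1, le_of_not_ge fun h3 => h2 ⟨h1, h3⟩⟩
  have eT2 := eT.trans (add_le_add (Ht Z (20 * r) hZ0 (by positivity)) le_rfl)
  have eO := h.outer_le (p := fun x => a none x ^ 2) ((as none).continuous.measurable.pow_const 2)
    (fun x => sq_nonneg _) (ai1 none) hZ (half_pos hR) fun x hx => aout x fun h0 => hx (by simp [h0])
  have eR := lintegral_pair_add_le (wfMeas Ψ) (k := fun x => ∑ i ∈ Kf, ‖(a i x : ℂ)‖ₑ ^ 2)
    (p := fun x => a none x ^ 2) (fun x => sq_nonneg _) fun x => by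
      rw [← hsq1 x, hsplit, hsq none]
      exact add_le_add le_self_add le_rfl
  simp only [← hsq none] at eO
  simp only [← hY, ← hW] at eD
  rw [← hW] at eO
  obtain ⟨Rk, hRk⟩ : ∃ q, q = ∫⁻ x : Fin N → E3, (∑ i, ∑ j, if i < j then
      (∑ β ∈ Kf, ‖(a β (x i) : ℂ)‖ₑ ^ 2) * (∑ β ∈ Kf, ‖(a β (x j) : ℂ)‖ₑ ^ 2) * coul (x i - x j) else 0)
        ∂(wfMeas Ψ) := ⟨_, rfl⟩
  obtain ⟨Ro, hRo⟩ : ∃ q, q = ∫⁻ x : Fin N → E3, (∑ i, ∑ j, if i < j then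
      ENNReal.ofReal (a none (x i) ^ 2 * a none (x j) ^ 2) * coul (x i - x j) else 0) ∂(wfMeas Ψ) := ⟨_, rfl⟩
  rw [← hRk] at hcut eR
  rw [← hRo] at eO eR
  change Rk + Ro ≤ repT Ψ at eR
  obtain ⟨yk, hyk⟩ : ∃ q, q = ∑ i ∈ Kf, Y i := ⟨_, rfl⟩
  obtain ⟨yd, hyd⟩ : ∃ q, q = ∑ i ∈ Df, Y i := ⟨_, rfl⟩
  obtain ⟨wk, hwk⟩ : ∃ q, q = ∑ i ∈ Kf, W i := ⟨_, rfl⟩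
  obtain ⟨wd, hwd⟩ : ∃ q, q = ∑ i ∈ Df, W i := ⟨_, rfl⟩
  rw [← hyk] at eY eK
  rw [← hyd] at eK eD
  rw [← hwk] at eW eW1 eW2
  rw [← hwd] at eW eD
  generalize Y none = yo at *
  generalize W none = wo at *
  have kt : kinT A Ψ ≠ ∞ := by rw [h.isTest.kinT_eq hA1.continuous]; exact ENNReal.ofReal_ne_top
  have at1 := h.isTest.attT_ne_top
  have rt := h.isTest.repT_ne_top
  generalize kinT A Ψ = kin at *
  generalize attT Ψ = att at *
  generalize repT Ψ = rep at *
  generalize (∫⁻ z in T, ENNReal.ofReal (tfScale Z z ^ 3 * (‖z‖ + 1 / Z))⁻¹) = tt at *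
  generalize (∫⁻ x, fieldE A x) = F at *
  have kt2 : kin + ENNReal.ofReal (48 * (Cp / (δ * l) ^ 2 * R)) * att ≠ ∞ := by finiteness
  have ykt := ne_top_of_le_ne_top kt2 ((le_self_add.trans le_self_add).trans eK)
  have ydt := ne_top_of_le_ne_top kt2 ((le_add_self.trans le_self_add).trans eK)
  have yot := ne_top_of_le_ne_top kt2 (le_add_self.trans eK)
  have wkt := ne_top_of_le_ne_top at1 ((le_self_add.trans le_self_add).trans eW.le)
  have wdt := ne_top_of_le_ne_top at1 ((le_add_self.trans le_self_add).trans eW.le)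
  have wot := ne_top_of_le_ne_top at1 (le_add_self.trans eW.le)
  have Rkt := ne_top_of_le_ne_top rt (le_self_add.trans eR)
  have Rot := ne_top_of_le_ne_top rt (le_add_self.trans eR)
  have W't := ne_top_of_le_ne_top wkt eW2
  have ttt : tt ≠ ∞ := ne_top_of_le_ne_top (by finiteness) eT2
  have f1 := ENNReal.toReal_mono W't eW1
  have f2 := ENNReal.toReal_mono (by finiteness) eY
  have f3 := ENNReal.toReal_mono kt2 eK
  have f4 := congrArg ENNReal.toReal eW
  have f5 := ENNReal.toReal_mono (by finiteness) eD
  have f6 := ENNReal.toReal_mono (by finiteness) eT2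
  have f7 := ENNReal.toReal_mono (by finiteness) eO
  have f8 := ENNReal.toReal_mono rt eR
  rw [ENNReal.toReal_mul, ENNReal.toReal_ofReal (by linarith)] at f1
  rw [ENNReal.toReal_mul, ENNReal.toReal_ofReal (by positivity)] at f2
  rw [ENNReal.toReal_add (by finiteness) yot, ENNReal.toReal_add ykt ydt, ENNReal.toReal_add kt (by finiteness),
    ENNReal.toReal_mul, ENNReal.toReal_ofReal (by positivity)] at f3
  rw [ENNReal.toReal_add (by finiteness) wot, ENNReal.toReal_add wkt wdt] at f4
  rw [ENNReal.toReal_mul, ENNReal.toReal_add (by finiteness) (by finiteness), ENNReal.toReal_mul, ENNReal.toReal_mul,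
    ENNReal.toReal_add (by finiteness) ttt, ENNReal.toReal_add (by finiteness) hF, ENNReal.toReal_ofReal hZ0.le,
    ENNReal.toReal_ofReal (by norm_num), ENNReal.toReal_ofReal (by positivity)] at f5
  rw [ENNReal.toReal_add (by finiteness) (by finiteness), ENNReal.toReal_mul, ENNReal.toReal_ofReal (by positivity),
    ENNReal.toReal_ofReal (by positivity)] at f6
  rw [ENNReal.toReal_mul, ENNReal.toReal_add Rot (by finiteness), ENNReal.toReal_ofReal hZ0.le,
    ENNReal.toReal_ofReal (by positivity), show 5 * Z ^ 2 / (R / 2) = 10 * Z ^ 2 / R by field_simp; ring] at f7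
  rw [ENNReal.toReal_add Rkt Rot] at f8
  have g1 := mul_le_mul_of_nonneg_left f1 hZ0.le
  have g2 := mul_le_mul_of_nonneg_left f3 (by positivity : 0 ≤ 1 + 4 * θ)
  have g3 := mul_le_mul_of_nonneg_left f6 (by positivity : 0 ≤ Ca * Z)
  have n1 : 0 ≤ δ * (Z * wd.toReal) := by positivity
  have n2 : 0 ≤ δ * (Z * wo.toReal) := by positivity
  have n3 : 0 ≤ θ * yd.toReal := by positivity
  have n4 : 0 ≤ θ * yo.toReal := by positivity
  have n5 : 0 ≤ yd.toReal := by positivity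
  have n6 : 0 ≤ yo.toReal := by positivity
  rw [← f4] at g2 ⊢
  nlinarith

theorem nf_le_cl_of_localization : ∃ C₁ C₂ C₃ : ℝ, 0 < C₁ ∧ 0 < C₂ ∧ 0 < C₃ ∧
    ∀ {N : ℕ} {Ψ : (Fin N → E3) → (Fin N → Fin 2) → ℂ}, IsWaveFun N Ψ → 1 ≤ N → ∀ A, IsVecPot A →
    ∀ Z α E₀ : ℝ, 1 ≤ Z → (∀ E ∈ nfSet Z α, E₀ ≤ E) →
    E₀ ≤ (kinT A Ψ).toReal - Z * (attT Ψ).toReal + (repT Ψ).toReal +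
      C₁ * Z ^ (-(1 / 63) : ℝ) * ((kinT A Ψ).toReal + Z * (attT Ψ).toReal) + C₂ * Z ^ (7 / 3 - 1 / 63 : ℝ) +
      C₃ * Z * (∫⁻ x, fieldE A x).toReal := by
  obtain ⟨Cg, Cp, Ca, Ct, hCg, hCp, hCa, hCt, H⟩ := nf_le_cl_of_scales
  refine ⟨1 + 6144 * Cp, 10 + Ca * (1 + Ct * 20 ^ (1 / 2 : ℝ)), Ca * (1 + 5971968 * Cg), by positivity, by positivity,
    by positivity, fun {N Ψ} h hN A hA Z α E₀ hZ hE => ?_⟩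
  have hZ0 : 0 < Z := by linarith
  set t := Z ^ (-(1 / 63) : ℝ) with ht
  have ht0 : 0 < t := by positivity
  have ht1 : t ≤ 1 := Real.rpow_le_one_of_one_le_of_nonpos hZ (by norm_num)
  have mono : ∀ {p q : ℝ}, p ≤ q → Z ^ p ≤ Z ^ q := fun h => Real.rpow_le_rpow_of_exponent_le hZ h
  have hl2 : (Z ^ (-(77 / 126) : ℝ)) ^ 2 = Z ^ (-(77 / 63) : ℝ) := by
    rw [← Real.rpow_mul_natCast hZ0.le]; norm_num
  have hl4 : (Z ^ (-(77 / 126) : ℝ)) ^ 4 = Z ^ (-(154 / 63) : ℝ) := by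
    rw [← Real.rpow_mul_natCast hZ0.le]; norm_num
  have ht2 : t ^ 2 = Z ^ (-(2 / 63) : ℝ) := by
    rw [ht, ← Real.rpow_mul_natCast hZ0.le]; norm_num
  have h1 := H h hN A hA Z α E₀ hZ hE (t / 8) (t / 4) (Z ^ (-(77 / 126) : ℝ)) (Z ^ (-(23 / 63) : ℝ))
    (Z ^ (-(20 / 63) : ℝ)) (by positivity) (by linarith) (by positivity) (by linarith)
    (by rw [one_div, ← Real.rpow_neg_one]; exact mono (by norm_num)) (mono (by norm_num)) (mono (by norm_num))
    (by rw [hl2, ← Real.rpow_sub_one hZ0.ne']; exact mono (by norm_num))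
  have e1 : 48 * (Cp / (t / 8 * Z ^ (-(77 / 126) : ℝ)) ^ 2 * Z ^ (-(20 / 63) : ℝ)) = 3072 * Cp * Z ^ (59 / 63 : ℝ) := by
    rw [mul_pow, div_pow, hl2, ht2, div_mul_eq_mul_div, mul_div_assoc', div_eq_iff (by positivity)]
    have : Z ^ (59 / 63 : ℝ) * (Z ^ (-(2 / 63) : ℝ) * Z ^ (-(77 / 63) : ℝ)) = Z ^ (-(20 / 63) : ℝ) := by
      rw [← Real.rpow_add hZ0, ← Real.rpow_add hZ0]; norm_num
    rw [← this]; ring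
  have e2 : 10 * Z ^ 2 / Z ^ (-(20 / 63) : ℝ) = 10 * Z ^ (7 / 3 - 1 / 63 : ℝ) := by
    rw [mul_div_assoc, ← Real.rpow_natCast, ← Real.rpow_sub hZ0]; norm_num
  have e3 : Z * (Z ^ (3 / 2 : ℝ) * (20 * Z ^ (-(23 / 63) : ℝ)) ^ (1 / 2 : ℝ)) =
      20 ^ (1 / 2 : ℝ) * Z ^ (7 / 3 - 1 / 63 : ℝ) := by
    rw [Real.mul_rpow (by norm_num) (by positivity), ← Real.rpow_mul hZ0.le]
    have : Z ^ (7 / 3 - 1 / 63 : ℝ) = Z ^ (1 : ℝ) * (Z ^ (3 / 2 : ℝ) * Z ^ (-(23 / 63) * (1 / 2) : ℝ)) := by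
      rw [← Real.rpow_add hZ0, ← Real.rpow_add hZ0]; norm_num
    rw [this, Real.rpow_one]; ring
  have e4 : 512 * 729 * ((Z ^ (-(77 / 126) : ℝ)) ^ 4 * (Z ^ (3 / 2 : ℝ) * (Z ^ (-(23 / 63) : ℝ)) ^ (-(5 / 2) : ℝ))) /
      ((t / 4) ^ 2 / Cg) = 5971968 * Cg := by
    rw [hl4, div_pow, ht2, ← Real.rpow_mul hZ0.le, ← Real.rpow_add hZ0, ← Real.rpow_add hZ0,
      div_eq_iff (by positivity)]
    have : (-(154 / 63) + (3 / 2 + -(23 / 63) * -(5 / 2)) : ℝ) = -(2 / 63) := by norm_num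
    rw [this]
    field_simp
    norm_num
  have e5 : Z * Z ≤ Z ^ (7 / 3 - 1 / 63 : ℝ) := by
    rw [← sq, ← Real.rpow_natCast]; exact mono (by norm_num)
  have e6 : Z ^ (59 / 63 : ℝ) ≤ Z * t := by
    have : Z * t = Z ^ (62 / 63 : ℝ) := by
      rw [ht]; nth_rewrite 1 [← Real.rpow_one Z]; rw [← Real.rpow_add hZ0]; norm_num
    rw [this]; exact mono (by norm_num)
  rw [e1, e2, e4] at h1
  have hk : 0 ≤ (kinT A Ψ).toReal := ENNReal.toReal_nonneg
  generalize (kinT A Ψ).toReal = k at *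
  have hW : 0 ≤ (attT Ψ).toReal := ENNReal.toReal_nonneg
  generalize (attT Ψ).toReal = w at *
  have hF : 0 ≤ (∫⁻ x, fieldE A x).toReal := ENNReal.toReal_nonneg
  generalize (∫⁻ x, fieldE A x).toReal = F at *
  set e := Z ^ (7 / 3 - 1 / 63 : ℝ) with he
  set q := Z ^ (3 / 2 : ℝ) * (20 * Z ^ (-(23 / 63) : ℝ)) ^ (1 / 2 : ℝ) with hq
  have b1 : (1 + 4 * (t / 4)) * (3072 * Cp * Z ^ (59 / 63 : ℝ) * w) ≤ 6144 * Cp * t * (Z * w) := by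
    calc _ ≤ 2 * (3072 * Cp * (Z * t) * w) := by gcongr; linarith
      _ = _ := by ring
  have b2 : Ca * Z * (Z + F + (Ct * q + 5971968 * Cg * F)) ≤
      Ca * (1 + Ct * 20 ^ (1 / 2 : ℝ)) * e + Ca * (1 + 5971968 * Cg) * Z * F := by
    have : Ca * Z * (Z + F + (Ct * q + 5971968 * Cg * F)) =
        Ca * (Z * Z) + Ca * Ct * (Z * q) + Ca * (1 + 5971968 * Cg) * Z * F := by ring
    rw [this, e3]
    have := mul_le_mul_of_nonneg_left e5 hCa.le
    linarith
  have b3 : 0 ≤ t * (Z * w) := by positivity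
  have b4 : 0 ≤ Cp * t * k := by positivity
  linarith

theorem cl_lower_bound : ∃ κ C : ℝ, 0 < κ ∧ 0 < C ∧ ∀ {N : ℕ} {Ψ : (Fin N → E3) → (Fin N → Fin 2) → ℂ},
    IsWaveFun N Ψ → 1 ≤ N → ∀ A, IsVecPot A → ∀ Z α E₀ : ℝ, 1 ≤ Z → 0 < α → Z * α ^ 2 ≤ κ →
    -(C * Z ^ (7 / 3 : ℝ)) ≤ clPauliEnergy N Z α A Ψ ∧
    ((∀ E ∈ nfSet Z α, E₀ ≤ E) → clPauliEnergy N Z α A Ψ ≤ 0 →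
      E₀ - C * Z ^ (7 / 3 - 1 / 63 : ℝ) ≤ clPauliEnergy N Z α A Ψ) := by
  obtain ⟨Λ, Cs, hΛ, hCs, Hs⟩ := stability
  obtain ⟨C₁, C₂, C₃, hC₁, hC₂, hC₃, H⟩ := nf_le_cl_of_localization
  refine ⟨1 / (8 * Real.pi * (Λ + C₃)), Cs + (2 * C₁ * Cs + C₂), by positivity, by positivity,
    fun {N Ψ} h hN A hA Z α E₀ hZ hα hκ => ?_⟩
  have hZ0 : 0 < Z := by linarith
  have hM : (Λ + C₃) * Z ≤ (8 * Real.pi * α ^ 2)⁻¹ := by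
    rw [le_div_iff₀ (by positivity)] at hκ
    rw [← one_div, le_div_iff₀ (by positivity)]
    linarith
  have hE := h.isTest.clPauliEnergy_eq hA.1.continuous Z α
  have hs := Hs h A hA Z (8 * Real.pi * α ^ 2)⁻¹ hZ (by nlinarith)
  have kt : kinT A Ψ ≠ ∞ := by rw [h.isTest.kinT_eq hA.1.continuous]; exact ENNReal.ofReal_ne_top
  have at1 := h.isTest.attT_ne_top
  have rt := h.isTest.repT_ne_top
  have hF0 : 0 ≤ ∫ x, curlSq A x := integral_nonneg fun x => by
    unfold curlSq; positivity
  have hloc := H h hN A hA Z α E₀ hZ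
  rw [hA.lintegral_fieldE] at hs hloc
  rw [ENNReal.toReal_ofReal hF0] at hloc
  have hs' := ENNReal.toReal_mono (by finiteness) hs
  rw [ENNReal.toReal_mul, ENNReal.toReal_add (by finiteness) (by finiteness),
    ENNReal.toReal_add (by finiteness) (by finiteness), ENNReal.toReal_add (by finiteness) (by finiteness),
    ENNReal.toReal_mul, ENNReal.toReal_ofReal (by positivity), ENNReal.toReal_ofReal (by positivity),
    ENNReal.toReal_ofReal hF0, ENNReal.toReal_ofReal (by positivity)] at hs'
  have n1 : 0 ≤ Z * (attT Ψ).toReal := by positivity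
  have n2 : 0 ≤ (kinT A Ψ).toReal := ENNReal.toReal_nonneg
  have n3 : 0 ≤ (repT Ψ).toReal := ENNReal.toReal_nonneg
  have n4 : 0 ≤ (8 * Real.pi * α ^ 2)⁻¹ * ∫ x, curlSq A x := by positivity
  have p1 : 0 < Z ^ (7 / 3 : ℝ) := by positivity
  have p2 : 0 < Z ^ (7 / 3 - 1 / 63 : ℝ) := by positivity
  rw [hE]
  constructor
  · nlinarith [mul_pos (by positivity : 0 < 2 * C₁ * Cs + C₂) p1]
  · intro hnf hE0
    have h1 := hloc hnf
    have h2 : (kinT A Ψ).toReal + Z * (attT Ψ).toReal ≤ 2 * Cs * Z ^ (7 / 3 : ℝ) := by linarith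
    have h3 : Z ^ (-(1 / 63) : ℝ) * Z ^ (7 / 3 : ℝ) = Z ^ (7 / 3 - 1 / 63 : ℝ) := by
      rw [← Real.rpow_add hZ0]; norm_num
    have h4 : C₁ * Z ^ (-(1 / 63) : ℝ) * ((kinT A Ψ).toReal + Z * (attT Ψ).toReal) ≤
        2 * C₁ * Cs * Z ^ (7 / 3 - 1 / 63 : ℝ) := by
      rw [← h3]
      refine (mul_le_mul_of_nonneg_left h2 (by positivity)).trans (le_of_eq (by ring))
    have h5 := mul_le_mul_of_nonneg_right hM hF0
    have h6 : 0 ≤ Λ * Z * ∫ x, curlSq A x := by positivity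
    nlinarith [mul_pos hCs p2]

theorem sInf_nfSet_nonpos {N : ℕ} {Ψ : (Fin N → E3) → (Fin N → Fin 2) → ℂ} (h : IsWaveFun N Ψ) (hN : 1 ≤ N)
    {Z α E₀ : ℝ} (hZ : 0 ≤ Z) (hE : ∀ E ∈ nfSet Z α, E₀ ≤ E) : E₀ ≤ 0 := by
  have := nf_le_of_cut (I := Unit) (b := fun _ _ => 1) h hN (fun _ => contDiff_const) (fun _ _ h => absurd h one_ne_zero)
    (fun y => by simp) ∅ (fun _ => 0) (by simp) hZ hE
  simpa using this

theorem isVecPot_zero : IsVecPot fun _ => 0 :=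
  ⟨contDiff_const, HasCompactSupport.zero, by simp [pdVec]⟩

end

/-- Thomas-Fermi theory is correct to leading order for the absolute ground state
energy of a large atom in a self-generated classical magnetic field:
E^{nf}_Z ≥ E^{cl}_{Z,α} ≥ E^{nf}_Z − C·Z^{7/3−1/63} whenever Zα² ≤ κ. -/
theorem atom_self_generated_field_TF :
    ∃ κ C : ℝ, 0 < κ ∧ 0 < C ∧ ∀ Z α : ℝ, 1 ≤ Z → 0 < α → Z * α ^ 2 ≤ κ →
      sInf (nfSet Z α) ≥ sInf (clSet Z α) ∧
      sInf (clSet Z α) ≥ sInf (nfSet Z α) - C * Z ^ ((7 : ℝ) / 3 - 1 / 63) := by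
  obtain ⟨κ, C, hκ, hC, H⟩ := cl_lower_bound
  refine ⟨κ, C, hκ, hC, fun Z α hZ hα hZα => ?_⟩
  have hZ0 : 0 ≤ Z := by linarith
  have hsub : nfSet Z α ⊆ clSet Z α := by
    rintro E ⟨N, hN, Ψ, hΨ, rfl⟩
    exact ⟨N, hN, _, isVecPot_zero, Ψ, hΨ, rfl⟩
  have hbd : BddBelow (clSet Z α) := by
    refine ⟨-(C * Z ^ (7 / 3 : ℝ)), ?_⟩
    rintro E ⟨N, hN, A, hA, Ψ, hΨ, rfl⟩
    exact (H hΨ hN A hA Z α 0 hZ hα hZα).1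
  have hp : 0 < C * Z ^ ((7 : ℝ) / 3 - 1 / 63) := by positivity
  rcases (clSet Z α).eq_empty_or_nonempty with he | hne
  · have hn : nfSet Z α = ∅ := Set.subset_empty_iff.1 (he ▸ hsub)
    rw [he, hn]
    exact ⟨le_rfl, by linarith⟩
  have hnf : ∀ E ∈ nfSet Z α, sInf (nfSet Z α) ≤ E := fun E hE => csInf_le (hbd.mono hsub) hE
  have hne' : (nfSet Z α).Nonempty := by
    obtain ⟨E, N, hN, A, hA, Ψ, hΨ, rfl⟩ := hne
    exact ⟨_, N, hN, Ψ, hΨ, rfl⟩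
  refine ⟨csInf_le_csInf hbd hne' hsub, le_csInf hne ?_⟩
  rintro E ⟨N, hN, A, hA, Ψ, hΨ, rfl⟩
  rcases le_or_gt (clPauliEnergy N Z α A Ψ) 0 with h0 | h0
  · exact (H hΨ hN A hA Z α _ hZ hα hZα).2 hnf h0
  · linarith [sInf_nfSet_nonpos hΨ hN hZ0 hnf]
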